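/- Let n ≥ 3, 2 ≤ i ≤ n−1, and let Φ_i : 𝒦ⁿ → 𝒦ⁿ be a C^∞₊ regular, translation invariant, even Minkowski valuation of degree i which commutes with SO(n). Then there exists ε > 0 such that if K ∈ 𝒦ⁿ has a C² support function satisfying ‖h_{γK} − h_{𝔹ⁿ}‖_{C²(𝕊^{n−1})} < ε for some γ > 0, then V_{i+1}(Φ_i K)/V_{i+1}(K)^i ≥ V_{i+1}(Φ_i 𝔹ⁿ)/V_{i+1}(𝔹ⁿ)^i, with equality if and only if K is a Euclidean ball. -/

import Mathlib

open scoped InnerProductSpace Pointwise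
open MeasureTheory Metric Filter Topology

noncomputable section

/-- Euclidean space `ℝⁿ`. -/
abbrev En (n : ℕ) := EuclideanSpace ℝ (Fin n)

namespace MinkIter

variable {n : ℕ}

/-- The unit sphere `𝕊^{n-1}` as a subtype. -/
abbrev Sph (n : ℕ) := Metric.sphere (0 : En n) 1

/-- Spherical Lebesgue measure on `𝕊^{n-1}`. -/
def sphVol (n : ℕ) : Measure (Sph n) := (volume : Measure (En n)).toSphere

/-- A fixed pole `ē ∈ 𝕊^{n-1}`. -/
def pole (n : ℕ) : En n :=
  if h : 0 < n then EuclideanSpace.single (⟨0, h⟩ : Fin n) 1 else 0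

/-- The support function of a convex body, as a function on all of `ℝⁿ`. -/
def supp (K : ConvexBody (En n)) (x : En n) : ℝ :=
  sSup ((fun y => ⟪x, y⟫_ℝ) '' (K : Set (En n)))

/-- The Euclidean unit ball `𝔹ⁿ` as a convex body. -/
def ballB (n : ℕ) : ConvexBody (En n) :=
  ⟨closedBall 0 1, convex_closedBall 0 1, isCompact_closedBall 0 1, ⟨0, by simp⟩⟩

/-- The dilate `c • K` of a convex body. -/
def scale (c : ℝ) (K : ConvexBody (En n)) : ConvexBody (En n) :=
  ⟨c • (K : Set (En n)), K.convex.smul c, K.isCompact.smul c, K.nonempty.smul_set⟩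

/-- The translate `K + x` of a convex body. -/
def translate (K : ConvexBody (En n)) (x : En n) : ConvexBody (En n) :=
  ⟨(fun y => x + y) '' (K : Set (En n)), K.convex.translate x,
    K.isCompact.image (continuous_add_left x), K.nonempty.image _⟩

/-- A linear isometry of `ℝⁿ` is a rotation (element of `SO(n)`) if it preserves
orientation. -/
def IsRotation (ρ : En n ≃ₗᵢ[ℝ] En n) : Prop :=
  0 < LinearMap.det (ρ.toLinearEquiv.toLinearMap)

/-- The image `ρ K` of a convex body under a linear isometry. -/
def rotate (ρ : En n ≃ₗᵢ[ℝ] En n) (K : ConvexBody (En n)) : ConvexBody (En n) :=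
  ⟨ρ '' (K : Set (En n)), K.convex.linear_image ρ.toLinearEquiv.toLinearMap,
    K.isCompact.image ρ.continuous, K.nonempty.image _⟩

/-- `Φ` is a Minkowski valuation: `ΦK + ΦL = Φ(K ∪ L) + Φ(K ∩ L)` whenever `K ∪ L`
is convex (Minkowski addition on the left). -/
def IsMinkowskiValuation (Φ : ConvexBody (En n) → ConvexBody (En n)) : Prop :=
  ∀ (K L : ConvexBody (En n)) (hu : Convex ℝ ((K : Set (En n)) ∪ (L : Set (En n))))
    (hi : ((K : Set (En n)) ∩ (L : Set (En n))).Nonempty),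
    Φ K + Φ L =
      Φ ⟨(K : Set (En n)) ∪ (L : Set (En n)), hu, K.isCompact.union L.isCompact,
          K.nonempty.inl⟩ +
      Φ ⟨(K : Set (En n)) ∩ (L : Set (En n)), K.convex.inter L.convex,
          K.isCompact.inter_right L.isCompact.isClosed, hi⟩

/-- `Φ` is translation invariant. -/
def TranslationInvariant (Φ : ConvexBody (En n) → ConvexBody (En n)) : Prop :=
  ∀ (K : ConvexBody (En n)) (x : En n), Φ (translate K x) = Φ K

/-- `Φ` is (positively) homogeneous of degree `i`. -/
def HasDegree (i : ℕ) (Φ : ConvexBody (En n) → ConvexBody (En n)) : Prop :=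
  ∀ (K : ConvexBody (En n)) (c : ℝ), 0 ≤ c → Φ (scale c K) = scale (c ^ i) (Φ K)

/-- `Φ` commutes with `SO(n)`. -/
def RotationEquivariant (Φ : ConvexBody (En n) → ConvexBody (En n)) : Prop :=
  ∀ ρ : En n ≃ₗᵢ[ℝ] En n, IsRotation ρ → ∀ K, Φ (rotate ρ K) = rotate ρ (Φ K)

/-- `Φ` is even: `Φ(-K) = ΦK`. -/
def IsEven (Φ : ConvexBody (En n) → ConvexBody (En n)) : Prop :=
  ∀ K, Φ (scale (-1) K) = Φ K

/-- `Φ` is monotone w.r.t. set inclusion. -/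
def MonotoneVal (Φ : ConvexBody (En n) → ConvexBody (En n)) : Prop :=
  ∀ K L : ConvexBody (En n), (K : Set (En n)) ⊆ (L : Set (En n)) →
    (Φ K : Set (En n)) ⊆ (Φ L : Set (En n))

/-- `Φ` is non-trivial: `ΦK ≠ {o}` for some `K`. -/
def NontrivialVal (Φ : ConvexBody (En n) → ConvexBody (En n)) : Prop :=
  ∃ K : ConvexBody (En n), (Φ K : Set (En n)) ≠ {0}

/-- The mixed volume `V(K₁,…,Kₙ)`, via polarization of the volume. -/
def mixedVol (Ks : Fin n → ConvexBody (En n)) : ℝ :=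
  ((n.factorial : ℝ))⁻¹ *
    ∑ S : Finset (Fin n), (-1 : ℝ) ^ (n - S.card) *
      (volume ((∑ k ∈ S, Ks k : ConvexBody (En n)) : Set (En n))).toReal

/-- `κ_m`, the volume of the `m`-dimensional unit ball. -/
def kappa (m : ℕ) : ℝ := (volume (closedBall (0 : En m) 1)).toReal

/-- `ω_m`, the surface area of the `m`-dimensional unit ball. -/
def omegaS (m : ℕ) : ℝ := m * kappa m

/-- The `j`-th intrinsic volume `V_j(K) = binom(n,j) V(K[j],𝔹ⁿ[n-j]) / κ_{n-j}`. -/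
def intrinsicVol (j : ℕ) (K : ConvexBody (En n)) : ℝ :=
  (n.choose j : ℝ) / kappa (n - j) *
    mixedVol (fun k : Fin n => if (k : ℕ) < j then K else ballB n)

/-- `μ` is the area measure of order `i` of `K`: for every convex body `L`,
`∫ h_L dμ = n V(L, K[i], 𝔹ⁿ[n-1-i])`. -/
def IsAreaMeasure (i : ℕ) (K : ConvexBody (En n)) (μ : Measure (Sph n)) : Prop :=
  ∀ L : ConvexBody (En n),
    (∫ v : Sph n, supp L (v : En n) ∂μ) =
      n * mixedVol (fun k : Fin n =>
        if (k : ℕ) = 0 then L else if (k : ℕ) ≤ i then K else ballB n)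

/-- `Φ` is generated by the zonal function with profile `g : [-1,1] → ℝ`, i.e.
`h_{ΦK} = S_i(K,·) ∗ g` where `∗` is the spherical convolution. -/
def GeneratedBy (i : ℕ) (Φ : ConvexBody (En n) → ConvexBody (En n)) (g : ℝ → ℝ) : Prop :=
  ∀ (K : ConvexBody (En n)) (μ : Measure (Sph n)), IsAreaMeasure i K μ →
    ∀ u : En n, ‖u‖ = 1 →
      supp (Φ K) u = ∫ v : Sph n, g ⟪u, (v : En n)⟫_ℝ ∂μ

/-- `L` is a body of revolution: invariant under all rotations fixing the pole. -/
def IsZonalBody (L : ConvexBody (En n)) : Prop :=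
  ∀ ρ : En n ≃ₗᵢ[ℝ] En n, IsRotation ρ → ρ (pole n) = pole n → rotate ρ L = L

/-- The quadratic form of the Hessian of `F` at `u` in direction `w`. -/
def hessQ (F : En n → ℝ) (u w : En n) : ℝ := iteratedFDeriv ℝ 2 F u ![w, w]

/-- `(j,l)` entry of the Hessian of `F` at `u`. -/
def hessE (F : En n → ℝ) (u : En n) (j l : Fin n) : ℝ :=
  iteratedFDeriv ℝ 2 F u ![EuclideanSpace.single j 1, EuclideanSpace.single l 1]

/-- A convex body is of class `C^k₊` if its support function is of class `C^k`
away from the origin and the restriction of its Hessian to `u^⊥` is positive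
definite for every unit vector `u`. -/
def IsCkPlus (k : ℕ∞) (L : ConvexBody (En n)) : Prop :=
  ContDiffOn ℝ k (supp L) {0}ᶜ ∧
    ∀ u : En n, ‖u‖ = 1 → ∀ w : En n, w ≠ 0 → ⟪u, w⟫_ℝ = 0 → 0 < hessQ (supp L) u w

/-- `Φ` is a `C^∞₊` regular Minkowski valuation of degree `i`: it is generated by
the support function of a body of revolution of class `C^∞₊`. -/
def CInfRegular (i : ℕ) (Φ : ConvexBody (En n) → ConvexBody (En n)) : Prop :=
  ∃ (L : ConvexBody (En n)) (g : ℝ → ℝ), IsZonalBody L ∧ IsCkPlus ⊤ L ∧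
    (∀ u : En n, ‖u‖ = 1 → supp L u = g ⟪u, pole n⟫_ℝ) ∧ GeneratedBy i Φ g

/-- The `C²(𝕊^{n-1})` distance of two functions. -/
def C2dist (F G : En n → ℝ) : ℝ :=
  ⨆ u : Sph n, (|F (u : En n) - G (u : En n)| +
    ‖fderiv ℝ F (u : En n) - fderiv ℝ G (u : En n)‖ +
    ‖iteratedFDeriv ℝ 2 F (u : En n) - iteratedFDeriv ℝ 2 G (u : En n)‖)

/-- The Legendre polynomial of dimension `d` and degree `k` (Rodrigues formula). -/
def legendreP (d k : ℕ) (t : ℝ) : ℝ :=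
  (-1 : ℝ) ^ k *
    (Real.Gamma (((d : ℝ) - 1) / 2) / (2 ^ k * Real.Gamma (((d : ℝ) - 1) / 2 + k))) *
    (1 - t ^ 2) ^ (-(((d : ℝ) - 3) / 2)) *
    iteratedDeriv k (fun s : ℝ => (1 - s ^ 2) ^ ((((d : ℝ) - 3) / 2) + (k : ℝ))) t

/-- The multiplier `a_k^d[h]` of a zonal function with profile `h : [-1,1] → ℝ`. -/
def multInt (d k : ℕ) (h : ℝ → ℝ) : ℝ :=
  omegaS (d - 1) *
    ∫ t in (-1 : ℝ)..1, legendreP d k t * h t * (1 - t ^ 2) ^ (((d : ℝ) - 3) / 2)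

/-- The multiplier `a_k^n[f] = ∫_{𝕊^{n-1}} f(u) P_k^n(ē·u) du` of a zonal function
`f` on the sphere. -/
def multSph (k : ℕ) (f : En n → ℝ) : ℝ :=
  ∫ u : Sph n, f (u : En n) * legendreP n k ⟪pole n, (u : En n)⟫_ℝ ∂(sphVol n)

/-- The projection `π₀ f` of `f` onto the constants (its mean value). -/
def proj0 (f : En n → ℝ) : ℝ :=
  (omegaS n)⁻¹ * ∫ u : Sph n, f (u : En n) ∂(sphVol n)

/-- The `L²(𝕊^{n-1})` norm. -/
def sphL2 (f : En n → ℝ) : ℝ :=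
  Real.sqrt (∫ u : Sph n, (f (u : En n)) ^ 2 ∂(sphVol n))

/-- The sup norm on the sphere. -/
def supSph (f : En n → ℝ) : ℝ := ⨆ u : Sph n, |f (u : En n)|

/-- `M ∈ UBounds α f` iff `M` witnesses `‖f‖_{𝒰_α} ≤ M`: `‖f‖_∞ ≤ M` and for every
`k ≥ 1` there is a polynomial of degree at most `k` with `‖f - p_k‖_{L²} ≤ M k^{-α}`. -/
def UBounds (α : ℝ) (f : En n → ℝ) : Set ℝ :=
  {M | (∀ u : En n, ‖u‖ = 1 → |f u| ≤ M) ∧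
    ∀ k : ℕ, 0 < k → ∃ p : MvPolynomial (Fin n) ℝ, p.totalDegree ≤ k ∧
      sphL2 (fun x => f x - MvPolynomial.eval (fun j => x j) p) ≤ M * (k : ℝ) ^ (-α)}

/-- `f ∈ 𝒰_α`. -/
def MemU (α : ℝ) (f : En n → ℝ) : Prop := (UBounds α f).Nonempty

/-- The norm `‖f‖_{𝒰_α}`. -/
def UNorm (α : ℝ) (f : En n → ℝ) : ℝ := sInf (UBounds α f)

/-- The convolution transform `T_g f` with zonal kernel of profile `g`, extended
1-homogeneously to `ℝⁿ`: `(T_g f)(u) = ∫_{𝕊^{n-1}} g(u·v) f(v) dv` for unit `u`. -/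
def Tg (g : ℝ → ℝ) (f : En n → ℝ) (x : En n) : ℝ :=
  ‖x‖ * ∫ v : Sph n, g ⟪‖x‖⁻¹ • x, (v : En n)⟫_ℝ * f (v : En n) ∂(sphVol n)

/-- The 0-homogeneous extension of a function on the sphere. -/
def zeroExt (f : En n → ℝ) (x : En n) : ℝ := f (‖x‖⁻¹ • x)

/-- The spherical Laplacian `Δ_𝕊 f`, i.e. the Euclidean Laplacian of the
0-homogeneous extension. -/
def sphLap (f : En n → ℝ) (u : En n) : ℝ := ∑ j : Fin n, hessE (zeroExt f) u j j

/-- The operator `□_n f = f + Δ_𝕊 f /(n-1)`. -/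
def boxN (f : En n → ℝ) (u : En n) : ℝ := f u + ((n : ℝ) - 1)⁻¹ * sphLap f u

/-- The mixed discriminant of `m` symmetric `m × m` matrices, via polarization of
the determinant. -/
def mixedDisc {m : ℕ} (A : Fin m → Matrix (Fin m) (Fin m) ℝ) : ℝ :=
  ((m.factorial : ℝ))⁻¹ *
    ∑ S : Finset (Fin m), (-1 : ℝ) ^ (m - S.card) * (∑ k ∈ S, A k).det

/-- The rank one matrix `u ⊗ u`. -/
def outer (u : En n) : Matrix (Fin n) (Fin n) ℝ := Matrix.of fun j l => u j * u l

/-- The matrix of the orthogonal projection onto `u^⊥`. -/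
def projMat (u : En n) : Matrix (Fin n) (Fin n) ℝ := 1 - outer u

/-- The Hessian matrix of `F` at `u`. -/
def hessMat (F : En n → ℝ) (u : En n) : Matrix (Fin n) (Fin n) ℝ :=
  Matrix.of fun j l => hessE F u j l

/-- The mixed discriminant `D_{n-1}(B₁|_{u^⊥},…,B_{n-1}|_{u^⊥})` of the restrictions
to `u^⊥` of matrices annihilating `u`, computed via the identity
`D_{n-1}(B₁|_{u^⊥},…) = n · D_n(u ⊗ u, B₁,…,B_{n-1})`. -/
def restrDisc (u : En n) (B : Fin (n - 1) → Matrix (Fin n) (Fin n) ℝ) : ℝ :=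
  n * mixedDisc (fun k : Fin n =>
    if h : (k : ℕ) = 0 then outer u else B ⟨(k : ℕ) - 1, by have := k.isLt; omega⟩)

/-- Total variation distance between two Borel measures on the sphere. -/
def dTV (μ ν : Measure (Sph n)) : ℝ :=
  ⨆ A : {A : Set (Sph n) // MeasurableSet A}, |(μ A).toReal - (ν A).toReal|

/-- Lévy–Prokhorov distance between two Borel measures on the sphere. -/
def dLP (μ ν : Measure (Sph n)) : ℝ :=
  sInf {ε : ℝ | 0 < ε ∧ ∀ A : Set (Sph n), MeasurableSet A →
    μ A ≤ ν (Metric.thickening ε A) + ENNReal.ofReal ε ∧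
    ν A ≤ μ (Metric.thickening ε A) + ENNReal.ofReal ε}

/-- Two convex bodies are homothetic: one is a translate of a positive dilate of
the other. -/
def Homothetic (K L : ConvexBody (En n)) : Prop :=
  ∃ (c : ℝ) (x : En n), 0 < c ∧ (L : Set (En n)) = x +ᵥ c • (K : Set (En n))

/-- The dimension of a convex body (dimension of its affine hull). -/
def bodyDim (K : ConvexBody (En n)) : ℕ :=
  Module.finrank ℝ (vectorSpan ℝ (K : Set (En n)))

/-- `K` is a Euclidean ball. -/
def IsBall (K : ConvexBody (En n)) : Prop :=
  ∃ (c : En n) (r : ℝ), 0 < r ∧ (K : Set (En n)) = closedBall c r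

/-- The mean width `w(K) = (2/ω_n) ∫_{𝕊^{n-1}} h_K`. -/
def meanWidth (K : ConvexBody (En n)) : ℝ :=
  2 / omegaS n * ∫ u : Sph n, supp K (u : En n) ∂(sphVol n)

/-- `N(n,k)`, the dimension of the space of spherical harmonics of dimension `n`
and degree `k`. -/
def Nnk (n k : ℕ) : ℝ :=
  (((n : ℝ) + 2 * k - 2) / ((n : ℝ) + k - 2)) * (Nat.choose (n + k - 2) (n - 2) : ℝ)

open Function (update)

section MixedDiscriminant

/-- Inclusion–exclusion over the supersets of a finite set. -/
lemma sum_superset_neg_one_pow (T : Finset (Fin n)) :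
    ∑ S : Finset (Fin n), (if T ⊆ S then (-1 : ℝ) ^ (n - S.card) else 0) =
      if T = Finset.univ then 1 else 0 := by
  classical
  have h1 : ∑ S : Finset (Fin n), (if T ⊆ S then (-1 : ℝ) ^ (n - S.card) else 0) =
      ∑ S : Finset (Fin n), (if S ⊆ Tᶜ then (-1 : ℝ) ^ S.card else 0) := by
    refine Fintype.sum_equiv (Equiv.mk (fun S => Sᶜ) (fun S => Sᶜ) (fun S => compl_compl S)
      (fun S => compl_compl S)) _ _ ?_
    intro S
    simp only [Equiv.coe_fn_mk, Finset.compl_subset_compl, Finset.card_compl, Fintype.card_fin]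
  rw [h1, ← Finset.sum_filter]
  have h2 : (Finset.univ.filter fun S : Finset (Fin n) => S ⊆ Tᶜ) = (Tᶜ).powerset := by
    ext S; simp
  rw [h2]
  have h3 := Finset.sum_powerset_neg_one_pow_card (x := Tᶜ)
  have h4 := congrArg (Int.cast : ℤ → ℝ) h3
  push_cast at h4
  rw [h4]
  simp [Finset.compl_eq_empty_iff]

/-- Polarization of a multilinear form, with an arbitrary base point. -/
lemma polarization {M : Type*} [AddCommGroup M] [Module ℝ M]
    (f : MultilinearMap ℝ (fun _ : Fin n => M) ℝ) (A₀ : M) (A : Fin n → M) :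
    ∑ S : Finset (Fin n), (-1 : ℝ) ^ (n - S.card) * f (fun _ => A₀ + ∑ j ∈ S, A j) =
      ∑ σ : Equiv.Perm (Fin n), f (fun j => A (σ j)) := by
  classical
  set g : Option (Fin n) → M := fun o => o.elim A₀ A with hg
  set T : (Fin n → Option (Fin n)) → Finset (Fin n) :=
    fun r => Finset.univ.filter fun j => ∃ i, r i = some j with hT
  have h1 : ∀ S : Finset (Fin n), f (fun _ => A₀ + ∑ j ∈ S, A j) =
      ∑ r : Fin n → Option (Fin n), if T r ⊆ S then f (fun i => g (r i)) else 0 := by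
    intro S
    have : (fun _ : Fin n => A₀ + ∑ j ∈ S, A j) =
        fun _ : Fin n => ∑ o ∈ Finset.insertNone S, g o := by
      funext _
      rw [Finset.sum_insertNone]; rfl
    rw [this, f.map_sum_finset (fun _ o => g o) (fun _ => Finset.insertNone S),
      ← Finset.sum_filter]
    refine Finset.sum_congr ?_ (fun _ _ => rfl)
    ext r
    simp only [Fintype.mem_piFinset, Finset.mem_insertNone, Finset.mem_filter, Finset.mem_univ,
      true_and, hT, Finset.subset_iff, Option.mem_def]
    constructor
    · rintro h j ⟨i, hi⟩; exact h i j hi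
    · intro h i j hi; exact h ⟨i, hi⟩
  simp_rw [h1, Finset.mul_sum]
  rw [Finset.sum_comm]
  have h2 : ∀ r : Fin n → Option (Fin n),
      ∑ S : Finset (Fin n), (-1 : ℝ) ^ (n - S.card) *
        (if T r ⊆ S then f (fun i => g (r i)) else 0) =
      if T r = Finset.univ then f (fun i => g (r i)) else 0 := by
    intro r
    have := sum_superset_neg_one_pow (T r)
    calc _ = (∑ S : Finset (Fin n), (if T r ⊆ S then (-1 : ℝ) ^ (n - S.card) else 0)) *
          f (fun i => g (r i)) := by
            rw [Finset.sum_mul]; refine Finset.sum_congr rfl fun S _ => ?_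
            split_ifs <;> simp
      _ = _ := by rw [this]; split_ifs <;> simp
  simp_rw [h2]
  rw [← Finset.sum_filter]
  symm
  refine Finset.sum_bij (fun σ _ => fun j => some (σ j)) ?_ ?_ ?_ ?_
  · intro σ _
    simp only [Finset.mem_filter, Finset.mem_univ, true_and, hT, Finset.eq_univ_iff_forall]
    intro j; exact ⟨σ.symm j, by simp⟩
  · intro σ _ τ _ h
    ext j
    have := congrFun h j
    simp only [Option.some.injEq] at this
    rw [this]
  · intro r hr
    simp only [Finset.mem_filter, Finset.mem_univ, true_and, hT,
      Finset.eq_univ_iff_forall] at hr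
    choose φ hφ using hr
    have hinj : Function.Injective φ := by
      intro a b hab
      have := (hφ a).symm.trans ((congrArg r hab).trans (hφ b))
      simpa using this
    let e := Equiv.ofBijective φ (Finite.injective_iff_bijective.1 hinj)
    refine ⟨e.symm, Finset.mem_univ _, ?_⟩
    funext j
    have := hφ (e.symm j)
    have h3 : φ (e.symm j) = j := e.apply_symm_apply j
    rw [h3] at this
    exact this.symm
  · intro σ _; rfl

/-- The determinant as a multilinear form in the images of the standard basis vectors. -/
def rowDet (n : ℕ) : MultilinearMap ℝ (fun _ : Fin n => En n →L[ℝ] En n) ℝ :=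
  (Matrix.detRowAlternating (R := ℝ) (n := Fin n)).toMultilinearMap.compLinearMap
    (fun j =>
      { toFun := fun A k => A (EuclideanSpace.single j 1) k
        map_add' := fun A B => by ext k; simp
        map_smul' := fun c A => by ext k; simp })

lemma rowDet_apply (A : Fin n → En n →L[ℝ] En n) :
    rowDet n A = Matrix.det (Matrix.of fun j k => A j (EuclideanSpace.single j 1) k) := rfl

lemma rowDet_diag (A : En n →L[ℝ] En n) : rowDet n (fun _ => A) = A.det := by
  rw [rowDet_apply, ← Matrix.det_transpose]
  have := LinearMap.det_toMatrix (EuclideanSpace.basisFun (Fin n) ℝ).toBasis (A : En n →ₗ[ℝ] En n)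
  rw [ContinuousLinearMap.det, ← this]
  congr 1

/-- The mixed discriminant of `n` endomorphisms of `ℝⁿ`. -/
def mdisc (n : ℕ) : MultilinearMap ℝ (fun _ : Fin n => En n →L[ℝ] En n) ℝ :=
  ((n.factorial : ℝ)⁻¹) • ∑ σ : Equiv.Perm (Fin n), (rowDet n).domDomCongr σ

lemma mdisc_apply (A : Fin n → En n →L[ℝ] En n) :
    mdisc n A = (n.factorial : ℝ)⁻¹ * ∑ σ : Equiv.Perm (Fin n), rowDet n (fun j => A (σ j)) := by
  simp [mdisc]

lemma mdisc_perm (A : Fin n → En n →L[ℝ] En n) (τ : Equiv.Perm (Fin n)) :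
    mdisc n (fun j => A (τ j)) = mdisc n A := by
  rw [mdisc_apply, mdisc_apply]
  congr 1
  exact Fintype.sum_equiv (Equiv.mulLeft τ) _ _ (fun σ => rfl)

lemma mdisc_diag (A : En n →L[ℝ] En n) : mdisc n (fun _ => A) = A.det := by
  rw [mdisc_apply]
  simp only [rowDet_diag, Finset.sum_const, Finset.card_univ, Fintype.card_perm, Fintype.card_fin,
    nsmul_eq_mul]
  rw [← mul_assoc, inv_mul_cancel₀ (by positivity), one_mul]

lemma mdisc_polarization (A₀ : En n →L[ℝ] En n) (A : Fin n → En n →L[ℝ] En n) :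
    ∑ S : Finset (Fin n), (-1 : ℝ) ^ (n - S.card) * (A₀ + ∑ j ∈ S, A j).det =
      n.factorial * mdisc n A := by
  have := polarization (rowDet n) A₀ A
  simp only [rowDet_diag] at this
  rw [this, mdisc_apply, ← mul_assoc, mul_inv_cancel₀ (by positivity), one_mul]

lemma det_adjoint (A : En n →L[ℝ] En n) : (ContinuousLinearMap.adjoint A).det = A.det := by
  have h1 : (ContinuousLinearMap.adjoint A).det =
      LinearMap.det (LinearMap.adjoint (A : En n →ₗ[ℝ] En n)) := rfl
  set b := EuclideanSpace.basisFun (Fin n) ℝ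
  rw [h1, ← LinearMap.det_toMatrix b.toBasis, LinearMap.toMatrix_adjoint,
    Matrix.det_conjTranspose, LinearMap.det_toMatrix]
  simp [ContinuousLinearMap.det]

lemma mdisc_adjoint (A : Fin n → En n →L[ℝ] En n) :
    mdisc n (fun j => ContinuousLinearMap.adjoint (A j)) = mdisc n A := by
  have h1 := mdisc_polarization 0 A
  have h2 := mdisc_polarization 0 (fun j => ContinuousLinearMap.adjoint (A j))
  have : ∀ S : Finset (Fin n), (0 + ∑ j ∈ S, ContinuousLinearMap.adjoint (A j)).det =
      (0 + ∑ j ∈ S, A j).det := by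
    intro S
    rw [zero_add, zero_add, ← map_sum, det_adjoint]
  simp only [this] at h2
  rw [h1] at h2
  exact (mul_left_cancel₀ (by positivity) h2).symm

/-- If all the ranges lie in `u^⊥`, the mixed discriminant vanishes. -/
lemma mdisc_eq_zero_of_range {u : En n} (hu : u ≠ 0) (A : Fin n → En n →L[ℝ] En n)
    (h : ∀ j w, ⟪u, A j w⟫_ℝ = 0) : mdisc n A = 0 := by
  rw [mdisc_apply]
  rw [Finset.sum_eq_zero, mul_zero]
  intro σ _
  rw [rowDet_apply]
  refine Matrix.exists_mulVec_eq_zero_iff.1 ⟨fun k => u k, ?_, ?_⟩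
  · intro h0; apply hu; ext k; exact congrFun h0 k
  · ext j
    have := h (σ j) (EuclideanSpace.single j 1)
    rw [PiLp.inner_apply] at this
    simpa [Matrix.mulVec, dotProduct, mul_comm] using this

lemma mdisc_eq_zero_of_ker {u : En n} (hu : u ≠ 0) (A : Fin n → En n →L[ℝ] En n)
    (h : ∀ j, A j u = 0) : mdisc n A = 0 := by
  rw [← mdisc_adjoint]
  refine mdisc_eq_zero_of_range hu _ fun j w => ?_
  rw [ContinuousLinearMap.adjoint_inner_right, h, inner_zero_left]

/-- If two of the endomorphisms have range in the line spanned by `u`, the mixed discriminant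
vanishes. -/
lemma mdisc_eq_zero_of_two_range {u : En n} (A : Fin n → En n →L[ℝ] En n) {j k : Fin n}
    (hjk : j ≠ k) (x y : En n) (hj : ∀ w, A j w = ⟪x, w⟫_ℝ • u) (hk : ∀ w, A k w = ⟪y, w⟫_ℝ • u) :
    mdisc n A = 0 := by
  rw [mdisc_apply]
  rw [Finset.sum_eq_zero, mul_zero]
  intro σ _
  rw [rowDet_apply]
  set a := σ.symm j
  set b := σ.symm k
  have hab : a ≠ b := fun h => hjk (σ.symm.injective h)
  set N : Matrix (Fin n) (Fin n) ℝ :=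
    Matrix.of fun i l => A (σ i) (EuclideanSpace.single i 1) l with hN
  have ha : N a = x a • (fun l => u l) := by
    ext l; simp [hN, a, hj, EuclideanSpace.inner_single_right]
  have hb : N b = y b • (fun l => u l) := by
    ext l; simp [hN, b, hk, EuclideanSpace.inner_single_right]
  have e : N = (N.updateRow a (x a • (fun l => u l))).updateRow b (y b • (fun l => u l)) := by
    rw [← ha, Matrix.updateRow_eq_self, ← hb, Matrix.updateRow_eq_self]
  rw [e, Matrix.det_updateRow_smul, Matrix.updateRow_comm _ hab, Matrix.det_updateRow_smul,
    Matrix.updateRow_comm _ hab.symm, Matrix.det_zero_of_row_eq hab, mul_zero, mul_zero]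
  rw [Matrix.updateRow_ne hab, Matrix.updateRow_self, Matrix.updateRow_self]

lemma mdisc_eq_zero_of_two_ker {u : En n} (A : Fin n → En n →L[ℝ] En n) {j k : Fin n}
    (hjk : j ≠ k) (x y : En n) (hj : ∀ w, A j w = ⟪u, w⟫_ℝ • x) (hk : ∀ w, A k w = ⟪u, w⟫_ℝ • y) :
    mdisc n A = 0 := by
  rw [← mdisc_adjoint]
  refine mdisc_eq_zero_of_two_range (u := u) _ hjk x y ?_ ?_
  · intro w
    refine ext_inner_left ℝ fun z => ?_
    rw [ContinuousLinearMap.adjoint_inner_right, hj, inner_smul_left, inner_smul_right]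
    simp [mul_comm, real_inner_comm]
  · intro w
    refine ext_inner_left ℝ fun z => ?_
    rw [ContinuousLinearMap.adjoint_inner_right, hk, inner_smul_left, inner_smul_right]
    simp [mul_comm, real_inner_comm]

lemma mdisc_continuous (n : ℕ) : Continuous (mdisc n) := by
  have : (mdisc n : (Fin n → En n →L[ℝ] En n) → ℝ) = fun A => (n.factorial : ℝ)⁻¹ *
      ∑ σ : Equiv.Perm (Fin n),
        Matrix.det (Matrix.of fun j k => A (σ j) (EuclideanSpace.single j 1) k) := by
    funext A; rw [mdisc_apply]; rfl
  rw [this]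
  refine continuous_const.mul (continuous_finsetSum _ fun σ _ => Continuous.matrix_det ?_)
  refine continuous_matrix fun j k => ?_
  simp only [Matrix.of_apply]
  fun_prop

/-- A bound for the mixed discriminant. -/
lemma exists_mdisc_bound (n : ℕ) : ∃ C : ℝ, 0 < C ∧ ∀ A : Fin n → En n →L[ℝ] En n,
    |mdisc n A| ≤ C * ∏ j, ‖A j‖ := by
  obtain ⟨C, hC, h⟩ := (mdisc n).exists_bound_of_continuous (mdisc_continuous n)
  exact ⟨C, hC, fun A => by simpa using h A⟩

end MixedDiscriminant

/-- Twice continuously differentiable (away from the origin) functions that are positively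
homogeneous of degree one. -/
def HFs (n : ℕ) : Submodule ℝ (En n → ℝ) where
  carrier := {f | ContDiffOn ℝ 2 f {0}ᶜ ∧ ∀ c : ℝ, 0 < c → ∀ x, f (c • x) = c * f x}
  zero_mem' := ⟨contDiffOn_const, fun c _ x => by simp⟩
  add_mem' := fun {f g} hf hg => ⟨hf.1.add hg.1, fun c hc x => by
    simp [hf.2 c hc x, hg.2 c hc x, mul_add]⟩
  smul_mem' := fun a f hf => ⟨contDiffOn_const.smul hf.1, fun c hc x => by
    simp [hf.2 c hc x]; ring⟩

/-- The type of such functions. -/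
abbrev HF (n : ℕ) : Type := HFs n

instance : CoeFun (HF n) (fun _ => En n → ℝ) := ⟨fun f => f.1⟩

@[simp] lemma HF.coe_add (f g : HF n) (x : En n) : (f + g) x = f x + g x := rfl
@[simp] lemma HF.coe_sub (f g : HF n) (x : En n) : (f - g) x = f x - g x := rfl
@[simp] lemma HF.coe_smul (a : ℝ) (f : HF n) (x : En n) : (a • f) x = a * f x := rfl

/-- The Hessian of a function as an operator. -/
def hess (f : En n → ℝ) (x : En n) : En n →L[ℝ] En n := fderiv ℝ (gradient f) x

/-- The rank one operator `w ↦ ⟪y, w⟫ x`. -/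
def rk (x y : En n) : En n →L[ℝ] En n := (innerSL ℝ y).smulRight x

@[simp] lemma rk_apply (x y w : En n) : rk x y w = ⟪y, w⟫_ℝ • x := rfl

lemma isOpen_compl_zero : IsOpen ({0}ᶜ : Set (En n)) := isOpen_compl_singleton

/-- The inverse Riesz map as a real linear map. -/
def dualInv (n : ℕ) : (En n →L[ℝ] ℝ) →L[ℝ] En n :=
  ((InnerProductSpace.toDual ℝ (En n)).symm.toContinuousLinearEquiv :
    StrongDual ℝ (En n) →L⋆[ℝ] En n)

@[simp] lemma inner_dualInv (l : En n →L[ℝ] ℝ) (w : En n) : ⟪dualInv n l, w⟫_ℝ = l w :=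
  InnerProductSpace.toDual_symm_apply

lemma gradient_eq_comp (f : En n → ℝ) :
    gradient f = fun x => dualInv n (fderiv ℝ f x) := rfl

lemma inner_gradient (f : En n → ℝ) (x w : En n) : ⟪gradient f x, w⟫_ℝ = fderiv ℝ f x w := by
  rw [gradient, InnerProductSpace.toDual_symm_apply]

section C2
variable {f g : En n → ℝ} {x : En n}

lemma contDiffAt_of_off (hf : ContDiffOn ℝ 2 f {0}ᶜ) (hx : x ≠ 0) : ContDiffAt ℝ 2 f x :=
  hf.contDiffAt (isOpen_compl_zero.mem_nhds hx)

lemma contDiffAt_gradient (hf : ContDiffAt ℝ 2 f x) : ContDiffAt ℝ 1 (gradient f) x := by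
  rw [gradient_eq_comp]
  exact (dualInv n).contDiff.contDiffAt.comp x
    (hf.fderiv_right (m := 1) (by norm_num))

lemma contDiffOn_gradient (hf : ContDiffOn ℝ 2 f {0}ᶜ) : ContDiffOn ℝ 1 (gradient f) {0}ᶜ :=
  fun _ hx => (contDiffAt_gradient (contDiffAt_of_off hf hx)).contDiffWithinAt

lemma hess_inner (hf : ContDiffAt ℝ 2 f x) (v w : En n) :
    ⟪hess f x v, w⟫_ℝ = fderiv ℝ (fderiv ℝ f) x v w := by
  have hd : DifferentiableAt ℝ (fderiv ℝ f) x :=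
    (hf.fderiv_right (m := 1) (by norm_num)).differentiableAt (by norm_num)
  rw [hess, gradient_eq_comp]
  have := ((dualInv n).hasFDerivAt.comp x hd.hasFDerivAt).fderiv
  rw [Function.comp_def] at this
  rw [this]; simp

lemma hess_inner_iter (hf : ContDiffAt ℝ 2 f x) (v w : En n) :
    ⟪hess f x v, w⟫_ℝ = iteratedFDeriv ℝ 2 f x ![v, w] := by
  rw [hess_inner hf, iteratedFDeriv_two_apply]; rfl

lemma hess_symm (hf : ContDiffAt ℝ 2 f x) (v w : En n) :
    ⟪hess f x v, w⟫_ℝ = ⟪v, hess f x w⟫_ℝ := by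
  rw [real_inner_comm _ v, hess_inner hf, hess_inner hf]
  exact (hf.isSymmSndFDerivAt (by simp)).eq v w

lemma hess_norm_le (hf : ContDiffAt ℝ 2 f x) : ‖hess f x‖ ≤ ‖iteratedFDeriv ℝ 2 f x‖ := by
  refine ContinuousLinearMap.opNorm_le_bound _ (norm_nonneg _) fun v => ?_
  by_cases h : hess f x v = 0
  · rw [h, norm_zero]; positivity
  have h1 : ⟪hess f x v, hess f x v⟫_ℝ ≤ ‖iteratedFDeriv ℝ 2 f x‖ * (‖v‖ * ‖hess f x v‖) := by
    rw [hess_inner_iter hf]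
    refine (le_abs_self _).trans ?_
    have := (iteratedFDeriv ℝ 2 f x).le_opNorm ![v, hess f x v]
    simpa [Fin.prod_univ_two] using this
  rw [real_inner_self_eq_norm_sq, sq, ← mul_assoc] at h1
  exact le_of_mul_le_mul_right h1 (norm_pos_iff.2 h)

lemma gradient_add (hf : DifferentiableAt ℝ f x) (hg : DifferentiableAt ℝ g x) :
    gradient (f + g) x = gradient f x + gradient g x := by
  simp [gradient, fderiv_add hf hg]

lemma gradient_smul (a : ℝ) (hf : DifferentiableAt ℝ f x) :
    gradient (a • f) x = a • gradient f x := by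
  simp [gradient, fderiv_const_smul hf]

lemma hess_add (hf : ContDiffOn ℝ 2 f {0}ᶜ) (hg : ContDiffOn ℝ 2 g {0}ᶜ) (hx : x ≠ 0) :
    hess (f + g) x = hess f x + hess g x := by
  have h : gradient (f + g) =ᶠ[𝓝 x] gradient f + gradient g := by
    filter_upwards [isOpen_compl_zero.mem_nhds hx] with y hy
    exact gradient_add ((contDiffAt_of_off hf hy).differentiableAt (by norm_num))
      ((contDiffAt_of_off hg hy).differentiableAt (by norm_num))
  rw [hess, h.fderiv_eq, fderiv_add]
  · rfl
  · exact (contDiffAt_gradient (contDiffAt_of_off hf hx)).differentiableAt (by norm_num)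
  · exact (contDiffAt_gradient (contDiffAt_of_off hg hx)).differentiableAt (by norm_num)

lemma hess_smul (a : ℝ) (hf : ContDiffOn ℝ 2 f {0}ᶜ) (hx : x ≠ 0) :
    hess (a • f) x = a • hess f x := by
  have h : gradient (a • f) =ᶠ[𝓝 x] a • gradient f := by
    filter_upwards [isOpen_compl_zero.mem_nhds hx] with y hy
    exact gradient_smul a ((contDiffAt_of_off hf hy).differentiableAt (by norm_num))
  rw [hess, h.fderiv_eq, fderiv_const_smul]
  · rfl
  · exact (contDiffAt_gradient (contDiffAt_of_off hf hx)).differentiableAt (by norm_num)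

lemma continuousOn_gradient (hf : ContDiffOn ℝ 2 f {0}ᶜ) : ContinuousOn (gradient f) {0}ᶜ :=
  (contDiffOn_gradient hf).continuousOn

lemma continuousOn_hess (hf : ContDiffOn ℝ 2 f {0}ᶜ) : ContinuousOn (hess f) {0}ᶜ :=
  (contDiffOn_gradient hf).continuousOn_fderiv_of_isOpen isOpen_compl_zero (by norm_num)

end C2

namespace HF
variable (f g : HF n) {x : En n}

lemma contDiffOn : ContDiffOn ℝ 2 f {0}ᶜ := f.2.1
lemma homog {c : ℝ} (hc : 0 < c) (x : En n) : f (c • x) = c * f x := f.2.2 c hc x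
lemma contDiffAt (hx : x ≠ 0) : ContDiffAt ℝ 2 f x := contDiffAt_of_off f.contDiffOn hx
lemma differentiableAt (hx : x ≠ 0) : DifferentiableAt ℝ f x :=
  (f.contDiffAt hx).differentiableAt (by norm_num)
lemma hasFDerivAt_gradient (hx : x ≠ 0) : HasFDerivAt (gradient f) (hess f x) x :=
  ((contDiffAt_gradient (f.contDiffAt hx)).differentiableAt (by norm_num)).hasFDerivAt

lemma inner_gradient_self (hx : x ≠ 0) : ⟪gradient f x, x⟫_ℝ = f x := by
  rw [inner_gradient]
  have h1 : HasDerivAt (fun c : ℝ => f (c • x)) (fderiv ℝ f x x) 1 := by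
    have h := (f.differentiableAt hx).hasFDerivAt
    have h2 : HasDerivAt (fun c : ℝ => c • x) x 1 := by
      simpa using (hasDerivAt_id (1 : ℝ)).smul_const x
    have h3 : HasFDerivAt f (fderiv ℝ f x) ((1 : ℝ) • x) := by simpa using h
    exact h3.comp_hasDerivAt 1 h2
  have h2 : HasDerivAt (fun c : ℝ => f (c • x)) (f x) 1 := by
    have h3 : HasDerivAt (fun c : ℝ => c * f x) (f x) 1 := by
      simpa using (hasDerivAt_id (1 : ℝ)).mul_const (f x)
    refine h3.congr_of_eventuallyEq ?_
    filter_upwards [lt_mem_nhds (zero_lt_one : (0 : ℝ) < 1)] with c hc using f.homog hc x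
  exact h1.unique h2

lemma gradient_smul_arg {c : ℝ} (hc : 0 < c) (hx : x ≠ 0) :
    gradient f (c • x) = gradient f x := by
  have hcx : c • x ≠ 0 := smul_ne_zero hc.ne' hx
  have h1 : HasFDerivAt (fun y : En n => f (c • y)) (c • fderiv ℝ f (c • x)) x := by
    have h := (f.differentiableAt hcx).hasFDerivAt
    have h2 : HasFDerivAt (fun y : En n => c • y) (c • ContinuousLinearMap.id ℝ (En n)) x :=
      (hasFDerivAt_id x).const_smul c
    exact (HasFDerivAt.comp (f := fun y : En n => c • y) x h h2).congr_fderiv (by ext w; simp)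
  have h2 : HasFDerivAt (fun y : En n => f (c • y)) (c • fderiv ℝ f x) x := by
    have h3 : (fun y : En n => f (c • y)) = fun y => c • f y := by
      funext y; exact f.homog hc y
    rw [h3]; exact (f.differentiableAt hx).hasFDerivAt.const_smul c
  have := smul_right_injective _ hc.ne' (h1.unique h2)
  rw [gradient, this, gradient]

lemma hess_smul_arg {c : ℝ} (hc : 0 < c) (hx : x ≠ 0) :
    hess f (c • x) = c⁻¹ • hess f x := by
  have hcx : c • x ≠ 0 := smul_ne_zero hc.ne' hx
  have h1 : HasFDerivAt (fun y : En n => gradient f (c • y)) (c • hess f (c • x)) x := by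
    have h := f.hasFDerivAt_gradient hcx
    have h2 : HasFDerivAt (fun y : En n => c • y) (c • ContinuousLinearMap.id ℝ (En n)) x :=
      (hasFDerivAt_id x).const_smul c
    exact (HasFDerivAt.comp (f := fun y : En n => c • y) x h h2).congr_fderiv (by ext w; simp)
  have h2 : HasFDerivAt (fun y : En n => gradient f (c • y)) (hess f x) x := by
    refine (f.hasFDerivAt_gradient hx).congr_of_eventuallyEq ?_
    filter_upwards [isOpen_compl_zero.mem_nhds hx] with y hy using f.gradient_smul_arg hc hy
  rw [← h1.unique h2, smul_smul, inv_mul_cancel₀ hc.ne', one_smul]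

lemma hess_self (hx : x ≠ 0) : hess f x x = 0 := by
  have h1 : HasDerivAt (fun c : ℝ => gradient f (c • x)) (hess f x x) 1 := by
    have h2 : HasDerivAt (fun c : ℝ => c • x) x 1 := by
      simpa using (hasDerivAt_id (1 : ℝ)).smul_const x
    have h3 : HasFDerivAt (gradient f) (hess f x) ((1 : ℝ) • x) := by
      simpa using f.hasFDerivAt_gradient hx
    exact h3.comp_hasDerivAt 1 h2
  have h2 : HasDerivAt (fun c : ℝ => gradient f (c • x)) 0 1 := by
    refine (hasDerivAt_const (1 : ℝ) (gradient f x)).congr_of_eventuallyEq ?_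
    filter_upwards [lt_mem_nhds (zero_lt_one : (0 : ℝ) < 1)] with c hc
    exact f.gradient_smul_arg hc hx
  exact h1.unique h2

lemma hess_symm (hx : x ≠ 0) (v w : En n) : ⟪hess f x v, w⟫_ℝ = ⟪v, hess f x w⟫_ℝ :=
  MinkIter.hess_symm (f.contDiffAt hx) v w

lemma inner_hess_self (hx : x ≠ 0) (w : En n) : ⟪x, hess f x w⟫_ℝ = 0 := by
  rw [← f.hess_symm hx, f.hess_self hx, inner_zero_left]

lemma hess_add (hx : x ≠ 0) : hess (f + g : HF n) x = hess f x + hess g x :=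
  MinkIter.hess_add f.contDiffOn g.contDiffOn hx

lemma hess_smul (a : ℝ) (hx : x ≠ 0) : hess (a • f : HF n) x = a • hess f x :=
  MinkIter.hess_smul a f.contDiffOn hx

end HF

lemma Sph.ne_zero (u : Sph n) : (u : En n) ≠ 0 := by
  intro h; have := norm_eq_of_mem_sphere u; rw [h] at this; simp at this

@[simp] lemma Sph.norm (u : Sph n) : ‖(u : En n)‖ = 1 := norm_eq_of_mem_sphere u

@[simp] lemma Sph.inner_self (u : Sph n) : ⟪(u : En n), u⟫_ℝ = 1 := by
  rw [real_inner_self_eq_norm_sq, Sph.norm]; norm_num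

lemma continuous_sph {X : Type*} [TopologicalSpace X] {F : En n → X} (h : ContinuousOn F {0}ᶜ) :
    Continuous (fun u : Sph n => F u) :=
  h.comp_continuous continuous_subtype_val fun u => Sph.ne_zero u

namespace HF
variable (f : HF n)

lemma continuous_sph : Continuous (fun u : Sph n => f u) :=
  MinkIter.continuous_sph f.contDiffOn.continuousOn
lemma continuous_gradient_sph : Continuous (fun u : Sph n => gradient f u) :=
  MinkIter.continuous_sph (continuousOn_gradient f.contDiffOn)
lemma continuous_hess_sph : Continuous (fun u : Sph n => hess f u) :=
  MinkIter.continuous_sph (continuousOn_hess f.contDiffOn)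
end HF

lemma continuous_rk {X : Type*} [TopologicalSpace X] {a b : X → En n} (ha : Continuous a)
    (hb : Continuous b) : Continuous (fun x => rk (a x) (b x)) := by
  unfold rk
  have h := (ContinuousLinearMap.smulRightL ℝ (En n) (En n)).continuous₂
  exact h.comp ((((innerSL ℝ).continuous).comp hb).prodMk ha)

/-- The full second-order operator `f(u) u ⊗ u + D²f(u)`. -/
def sop (f : En n → ℝ) (u : En n) : En n →L[ℝ] En n := f u • rk u u + hess f u

lemma HF.continuous_sop (f : HF n) : Continuous (fun u : Sph n => sop f u) :=
  (f.continuous_sph.smul (continuous_rk continuous_subtype_val continuous_subtype_val)).add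
    f.continuous_hess_sph

lemma sop_add (f g : HF n) (u : Sph n) : sop (f + g : HF n) u = sop f u + sop g u := by
  rw [sop, HF.hess_add f g (Sph.ne_zero u), HF.coe_add, sop, sop]
  ext w k; simp; ring

lemma sop_smul (a : ℝ) (f : HF n) (u : Sph n) : sop (a • f : HF n) u = a • sop f u := by
  rw [sop, HF.hess_smul f a (Sph.ne_zero u), HF.coe_smul, sop]
  ext w k; simp; ring

/-- The norm as an element of `HF n`. -/
def nrm (n : ℕ) : HF n := ⟨fun x => ‖x‖, fun _ hx => (contDiffAt_norm ℝ hx).contDiffWithinAt,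
  fun c hc x => by simp [norm_smul, Real.norm_of_nonneg hc.le]⟩

@[simp] lemma nrm_apply (x : En n) : nrm n x = ‖x‖ := rfl

/-- A linear functional as an element of `HF n`. -/
def lin (a : En n) : HF n := ⟨fun x => ⟪a, x⟫_ℝ, (innerSL ℝ a).contDiff.contDiffOn,
  fun c _ x => by simp [inner_smul_right]⟩

@[simp] lemma lin_apply (a x : En n) : lin a x = ⟪a, x⟫_ℝ := rfl

lemma gradient_of_hasFDerivAt {f : En n → ℝ} {x p : En n} (h : HasFDerivAt f (innerSL ℝ p) x) :
    gradient f x = p := by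
  refine HasGradientAt.gradient ?_
  exact h

lemma gradient_lin (a x : En n) : gradient (lin a) x = a :=
  gradient_of_hasFDerivAt (innerSL ℝ a).hasFDerivAt

lemma hess_lin (a x : En n) : hess (lin a) x = 0 := by
  have : gradient (lin a : En n → ℝ) = fun _ => a := funext (gradient_lin a)
  rw [hess, this]; simp

lemma hasFDerivAt_norm {x : En n} (hx : x ≠ 0) :
    HasFDerivAt (fun y : En n => ‖y‖) (innerSL ℝ (‖x‖⁻¹ • x)) x := by
  have h := (contDiffAt_norm ℝ hx (n := 1)).differentiableAt (by norm_num)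
  have h1 : HasFDerivAt (fun y : En n => ‖y‖ ^ 2) (2 • innerSL ℝ x) x :=
    (hasStrictFDerivAt_norm_sq x).hasFDerivAt
  have h2 : HasFDerivAt (fun y : En n => ‖y‖ ^ 2) ((2 * ‖x‖) • fderiv ℝ (fun y : En n => ‖y‖) x) x := by
    simpa using h.hasFDerivAt.pow 2
  have h3 := h2.unique h1
  have hx' : ‖x‖ ≠ 0 := norm_ne_zero_iff.2 hx
  have : fderiv ℝ (fun y : En n => ‖y‖) x = innerSL ℝ (‖x‖⁻¹ • x) := by
    ext w
    have := congrArg (fun A : En n →L[ℝ] ℝ => A w) h3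
    simp at this ⊢
    field_simp; linarith
  rw [← this]; exact h.hasFDerivAt

lemma gradient_nrm {x : En n} (hx : x ≠ 0) : gradient (nrm n) x = ‖x‖⁻¹ • x :=
  gradient_of_hasFDerivAt (hasFDerivAt_norm hx)

/-- The orthogonal projection onto the complement of the line spanned by a unit vector. -/
def prj (u : En n) : En n →L[ℝ] En n := ContinuousLinearMap.id ℝ (En n) - rk u u

@[simp] lemma prj_apply (u w : En n) : prj u w = w - ⟪u, w⟫_ℝ • u := rfl

lemma hasFDerivAt_norm_inv {x : En n} (hx : x ≠ 0) :
    HasFDerivAt (fun y : En n => ‖y‖⁻¹) (-(‖x‖ ^ 3)⁻¹ • innerSL ℝ x) x := by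
  have hx' : ‖x‖ ≠ 0 := norm_ne_zero_iff.2 hx
  have := (hasDerivAt_inv hx').comp_hasFDerivAt x (hasFDerivAt_norm hx)
  refine this.congr_fderiv ?_
  ext w
  simp
  field_simp

lemma hess_nrm (u : Sph n) : hess (nrm n) u = prj u := by
  have h : gradient (nrm n) =ᶠ[𝓝 (u : En n)] fun x => ‖x‖⁻¹ • x := by
    filter_upwards [isOpen_compl_zero.mem_nhds (Sph.ne_zero u)] with y hy using gradient_nrm hy
  have h2 := (hasFDerivAt_norm_inv (Sph.ne_zero u)).smul (hasFDerivAt_id (u : En n))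
  rw [hess, h.fderiv_eq]
  refine (HasFDerivAt.fderiv h2).trans ?_
  ext w
  simp [sub_eq_add_neg]

lemma sop_nrm (u : Sph n) : sop (nrm n) u = ContinuousLinearMap.id ℝ (En n) := by
  rw [sop, hess_nrm]; simp [prj]

lemma integral_congr_all {X : Type*} [MeasurableSpace X] {μ : Measure X} {E : Type*}
    [NormedAddCommGroup E] [NormedSpace ℝ E] {f g : X → E} (h : ∀ x, f x = g x) :
    ∫ x, f x ∂μ = ∫ x, g x ∂μ := by
  simp_rw [h]

/-- The rotation invariant probability measure on the sphere. -/
def sg (n : ℕ) : Measure (Sph n) := (sphVol n Set.univ)⁻¹ • sphVol n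

instance : IsFiniteMeasure (sphVol n) := by unfold sphVol; infer_instance

lemma integral_polar (hn : 0 < n) (φ : ℝ → ℝ) (G : En n → ℝ) :
    ∫ x : En n, φ ‖x‖ * G (‖x‖⁻¹ • x) =
      (∫ u : Sph n, G u ∂(sphVol n)) * ∫ r in Set.Ioi (0 : ℝ), r ^ (n - 1) * φ r := by
  have : Nonempty (Fin n) := ⟨⟨0, hn⟩⟩
  have hmp := (volume : Measure (En n)).measurePreserving_homeomorphUnitSphereProd
  have h1 : ∫ x : En n, φ ‖x‖ * G (‖x‖⁻¹ • x) =
      ∫ x : ({0}ᶜ : Set (En n)), φ ‖(x : En n)‖ * G (‖(x : En n)‖⁻¹ • x)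
        ∂((volume : Measure (En n)).comap Subtype.val) := by
    rw [integral_subtype_comap (measurableSet_singleton _).compl
      (fun x : En n => φ ‖x‖ * G (‖x‖⁻¹ • x))]
    rw [restrict_compl_singleton]
  have h2 := hmp.integral_comp (Homeomorph.measurableEmbedding _)
    (fun p : Sph n × Set.Ioi (0 : ℝ) => G p.1 * φ p.2)
  rw [h1]
  rw [finrank_euclideanSpace_fin] at h2
  have h3 := integral_prod_mul (μ := sphVol n) (ν := Measure.volumeIoiPow (n - 1))
    (fun u : Sph n => G u) (fun r : Set.Ioi (0 : ℝ) => φ r)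
  have h4 : ∫ r : Set.Ioi (0 : ℝ), φ r ∂(Measure.volumeIoiPow (n - 1)) =
      ∫ r in Set.Ioi (0 : ℝ), r ^ (n - 1) * φ r := by
    rw [Measure.volumeIoiPow]
    have hm : Measurable fun r : Set.Ioi (0 : ℝ) => ENNReal.ofReal (r.1 ^ (n - 1)) := by fun_prop
    rw [integral_withDensity_eq_integral_toReal_smul hm (by simp)]
    rw [← integral_subtype_comap measurableSet_Ioi (fun r : ℝ => r ^ (n - 1) * φ r)]
    refine integral_congr_all fun r => ?_
    have hr : (0 : ℝ) < r := r.2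
    simp [ENNReal.toReal_ofReal (pow_nonneg hr.le (n - 1))]
  rw [← h4, ← h3]
  refine Eq.trans ?_ h2
  refine integral_congr_all fun x => ?_
  simp [homeomorphUnitSphereProd, mul_comm]

lemma sphVol_univ_pos (hn : 0 < n) : 0 < (sphVol n Set.univ).toReal := by
  have : Nonempty (Fin n) := ⟨⟨0, hn⟩⟩
  refine ENNReal.toReal_pos ?_ (measure_ne_top _ _)
  rw [Ne, Measure.measure_univ_eq_zero]
  exact Measure.toSphere_ne_zero _

lemma integral_sg (F : Sph n → ℝ) :
    ∫ u, F u ∂sg n = (sphVol n Set.univ).toReal⁻¹ * ∫ u, F u ∂(sphVol n) := by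
  rw [sg, integral_smul_measure, ENNReal.toReal_inv, smul_eq_mul]

lemma integral_sphVol (hn : 0 < n) (F : Sph n → ℝ) :
    ∫ u, F u ∂(sphVol n) = (sphVol n Set.univ).toReal * ∫ u, F u ∂sg n := by
  rw [integral_sg, mul_inv_cancel_left₀ (sphVol_univ_pos hn).ne']

lemma sg_isProb (hn : 0 < n) : IsProbabilityMeasure (sg n) := by
  constructor
  rw [sg, Measure.smul_apply, smul_eq_mul, ENNReal.inv_mul_cancel]
  · intro h; have := sphVol_univ_pos hn; rw [h] at this; simp at this
  · exact measure_ne_top _ _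

instance : IsFiniteMeasure (sg n) := by
  rcases Nat.eq_zero_or_pos n with h | h
  · subst h
    constructor
    have : IsEmpty (Sph 0) := ⟨fun u => Sph.ne_zero u (Subsingleton.elim _ _)⟩
    rw [Set.univ_eq_empty_iff.2 this]; simp
  · have := sg_isProb h; infer_instance

lemma integrable_sg {X : Type*} [NormedAddCommGroup X] {F : Sph n → X} (hF : Continuous F) :
    Integrable F (sg n) := hF.integrable_of_hasCompactSupport (HasCompactSupport.of_compactSpace F)

lemma det_one_add_pos (A : En n →L[ℝ] En n) (hA : ‖A‖ < 1) : 0 < (1 + A).det := by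
  have hne : ∀ t ∈ Set.Icc (0 : ℝ) 1, (1 + t • A).det ≠ 0 := by
    intro t ht h
    have h1 : ‖-(t • A)‖ < 1 := by
      rw [norm_neg, norm_smul, Real.norm_of_nonneg ht.1]
      exact lt_of_le_of_lt (mul_le_of_le_one_left (norm_nonneg _) ht.2) hA
    have hu : IsUnit (1 + t • A) := by
      have := isUnit_one_sub_of_norm_lt_one h1
      simpa using this
    have h2 : IsUnit ((1 + t • A : En n →L[ℝ] En n) : En n →ₗ[ℝ] En n) :=
      hu.map (ContinuousLinearMap.toLinearMapRingHom : (En n →L[ℝ] En n) →+* _)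
    have h3 := (LinearMap.isUnit_det _ h2)
    exact h3.ne_zero h
  have hc : ContinuousOn (fun t : ℝ => (1 + t • A).det) (Set.Icc 0 1) := by
    exact ((ContinuousLinearMap.continuous_det (𝕜 := ℝ) (E := En n)).comp
      (f := fun t : ℝ => 1 + t • A) (by fun_prop)).continuousOn
  by_contra hneg
  push Not at hneg
  have := intermediate_value_Icc' (zero_le_one) hc
  obtain ⟨t, ht, h0⟩ := this (show (0 : ℝ) ∈ Set.Icc _ _ by
    constructor
    · simpa using hneg
    · simp [ContinuousLinearMap.det])
  exact hne t ht h0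

lemma integral_det_one_add {P : En n → En n} (hP : ContDiff ℝ 1 P) {c : NNReal} (hc : c < 1)
    (hL : LipschitzWith c P) {R : ℝ} (hR : ∀ x, R < ‖x‖ → P x = 0) :
    ∫ x in closedBall (0 : En n) R, (1 + fderiv ℝ P x).det =
      (volume (closedBall (0 : En n) R)).toReal := by
  set T : En n → En n := fun x => x + P x with hT
  have happ : ApproximatesLinearOn T
      ((ContinuousLinearEquiv.refl ℝ (En n) : En n ≃L[ℝ] En n) : En n →L[ℝ] En n) Set.univ c := by
    intro x _ y _
    have := hL.norm_sub_le x y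
    simpa [hT, add_sub_add_comm] using this
  have hsmall : Subsingleton (En n) ∨ c <
      ‖((ContinuousLinearEquiv.refl ℝ (En n) : En n ≃L[ℝ] En n).symm : En n →L[ℝ] En n)‖₊⁻¹ := by
    rcases subsingleton_or_nontrivial (En n) with h | h
    · exact Or.inl h
    · right
      have : ‖((ContinuousLinearEquiv.refl ℝ (En n) : En n ≃L[ℝ] En n).symm : En n →L[ℝ] En n)‖₊
          = 1 := by
        ext; exact ContinuousLinearMap.norm_id
      rw [this]; simpa using hc
  have hinj : Function.Injective T := Set.injOn_univ.1 (happ.injOn hsmall)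
  have hsurj : Function.Surjective T := happ.surjective hsmall
  have hout : ∀ x, x ∉ closedBall (0 : En n) R → T x = x := by
    intro x hx
    simp only [mem_closedBall, dist_zero_right, not_le] at hx
    simp [hT, hR x hx]
  have himg : T '' closedBall 0 R = closedBall 0 R := by
    ext y; constructor
    · rintro ⟨x, hx, rfl⟩
      by_contra hy
      have := hinj (hout _ hy)
      rw [this] at hy; exact hy hx
    · intro hy
      obtain ⟨x, rfl⟩ := hsurj y
      by_contra hx
      have hx' : x ∉ closedBall (0 : En n) R := fun h => hx ⟨x, h, rfl⟩
      rw [hout x hx'] at hy; exact hx' hy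
  have hd : ∀ x ∈ closedBall (0 : En n) R,
      HasFDerivWithinAt T (1 + fderiv ℝ P x) (closedBall 0 R) x := fun x _ =>
    ((hasFDerivAt_id x).add (hP.differentiable (by norm_num) x).hasFDerivAt).hasFDerivWithinAt
  have h := integral_image_eq_integral_abs_det_fderiv_smul volume
    (isClosed_closedBall.measurableSet) hd hinj.injOn (fun _ => (1 : ℝ))
  rw [himg] at h
  simp only [integral_const, smul_eq_mul, mul_one] at h
  rw [measureReal_restrict_apply_univ] at h
  rw [← measureReal_def, h]
  refine integral_congr_all fun x => ?_
  have h1 : ‖fderiv ℝ P x‖ < 1 :=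
    lt_of_le_of_lt (norm_fderiv_le_of_lipschitz ℝ hL) (by exact_mod_cast hc)
  exact (abs_of_pos (det_one_add_pos _ h1)).symm

/-- Mixed discriminants of derivatives are null Lagrangians. -/
lemma integral_mdisc_fderiv (hn : 0 < n) (P : Fin n → En n → En n)
    (hP : ∀ j, ContDiff ℝ 1 (P j)) (hs : ∀ j, HasCompactSupport (P j)) :
    ∫ x, mdisc n (fun j => fderiv ℝ (P j) x) = 0 := by
  choose C hC using fun j => (hP j).lipschitzWith_of_hasCompactSupport (hs j) (by norm_num)
  have hbd : ∃ R : ℝ, ∀ j x, R < ‖x‖ → P j x = 0 := by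
    have : ∀ j, ∃ R : ℝ, ∀ x, R < ‖x‖ → P j x = 0 := by
      intro j
      obtain ⟨R, hR⟩ := (hs j).isCompact.isBounded.subset_closedBall 0
      refine ⟨R, fun x hx => image_eq_zero_of_notMem_tsupport fun h => ?_⟩
      have := hR h
      simp at this; linarith
    choose R hR using this
    refine ⟨∑ j, |R j|, fun j x hx => hR j x (lt_of_le_of_lt ?_ hx)⟩
    exact (le_abs_self _).trans (Finset.single_le_sum (f := fun j => |R j|)
      (fun _ _ => abs_nonneg _) (Finset.mem_univ j))
  obtain ⟨R, hR⟩ := hbd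
  set l : NNReal := (2 * (1 + ∑ j, C j))⁻¹ with hl
  have hlpos : (0 : ℝ) < l := by rw [hl]; positivity
  have hsub : ∀ S : Finset (Fin n),
      ∫ x in closedBall (0 : En n) R, (1 + ∑ j ∈ S, (l : ℝ) • fderiv ℝ (P j) x).det =
      (volume (closedBall (0 : En n) R)).toReal := by
    intro S
    have hL : LipschitzWith (l * ∑ j ∈ S, C j) (fun x => (l : ℝ) • ∑ j ∈ S, P j x) := by
      refine LipschitzWith.of_dist_le_mul fun x y => ?_
      rw [dist_eq_norm, ← smul_sub, norm_smul, Real.norm_of_nonneg hlpos.le, ← Finset.sum_sub_distrib]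
      push_cast
      rw [mul_assoc, Finset.sum_mul]
      refine mul_le_mul_of_nonneg_left ((norm_sum_le _ _).trans ?_) hlpos.le
      exact Finset.sum_le_sum fun j _ => by
        rw [← dist_eq_norm]; exact (hC j).dist_le_mul x y
    have hlt : l * ∑ j ∈ S, C j < 1 := by
      have h1 : ∑ j ∈ S, C j ≤ ∑ j, C j := Finset.sum_le_univ_sum_of_nonneg fun _ => zero_le
      have h2 : l * ∑ j ∈ S, C j ≤ l * ∑ j, C j := by gcongr
      refine lt_of_le_of_lt h2 ?_
      rw [hl, ← NNReal.coe_lt_coe]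
      push_cast
      rw [inv_mul_lt_iff₀ (by positivity)]
      have : (0 : ℝ) ≤ ∑ j, (C j : ℝ) := by positivity
      linarith
    have hcd : ContDiff ℝ 1 (fun x => (l : ℝ) • ∑ j ∈ S, P j x) :=
      (ContDiff.sum fun j _ => hP j).const_smul (l : ℝ)
    rw [← integral_det_one_add hcd hlt hL (R := R) (fun x hx => by
      simp [Finset.sum_eq_zero fun j _ => hR j x hx])]
    refine integral_congr_all fun x => ?_
    have : fderiv ℝ (fun x => (l : ℝ) • ∑ j ∈ S, P j x) x = ∑ j ∈ S, (l : ℝ) • fderiv ℝ (P j) x := by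
      have h1 : HasFDerivAt (fun x => (l : ℝ) • ∑ j ∈ S, P j x)
          ((l : ℝ) • ∑ j ∈ S, fderiv ℝ (P j) x) x :=
        (HasFDerivAt.fun_sum fun j _ =>
          ((hP j).differentiable (by norm_num) x).hasFDerivAt).const_smul (l : ℝ)
      rw [h1.fderiv, Finset.smul_sum]
    simp only [this]
  have hcont : ∀ j, Continuous (fun x => fderiv ℝ (P j) x) := fun j =>
    (hP j).continuous_fderiv (by norm_num)
  have hsum : ∫ x in closedBall (0 : En n) R, mdisc n (fun j => fderiv ℝ (P j) x) = 0 := by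
    have h1 : ∀ x, ∑ S : Finset (Fin n), (-1 : ℝ) ^ (n - S.card) *
        (1 + ∑ j ∈ S, (l : ℝ) • fderiv ℝ (P j) x).det =
        (n.factorial * (l : ℝ) ^ n) * mdisc n (fun j => fderiv ℝ (P j) x) := by
      intro x
      rw [mdisc_polarization 1 (fun j => (l : ℝ) • fderiv ℝ (P j) x)]
      rw [(mdisc n).map_smul_univ (fun _ => (l : ℝ)) (fun j => fderiv ℝ (P j) x)]
      simp [mul_assoc]
    have h2 : ∫ x in closedBall (0 : En n) R, (n.factorial * (l : ℝ) ^ n) *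
        mdisc n (fun j => fderiv ℝ (P j) x) = 0 := by
      simp only [← h1]
      rw [integral_finsetSum]
      · simp only [integral_const_mul, hsub, ← Finset.sum_mul]
        have := sum_superset_neg_one_pow (n := n) ∅
        simp only [Finset.empty_subset, if_true] at this
        rw [this, if_neg, zero_mul]
        intro h
        have := congrArg Finset.card h
        simp at this; omega
      · intro S _
        refine (Continuous.continuousOn ?_).integrableOn_compact (isCompact_closedBall _ _)
        exact ((ContinuousLinearMap.continuous_det (𝕜 := ℝ) (E := En n)).comp
          (f := fun x => 1 + ∑ j ∈ S, (l : ℝ) • fderiv ℝ (P j) x) (by fun_prop)).const_mul _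
    rw [integral_const_mul] at h2
    exact (mul_eq_zero.1 h2).resolve_left (by positivity)
  rw [← hsum, setIntegral_eq_integral_of_forall_compl_eq_zero]
  intro x hx
  have hx' : R < ‖x‖ := by simpa using hx
  have : fderiv ℝ (P ⟨0, hn⟩) x = 0 := by
    have h : P ⟨0, hn⟩ =ᶠ[𝓝 x] fun _ => 0 := by
      filter_upwards [(isOpen_lt continuous_const continuous_norm).mem_nhds hx'] with y hy
        using hR _ y hy
    rw [h.fderiv_eq]; simp
  exact (mdisc n).map_coord_zero ⟨0, hn⟩ this

section Algebra

lemma norm_normalize {x : En n} (hx : 0 < ‖x‖) : ‖‖x‖⁻¹ • x‖ = 1 := by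
  rw [norm_smul, norm_inv, norm_norm, inv_mul_cancel₀ hx.ne']

lemma rk_add_left (x x' y : En n) : rk (x + x') y = rk x y + rk x' y := by
  ext w k; simp

lemma rk_smul_left (c : ℝ) (x y : En n) : rk (c • x) y = c • rk x y := by
  ext w k; simp; ring

lemma mdisc_update_rk {u : En n} (hu : ‖u‖ = 1) (A : Fin n → En n →L[ℝ] En n) (q : En n)
    (hR : ∀ l w, ⟪u, A l w⟫_ℝ = 0) (l : Fin n) :
    mdisc n (update A l (rk q u)) =
      ⟪u, q⟫_ℝ * mdisc n (update A l (rk u u)) := by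
  have hq : q = ⟪u, q⟫_ℝ • u + (q - ⟪u, q⟫_ℝ • u) := by abel
  have hu0 : u ≠ 0 := by intro h; simp [h] at hu
  conv_lhs => rw [hq, rk_add_left, MultilinearMap.map_update_add, rk_smul_left,
    MultilinearMap.map_update_smul, smul_eq_mul]
  rw [add_eq_left]
  refine mdisc_eq_zero_of_range hu0 _ fun j w => ?_
  rcases eq_or_ne j l with rfl | h
  · simp [inner_smul_right, inner_sub_right, hu]
  · rw [Function.update_of_ne h]; exact hR j w

lemma mdisc_add_rk {u : En n} (hu : ‖u‖ = 1) (A : Fin n → En n →L[ℝ] En n) (q : Fin n → En n)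
    (hK : ∀ l, A l u = 0) (hR : ∀ l w, ⟪u, A l w⟫_ℝ = 0) :
    mdisc n (fun l => A l + rk (q l) u) =
      ∑ l, ⟪u, q l⟫_ℝ * mdisc n (update A l (rk u u)) := by
  have hu0 : u ≠ 0 := by intro h; simp [h] at hu
  have h0 : (fun l => A l + rk (q l) u) = A + fun l => rk (q l) u := rfl
  rw [h0, MultilinearMap.map_add_univ]
  symm
  refine Finset.sum_of_injOn (fun l => ({l} : Finset (Fin n))ᶜ) ?_ ?_ ?_ ?_
  · intro a _ b _ h
    simpa using h
  · intro _ _; simp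
  · intro s _ hs
    rcases Nat.lt_trichotomy sᶜ.card 1 with h | h | h
    · have h1 : s = Finset.univ := by
        rw [← Finset.compl_eq_empty_iff, ← Finset.card_eq_zero]; omega
      rw [h1, Finset.piecewise_univ]
      exact mdisc_eq_zero_of_ker hu0 _ hK
    · obtain ⟨l, hl⟩ := Finset.card_eq_one.1 h
      refine absurd ⟨l, by simp, ?_⟩ hs
      simp [← hl]
    · obtain ⟨j, k, hj, hk, hjk⟩ := Finset.one_lt_card_iff.1 h
      rw [Finset.mem_compl] at hj hk
      refine mdisc_eq_zero_of_two_ker (u := u) _ hjk (q j) (q k) (fun w => ?_) (fun w => ?_)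
      · rw [Finset.piecewise_eq_of_notMem _ _ _ hj]; rfl
      · rw [Finset.piecewise_eq_of_notMem _ _ _ hk]; rfl
  · intro l _
    rw [← mdisc_update_rk hu A (q l) hR l]
    congr 1
    ext1 j
    rcases eq_or_ne j l with rfl | h
    · simp
    · rw [Function.update_of_ne h, Finset.piecewise_eq_of_mem]; simpa using h

lemma mdisc_update_swap (A : Fin n → En n →L[ℝ] En n) (X : En n →L[ℝ] En n) {j k : Fin n}
    (h : A j = A k) : mdisc n (update A j X) = mdisc n (update A k X) := by
  rcases eq_or_ne j k with rfl | hjk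
  · rfl
  rw [← mdisc_perm (update A k X) (Equiv.swap j k)]
  congr 1
  ext1 l
  rcases eq_or_ne l j with rfl | hj
  · simp
  rcases eq_or_ne l k with rfl | hk
  · rw [Equiv.swap_apply_right, Function.update_of_ne hj, Function.update_of_ne hjk, h]
  · rw [Equiv.swap_apply_of_ne_of_ne hj hk, Function.update_of_ne hj, Function.update_of_ne hk]

end Algebra

section Flux

lemma hasFDerivAt_flux (f : HF n) {ζ : ℝ → ℝ} (hζ : ContDiff ℝ 2 ζ) {x : En n} (hx : x ≠ 0) :
    HasFDerivAt (fun x : En n => ζ (‖x‖ ^ 2) • (‖x‖ • gradient f x))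
      (ζ (‖x‖ ^ 2) • hess f (‖x‖⁻¹ • x) + (ζ (‖x‖ ^ 2) + 2 * ‖x‖ ^ 2 * deriv ζ (‖x‖ ^ 2)) •
        rk (gradient f (‖x‖⁻¹ • x)) (‖x‖⁻¹ • x)) x := by
  have hx' : 0 < ‖x‖ := norm_pos_iff.2 hx
  have h1 : HasFDerivAt (fun y : En n => ‖y‖ ^ 2) (2 • innerSL ℝ x) x :=
    (hasStrictFDerivAt_norm_sq x).hasFDerivAt
  have h2 := ((hζ.differentiable (by norm_num) (‖x‖ ^ 2)).hasDerivAt).comp_hasFDerivAt x h1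
  have h3 := (hasFDerivAt_norm hx).smul (f.hasFDerivAt_gradient hx)
  have h4 := h2.smul h3
  rw [f.hess_smul_arg (inv_pos.2 hx') hx, f.gradient_smul_arg (inv_pos.2 hx') hx]
  refine h4.congr_fderiv ?_
  ext w k
  simp [inner_smul_left]
  field_simp
  ring

lemma contDiff_flux (f : HF n) {ζ : ℝ → ℝ} (hζ : ContDiff ℝ 2 ζ) {δ : ℝ} (hδ : 0 < δ)
    (h0 : ∀ s < δ, ζ s = 0) :
    ContDiff ℝ 1 (fun x : En n => ζ (‖x‖ ^ 2) • (‖x‖ • gradient f x)) := by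
  rw [contDiff_iff_contDiffAt]
  intro x
  rcases eq_or_ne x 0 with rfl | hx
  · have : (fun x : En n => ζ (‖x‖ ^ 2) • (‖x‖ • gradient f x)) =ᶠ[𝓝 0] fun _ => 0 := by
      have hc : Continuous fun y : En n => ‖y‖ ^ 2 := by fun_prop
      filter_upwards [(isOpen_lt hc continuous_const).mem_nhds
        (show (0 : En n) ∈ {y : En n | ‖y‖ ^ 2 < δ} by simpa using hδ)] with y hy
      rw [h0 _ hy, zero_smul]
    exact contDiffAt_const.congr_of_eventuallyEq this
  · have h1 : ContDiffAt ℝ 1 (fun x : En n => ζ (‖x‖ ^ 2)) x :=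
      ((hζ.of_le (by norm_num : (1 : WithTop ℕ∞) ≤ 2)).contDiffAt).comp x (contDiff_norm_sq ℝ).contDiffAt
    have h2 : ContDiffAt ℝ 1 (fun x : En n => ‖x‖ • gradient f x) x :=
      (contDiffAt_norm ℝ hx).smul (contDiffAt_gradient (f.contDiffAt hx))
    exact h1.smul h2

end Flux

/-- The Hessians of a family of functions. -/
def hs (F : Fin n → HF n) (u : En n) : Fin n → En n →L[ℝ] En n := fun j => hess (F j) u

lemma continuous_mdisc {X : Type*} [TopologicalSpace X] {A : X → Fin n → En n →L[ℝ] En n}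
    (h : ∀ j, Continuous fun x => A x j) : Continuous fun x => mdisc n (A x) :=
  (mdisc_continuous n).comp (continuous_pi h)

lemma continuous_update_uu {A : Sph n → Fin n → En n →L[ℝ] En n} (h : ∀ j, Continuous fun u => A u j)
    (a : Fin n) {B : Sph n → En n →L[ℝ] En n} (hB : Continuous B) (j : Fin n) :
    Continuous fun u => update (A u) a (B u) j := by
  rcases eq_or_ne j a with rfl | hj
  · simpa using hB
  · simpa [Function.update_of_ne hj] using h j

lemma continuous_rk_self : Continuous fun u : Sph n => rk (u : En n) u :=
  continuous_rk continuous_subtype_val continuous_subtype_val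

lemma continuous_hs (F : Fin n → HF n) (j : Fin n) : Continuous fun u : Sph n => hs F u j :=
  (F j).continuous_hess_sph

lemma hs_ker (F : Fin n → HF n) {u : En n} (hu : u ≠ 0) (l : Fin n) : hs F u l u = 0 :=
  (F l).hess_self hu

lemma hs_range (F : Fin n → HF n) {u : En n} (hu : u ≠ 0) (l : Fin n) (w : En n) :
    ⟪u, hs F u l w⟫_ℝ = 0 := (F l).inner_hess_self hu w

lemma hasCompactSupport_comp_sq {z : ℝ → ℝ} (hs : HasCompactSupport z) :
    HasCompactSupport fun r : ℝ => z (r ^ 2) := by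
  obtain ⟨R, hR⟩ := hs.isCompact.isBounded.subset_closedBall 0
  refine HasCompactSupport.of_support_subset_isCompact (isCompact_closedBall (0 : ℝ) (1 + |R|)) ?_
  intro r hr
  have h1 : r ^ 2 ∈ closedBall (0 : ℝ) R := hR (subset_tsupport _ hr)
  simp only [mem_closedBall, dist_zero_right, Real.norm_eq_abs] at h1 ⊢
  have h2 : |r| ^ 2 ≤ |R| := by
    rw [sq_abs]; exact (le_abs_self _).trans (h1.trans (le_abs_self _))
  by_contra h3
  push Not at h3
  nlinarith [abs_nonneg R, abs_nonneg r]

lemma radial_integral (hn : 0 < n) {z : ℝ → ℝ} (hz : ContDiff ℝ 2 z) (hs : HasCompactSupport z) :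
    ∫ r in Set.Ioi (0 : ℝ), r ^ (n - 1) * (2 * r ^ 2 * deriv z (r ^ 2)) =
      -(n * ∫ r in Set.Ioi (0 : ℝ), r ^ (n - 1) * z (r ^ 2)) := by
  have hcs := hasCompactSupport_comp_sq hs
  have hcs' := hasCompactSupport_comp_sq hs.deriv
  have hd : Continuous (deriv z) := hz.continuous_deriv (by norm_num)
  have i1 : Integrable (fun r : ℝ => r ^ (n - 1) * z (r ^ 2)) :=
    Continuous.integrable_of_hasCompactSupport (by have := hz.continuous; fun_prop) hcs.mul_left
  have i2 : Integrable (fun r : ℝ => r ^ (n - 1) * (2 * r ^ 2 * deriv z (r ^ 2))) :=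
    Continuous.integrable_of_hasCompactSupport (by fun_prop) (hcs'.mul_left.mul_left)
  have h := integral_Ioi_of_hasDerivAt_of_tendsto' (a := (0 : ℝ)) (m := 0)
    (f := fun r : ℝ => r ^ n * z (r ^ 2))
    (f' := fun r => r ^ (n - 1) * (2 * r ^ 2 * deriv z (r ^ 2)) + n * (r ^ (n - 1) * z (r ^ 2))) ?_
    ((i2.add (i1.const_mul n)).integrableOn) ?_
  · rw [integral_add i2.integrableOn (i1.const_mul _).integrableOn, integral_const_mul] at h
    simp [hn.ne'] at h
    linarith
  · intro r _
    have h1 := ((hz.differentiable (by norm_num) (r ^ 2)).hasDerivAt).comp r (hasDerivAt_pow 2 r)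
    have h2 := (hasDerivAt_pow n r).mul h1
    refine h2.congr_deriv ?_
    obtain ⟨m, rfl⟩ : ∃ m, n = m + 1 := ⟨n - 1, by omega⟩
    simp [pow_succ]; ring
  · have : (fun r : ℝ => r ^ n * z (r ^ 2)) =ᶠ[atTop] fun _ => 0 := by
      have h1 := (hcs.mul_left (f := fun r : ℝ => r ^ n))
      obtain ⟨R, hR⟩ := h1.isCompact.isBounded.subset_closedBall 0
      filter_upwards [eventually_gt_atTop (max R 0)] with r hr
      refine image_eq_zero_of_notMem_tsupport (f := fun r : ℝ => r ^ n * z (r ^ 2)) fun h => ?_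
      have := hR h
      simp only [mem_closedBall, dist_zero_right, Real.norm_eq_abs] at this
      have := (le_abs_self r).trans this
      have := (le_max_left R 0).trans_lt hr
      linarith
    exact (tendsto_const_nhds).congr' this.symm

lemma continuousOn_normalize {G : En n → ℝ} (hG : Continuous fun u : Sph n => G u) :
    ContinuousOn (fun x : En n => G (‖x‖⁻¹ • x)) {0}ᶜ := by
  rw [continuousOn_iff_continuous_domRestrict]
  have hc : Continuous fun x : ({0}ᶜ : Set (En n)) =>
      (⟨‖(x : En n)‖⁻¹ • (x : En n), by
        have : ‖(x : En n)‖ ≠ 0 := norm_ne_zero_iff.2 x.2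
        rw [mem_sphere_zero_iff_norm, norm_smul, norm_inv, norm_norm, inv_mul_cancel₀ this]⟩ : Sph n) := by
    refine Continuous.subtype_mk (Continuous.smul (Continuous.inv₀
      (continuous_norm.comp continuous_subtype_val) ?_) continuous_subtype_val) _
    intro x; exact norm_ne_zero_iff.2 x.2
  exact hG.comp hc

lemma integrable_polar {φ : ℝ → ℝ} (hφ : Continuous φ) {δ R : ℝ} (hδ : 0 < δ)
    (h0 : ∀ r < δ, 0 ≤ r → φ r = 0) (h1 : ∀ r > R, φ r = 0) {G : En n → ℝ}
    (hG : Continuous fun u : Sph n => G u) :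
    Integrable fun x : En n => φ ‖x‖ * G (‖x‖⁻¹ • x) := by
  refine Continuous.integrable_of_hasCompactSupport ?_ ?_
  · rw [continuous_iff_continuousAt]
    intro x
    rcases eq_or_ne x 0 with rfl | hx
    · have : (fun x : En n => φ ‖x‖ * G (‖x‖⁻¹ • x)) =ᶠ[𝓝 0] fun _ => 0 := by
        filter_upwards [(isOpen_lt continuous_norm continuous_const).mem_nhds
          (show (0 : En n) ∈ {y : En n | ‖y‖ < δ} by simpa using hδ)] with y hy
        rw [h0 _ hy (norm_nonneg _), zero_mul]
      exact continuousAt_const.congr this.symm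
    · exact (hφ.comp continuous_norm).continuousAt.mul
        ((continuousOn_normalize hG).continuousAt (isOpen_compl_zero.mem_nhds hx))
  · refine HasCompactSupport.of_support_subset_isCompact (isCompact_closedBall (0 : En n) R) ?_
    intro x hx
    simp only [mem_closedBall, dist_zero_right]
    by_contra h
    push Not at h
    exact hx (by simp only [h1 _ h, zero_mul])

/-- The basic integration by parts: all mixed discriminant expansions over the sphere agree. -/
lemma sum_integral_eq (hn : 0 < n) (F : Fin n → HF n) (a : Fin n) :
    ∑ l, ∫ u, F l u * mdisc n (update (hs F u) l (rk (u : En n) u)) ∂sg n =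
      n * ∫ u, F a u * mdisc n (update (hs F u) a (rk (u : En n) u)) ∂sg n := by
  set zb : ContDiffBump (5 / 2 : ℝ) := ⟨1 / 2, 1, by norm_num, by norm_num⟩ with hzb
  set xb : ContDiffBump (5 / 2 : ℝ) := ⟨5 / 4, 3 / 2, by norm_num, by norm_num⟩ with hxb
  set ζ : Fin n → ℝ → ℝ := fun l => if l = a then zb else xb with hζ
  have hζc : ∀ l, ContDiff ℝ 2 (ζ l) := fun l => by
    by_cases h : l = a
    · simp only [hζ, h, if_true]; exact zb.contDiff
    · simp only [hζ, h, if_false]; exact xb.contDiff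
  have hz0 : ∀ s : ℝ, 1 ≤ |s - 5 / 2| → zb s = 0 := fun s hs =>
    zb.zero_of_le_dist (by rw [Real.dist_eq]; exact hs)
  have hζ0 : ∀ l, ∀ s < (1 : ℝ), ζ l s = 0 := fun l s hs => by
    by_cases h : l = a
    · simp only [hζ, h, if_true]
      refine hz0 s ?_
      rw [abs_of_neg (by linarith)]; linarith
    · simp only [hζ, h, if_false]
      refine xb.zero_of_le_dist ?_
      rw [Real.dist_eq, abs_of_neg (by linarith)]; simp [hxb]; linarith
  have hζs : ∀ l, ∀ s, (4 : ℝ) < s → ζ l s = 0 := fun l s hs => by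
    by_cases h : l = a
    · simp only [hζ, h, if_true]
      refine hz0 s ?_
      rw [abs_of_pos (by linarith)]; linarith
    · simp only [hζ, h, if_false]
      refine xb.zero_of_le_dist ?_
      rw [Real.dist_eq, abs_of_pos (by linarith)]; simp [hxb]; linarith
  have hzd : ∀ s : ℝ, 1 < |s - 5 / 2| → deriv zb s = 0 := fun s hs => by
    have : (zb : ℝ → ℝ) =ᶠ[𝓝 s] fun _ => 0 := by
      filter_upwards [(isOpen_lt continuous_const
        (by fun_prop : Continuous fun s : ℝ => |s - 5 / 2|)).mem_nhds hs] with y hy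
      exact hz0 y (le_of_lt hy)
    rw [this.deriv_eq]; simp
  have hx1 : ∀ s : ℝ, |s - 5 / 2| < 5 / 4 → xb s = 1 ∧ deriv xb s = 0 := fun s hs => by
    have hb := xb.eventuallyEq_one_of_mem_ball (x := s) (by rw [mem_ball, Real.dist_eq]; exact hs)
    refine ⟨hb.eq_of_nhds, ?_⟩
    rw [hb.deriv_eq]; exact deriv_const s 1
  set P : Fin n → En n → En n := fun l x => ζ l (‖x‖ ^ 2) • (‖x‖ • gradient (F l) x) with hP
  have hPs : ∀ l, HasCompactSupport (P l) := fun l => by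
    refine HasCompactSupport.of_support_subset_isCompact (isCompact_closedBall (0 : En n) 2) ?_
    intro x hx
    simp only [mem_closedBall, dist_zero_right]
    by_contra h
    push Not at h
    exact hx (by simp only [hP]; rw [hζs l _ (by nlinarith), zero_smul])
  have key := integral_mdisc_fderiv hn P (fun l => contDiff_flux (F l) (hζc l) one_pos (hζ0 l)) hPs
  set G : Fin n → En n → ℝ := fun l u =>
    F l u * mdisc n (update (hs F u) l (rk u u)) with hG
  have hpt : ∀ x : En n, x ≠ 0 → mdisc n (fun l => fderiv ℝ (P l) x) =
      zb (‖x‖ ^ 2) * ∑ l, G l (‖x‖⁻¹ • x) + (2 * ‖x‖ ^ 2 * deriv zb (‖x‖ ^ 2)) * G a (‖x‖⁻¹ • x) := by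
    intro x hx
    have hx' : 0 < ‖x‖ := norm_pos_iff.2 hx
    set u := ‖x‖⁻¹ • x with hu
    set r := ‖x‖ with hr
    have hun : ‖u‖ = 1 := norm_normalize hx'
    have hu0 : u ≠ 0 := by intro h; simp [h] at hun
    have hD : ∀ l, fderiv ℝ (P l) x = ζ l (r ^ 2) • hess (F l) u +
        rk ((ζ l (r ^ 2) + 2 * r ^ 2 * deriv (ζ l) (r ^ 2)) • gradient (F l) u) u := fun l => by
      rw [rk_smul_left]
      exact (hasFDerivAt_flux (F l) (hζc l) hx).fderiv
    simp only [hD]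
    rw [mdisc_add_rk hun (fun l => ζ l (r ^ 2) • hess (F l) u) _ (fun l => by
      simp [(F l).hess_self hu0]) (fun l w => by simp [inner_smul_right, (F l).inner_hess_self hu0])]
    have hgr : ∀ l, ⟪u, gradient (F l) u⟫_ℝ = F l u := fun l => by
      rw [real_inner_comm, (F l).inner_gradient_self hu0]
    simp only [inner_smul_right, hgr]
    by_cases hs1 : |r ^ 2 - 5 / 2| < 5 / 4
    · obtain ⟨hv, hd⟩ := hx1 _ hs1
      have hup : ∀ l, mdisc n (update (fun l => ζ l (r ^ 2) • hess (F l) u) l (rk u u)) =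
          (if l = a then 1 else zb (r ^ 2)) * mdisc n (update (hs F u) l (rk u u)) := by
        intro l
        by_cases hl : l = a
        · subst hl
          rw [if_pos rfl, one_mul]
          congr 1
          ext1 j
          rcases eq_or_ne j l with rfl | hj
          · simp
          · simp [hζ, hj, hv, hs]
        · rw [if_neg hl, ← smul_eq_mul, ← MultilinearMap.map_update_smul _ _ _ (zb (r ^ 2))]
          have : update (fun l => ζ l (r ^ 2) • hess (F l) u) l (rk u u) =
              update (update (hs F u) l (rk u u)) a (zb (r ^ 2) • hess (F a) u) := by
            ext1 j
            rcases eq_or_ne j a with rfl | hj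
            · simp [Function.update_of_ne (Ne.symm hl), hζ]
            · rcases eq_or_ne j l with rfl | hj'
              · simp [hj]
              · simp [Function.update_of_ne hj', hζ, hj, hv, hs]
          rw [this, MultilinearMap.map_update_smul]
          rw [MultilinearMap.map_update_smul]
          congr 2
          ext1 j
          rcases eq_or_ne j a with rfl | hj
          · simp [Function.update_of_ne (Ne.symm hl), hs]
          · simp [Function.update_of_ne hj]
      simp only [hup]
      rw [Finset.mul_sum, ← Finset.add_sum_erase _ _ (Finset.mem_univ a),
        ← Finset.add_sum_erase Finset.univ (fun i => zb (r ^ 2) * G i u) (Finset.mem_univ a)]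
      have he : ∀ l ∈ Finset.univ.erase a,
          (ζ l (r ^ 2) + 2 * r ^ 2 * deriv (ζ l) (r ^ 2)) * F l u *
          ((if l = a then 1 else zb (r ^ 2)) * mdisc n (update (hs F u) l (rk u u))) =
          zb (r ^ 2) * G l u := by
        intro l hl
        have hl := (Finset.mem_erase.1 hl).1
        simp only [hζ, hl, if_false, hv, hd, hG]; ring
      rw [Finset.sum_congr rfl he]
      simp only [hζ, if_true, hG]; ring
    · push Not at hs1
      rw [hz0 _ (by linarith), hzd _ (by linarith)]
      simp only [zero_mul, mul_zero, add_zero]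
      refine Finset.sum_eq_zero fun l _ => ?_
      by_cases hl : l = a
      · simp only [hζ, hl, if_true]
        rw [hz0 _ (by linarith), hzd _ (by linarith)]; simp
      · rw [(mdisc n).map_coord_zero a, mul_zero]
        rw [Function.update_of_ne (Ne.symm hl)]
        simp only [hζ, if_true]
        rw [hz0 _ (by linarith)]
        exact zero_smul ℝ (hess (F a) u)
  have hGc : ∀ l, Continuous fun u : Sph n => G l u := fun l =>
    (F l).continuous_sph.mul (continuous_mdisc (continuous_update_uu (continuous_hs F) l
      continuous_rk_self))
  have hzc : Continuous (deriv zb) := (zb.contDiff (n := 2)).continuous_deriv (by norm_num)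
  have hdz : ∀ r : ℝ, 0 ≤ r → (r < 1 ∨ 2 < r) → 1 < |r ^ 2 - 5 / 2| := by
    rintro r h0 (h | h)
    · rw [abs_of_neg (by nlinarith)]; nlinarith
    · rw [abs_of_pos (by nlinarith)]; nlinarith
  have hI1 : Integrable fun x : En n => zb (‖x‖ ^ 2) * ∑ l, G l (‖x‖⁻¹ • x) :=
    integrable_polar (φ := fun r => zb (r ^ 2)) (G := fun u => ∑ l, G l u)
      (zb.continuous.comp (continuous_pow 2)) one_pos
      (fun r h h' => hz0 _ (hdz r h' (Or.inl h)).le)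
      (fun r (h : r > 2) => hz0 _ (hdz r (by linarith) (Or.inr h)).le)
      (continuous_finsetSum _ fun l _ => hGc l)
  have hI2 : Integrable fun x : En n =>
      (2 * ‖x‖ ^ 2 * deriv zb (‖x‖ ^ 2)) * G a (‖x‖⁻¹ • x) :=
    integrable_polar (φ := fun r => 2 * r ^ 2 * deriv zb (r ^ 2)) (G := G a)
      (by fun_prop) one_pos
      (fun r h h' => by rw [hzd _ (hdz r h' (Or.inl h)), mul_zero])
      (fun r (h : r > 2) => by rw [hzd _ (hdz r (by linarith) (Or.inr h)), mul_zero]) (hGc a)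
  have hnt : Nontrivial (En n) := by
    have : Nonempty (Fin n) := ⟨⟨0, hn⟩⟩
    infer_instance
  have hae : ∀ᵐ x : En n, mdisc n (fun l => fderiv ℝ (P l) x) =
      zb (‖x‖ ^ 2) * ∑ l, G l (‖x‖⁻¹ • x) +
        (2 * ‖x‖ ^ 2 * deriv zb (‖x‖ ^ 2)) * G a (‖x‖⁻¹ • x) := by
    filter_upwards [(volume : Measure (En n)).ae_ne 0] with x hx using hpt x hx
  rw [integral_congr_ae hae, integral_add hI1 hI2,
    integral_polar hn (fun r => zb (r ^ 2)) (fun u => ∑ l, G l u),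
    integral_polar hn (fun r => 2 * r ^ 2 * deriv zb (r ^ 2)) (G a),
    radial_integral hn zb.contDiff zb.hasCompactSupport,
    integral_sphVol hn, integral_sphVol hn] at key
  have hpos : 0 < ∫ r in Set.Ioi (0 : ℝ), r ^ (n - 1) * zb (r ^ 2) := by
    rw [setIntegral_pos_iff_support_of_nonneg_ae]
    · refine lt_of_lt_of_le ?_ (measure_mono (show Set.Ioo (3 / 2 : ℝ) (8 / 5) ⊆ _ from ?_))
      · rw [Real.volume_Ioo]; simp; norm_num
      · intro r hr
        have hr1 := hr.1
        have hr2 := hr.2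
        refine ⟨?_, by simp only [Set.mem_Ioi]; linarith⟩
        simp only [Function.mem_support]
        have : zb (r ^ 2) = 1 := zb.one_of_mem_closedBall (by
          rw [mem_closedBall, Real.dist_eq, abs_le]; simp [hzb]; constructor <;> nlinarith)
        rw [this]; positivity
    · filter_upwards [ae_restrict_mem measurableSet_Ioi] with r hr
      have hr : (0 : ℝ) < r := hr
      have := zb.nonneg (x := r ^ 2)
      simp only [Pi.zero_apply]; positivity
    · have hc : HasCompactSupport fun r : ℝ => r ^ (n - 1) * zb (r ^ 2) := by
        refine HasCompactSupport.of_support_subset_isCompact (isCompact_closedBall (0 : ℝ) 2) ?_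
        intro r hr
        simp only [mem_closedBall, dist_zero_right, Real.norm_eq_abs]
        by_contra h
        push Not at h
        have := hz0 _ (hdz |r| (abs_nonneg r) (Or.inr h)).le
        rw [sq_abs] at this
        exact hr (by simp only [this, mul_zero])
      have hzb' := zb.continuous
      exact ((by fun_prop : Continuous fun r : ℝ => r ^ (n - 1) * zb (r ^ 2)).integrable_of_hasCompactSupport
        hc).integrableOn
  rw [integral_finsetSum _ (fun l _ => integrable_sg (hGc l))] at key
  have hv := sphVol_univ_pos hn
  have h3 : (sphVol n Set.univ).toReal * (∫ r in Set.Ioi (0 : ℝ), r ^ (n - 1) * zb (r ^ 2)) *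
      (∑ l, ∫ u, G l u ∂sg n - n * ∫ u, G a u ∂sg n) = 0 := by linarith
  have h4 := (mul_eq_zero.1 h3).resolve_left (by positivity)
  linarith

section Trace

/-- The trace of an operator on Euclidean space. -/
def trc (A : En n →L[ℝ] En n) : ℝ := ∑ j, A (EuclideanSpace.single j 1) j

lemma trc_add (A B : En n →L[ℝ] En n) : trc (A + B) = trc A + trc B := by
  simp [trc, Finset.sum_add_distrib]

lemma trc_sub (A B : En n →L[ℝ] En n) : trc (A - B) = trc A - trc B := by
  simp [trc, Finset.sum_sub_distrib]

lemma trc_smul (c : ℝ) (A : En n →L[ℝ] En n) : trc (c • A) = c * trc A := by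
  simp [trc, Finset.mul_sum]

lemma trc_id : trc (ContinuousLinearMap.id ℝ (En n)) = n := by simp [trc]

lemma trc_rk (x y : En n) : trc (rk x y) = ⟪x, y⟫_ℝ := by
  simp [trc, PiLp.inner_apply, mul_comm]

lemma continuous_trc : Continuous (trc : (En n →L[ℝ] En n) → ℝ) := by
  unfold trc
  refine continuous_finsetSum _ fun j _ => ?_
  fun_prop

lemma trc_prj {u : En n} (hu : ‖u‖ = 1) : trc (prj u) = n - 1 := by
  rw [prj, trc_sub, trc_id, trc_rk, real_inner_self_eq_norm_sq, hu]; norm_num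

lemma rowDet_update_id (j : Fin n) (A : En n →L[ℝ] En n) :
    rowDet n (update (fun _ => ContinuousLinearMap.id ℝ (En n)) j A) =
      A (EuclideanSpace.single j 1) j := by
  have h := Matrix.cramer_one (n := Fin n) (α := ℝ)
  have h1 : Matrix.cramer (1 : Matrix (Fin n) (Fin n) ℝ) (fun k => A (EuclideanSpace.single j 1) k) j =
      A (EuclideanSpace.single j 1) j := by rw [h]; rfl
  rw [Matrix.cramer_apply, ← Matrix.det_transpose] at h1
  rw [← h1, rowDet_apply]
  congr 1
  ext a b
  rcases eq_or_ne a j with rfl | ha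
  · simp [Matrix.transpose_apply]
  · simp [Matrix.transpose_apply, Function.update_of_ne ha, Matrix.updateCol_ne ha, Matrix.one_apply, eq_comm]

lemma mdisc_update_id (a : Fin n) (A : En n →L[ℝ] En n) :
    mdisc n (update (fun _ => ContinuousLinearMap.id ℝ (En n)) a A) = trc A / n := by
  have hn : (0 : ℝ) < n := by exact_mod_cast a.pos
  have h1 : ∀ j, mdisc n (update (fun _ => ContinuousLinearMap.id ℝ (En n)) j A) =
      mdisc n (update (fun _ => ContinuousLinearMap.id ℝ (En n)) a A) := fun j =>
    mdisc_update_swap _ _ rfl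
  have h2 : ∑ j, mdisc n (update (fun _ => ContinuousLinearMap.id ℝ (En n)) j A) = trc A := by
    simp only [mdisc_apply]
    rw [← Finset.mul_sum, Finset.sum_comm]
    have : ∀ σ : Equiv.Perm (Fin n), ∑ j, rowDet n (fun l =>
        update (fun _ => ContinuousLinearMap.id ℝ (En n)) j A (σ l)) = trc A := by
      intro σ
      rw [← Equiv.sum_comp σ, trc]
      refine Finset.sum_congr rfl fun j _ => ?_
      rw [← rowDet_update_id]
      congr 1
      ext1 l
      rcases eq_or_ne l j with rfl | h
      · simp
      · rw [Function.update_of_ne h, Function.update_of_ne (by simpa using h)]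
    rw [Finset.sum_congr rfl fun σ _ => this σ]
    simp only [Finset.sum_const, Finset.card_univ, Fintype.card_perm, Fintype.card_fin, nsmul_eq_mul]
    rw [← mul_assoc, inv_mul_cancel₀ (by positivity), one_mul]
  simp only [h1, Finset.sum_const, Finset.card_univ, Fintype.card_fin, nsmul_eq_mul] at h2
  rw [← h2]; field_simp

variable {u : En n}

lemma prj_self (hu : ‖u‖ = 1) : prj u u = 0 := by simp [hu]

lemma inner_prj (hu : ‖u‖ = 1) (w : En n) : ⟪u, prj u w⟫_ℝ = 0 := by
  simp [inner_sub_right, inner_smul_right, hu]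

lemma prj_add_rk (u : En n) : prj u + rk u u = ContinuousLinearMap.id ℝ (En n) := by
  simp [prj]

lemma mdisc_uu (hu : ‖u‖ = 1) {a b : Fin n} (hab : a ≠ b) {B : En n →L[ℝ] En n}
    (hB : B u = 0) (hB' : ∀ w, ⟪u, B w⟫_ℝ = 0) :
    mdisc n (update (update (fun _ => prj u) b B) a (rk u u)) =
      trc B / (n * (n - 1)) := by
  have hn : (0 : ℝ) < n := by exact_mod_cast a.pos
  have h := mdisc_add_rk hu (update (fun _ => prj u) b B) (fun l => if l = b then 0 else u)
    (fun l => by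
      rcases eq_or_ne l b with rfl | h
      · simpa using hB
      · rw [Function.update_of_ne h]; exact prj_self hu)
    (fun l w => by
      rcases eq_or_ne l b with rfl | h
      · simpa using hB' w
      · rw [Function.update_of_ne h]; exact inner_prj hu w)
  have h1 : (fun l => update (fun _ => prj u) b B l + rk (if l = b then 0 else u) u) =
      update (fun _ => ContinuousLinearMap.id ℝ (En n)) b B := by
    ext1 l
    rcases eq_or_ne l b with rfl | h
    · ext w k; simp
    · simp [h, prj_add_rk]
  have h2 : ∀ l, ⟪u, if l = b then 0 else u⟫_ℝ *
      mdisc n (update (update (fun _ => prj u) b B) l (rk u u)) =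
      if l = b then 0 else
        mdisc n (update (update (fun _ => prj u) b B) a (rk u u)) := by
    intro l
    split_ifs with h
    · simp
    · rw [real_inner_self_eq_norm_sq, hu]
      norm_num
      refine mdisc_update_swap _ _ ?_
      rw [Function.update_of_ne h, Function.update_of_ne hab]
  rw [h1, mdisc_update_id] at h
  simp only [h2] at h
  rw [Finset.sum_ite] at h
  simp only [Finset.sum_const_zero, zero_add, Finset.sum_const, nsmul_eq_mul,
    Finset.filter_ne', Finset.card_erase_of_mem (Finset.mem_univ _), Finset.card_univ,
    Fintype.card_fin] at h
  have hn2 : 2 ≤ n := by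
    by_contra h'
    exact hab (Fin.ext (by omega))
  have hn2' : (2 : ℝ) ≤ n := by exact_mod_cast hn2
  rw [Nat.cast_sub (by omega)] at h
  push_cast at h
  have h3 : (n : ℝ) - 1 ≠ 0 := by linarith
  field_simp at h ⊢
  linarith

lemma mdisc_uu_prj (hu : ‖u‖ = 1) (a : Fin n) :
    mdisc n (update (fun _ => prj u) a (rk u u)) = 1 / n := by
  have h := mdisc_add_rk hu (update (fun _ => prj u) a 0) (fun _ => u)
    (fun l => by
      rcases eq_or_ne l a with rfl | h
      · simp
      · rw [Function.update_of_ne h]; exact prj_self hu)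
    (fun l w => by
      rcases eq_or_ne l a with rfl | h
      · simp
      · rw [Function.update_of_ne h]; exact inner_prj hu w)
  have h1 : (fun l => update (fun _ => prj u) a 0 l + rk u u) =
      update (fun _ => ContinuousLinearMap.id ℝ (En n)) a (rk u u) := by
    ext1 l
    rcases eq_or_ne l a with rfl | h
    · simp
    · simp [Function.update_of_ne h, prj_add_rk]
  rw [h1, mdisc_update_id, trc_rk, Finset.sum_eq_single a] at h
  · simpa [hu] using h.symm
  · intro l _ hl
    rw [(mdisc n).map_coord_zero a, mul_zero]
    simp [Function.update_of_ne hl.symm]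
  · simp

lemma mdisc_pp {p : En n} (hp : ‖p‖ = 1) {b c : Fin n} (hbc : b ≠ c) (B : En n →L[ℝ] En n) :
    mdisc n (update (update (fun _ => ContinuousLinearMap.id ℝ (En n)) b B) c
      (rk p p)) = (trc B - ⟪B p, p⟫_ℝ) / (n * (n - 1)) := by
  set y : En n := ContinuousLinearMap.adjoint B p - ⟪B p, p⟫_ℝ • p with hy
  set B' : En n →L[ℝ] En n := B - rk (B p) p - rk p y with hB'
  have hyin : ∀ w, ⟪y, w⟫_ℝ = ⟪p, B w⟫_ℝ - ⟪B p, p⟫_ℝ * ⟪p, w⟫_ℝ := fun w => by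
    rw [hy, inner_sub_left, ContinuousLinearMap.adjoint_inner_left, real_inner_smul_left]
  have hpp : ⟪p, p⟫_ℝ = 1 := by rw [real_inner_self_eq_norm_sq, hp]; norm_num
  have hB'p : B' p = 0 := by
    have : ⟪y, p⟫_ℝ = 0 := by rw [hyin, hpp, real_inner_comm]; ring
    simp [hB', hp, this]
  have hB'r : ∀ w, ⟪p, B' w⟫_ℝ = 0 := fun w => by
    simp [hB', inner_sub_right, inner_smul_right, hp, hyin, real_inner_comm p (B p)]
    ring
  have hdec : B = (B' + rk (B p) p) + rk p y := by rw [hB']; abel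
  set I := update (fun _ : Fin n => ContinuousLinearMap.id ℝ (En n)) with hI
  have hsplit : mdisc n (update (I b B) c (rk p p)) =
      mdisc n (update (I b (B' + rk (B p) p)) c (rk p p)) := by
    rw [hI, Function.update_comm hbc]
    conv_lhs => rw [hdec, MultilinearMap.map_update_add]
    rw [Function.update_comm hbc]
    rw [add_eq_left]
    refine mdisc_eq_zero_of_two_range (u := p) _ hbc y p (fun w => ?_) (fun w => ?_)
    · simp
    · rw [Function.update_of_ne hbc.symm]; simp
  rw [hsplit]
  have h := mdisc_add_rk hp (update (update (fun _ => prj p) b B') c 0)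
    (fun l => if l = b then B p else p)
    (fun l => by
      rcases eq_or_ne l c with rfl | h
      · simp
      · rw [Function.update_of_ne h]
        rcases eq_or_ne l b with rfl | h'
        · simpa using hB'p
        · rw [Function.update_of_ne h']; exact prj_self hp)
    (fun l w => by
      rcases eq_or_ne l c with rfl | h
      · simp
      · rw [Function.update_of_ne h]
        rcases eq_or_ne l b with rfl | h'
        · simpa using hB'r w
        · rw [Function.update_of_ne h']; exact inner_prj hp w)
  have h1 : (fun l => update (update (fun _ => prj p) b B') c 0 l +
      rk (if l = b then B p else p) p) =
      update (I b (B' + rk (B p) p)) c (rk p p) := by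
    ext1 l
    rcases eq_or_ne l c with rfl | hlc
    · simp [hbc.symm]
    · rcases eq_or_ne l b with rfl | h'
      · simp [Function.update_of_ne hlc, hI]
      · simp [Function.update_of_ne hlc, hI, h', prj_add_rk]
  rw [h1, Finset.sum_eq_single c] at h
  · rw [h, if_neg hbc.symm, hpp, one_mul, Function.update_idem, mdisc_uu hp hbc.symm hB'p hB'r]
    have hyp : ⟪p, y⟫_ℝ = 0 := by rw [real_inner_comm, hyin, hpp, real_inner_comm]; ring
    rw [hB', trc_sub, trc_sub, trc_rk, trc_rk, hyp, sub_zero]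
  · intro l _ hl
    rw [(mdisc n).map_coord_zero c, mul_zero]
    simp [Function.update_of_ne hl.symm]
  · simp

lemma mdisc_rk_self (p : En n) {b c : Fin n} (hbc : b ≠ c) (B : En n →L[ℝ] En n) :
    mdisc n (update (update (fun _ => ContinuousLinearMap.id ℝ (En n)) b B) c
      (rk p p)) = (‖p‖ ^ 2 * trc B - ⟪B p, p⟫_ℝ) / (n * (n - 1)) := by
  rcases eq_or_ne p 0 with rfl | hp
  · rw [(mdisc n).map_coord_zero c]
    · simp
    · ext w k; simp
  have hp' : 0 < ‖p‖ := norm_pos_iff.2 hp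
  have h := mdisc_pp (p := ‖p‖⁻¹ • p) (by rw [norm_smul, norm_inv, norm_norm, inv_mul_cancel₀ hp'.ne'])
    hbc B
  have h1 : rk p p = (‖p‖ ^ 2) • rk (‖p‖⁻¹ • p) (‖p‖⁻¹ • p) := by
    ext w k
    simp [inner_smul_left]
    field_simp
  rw [h1, MultilinearMap.map_update_smul, h]
  simp only [map_smul, inner_smul_left, inner_smul_right, smul_eq_mul, RCLike.conj_to_real]
  field_simp

lemma mdisc_uu_pp (hu : ‖u‖ = 1) {a b c : Fin n} (hab : a ≠ b) (hac : a ≠ c) (hbc : b ≠ c)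
    {B : En n →L[ℝ] En n} (hB : B u = 0) (hB' : ∀ w, ⟪u, B w⟫_ℝ = 0) {p : En n} (hp : ⟪u, p⟫_ℝ = 0) :
    mdisc n (update (update (update (fun _ => prj u) b B) c (rk p p))
      a (rk u u)) = (‖p‖ ^ 2 * trc B - ⟪B p, p⟫_ℝ) / (n * (n - 1) * (n - 2)) := by
  have hn : (0 : ℝ) < n := by exact_mod_cast a.pos
  set A := update (update (fun _ => prj u) b B) c (rk p p) with hA
  have h := mdisc_add_rk hu A (fun l => if l = b ∨ l = c then 0 else u)
    (fun l => by
      rcases eq_or_ne l c with rfl | h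
      · simp [hA, real_inner_comm u p ▸ hp]
      rcases eq_or_ne l b with rfl | h'
      · simpa [hA, Function.update_of_ne h] using hB
      · rw [hA, Function.update_of_ne h, Function.update_of_ne h']; exact prj_self hu)
    (fun l w => by
      rcases eq_or_ne l c with rfl | h
      · simp [hA, inner_smul_right, hp]
      rcases eq_or_ne l b with rfl | h'
      · simpa [hA, Function.update_of_ne h] using hB' w
      · rw [hA, Function.update_of_ne h, Function.update_of_ne h']; exact inner_prj hu w)
  have h1 : (fun l => A l + rk (if l = b ∨ l = c then 0 else u) u) =
      update (update (fun _ => ContinuousLinearMap.id ℝ (En n)) b B) c (rk p p) := by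
    ext1 l
    rcases eq_or_ne l c with rfl | hlc
    · ext w k; simp [hA]
    rcases eq_or_ne l b with rfl | h'
    · ext w k; simp [hA, Function.update_of_ne hlc]
    · simp [hA, hlc, h', prj_add_rk]
  have h2 : ∀ l, ⟪u, if l = b ∨ l = c then 0 else u⟫_ℝ * mdisc n (update A l (rk u u)) =
      if l = b ∨ l = c then 0 else mdisc n (update A a (rk u u)) := by
    intro l
    split_ifs with h
    · simp
    · push Not at h
      rw [real_inner_self_eq_norm_sq, hu]
      norm_num
      refine mdisc_update_swap _ _ ?_
      rw [hA, Function.update_of_ne h.2, Function.update_of_ne h.1, Function.update_of_ne hac,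
        Function.update_of_ne hab]
  rw [h1, mdisc_rk_self p hbc] at h
  simp only [h2] at h
  rw [Finset.sum_ite] at h
  have hcard : (Finset.univ.filter fun l => ¬(l = b ∨ l = c)).card = n - 2 := by
    have : (Finset.univ.filter fun l => ¬(l = b ∨ l = c)) = ({b, c} : Finset (Fin n))ᶜ := by
      ext l; simp
    rw [this, Finset.card_compl, Finset.card_pair hbc, Fintype.card_fin]
  simp only [Finset.sum_const_zero, zero_add, Finset.sum_const, nsmul_eq_mul, hcard] at h
  have hn3 : 3 ≤ n := by
    have := Finset.card_le_univ ({a, b, c} : Finset (Fin n))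
    rwa [Finset.card_eq_three.2 ⟨a, b, c, hab, hac, hbc, rfl⟩, Fintype.card_fin] at this
  have hn3' : (3 : ℝ) ≤ n := by exact_mod_cast hn3
  rw [Nat.cast_sub (by omega)] at h
  push_cast at h
  have h3 : (n : ℝ) - 1 ≠ 0 := by linarith
  have h4 : (n : ℝ) - 2 ≠ 0 := by linarith
  field_simp at h ⊢
  linarith

end Trace

section MixedVolume

/-- The mixed volume functional of positively homogeneous `C²` functions, normalised so that
the value at the Euclidean norm is `1`. -/
def mixV (n : ℕ) : MultilinearMap ℝ (fun _ : Fin n => HF n) ℝ :=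
  MultilinearMap.mk' (fun F => ∫ u, mdisc n (fun j => sop (F j) u) ∂sg n)
    (fun F a f g => by
      rw [← integral_add (integrable_sg (continuous_mdisc fun j => (update F a f j).continuous_sop))
        (integrable_sg (continuous_mdisc fun j => (update F a g j).continuous_sop))]
      refine integral_congr_all fun u => ?_
      have h (f : HF n) : (fun j => sop (update F a f j) u) =
          update (fun j => sop (F j) u) a (sop f u) := by
        ext1 j
        rcases eq_or_ne j a with rfl | hj
        · simp
        · simp [hj]
      simp only [h, sop_add, MultilinearMap.map_update_add])
    (fun F a c f => by
      rw [smul_eq_mul, ← integral_const_mul]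
      refine integral_congr_all fun u => ?_
      have h (f : HF n) : (fun j => sop (update F a f j) u) =
          update (fun j => sop (F j) u) a (sop f u) := by
        ext1 j
        rcases eq_or_ne j a with rfl | hj
        · simp
        · simp [hj]
      simp only [h, sop_smul, MultilinearMap.map_update_smul, smul_eq_mul])

lemma mixV_apply (F : Fin n → HF n) : mixV n F = ∫ u, mdisc n (fun j => sop (F j) u) ∂sg n := rfl

lemma mixV_perm (F : Fin n → HF n) (τ : Equiv.Perm (Fin n)) :
    mixV n (fun j => F (τ j)) = mixV n F := by
  rw [mixV_apply, mixV_apply]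
  refine integral_congr_all fun u => ?_
  exact mdisc_perm (fun j => sop (F j) u) τ

lemma continuous_slot (F : Fin n → HF n) (a : Fin n) :
    Continuous fun u : Sph n => mdisc n (update (hs F u) a (rk (u : En n) u)) :=
  continuous_mdisc (continuous_update_uu (continuous_hs F) a continuous_rk_self)

lemma mixV_eq (F : Fin n → HF n) (a : Fin n) :
    mixV n F = n * ∫ u, F a u * mdisc n (update (hs F u) a (rk (u : En n) u)) ∂sg n := by
  have hmas : ∀ l ∈ (Finset.univ : Finset (Fin n)), Integrable (fun u : Sph n =>
      F l u * mdisc n (update (hs F u) l (rk (u : En n) u))) (sg n) := fun l _ =>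
    integrable_sg ((F l).continuous_sph.mul (continuous_slot F l))
  rw [← sum_integral_eq a.pos F a, ← integral_finsetSum _ hmas, mixV_apply]
  refine integral_congr_all fun u => ?_
  have h := mdisc_add_rk (Sph.norm u) (hs F u) (fun l => F l u • (u : En n))
    (fun l => hs_ker F (Sph.ne_zero u) l) (fun l w => hs_range F (Sph.ne_zero u) l w)
  have h1 : (fun j => sop (F j) u) = fun l => hs F u l + rk (F l u • (u : En n)) u := by
    ext1 l
    rw [sop, rk_smul_left, add_comm]; rfl
  simp only [h1]
  rw [h]
  simp [inner_smul_right]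

lemma mixV_nrm (hn : 0 < n) : mixV n (fun _ => nrm n) = 1 := by
  have := sg_isProb hn
  simp only [mixV_apply, sop_nrm]
  have h : mdisc n (fun _ => ContinuousLinearMap.id ℝ (En n)) = 1 := by
    rw [mdisc_diag]
    exact LinearMap.det_id
  simp [h]

lemma mixV_lin (hn : 2 ≤ n) (F : Fin n → HF n) (a : Fin n) (x : En n) :
    mixV n (update F a (lin x)) = 0 := by
  obtain ⟨b, hb⟩ : ∃ b : Fin n, b ≠ a := by
    have : Nontrivial (Fin n) := Fin.nontrivial_iff_two_le.2 hn
    exact exists_ne a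
  rw [mixV_eq _ b]
  refine mul_eq_zero_of_right _ ?_
  rw [integral_eq_zero_of_ae]
  refine Eventually.of_forall fun u => ?_
  refine mul_eq_zero_of_right _ ((mdisc n).map_coord_zero a ?_)
  rw [Function.update_of_ne hb.symm, hs]
  simp [hess_lin]

/-- The operator `f ↦ f + Δ_𝕊 f / (n-1)`, written through the trace of the Hessian. -/
def bx (f : En n → ℝ) (u : En n) : ℝ := ((n : ℝ) - 1)⁻¹ * trc (hess f u)

lemma HF.continuous_bx (f : HF n) : Continuous fun u : Sph n => bx f u :=
  continuous_const.mul (continuous_trc.comp f.continuous_hess_sph)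

lemma bx_add (f g : HF n) (u : Sph n) : bx (f + g : HF n) u = bx f u + bx g u := by
  rw [bx, HF.hess_add f g (Sph.ne_zero u), trc_add, mul_add]; rfl

lemma bx_smul (c : ℝ) (f : HF n) (u : Sph n) : bx (c • f : HF n) u = c * bx f u := by
  rw [bx, HF.hess_smul f c (Sph.ne_zero u), trc_smul, bx]; ring

lemma bx_sub (f g : HF n) (u : Sph n) : bx (f - g : HF n) u = bx f u - bx g u := by
  have h : f - g = f + (-1 : ℝ) • g := by
    ext x; simp [sub_eq_add_neg]
  rw [h, bx_add, bx_smul]; ring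

lemma bx_nrm (hn : 2 ≤ n) (u : Sph n) : bx (nrm n) u = 1 := by
  have : (2 : ℝ) ≤ n := by exact_mod_cast hn
  rw [bx, hess_nrm, trc_prj (Sph.norm u), inv_mul_cancel₀ (by linarith)]

lemma mixV_two (f g : HF n) {a b : Fin n} (hab : a ≠ b) :
    mixV n (update (update (fun _ => nrm n) b g) a f) =
      ∫ u, f u * bx g u ∂sg n := by
  rw [mixV_eq _ a, ← integral_const_mul]
  refine integral_congr_all fun u => ?_
  have h : update (hs (update (update (fun _ => nrm n) b g) a f) u) a
      (rk (u : En n) u) = update (update (fun _ => prj (u : En n)) b (hess g u)) a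
        (rk (u : En n) u) := by
    ext1 l
    rcases eq_or_ne l a with rfl | hla
    · simp
    rw [Function.update_of_ne hla, Function.update_of_ne hla, hs, Function.update_of_ne hla]
    rcases eq_or_ne l b with rfl | hlb
    · simp
    · rw [Function.update_of_ne hlb, Function.update_of_ne hlb, hess_nrm]
  simp only [h, Function.update_self]
  rw [mdisc_uu (Sph.norm u) hab (g.hess_self (Sph.ne_zero u)) (g.inner_hess_self (Sph.ne_zero u)), bx]
  have : (n : ℝ) ≠ 0 := by exact_mod_cast a.pos.ne'
  field_simp

lemma integral_bx_comm (hn : 2 ≤ n) (f g : HF n) :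
    ∫ u, f u * bx g u ∂sg n = ∫ u, g u * bx f u ∂sg n := by
  have hab : (⟨0, by omega⟩ : Fin n) ≠ ⟨1, by omega⟩ := by simp
  rw [← mixV_two f g hab, ← mixV_two g f hab.symm, Function.update_comm hab]

lemma integral_bx (hn : 2 ≤ n) (f : HF n) : ∫ u, bx f u ∂sg n = ∫ u, f u ∂sg n := by
  have h := integral_bx_comm hn (nrm n) f
  simpa [bx_nrm hn] using h

end MixedVolume

section Square

/-- The homogeneous function `f² / ‖x‖`. -/
def sqh (f : HF n) : HF n := ⟨fun x => f x ^ 2 * ‖x‖⁻¹, by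
    have h1 := f.contDiffOn
    have h2 : ContDiffOn ℝ 2 (fun x : En n => ‖x‖⁻¹) {0}ᶜ := (nrm n).contDiffOn.inv fun x hx => by
      simpa using hx
    exact (h1.pow 2).mul h2,
  fun c hc x => by
    show f (c • x) ^ 2 * ‖c • x‖⁻¹ = c * (f x ^ 2 * ‖x‖⁻¹)
    rw [f.homog hc, norm_smul, Real.norm_of_nonneg hc.le, mul_inv]
    field_simp⟩

lemma sqh_apply (f : HF n) (x : En n) : sqh f x = f x ^ 2 * ‖x‖⁻¹ := rfl

/-- The tangential gradient on the sphere. -/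
def tgr (f : En n → ℝ) (u : En n) : En n := gradient f u - f u • u

lemma HF.continuous_tgr (f : HF n) : Continuous fun u : Sph n => tgr f u :=
  f.continuous_gradient_sph.sub (f.continuous_sph.smul continuous_subtype_val)

lemma hasFDerivAt_HF (f : HF n) {x : En n} (hx : x ≠ 0) :
    HasFDerivAt f (innerSL ℝ (gradient f x)) x := by
  have h := (f.differentiableAt hx).hasFDerivAt
  refine h.congr_fderiv ?_
  ext w
  rw [innerSL_apply_apply, inner_gradient]

lemma gradient_sqh (f : HF n) {x : En n} (hx : x ≠ 0) :
    gradient (sqh f) x = (2 * f x * ‖x‖⁻¹) • gradient f x - (f x ^ 2 * (‖x‖ ^ 3)⁻¹) • x := by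
  refine gradient_of_hasFDerivAt ?_
  have h := ((hasFDerivAt_HF f hx).pow 2).mul (hasFDerivAt_norm_inv hx)
  refine h.congr_fderiv ?_
  ext w
  simp
  ring

lemma hess_sqh (f : HF n) (u : Sph n) :
    hess (sqh f) u = (2 * f u) • hess f u + (2 : ℝ) • rk (tgr f u) (tgr f u) -
      (f u ^ 2) • prj (u : En n) := by
  have hu := Sph.ne_zero u
  have h : gradient (sqh f) =ᶠ[𝓝 (u : En n)] fun x =>
      (2 * f x * ‖x‖⁻¹) • gradient f x - (f x ^ 2 * (‖x‖⁻¹) ^ 3) • x := by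
    filter_upwards [isOpen_compl_zero.mem_nhds hu] with y hy
    rw [gradient_sqh f hy, inv_pow]
  have hf := hasFDerivAt_HF f hu
  have hi := hasFDerivAt_norm_inv hu
  have h1 := (((hf.const_mul 2).mul hi).smul (f.hasFDerivAt_gradient hu)).sub
    (((hf.pow 2).mul (hi.pow 3)).smul (hasFDerivAt_id (u : En n)))
  rw [hess, h.fderiv_eq]
  refine (HasFDerivAt.fderiv h1).trans ?_
  have hg : gradient f (u : En n) = tgr f u + f u • (u : En n) := by simp [tgr]
  rw [hg]
  ext w k
  simp
  ring

/-- The squared `W^{1,2}` norm on the sphere. -/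
def nsq (f : HF n) : ℝ := ∫ u, (f u ^ 2 + ‖tgr f u‖ ^ 2) ∂sg n

lemma nsq_eq (f : HF n) : nsq f = ∫ u, f u ^ 2 ∂sg n + ∫ u, ‖tgr f u‖ ^ 2 ∂sg n :=
  integral_add (integrable_sg (f.continuous_sph.pow 2)) (integrable_sg (f.continuous_tgr.norm.pow 2))

lemma nsq_nonneg (f : HF n) : 0 ≤ nsq f := integral_nonneg fun u => by positivity

lemma integral_bx_self (hn : 2 ≤ n) (f : HF n) :
    ∫ u, f u * bx f u ∂sg n =
      ∫ u, f u ^ 2 ∂sg n - ((n : ℝ) - 1)⁻¹ * ∫ u, ‖tgr f u‖ ^ 2 ∂sg n := by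
  have hn' : (2 : ℝ) ≤ n := by exact_mod_cast hn
  have h := integral_bx hn (sqh f)
  have h1 : ∀ u : Sph n, bx (sqh f) u =
      2 * (f u * bx f u) + 2 * ((n : ℝ) - 1)⁻¹ * ‖tgr f u‖ ^ 2 - f u ^ 2 := fun u => by
    have : (n : ℝ) - 1 ≠ 0 := by linarith
    rw [bx, hess_sqh, trc_sub, trc_add, trc_smul, trc_smul, trc_smul, trc_rk, trc_prj (Sph.norm u),
      real_inner_self_eq_norm_sq, bx]
    field_simp
  have i1 : Integrable (fun u : Sph n => f u * bx f u) (sg n) :=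
    integrable_sg (f.continuous_sph.mul f.continuous_bx)
  have i2 : Integrable (fun u : Sph n => ‖tgr f u‖ ^ 2) (sg n) :=
    integrable_sg (f.continuous_tgr.norm.pow 2)
  have i3 : Integrable (fun u : Sph n => f u ^ 2) (sg n) := integrable_sg (f.continuous_sph.pow 2)
  simp only [h1] at h
  have i12 : Integrable (fun u : Sph n => 2 * (f u * bx f u) +
      2 * ((n : ℝ) - 1)⁻¹ * ‖tgr f u‖ ^ 2) (sg n) := (i1.const_mul 2).add (i2.const_mul _)
  rw [integral_sub i12 i3, integral_add (i1.const_mul 2) (i2.const_mul _),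
    integral_const_mul, integral_const_mul] at h
  simp only [sqh_apply, Sph.norm, inv_one, mul_one] at h
  linarith

lemma norm_rk_le (x y : En n) : ‖rk x y‖ ≤ ‖x‖ * ‖y‖ :=
  ContinuousLinearMap.opNorm_le_bound _ (by positivity) fun w => by
    rw [rk_apply, norm_smul]
    nlinarith [norm_inner_le_norm (𝕜 := ℝ) y w, norm_nonneg x]

lemma norm_prj_le {u : En n} (hu : ‖u‖ = 1) : ‖prj u‖ ≤ 2 := by
  rw [prj]
  refine (norm_sub_le _ _).trans ?_
  have h1 := norm_rk_le u u
  have h2 := ContinuousLinearMap.norm_id_le (𝕜 := ℝ) (E := En n)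
  rw [hu] at h1
  linarith

/-- Mixed volumes with a repeated entry are controlled by the `W^{1,2}` norm of that entry. -/
lemma exists_mixV_bound (n : ℕ) : ∃ C > 0, ∀ (F : Fin n → HF n) (M : Fin n → ℝ) (a b : Fin n),
    a ≠ b → F a = F b → M a = 1 → M b = 1 →
    (∀ l, l ≠ a → l ≠ b → ∀ u : Sph n, ‖hess (F l) u‖ ≤ M l) →
    |mixV n F| ≤ C * (∏ l, M l) * nsq (F a) := by
  obtain ⟨C, hC, hb⟩ := exists_mdisc_bound n
  refine ⟨2 * C * n + 1, by positivity, fun F M a b hab hFab hMa hMb hM => ?_⟩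
  set f := F a with hf
  have hMnn : ∀ l, 0 ≤ M l := fun l => by
    rcases eq_or_ne l a with rfl | hla
    · simp [hMa]
    rcases eq_or_ne l b with rfl | hlb
    · simp [hMb]
    have : Nontrivial (Fin n) := ⟨a, b, hab⟩
    let e : Sph n := ⟨EuclideanSpace.single a 1, by simp⟩
    exact (norm_nonneg _).trans (hM l hla hlb e)
  have hP : 0 ≤ ∏ l, M l := Finset.prod_nonneg fun l _ => hMnn l
  set G := update (update F b (nrm n)) a (sqh f) with hG
  have e1 := mixV_eq G a
  rw [mixV_eq G b] at e1
  have hGa : G a = sqh f := by simp [hG]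
  have hGb : G b = nrm n := by simp [hG, hab.symm]
  have hGl : ∀ l, l ≠ a → l ≠ b → G l = F l := fun l h1 h2 => by simp [hG, h1, h2]
  set m1 : Sph n → ℝ := fun u => mdisc n (update (hs G u) a (rk (u : En n) u)) with hm1
  set D : Sph n → (En n →L[ℝ] En n) → ℝ := fun u X =>
    mdisc n (update (update (hs F u) b (rk (u : En n) u)) a X) with hD
  have hm2 : ∀ u : Sph n, mdisc n (update (hs G u) b (rk (u : En n) u)) =
      2 * (f u * mdisc n (update (hs F u) b (rk (u : En n) u))) +
        2 * D u (rk (tgr f u) (tgr f u)) - f u ^ 2 * D u (prj u) := fun u => by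
    have h1 : update (hs G u) b (rk (u : En n) u) =
        update (update (hs F u) b (rk (u : En n) u)) a
          ((2 * f u) • hess f u + (2 : ℝ) • rk (tgr f u) (tgr f u) - (f u ^ 2) • prj (u : En n)) := by
      ext1 l
      rcases eq_or_ne l a with rfl | hla
      · rw [Function.update_self, Function.update_of_ne hab, hs, hGa, hess_sqh]
      rw [Function.update_of_ne hla]
      rcases eq_or_ne l b with rfl | hlb
      · simp
      · rw [Function.update_of_ne hlb, Function.update_of_ne hlb, hs, hs, hGl l hla hlb]
    have h2 : D u (hess f u) = mdisc n (update (hs F u) b (rk (u : En n) u)) := by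
      rw [hD]
      simp only
      congr 1
      ext1 l
      rcases eq_or_ne l a with rfl | hla
      · rw [Function.update_self, Function.update_of_ne hab, hs]
      · rw [Function.update_of_ne hla]
    rw [h1, MultilinearMap.map_update_sub, MultilinearMap.map_update_add,
      MultilinearMap.map_update_smul, MultilinearMap.map_update_smul,
      MultilinearMap.map_update_smul, ← h2]
    simp only [smul_eq_mul, hD]
    ring
  have hDc : ∀ X : Sph n → En n →L[ℝ] En n, Continuous X → Continuous fun u => D u (X u) :=
    fun X hX => continuous_mdisc (continuous_update_uu
      (continuous_update_uu (continuous_hs F) b continuous_rk_self) a hX)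
  have hfc := f.continuous_sph
  have hprjc : Continuous fun u : Sph n => prj (u : En n) := by
    simpa only [hess_nrm] using (nrm n).continuous_hess_sph
  have ct : Continuous fun u : Sph n => rk (tgr f u) (tgr f u) :=
    continuous_rk f.continuous_tgr f.continuous_tgr
  have i1 : Integrable (fun u : Sph n =>
      f u * mdisc n (update (hs F u) b (rk (u : En n) u))) (sg n) :=
    integrable_sg (hfc.mul (continuous_slot F b))
  have i2 : Integrable (fun u : Sph n => D u (rk (tgr f u) (tgr f u))) (sg n) :=
    integrable_sg (hDc _ ct)
  have i3 : Integrable (fun u : Sph n => f u ^ 2 * D u (prj u)) (sg n) :=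
    integrable_sg ((hfc.pow 2).mul (hDc _ hprjc))
  have i4 : Integrable (fun u : Sph n => f u ^ 2 * m1 u) (sg n) :=
    integrable_sg ((hfc.pow 2).mul (continuous_slot G a))
  have i12 : Integrable (fun u : Sph n => 2 * (f u * mdisc n
      (update (hs F u) b (rk (u : En n) u))) + 2 * D u (rk (tgr f u) (tgr f u))) (sg n) :=
    (i1.const_mul 2).add (i2.const_mul 2)
  have i34 : Integrable (fun u : Sph n => (f u ^ 2 * m1 u + f u ^ 2 * D u (prj u)) / 2) (sg n) :=
    (i3.const_mul 1 |>.add i4 |>.div_const 2).congr (Eventually.of_forall fun u => by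
      simp only [Pi.add_apply]; ring)
  have e2 : ∫ u : Sph n, G b u * mdisc n (update (hs G u) b (rk (u : En n) u)) ∂sg n =
      2 * ∫ u : Sph n, f u * mdisc n (update (hs F u) b (rk (u : En n) u)) ∂sg n +
      2 * ∫ u : Sph n, D u (rk (tgr f u) (tgr f u)) ∂sg n - ∫ u : Sph n, f u ^ 2 * D u (prj u) ∂sg n := by
    rw [← integral_const_mul, ← integral_const_mul, ← integral_add (i1.const_mul 2) (i2.const_mul 2),
      ← integral_sub i12 i3]
    refine integral_congr_all fun u => ?_
    simp only [hm2 u, hGb, nrm_apply, Sph.norm, one_mul]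
  have hn0 : (n : ℝ) ≠ 0 := by exact_mod_cast a.pos.ne'
  have e3 : ∫ u : Sph n, G a u * mdisc n (update (hs G u) a (rk (u : En n) u)) ∂sg n =
      ∫ u : Sph n, f u ^ 2 * m1 u ∂sg n := by
    refine integral_congr_all fun u => ?_
    simp only [hGa, sqh_apply, Sph.norm, inv_one, mul_one, hm1]
  have e4 : mixV n F = n * ∫ u : Sph n, ((f u ^ 2 * m1 u + f u ^ 2 * D u (prj u)) / 2 -
      D u (rk (tgr f u) (tgr f u))) ∂sg n := by
    rw [integral_sub i34 i2, integral_div, integral_add i4 i3]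
    rw [e2, e3] at e1
    have e5 := mixV_eq F b
    rw [← hFab] at e5
    have := mul_left_cancel₀ hn0 e1
    rw [e5]
    congr 1
    linarith
  have hprod : ∀ (u : Sph n) (A : Fin n → En n →L[ℝ] En n) (c : ℝ), 0 ≤ c →
      (∀ l, l ≠ a → l ≠ b → ‖A l‖ ≤ M l) → ‖A a‖ * ‖A b‖ ≤ c →
      |mdisc n A| ≤ C * c * ∏ l, M l := fun u A c hc hA hAab => by
    refine (hb A).trans ?_
    rw [mul_assoc]
    refine mul_le_mul_of_nonneg_left ?_ hC.le
    have hsub : b ∈ (Finset.univ.erase a : Finset (Fin n)) := by simp [hab.symm]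
    rw [← Finset.mul_prod_erase _ _ (Finset.mem_univ a), ← Finset.mul_prod_erase _ _ hsub,
      ← Finset.mul_prod_erase _ (fun l => M l) (Finset.mem_univ a),
      ← Finset.mul_prod_erase _ (fun l => M l) hsub, hMa, hMb, one_mul, one_mul, ← mul_assoc]
    refine mul_le_mul hAab (Finset.prod_le_prod (fun _ _ => norm_nonneg _) fun l hl => ?_)
      (Finset.prod_nonneg fun _ _ => norm_nonneg _) hc
    simp only [Finset.mem_erase, Finset.mem_univ, and_true] at hl
    exact hA l hl.2 hl.1
  have huu : ∀ u : Sph n, ‖rk (u : En n) u‖ ≤ 1 := fun u => by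
    simpa using norm_rk_le (u : En n) u
  have hbm1 : ∀ u, |m1 u| ≤ C * 2 * ∏ l, M l := fun u => by
    refine hprod u _ 2 (by norm_num) (fun l h1 h2 => ?_) ?_
    · rw [Function.update_of_ne h1, hs, hGl l h1 h2]; exact hM l h1 h2 u
    · rw [Function.update_self, Function.update_of_ne hab.symm, hs, hGb, hess_nrm]
      nlinarith [huu u, norm_prj_le (Sph.norm u), norm_nonneg (rk (u : En n) u)]
  have hbD : ∀ u X, |D u X| ≤ C * ‖X‖ * ∏ l, M l := fun u X => by
    refine hprod u _ _ (norm_nonneg _) (fun l h1 h2 => ?_) ?_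
    · rw [Function.update_of_ne h1, Function.update_of_ne h2]; exact hM l h1 h2 u
    · rw [Function.update_self, Function.update_of_ne hab.symm, Function.update_self]
      nlinarith [huu u, norm_nonneg X]
  rw [e4, abs_mul, abs_of_nonneg (by positivity : (0 : ℝ) ≤ n)]
  have hfin : |∫ u : Sph n, ((f u ^ 2 * m1 u + f u ^ 2 * D u (prj u)) / 2 -
      D u (rk (tgr f u) (tgr f u))) ∂sg n| ≤ 2 * C * (∏ l, M l) * nsq f := by
    rw [nsq, ← integral_const_mul]
    refine abs_integral_le_integral_abs.trans (integral_mono_of_nonneg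
      (Eventually.of_forall fun u => abs_nonneg _) ((integrable_sg
        ((hfc.pow 2).add (f.continuous_tgr.norm.pow 2))).const_mul _)
      (Eventually.of_forall fun u => ?_))
    have b1 := abs_le.1 (hbm1 u)
    have b2 := abs_le.1 ((hbD u (prj u)).trans (mul_le_mul_of_nonneg_right
      (mul_le_mul_of_nonneg_left (norm_prj_le (Sph.norm u)) hC.le) hP))
    have b3 := abs_le.1 ((hbD u (rk (tgr f u) (tgr f u))).trans (mul_le_mul_of_nonneg_right
      (mul_le_mul_of_nonneg_left (norm_rk_le _ _) hC.le) hP))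
    have hs1 := sq_nonneg (f u)
    have hCP : 0 ≤ C * ∏ l, M l := mul_nonneg hC.le hP
    have hs2 : 0 ≤ C * (∏ l, M l) * ‖tgr f u‖ ^ 2 := mul_nonneg hCP (sq_nonneg _)
    simp only
    rw [abs_le]
    constructor
    · nlinarith [mul_le_mul_of_nonneg_left b1.1 hs1, mul_le_mul_of_nonneg_left b2.1 hs1]
    · nlinarith [mul_le_mul_of_nonneg_left b1.2 hs1, mul_le_mul_of_nonneg_left b2.2 hs1]
  have hN := nsq_nonneg f
  calc (n : ℝ) * _ ≤ n * (2 * C * (∏ l, M l) * nsq f) := by gcongr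
    _ ≤ (2 * C * n + 1) * (∏ l, M l) * nsq f := by
      have := mul_nonneg hP hN
      nlinarith

end Square

section Zonal

open Polynomial in
/-- The homogeneous extension of the zonal function `u ↦ q (⟪e, u⟫)`. -/
def zon (e : En n) (q : ℝ[X]) : HF n := ⟨fun x => ‖x‖ * q.eval (⟪e, x⟫_ℝ * ‖x‖⁻¹), by
    have h1 := (nrm n).contDiffOn
    have h2 : ContDiffOn ℝ 2 (fun x : En n => ‖x‖⁻¹) {0}ᶜ := h1.inv fun x hx => by simpa using hx
    have h3 : ContDiffOn ℝ 2 (fun x : En n => ⟪e, x⟫_ℝ) {0}ᶜ := (innerSL ℝ e).contDiff.contDiffOn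
    have h4 : ContDiff ℝ 2 fun t : ℝ => q.eval t := by
      simpa using q.contDiff_aeval (𝕜 := ℝ) 2
    exact h1.mul (h4.comp_contDiffOn (h3.mul h2)),
  fun c hc x => by
    show ‖c • x‖ * q.eval (⟪e, c • x⟫_ℝ * ‖c • x‖⁻¹) = c * (‖x‖ * q.eval (⟪e, x⟫_ℝ * ‖x‖⁻¹))
    have : ⟪e, c • x⟫_ℝ * ‖c • x‖⁻¹ = ⟪e, x⟫_ℝ * ‖x‖⁻¹ := by
      rw [norm_smul, Real.norm_of_nonneg hc.le, inner_smul_right, mul_inv]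
      field_simp
    rw [this, norm_smul, Real.norm_of_nonneg hc.le, mul_assoc]⟩

variable (e : En n) (q : Polynomial ℝ)

lemma zon_apply (x : En n) : zon e q x = ‖x‖ * q.eval (⟪e, x⟫_ℝ * ‖x‖⁻¹) := rfl

lemma zon_sph (u : Sph n) : zon e q u = q.eval ⟪e, u⟫_ℝ := by simp [zon_apply]

lemma hasFDerivAt_arg {x : En n} (hx : x ≠ 0) :
    HasFDerivAt (fun x : En n => ⟪e, x⟫_ℝ * ‖x‖⁻¹)
      (innerSL ℝ (‖x‖⁻¹ • e - (⟪e, x⟫_ℝ * (‖x‖ ^ 3)⁻¹) • x)) x := by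
  have h := (innerSL ℝ e).hasFDerivAt.mul (hasFDerivAt_norm_inv hx) (x := x)
  refine h.congr_fderiv ?_
  ext w
  simp
  ring

lemma gradient_zon {x : En n} (hx : x ≠ 0) :
    gradient (zon e q) x = ((q - Polynomial.X * q.derivative).eval (⟪e, x⟫_ℝ * ‖x‖⁻¹) * ‖x‖⁻¹) • x +
      (q.derivative.eval (⟪e, x⟫_ℝ * ‖x‖⁻¹)) • e := by
  refine gradient_of_hasFDerivAt ?_
  have h := (hasFDerivAt_norm hx).mul
    ((q.hasDerivAt (⟪e, x⟫_ℝ * ‖x‖⁻¹)).comp_hasFDerivAt x (hasFDerivAt_arg e hx))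
  have hx' := norm_ne_zero_iff.2 hx
  refine h.congr_fderiv ?_
  ext w
  simp
  field_simp
  ring

lemma hess_zon (u : Sph n) : hess (zon e q) u =
    (q.derivative.derivative.eval ⟪e, u⟫_ℝ) •
      rk (e - ⟪e, u⟫_ℝ • (u : En n)) (e - ⟪e, u⟫_ℝ • (u : En n)) +
    ((q - Polynomial.X * q.derivative).eval ⟪e, u⟫_ℝ) • prj (u : En n) := by
  have hu := Sph.ne_zero u
  have h : gradient (zon e q) =ᶠ[𝓝 (u : En n)] fun x =>
      ((q - Polynomial.X * q.derivative).eval (⟪e, x⟫_ℝ * ‖x‖⁻¹) * ‖x‖⁻¹) • x +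
      (q.derivative.eval (⟪e, x⟫_ℝ * ‖x‖⁻¹)) • e := by
    filter_upwards [isOpen_compl_zero.mem_nhds hu] with y hy using gradient_zon e q hy
  have ha := hasFDerivAt_arg e hu
  have h1 := ((((q - Polynomial.X * q.derivative).hasDerivAt _).comp_hasFDerivAt _ ha).mul
    (hasFDerivAt_norm_inv hu)).smul (hasFDerivAt_id (u : En n)) |>.add
    (((q.derivative.hasDerivAt _).comp_hasFDerivAt _ ha).smul_const e)
  rw [hess, h.fderiv_eq]
  refine (HasFDerivAt.fderiv h1).trans ?_
  ext w k
  simp [inner_sub_left, inner_smul_left]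
  ring

/-- The action of `bx` on profiles of zonal functions. -/
def boxP (n : ℕ) (q : Polynomial ℝ) : Polynomial ℝ :=
  q - Polynomial.X * q.derivative +
    Polynomial.C (((n : ℝ) - 1)⁻¹) * ((1 - Polynomial.X ^ 2) * q.derivative.derivative)

lemma perp_norm_sq (he : ‖e‖ = 1) (u : Sph n) :
    ‖e - ⟪e, u⟫_ℝ • (u : En n)‖ ^ 2 = 1 - ⟪e, u⟫_ℝ ^ 2 := by
  rw [norm_sub_sq_real, he, inner_smul_right, norm_smul, Sph.norm, mul_one, Real.norm_eq_abs, sq_abs]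
  ring

lemma bx_zon (hn : 2 ≤ n) (he : ‖e‖ = 1) (u : Sph n) :
    bx (zon e q) u = (boxP n q).eval ⟪e, u⟫_ℝ := by
  have hn' : (2 : ℝ) ≤ n := by exact_mod_cast hn
  have : (n : ℝ) - 1 ≠ 0 := by linarith
  rw [bx, hess_zon, trc_add, trc_smul, trc_smul, trc_rk, trc_prj (Sph.norm u),
    real_inner_self_eq_norm_sq, perp_norm_sq e he, boxP]
  simp
  field_simp
  ring

/-- The identity obtained from the symmetry of the mixed volume of a zonal function, an arbitrary
function and Euclidean norms. -/
lemma zon_identity (hn : 3 ≤ n) (he : ‖e‖ = 1) (h : HF n) :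
    ∫ u : Sph n, (q.derivative.derivative.eval ⟪e, u⟫_ℝ *
      ((1 - ⟪e, u⟫_ℝ ^ 2) * trc (hess h u) - ⟪hess h u e, e⟫_ℝ) -
      (n - 2) * (⟪e, u⟫_ℝ * q.derivative.eval ⟪e, u⟫_ℝ) * trc (hess h u)) ∂sg n = 0 := by
  have hn' : (3 : ℝ) ≤ n := by exact_mod_cast hn
  obtain ⟨a, b, c, hab, hac, hbc⟩ : ∃ a b c : Fin n, a ≠ b ∧ a ≠ c ∧ b ≠ c :=
    ⟨⟨0, by omega⟩, ⟨1, by omega⟩, ⟨2, by omega⟩, by simp, by simp, by simp⟩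
  set F := update (update (fun _ => nrm n) b h) c (zon e q) with hF
  have e1 := mixV_eq F a
  rw [mixV_eq F c] at e1
  have hFa : F a = nrm n := by simp [hF, hab, hac]
  have hFb : F b = h := by simp [hF, hbc]
  have hFc : F c = zon e q := by simp [hF]
  have hhs : ∀ u : Sph n, hs F u = update (update (fun _ => prj (u : En n)) b
      (hess h u)) c (hess (zon e q) u) := fun u => by
    ext1 l
    rcases eq_or_ne l c with rfl | hlc
    · rw [hs, hFc, Function.update_self]
    rcases eq_or_ne l b with rfl | hlb
    · rw [hs, hFb, Function.update_of_ne hlc, Function.update_self]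
    · rw [hs, hF, Function.update_of_ne hlc, Function.update_of_ne hlb, Function.update_of_ne hlc,
        Function.update_of_ne hlb, hess_nrm]
  have k1 : ∀ u : Sph n, mdisc n (update (hs F u) c (rk (u : En n) u)) =
      trc (hess h u) / (n * (n - 1)) := fun u => by
    rw [hhs, Function.update_idem, mdisc_uu (Sph.norm u) hbc.symm (h.hess_self (Sph.ne_zero u))
      (h.inner_hess_self (Sph.ne_zero u))]
  set t : Sph n → ℝ := fun u => ⟪e, u⟫_ℝ with ht
  have k2 : ∀ u : Sph n, mdisc n (update (hs F u) a (rk (u : En n) u)) =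
      q.derivative.derivative.eval (t u) * (((1 - t u ^ 2) * trc (hess h u) - ⟪hess h u e, e⟫_ℝ) /
        (n * (n - 1) * (n - 2))) + (q - Polynomial.X * q.derivative).eval (t u) *
          (trc (hess h u) / (n * (n - 1))) := fun u => by
    have h0 := h.hess_self (Sph.ne_zero u)
    have h1 := h.inner_hess_self (Sph.ne_zero u)
    rw [hhs, hess_zon, Function.update_comm hac.symm, MultilinearMap.map_update_add,
      MultilinearMap.map_update_smul, MultilinearMap.map_update_smul]
    rw [Function.update_comm hac, Function.update_comm hac]
    rw [mdisc_uu_pp (Sph.norm u) hab hac hbc h0 h1 (by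
      rw [inner_sub_right, inner_smul_right, Sph.inner_self, real_inner_comm]; ring)]
    have : update (update (fun _ => prj (u : En n)) b (hess h u)) c
        (prj (u : En n)) = update (fun _ => prj (u : En n)) b (hess h u) := by
      rw [Function.update_eq_self_iff, Function.update_of_ne hbc.symm]
    rw [this, mdisc_uu (Sph.norm u) hab h0 h1, perp_norm_sq e he]
    have h2 : ⟪hess h u (e - ⟪e, u⟫_ℝ • (u : En n)), e - ⟪e, u⟫_ℝ • (u : En n)⟫_ℝ =
        ⟪hess h u e, e⟫_ℝ := by
      have h3 : ⟪hess h u e, u⟫_ℝ = 0 := by rw [real_inner_comm]; exact h1 e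
      rw [map_sub, map_smul, h0, smul_zero, sub_zero, inner_sub_right, inner_smul_right, h3,
        mul_zero, sub_zero]
    rw [h2]
    simp only [smul_eq_mul, ht]
  have hn0 : (n : ℝ) ≠ 0 := by linarith
  have e2 := mul_left_cancel₀ hn0 e1
  have e3 : ∫ u : Sph n, (F a u * mdisc n (update (hs F u) a (rk (u : En n) u)) -
      F c u * mdisc n (update (hs F u) c (rk (u : En n) u))) ∂sg n = 0 := by
    have i1 : Integrable (fun u : Sph n => F a u *
        mdisc n (update (hs F u) a (rk (u : En n) u))) (sg n) :=
      integrable_sg ((F a).continuous_sph.mul (continuous_slot F a))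
    have i2 : Integrable (fun u : Sph n => F c u *
        mdisc n (update (hs F u) c (rk (u : En n) u))) (sg n) :=
      integrable_sg ((F c).continuous_sph.mul (continuous_slot F c))
    rw [integral_sub i1 i2, ← e2, sub_self]
  have e4 : ∫ u : Sph n, (n * (n - 1) * (n - 2) : ℝ) * (F a u * mdisc n (update (hs F u) a (rk (u : En n) u)) -
      F c u * mdisc n (update (hs F u) c (rk (u : En n) u))) ∂sg n = 0 := by
    rw [integral_const_mul, e3, mul_zero]
  rw [← e4]
  refine integral_congr_all fun u => ?_
  have h3 : (n : ℝ) - 1 ≠ 0 := by linarith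
  have h4 : (n : ℝ) - 2 ≠ 0 := by linarith
  simp only [k1, k2, hFa, hFc, zon_sph, nrm_apply, Sph.norm]
  simp only [Polynomial.eval_sub, Polynomial.eval_mul, Polynomial.eval_X, ht]
  field_simp
  ring

end Zonal

section Legendre

open Polynomial

/-- Legendre polynomials of dimension `n`, by the three term recurrence. -/
def legP (n : ℕ) : ℕ → ℝ[X]
  | 0 => 1
  | 1 => X
  | k + 2 => C ((k + n - 1 : ℝ)⁻¹) * (C (2 * k + n : ℝ) * (X * legP n (k + 1)) - C (k + 1 : ℝ) * legP n k)

lemma legP_zero : legP n 0 = 1 := rfl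
lemma legP_one : legP n 1 = X := rfl

lemma add_sub_one_ne_zero (hn : 3 ≤ n) (k : ℕ) : (k + n - 1 : ℝ) ≠ 0 := by
  have hn' : (3 : ℝ) ≤ n := by exact_mod_cast hn
  have : (0 : ℝ) ≤ k := k.cast_nonneg
  linarith

lemma legP_rec (hn : 3 ≤ n) (k : ℕ) (t : ℝ) : (k + n - 1 : ℝ) * (legP n (k + 2)).eval t =
    (2 * k + n) * (t * (legP n (k + 1)).eval t) - (k + 1) * (legP n k).eval t := by
  have := add_sub_one_ne_zero hn k
  simp only [legP, eval_mul, eval_sub, eval_C, eval_X]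
  field_simp

lemma legP_rec_deriv (hn : 3 ≤ n) (k : ℕ) (t : ℝ) :
    (k + n - 1 : ℝ) * (derivative (legP n (k + 2))).eval t =
    (2 * k + n) * ((legP n (k + 1)).eval t + t * (derivative (legP n (k + 1))).eval t) -
      (k + 1) * (derivative (legP n k)).eval t := by
  have := add_sub_one_ne_zero hn k
  simp only [legP, derivative_mul, derivative_sub, derivative_C, derivative_X, zero_mul, zero_add,
    eval_mul, eval_sub, eval_C, eval_add, eval_X, one_mul]
  field_simp

lemma legP_eval_one (hn : 3 ≤ n) : ∀ k, (legP n k).eval 1 = 1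
  | 0 => by simp [legP]
  | 1 => by simp [legP]
  | k + 2 => by
    have := add_sub_one_ne_zero hn k
    have h := legP_rec hn k 1
    rw [legP_eval_one hn (k + 1), legP_eval_one hn k] at h
    apply mul_left_cancel₀ this
    rw [h]; ring

lemma legP_deriv_aux (hn : 3 ≤ n) (t : ℝ) : ∀ k,
    (1 - t ^ 2) * (derivative (legP n k)).eval t =
      (k + n - 2) * (t * (legP n k).eval t - (legP n (k + 1)).eval t) ∧
    (1 - t ^ 2) * (derivative (legP n (k + 1))).eval t =
      (k + 1) * ((legP n k).eval t - t * (legP n (k + 1)).eval t)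
  | 0 => by simp [legP]; ring
  | k + 1 => by
    obtain ⟨h1, h2⟩ := legP_deriv_aux hn t k
    have hr := legP_rec hn k t
    have hd := legP_rec_deriv hn k t
    have := add_sub_one_ne_zero hn k
    push_cast
    constructor
    · linear_combination h2 + hr
    · apply mul_left_cancel₀ this
      linear_combination (1 - t ^ 2) * hd + (2 * k + n) * t * h2 - (k + 1) * h1 + (k + 2) * t * hr

/-- The eigenvalue of the Laplacian. -/
def lam (n : ℕ) (k : ℕ) : ℝ := k * (k + n - 2)

lemma legP_ode (hn : 3 ≤ n) (k : ℕ) (t : ℝ) :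
    (1 - t ^ 2) * (derivative (derivative (legP n k))).eval t -
      (n - 1) * (t * (derivative (legP n k)).eval t) + lam n k * (legP n k).eval t = 0 := by
  have key : (1 - X ^ 2) * ((1 - X ^ 2) * derivative (derivative (legP n k)) -
      C ((n : ℝ) - 1) * (X * derivative (legP n k)) + C (lam n k) * legP n k) = 0 := by
    cases k with
    | zero => simp [legP, lam]
    | succ k =>
      have hp : (1 - X ^ 2) * derivative (legP n (k + 1)) =
          C ((k : ℝ) + 1) * (legP n k - X * legP n (k + 1)) := by
        refine Polynomial.funext fun t => ?_
        simpa using (legP_deriv_aux hn t k).2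
      have hp' := congrArg derivative hp
      refine Polynomial.funext fun t => ?_
      have h3 := congrArg (eval t) hp'
      obtain ⟨h1, h2⟩ := legP_deriv_aux hn t k
      simp only [derivative_mul, derivative_sub, derivative_C, derivative_X, derivative_one,
        derivative_X_pow, eval_mul, eval_sub, eval_add, eval_C, eval_X, eval_one, eval_pow,
        eval_zero, Nat.cast_ofNat] at h3
      simp only [eval_mul, eval_sub, eval_add, eval_C, eval_X, eval_one, eval_pow, eval_zero, lam]
      push_cast
      linear_combination (1 - t ^ 2) * h3 + (k + 1) * h1 - (k + n - 2) * t * h2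
  have h0 : (1 - X ^ 2 : ℝ[X]) ≠ 0 := fun h => by
    have := congrArg (eval 0) h
    simp at this
  have := congrArg (eval t) ((mul_eq_zero.1 key).resolve_left h0)
  simpa using this

/-- The eigenvalue of `bx`. -/
def bk (n k : ℕ) : ℝ := 1 - lam n k / (n - 1)

lemma boxP_legP (hn : 3 ≤ n) (k : ℕ) : boxP n (legP n k) = C (bk n k) * legP n k := by
  refine Polynomial.funext fun t => ?_
  have hn' : (3 : ℝ) ≤ n := by exact_mod_cast hn
  have : (n : ℝ) - 1 ≠ 0 := by linarith
  have h := legP_ode hn k t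
  simp only [boxP, bk, eval_mul, eval_sub, eval_add, eval_C, eval_X, eval_one, eval_pow]
  field_simp
  linear_combination h

lemma lam_strictMono (hn : 3 ≤ n) : StrictMono (lam n) := by
  have hn' : (3 : ℝ) ≤ n := by exact_mod_cast hn
  refine strictMono_nat_of_lt_succ fun k => ?_
  simp only [lam]
  have : (0 : ℝ) ≤ k := k.cast_nonneg
  push_cast
  nlinarith

lemma bk_injective (hn : 3 ≤ n) : Function.Injective (bk n) := fun k l h => by
  have hn' : (3 : ℝ) ≤ n := by exact_mod_cast hn
  have : (n : ℝ) - 1 ≠ 0 := by linarith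
  simp only [bk] at h
  field_simp at h
  exact (lam_strictMono hn).injective (by linarith)

lemma bk_zero : bk n 0 = 1 := by simp [bk, lam]
lemma bk_one (hn : 3 ≤ n) : bk n 1 = 0 := by
  have hn' : (3 : ℝ) ≤ n := by exact_mod_cast hn
  have : (n : ℝ) - 1 ≠ 0 := by linarith
  simp only [bk, lam]
  field_simp
  push_cast
  ring

lemma bk_le_two (hn : 3 ≤ n) {k : ℕ} (hk : 2 ≤ k) : bk n k ≤ bk n 2 := by
  have hn' : (3 : ℝ) ≤ n := by exact_mod_cast hn
  have : (0 : ℝ) < (n : ℝ) - 1 := by linarith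
  have := (lam_strictMono hn).monotone hk
  simp only [bk]
  gcongr

lemma bk_two_neg (hn : 3 ≤ n) : bk n 2 < 0 := by
  rw [← bk_one hn]
  have hn' : (3 : ℝ) ≤ n := by exact_mod_cast hn
  have : (0 : ℝ) < (n : ℝ) - 1 := by linarith
  have := (lam_strictMono hn) one_lt_two
  simp only [bk]
  gcongr

lemma bx_legP (hn : 3 ≤ n) {e : En n} (he : ‖e‖ = 1) (k : ℕ) (u : Sph n) :
    bx (zon e (legP n k)) u = bk n k * zon e (legP n k) u := by
  rw [bx_zon e _ (by omega) he, boxP_legP hn, zon_sph, eval_mul, eval_C]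

lemma integral_legP (hn : 3 ≤ n) {e : En n} (he : ‖e‖ = 1) {k : ℕ} (hk : k ≠ 0) :
    ∫ u : Sph n, (legP n k).eval ⟪e, u⟫_ℝ ∂sg n = 0 := by
  have h := integral_bx (by omega) (zon e (legP n k))
  simp only [bx_legP hn he, zon_sph] at h
  rw [integral_const_mul] at h
  have : bk n k ≠ 1 := fun h => hk (bk_injective hn (h.trans bk_zero.symm))
  have h2 : (bk n k - 1) * ∫ u : Sph n, (legP n k).eval ⟪e, u⟫_ℝ ∂sg n = 0 := by
    linear_combination h
  exact (mul_eq_zero.1 h2).resolve_left (sub_ne_zero.2 this)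

lemma legP_neg (k : ℕ) (t : ℝ) : (legP n k).eval (-t) = (-1) ^ k * (legP n k).eval t := by
  induction k using Nat.twoStepInduction with
  | zero => simp [legP]
  | one => simp [legP]
  | more k h1 h2 =>
    simp only [legP, eval_mul, eval_sub, eval_C, eval_X, h1, h2]
    ring

end Legendre

section PolynomialBounds

/-- Nonnegativity of a quintic on an interval from its coefficients in the Bernstein basis. -/
lemma nonneg_of_bernstein {a b x y : ℝ} (c₀ c₁ c₂ c₃ c₄ c₅ : ℝ) (ha : a ≤ x) (hb : x ≤ b)
    (hc : 0 ≤ c₀ ∧ 0 ≤ c₁ ∧ 0 ≤ c₂ ∧ 0 ≤ c₃ ∧ 0 ≤ c₄ ∧ 0 ≤ c₅)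
    (h : y = c₀ * (b - x) ^ 5 + c₁ * ((x - a) * (b - x) ^ 4) + c₂ * ((x - a) ^ 2 * (b - x) ^ 3) +
      c₃ * ((x - a) ^ 3 * (b - x) ^ 2) + c₄ * ((x - a) ^ 4 * (b - x)) + c₅ * (x - a) ^ 5) :
    0 ≤ y := by
  obtain ⟨h0, h1, h2, h3, h4, h5⟩ := hc
  have hp := sub_nonneg.2 ha
  have hq := sub_nonneg.2 hb
  rw [h]
  positivity

lemma poly_lower_6 {x : ℝ} (h0 : 0 ≤ x) (h1 : x ≤ 1) :
    0 ≤ 3/8 + 95/8 * x - 255/8 * x ^ 2 + 165/8 * x ^ 3 := by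
  rcases le_total x (1/2) with h2 | h2
  · exact nonneg_of_bernstein 12 250 625 (1155/2) 220 (59/2) h0 h2 (by norm_num)
      (by ring)
  rcases le_total x (3/4) with h3 | h3
  · exact nonneg_of_bernstein 944 3560 4740 2630 560 54 h2 h3 (by norm_num)
      (by ring)
  rcases le_total x (7/8) with h4 | h4
  · exact nonneg_of_bernstein 1728 4000 6160 13080 15040 5848 h3 h4 (by norm_num)
      (by ring)
  exact nonneg_of_bernstein 5848 43440 126680 179200 122880 32768 h4 h1 (by norm_num) (by ring)

lemma poly_upper_6 {x : ℝ} (h0 : 0 ≤ x) (h1 : x ≤ 1) :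
    0 ≤ 13/8 - 95/8 * x + 255/8 * x ^ 2 - 165/8 * x ^ 3 := by
  rcases le_total x (1/4) with h2 | h2
  · exact nonneg_of_bernstein 1664 5280 6520 4190 1620 334 h0 h2 (by norm_num)
      (by ring)
  rcases le_total x (1/2) with h3 | h3
  · exact nonneg_of_bernstein 334 1720 4590 6460 4360 1104 h2 h3 (by norm_num)
      (by ring)
  exact nonneg_of_bernstein (69/2) 245 (1285/2) 720 320 32 h3 h1 (by norm_num) (by ring)

lemma poly_lower_8 {x : ℝ} (h0 : 0 ≤ x) (h1 : x ≤ 1) :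
    0 ≤ 99/64 - 595/32 * x + 385/4 * x ^ 2 - 5005/32 * x ^ 3 + 5005/64 * x ^ 4 := by
  rcases le_total x (1/4) with h2 | h2
  · exact nonneg_of_bernstein 1584 3160 2960 (6515/2) (42685/16) (12709/16) h0 h2 (by norm_num)
      (by ring)
  rcases le_total x (1/2) with h3 | h3
  · exact nonneg_of_bernstein (12709/16) (84405/16) (27375/2) (32205/2) 8585 1689 h2 h3 (by norm_num)
      (by ring)
  rcases le_total x (3/4) with h4 | h4
  · exact nonneg_of_bernstein 1689 8305 (29965/2) (24015/2) (66485/16) (8229/16) h3 h4 (by norm_num)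
      (by ring)
  rcases le_total x (7/8) with h5 | h5
  · exact nonneg_of_bernstein 16458 56950 67455 30250 (34165/8) (7869/8) h4 h5 (by norm_num)
      (by ring)
  exact nonneg_of_bernstein (7869/8) (44525/8) 35430 90240 92160 32768 h5 h1 (by norm_num) (by ring)

lemma poly_upper_8 {x : ℝ} (h0 : 0 ≤ x) (h1 : x ≤ 1) :
    0 ≤ 29/64 + 595/32 * x - 385/4 * x ^ 2 + 5005/32 * x ^ 3 - 5005/64 * x ^ 4 := by
  rcases le_total x (1/2) with h2 | h2
  · exact nonneg_of_bernstein (29/2) 370 565 (1965/8) (1515/32) (359/32) h0 h2 (by norm_num)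
      (by ring)
  exact nonneg_of_bernstein (359/32) (2075/32) (2525/8) 670 440 32 h2 h1 (by norm_num) (by ring)

lemma poly_lower_10 {x : ℝ} (h0 : 0 ≤ x) (h1 : x ≤ 1) :
    0 ≤ 65/128 + 3339/128 * x - 13923/64 * x ^ 2 + 40131/64 * x ^ 3 - 93483/128 * x ^ 4 + 37791/128 * x ^ 5 := by
  rcases le_total x (1/4) with h2 | h2
  · exact nonneg_of_bernstein 520 9278 17989 (54127/4) (149989/32) (87251/128) h0 h2 (by norm_num)
      (by ring)
  rcases le_total x (1/2) with h3 | h3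
  · exact nonneg_of_bernstein (87251/128) (136277/64) (52807/16) (41933/8) (33967/8) (4609/4) h2 h3 (by norm_num)
      (by ring)
  rcases le_total x (3/4) with h4 | h4
  · exact nonneg_of_bernstein (4609/4) (58213/8) (138917/8) (294853/16) (520901/64) (159521/128) h3 h4 (by norm_num)
      (by ring)
  rcases le_total x (7/8) with h5 | h5
  · exact nonneg_of_bernstein (159521/4) (1351013/8) (2107045/8) (2910053/16) (3375013/64) (708577/128) h4 h5 (by norm_num)
      (by ring)
  rcases le_total x (15/16) with h6 | h6
  · exact nonneg_of_bernstein (708577/4) (3878629/8) (3026021/8) (1312741/16) (5882213/64) (10333025/128) h5 h6 (by norm_num)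
      (by ring)
  exact nonneg_of_bernstein (10333025/128) 715358 2575840 4366336 3473408 1048576 h6 h1 (by norm_num) (by ring)

lemma poly_upper_10 {x : ℝ} (h0 : 0 ≤ x) (h1 : x ≤ 1) :
    0 ≤ 191/128 - 3339/128 * x + 13923/64 * x ^ 2 - 40131/64 * x ^ 3 + 93483/128 * x ^ 4 - 37791/128 * x ^ 5 := by
  rcases le_total x (1/4) with h2 | h2
  · exact nonneg_of_bernstein 1528 962 2491 (27793/4) (177691/32) (174893/128) h0 h2 (by norm_num)
      (by ring)
  rcases le_total x (1/2) with h3 | h3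
  · exact nonneg_of_bernstein (174893/128) (519083/64) (274873/16) (121907/8) (47953/8) (3583/4) h2 h3 (by norm_num)
      (by ring)
  rcases le_total x (3/4) with h4 | h4
  · exact nonneg_of_bernstein (3583/4) (23707/8) (24923/8) (32827/16) (134459/64) (102623/128) h3 h4 (by norm_num)
      (by ring)
  exact nonneg_of_bernstein (102623/128) (11833/2) 17314 22912 12032 1024 h4 h1 (by norm_num) (by ring)

lemma poly_tail_nonneg {x : ℝ} (h0 : 0 ≤ x) (h1 : x ≤ 1) :
    0 ≤ 381/2560 + 263/2560 * x - 1667/1280 * x ^ 2 + 231/256 * x ^ 3 + 357/512 * x ^ 4 + 231/512 * x ^ 5 := by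
  rcases le_total x (1/2) with h2 | h2
  · exact nonneg_of_bernstein (381/80) (4073/160) (1401/32) (9549/320) (9913/1280) (3693/2560) h0 h2 (by norm_num)
      (by ring)
  exact nonneg_of_bernstein (3693/2560) (1069/160) (2047/80) (324/5) 76 32 h2 h1 (by norm_num) (by ring)

end PolynomialBounds

section Laplace

open Polynomial

lemma integral_ibp_real {m : ℕ} (hm : 2 ≤ m) {e : En m} (he : ‖e‖ = 1) (j : ℕ) :
    ∫ v : Sph m, ((1 - ⟪e, (v : En m)⟫_ℝ ^ 2) * (j * ⟪e, (v : En m)⟫_ℝ ^ (j - 1)) -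
      (m - 1) * (⟪e, (v : En m)⟫_ℝ * ⟪e, (v : En m)⟫_ℝ ^ j)) ∂(sg m) = 0 := by
  have hm' : (2 : ℝ) ≤ m := by exact_mod_cast hm
  have hm1 : (m : ℝ) - 1 ≠ 0 := by linarith
  have hj : (j : ℝ) + 1 ≠ 0 := by positivity
  have h := integral_bx hm (zon e (X ^ (j + 1) : ℝ[X]))
  have i1 : Integrable (fun u : Sph m => bx (zon e (X ^ (j + 1) : ℝ[X])) u) (sg m) :=
    integrable_sg (HF.continuous_bx _)
  have i2 : Integrable (fun u : Sph m => zon e (X ^ (j + 1) : ℝ[X]) u) (sg m) :=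
    integrable_sg (HF.continuous_sph _)
  have h2 : ((m : ℝ) - 1) * (j + 1 : ℝ)⁻¹ * ∫ u : Sph m, (bx (zon e (X ^ (j + 1) : ℝ[X])) u -
      zon e (X ^ (j + 1) : ℝ[X]) u) ∂(sg m) = 0 := by
    rw [integral_sub i1 i2, h, sub_self, mul_zero]
  rw [← integral_const_mul] at h2
  rw [← h2]
  refine integral_congr_all fun u => ?_
  simp only [bx_zon e _ hm he, zon_sph, boxP, derivative_X_pow, derivative_mul, derivative_natCast,
    map_natCast, zero_mul, zero_add, eval_mul, eval_sub, eval_add, eval_C, eval_X, eval_one, eval_pow,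
    eval_natCast, Nat.add_sub_cancel]
  push_cast
  field_simp
  ring

lemma continuous_arg {m : ℕ} (e : En m) : Continuous fun v : Sph m => ⟪e, (v : En m)⟫_ℝ := by
  fun_prop

lemma integral_ibp {m : ℕ} (hm : 2 ≤ m) {e : En m} (he : ‖e‖ = 1) (p : ℂ[X]) :
    ∫ v : Sph m, ((1 - (⟪e, (v : En m)⟫_ℝ : ℂ) ^ 2) * (derivative p).eval (⟪e, (v : En m)⟫_ℝ : ℂ) -
      (m - 1) * ((⟪e, (v : En m)⟫_ℝ : ℂ) * p.eval (⟪e, (v : En m)⟫_ℝ : ℂ))) ∂(sg m) = 0 := by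
  have hc : Continuous fun v : Sph m => (⟪e, (v : En m)⟫_ℝ : ℂ) :=
    Complex.continuous_ofReal.comp (continuous_arg e)
  have hi : ∀ p : ℂ[X], Integrable (fun v : Sph m => (1 - (⟪e, (v : En m)⟫_ℝ : ℂ) ^ 2) *
      (derivative p).eval (⟪e, (v : En m)⟫_ℝ : ℂ) -
      (m - 1) * ((⟪e, (v : En m)⟫_ℝ : ℂ) * p.eval (⟪e, (v : En m)⟫_ℝ : ℂ))) (sg m) := fun p => by
    refine integrable_sg ?_
    have h1 := (derivative p).continuous.comp hc
    have h2 := p.continuous.comp hc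
    exact ((continuous_const.sub (hc.pow 2)).mul h1).sub (continuous_const.mul (hc.mul h2))
  induction p using Polynomial.induction_on' with
  | add p q hp hq =>
    have := integral_add (hi p) (hi q)
    rw [hp, hq, add_zero] at this
    rw [← this]
    refine integral_congr_all fun u => ?_
    simp only [derivative_add, eval_add]
    ring
  | monomial j c =>
    have h := integral_ibp_real hm he j
    have h2 : c * ((∫ v : Sph m, ((1 - ⟪e, (v : En m)⟫_ℝ ^ 2) * (j * ⟪e, (v : En m)⟫_ℝ ^ (j - 1)) -
      (m - 1) * (⟪e, (v : En m)⟫_ℝ * ⟪e, (v : En m)⟫_ℝ ^ j)) ∂(sg m) : ℝ) : ℂ) = 0 := by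
      rw [h]; simp
    rw [← integral_complex_ofReal, ← integral_const_mul] at h2
    rw [← h2]
    refine integral_congr_all fun u => ?_
    simp only [derivative_monomial, eval_monomial]
    push_cast
    ring

/-- The integrand of Laplace's representation. -/
def lapz (t w : ℝ) : ℂ := t + (Complex.I * √(1 - t ^ 2)) * w

lemma lapz_norm_sq {t w : ℝ} (ht : t ^ 2 ≤ 1) : ‖lapz t w‖ ^ 2 = t ^ 2 + (1 - t ^ 2) * w ^ 2 := by
  have h : lapz t w = (t : ℂ) + ((√(1 - t ^ 2) * w : ℝ) : ℂ) * Complex.I := by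
    simp only [lapz]; push_cast; ring
  rw [h, ← Complex.normSq_eq_norm_sq, Complex.normSq_add_mul_I, mul_pow, Real.sq_sqrt (by linarith)]

lemma laplace (hn : 3 ≤ n) {e : En (n - 1)} (he : ‖e‖ = 1) {t : ℝ} (ht : t ^ 2 ≤ 1) (k : ℕ) :
    ∫ v : Sph (n - 1), lapz t ⟪e, (v : En (n - 1))⟫_ℝ ^ k ∂(sg (n - 1)) =
      (((legP n k).eval t : ℝ) : ℂ) := by
  have hm : 2 ≤ n - 1 := by omega
  have hcast : ((n - 1 : ℕ) : ℂ) = n - 1 := by push_cast [show 1 ≤ n by omega]; ring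
  have hP : IsProbabilityMeasure (sg (n - 1)) := sg_isProb (by omega)
  have hz : Continuous fun v : Sph (n - 1) => lapz t ⟪e, (v : En (n - 1))⟫_ℝ := by
    unfold lapz
    exact continuous_const.add (continuous_const.mul
      (Complex.continuous_ofReal.comp (continuous_arg e)))
  have hi : ∀ j : ℕ, ∀ c : ℂ, Integrable (fun v : Sph (n - 1) =>
      c * lapz t ⟪e, (v : En (n - 1))⟫_ℝ ^ j) (sg (n - 1)) := fun j c =>
    integrable_sg (continuous_const.mul (hz.pow j))
  have hs : ((√(1 - t ^ 2) : ℝ) : ℂ) ^ 2 = 1 - (t : ℂ) ^ 2 := by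
    rw [← Complex.ofReal_pow, Real.sq_sqrt (by linarith)]; push_cast; ring
  induction k using Nat.twoStepInduction with
  | zero => simp [legP]
  | one =>
    have h := integral_ibp hm he 1
    simp only [derivative_one, eval_zero, mul_zero, zero_sub, eval_one, mul_one] at h
    rw [integral_neg, integral_const_mul, hcast, neg_eq_zero, mul_eq_zero] at h
    have h1 : (n : ℂ) - 1 - 1 ≠ 0 := by
      have hn' : (3 : ℝ) ≤ n := by exact_mod_cast hn
      have : (n : ℝ) - 1 - 1 ≠ 0 := by linarith
      exact_mod_cast this
    have h2 := h.resolve_left h1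
    have i1 : Integrable (fun _ : Sph (n - 1) => (t : ℂ)) (sg (n - 1)) := integrable_const _
    have i2 : Integrable (fun v : Sph (n - 1) => (Complex.I * √(1 - t ^ 2)) *
      ((⟪e, (v : En (n - 1))⟫_ℝ : ℝ) : ℂ)) (sg (n - 1)) :=
      integrable_sg (continuous_const.mul (Complex.continuous_ofReal.comp (continuous_arg e)))
    simp only [pow_one, lapz, legP, eval_X]
    rw [integral_add i1 i2, integral_const_mul, h2, mul_zero, add_zero]
    simp
  | more k h1 h2 =>
    have h := integral_ibp hm he ((C (t : ℂ) + C (Complex.I * √(1 - t ^ 2)) * X) ^ (k + 1))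
    have e1 : ∫ v : Sph (n - 1), (((-(k + n - 1) : ℂ) * lapz t ⟪e, (v : En (n - 1))⟫_ℝ ^ (k + 2) +
        ((2 * k + n) * t : ℂ) * lapz t ⟪e, (v : En (n - 1))⟫_ℝ ^ (k + 1)) -
        (k + 1 : ℂ) * lapz t ⟪e, (v : En (n - 1))⟫_ℝ ^ k) ∂(sg (n - 1)) = 0 := by
      have h3 : (Complex.I * √(1 - t ^ 2)) * ∫ v : Sph (n - 1), ((1 - ((⟪e, (v : En (n - 1))⟫_ℝ : ℝ) : ℂ) ^ 2) *
          (derivative ((C (t : ℂ) + C (Complex.I * √(1 - t ^ 2)) * X) ^ (k + 1))).eval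
            ((⟪e, (v : En (n - 1))⟫_ℝ : ℝ) : ℂ) -
          ((n - 1 : ℕ) - 1) * (((⟪e, (v : En (n - 1))⟫_ℝ : ℝ) : ℂ) *
          ((C (t : ℂ) + C (Complex.I * √(1 - t ^ 2)) * X) ^ (k + 1)).eval
            ((⟪e, (v : En (n - 1))⟫_ℝ : ℝ) : ℂ))) ∂(sg (n - 1)) = 0 := by
        rw [h, mul_zero]
      rw [← integral_const_mul] at h3
      rw [← h3]
      refine integral_congr_all fun v => ?_
      have hI := Complex.I_sq
      simp only [derivative_pow, derivative_add, derivative_mul, derivative_C, derivative_X, zero_mul,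
        zero_add, mul_one, eval_mul, eval_add, eval_pow, eval_C, eval_X, lapz, hcast, map_natCast,
        eval_natCast, Nat.add_sub_cancel]
      generalize ((⟪e, (v : En (n - 1))⟫_ℝ : ℝ) : ℂ) = w
      generalize ((√(1 - t ^ 2) : ℝ) : ℂ) = s at hs
      push_cast
      have hz2 : (t + Complex.I * s * w) ^ 2 = 2 * t * (t + Complex.I * s * w) - 1 + (1 - w ^ 2) * s ^ 2 := by
        linear_combination s ^ 2 * w ^ 2 * hI - hs
      rw [pow_add _ k 2, pow_succ _ k]
      generalize (t + Complex.I * s * w) ^ k = Z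
      linear_combination (-(k + 1 : ℂ)) * Z * hz2 - (k + 1) * Z * s ^ 2 * (1 - w ^ 2) * hI
    have e2 := hi (k + 2) (-(k + n - 1) : ℂ)
    have e3 := hi (k + 1) ((2 * k + n) * t : ℂ)
    have e4 := hi k (k + 1 : ℂ)
    have e23 : Integrable (fun v : Sph (n - 1) => (-(k + n - 1) : ℂ) * lapz t ⟪e, (v : En (n - 1))⟫_ℝ ^ (k + 2) +
        ((2 * k + n) * t : ℂ) * lapz t ⟪e, (v : En (n - 1))⟫_ℝ ^ (k + 1)) (sg (n - 1)) := e2.add e3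
    rw [integral_sub e23 e4, integral_add e2 e3, integral_const_mul, integral_const_mul,
      integral_const_mul, h1, h2] at e1
    have hr := congrArg (fun x : ℝ => (x : ℂ)) (legP_rec hn k t)
    push_cast at hr
    have h5 : (k + n - 1 : ℂ) ≠ 0 := by
      have hn' : (3 : ℝ) ≤ n := by exact_mod_cast hn
      have : (k + n - 1 : ℝ) ≠ 0 := by have : (0 : ℝ) ≤ k := k.cast_nonneg; linarith
      exact_mod_cast this
    apply mul_left_cancel₀ h5
    linear_combination -e1 - hr

/-- Even moments of a coordinate on the sphere of dimension `m - 1`. -/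
def mom (m : ℕ) : ℕ → ℝ
  | 0 => 1
  | j + 1 => (2 * j + 1) / (m + 2 * j) * mom m j

lemma integral_even_pow {m : ℕ} (hm : 2 ≤ m) {e : En m} (he : ‖e‖ = 1) (j : ℕ) :
    ∫ v : Sph m, ⟪e, (v : En m)⟫_ℝ ^ (2 * j) ∂(sg m) = mom m j := by
  have hP : IsProbabilityMeasure (sg m) := sg_isProb (by omega)
  induction j with
  | zero => simp [mom]
  | succ j ih =>
    have h := integral_ibp_real hm he (2 * j + 1)
    have i1 : Integrable (fun v : Sph m => (2 * j + 1 : ℝ) * ⟪e, (v : En m)⟫_ℝ ^ (2 * j)) (sg m) :=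
      integrable_sg (continuous_const.mul ((continuous_arg e).pow _))
    have i2 : Integrable (fun v : Sph m => (m + 2 * j : ℝ) * ⟪e, (v : En m)⟫_ℝ ^ (2 * (j + 1))) (sg m) :=
      integrable_sg (continuous_const.mul ((continuous_arg e).pow _))
    have h2 : ∫ v : Sph m, ((2 * j + 1 : ℝ) * ⟪e, (v : En m)⟫_ℝ ^ (2 * j) -
        (m + 2 * j : ℝ) * ⟪e, (v : En m)⟫_ℝ ^ (2 * (j + 1))) ∂(sg m) = 0 := by
      rw [← h]
      refine integral_congr_all fun v => ?_
      simp only [Nat.add_sub_cancel]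
      push_cast
      ring
    rw [integral_sub i1 i2, integral_const_mul, integral_const_mul, ih] at h2
    have : (m + 2 * j : ℝ) ≠ 0 := by
      have : (2 : ℝ) ≤ m := by exact_mod_cast hm
      positivity
    rw [mom]
    field_simp
    linarith

/-- The even tail majorant of Legendre polynomials, as a function of `t ^ 2`. -/
def tailm (n h : ℕ) (x : ℝ) : ℝ :=
  ∑ j ∈ Finset.range (h + 1), x ^ j * (1 - x) ^ (h - j) * mom (n - 1) (h - j) * (h.choose j)

lemma abs_legP_le (hn : 3 ≤ n) {t : ℝ} (ht : t ^ 2 ≤ 1) {k h : ℕ} (hk : 2 * h ≤ k) :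
    |(legP n k).eval t| ≤ tailm n h (t ^ 2) := by
  have hm : 2 ≤ n - 1 := by omega
  have hP : IsProbabilityMeasure (sg (n - 1)) := sg_isProb (by omega)
  set e : En (n - 1) := EuclideanSpace.single ⟨0, by omega⟩ 1
  have he : ‖e‖ = 1 := by simp [e]
  have h1 : |(legP n k).eval t| = ‖(((legP n k).eval t : ℝ) : ℂ)‖ := by simp
  rw [h1, ← laplace hn he ht]
  refine (norm_integral_le_integral_norm _).trans ?_
  have h2 : ∫ v : Sph (n - 1), (t ^ 2 + (1 - t ^ 2) * ⟪e, (v : En (n - 1))⟫_ℝ ^ 2) ^ h ∂(sg (n - 1)) =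
      tailm n h (t ^ 2) := by
    simp only [add_pow, tailm]
    rw [integral_finsetSum]
    · refine Finset.sum_congr rfl fun j _ => ?_
      rw [← integral_even_pow hm he, ← integral_const_mul, ← integral_mul_const]
      refine integral_congr_all fun v => ?_
      simp only [mul_pow, ← pow_mul]
      ring
    · intro j _
      refine integrable_sg ?_
      have := continuous_arg e
      fun_prop
  rw [← h2]
  have hc := continuous_arg e
  refine integral_mono (integrable_sg ?_) (integrable_sg (by fun_prop)) fun v => ?_
  · refine continuous_norm.comp (Continuous.pow ?_ _)
    unfold lapz
    exact continuous_const.add (continuous_const.mul (Complex.continuous_ofReal.comp hc))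
  · have hw : ⟪e, (v : En (n - 1))⟫_ℝ ^ 2 ≤ 1 := by
      have := abs_real_inner_le_norm e (v : En (n - 1))
      rw [he, Sph.norm, one_mul] at this
      exact (sq_le_one_iff_abs_le_one _).2 this
    have h3 := lapz_norm_sq (w := ⟪e, (v : En (n - 1))⟫_ℝ) ht
    show ‖lapz t ⟪e, (v : En (n - 1))⟫_ℝ ^ k‖ ≤ _
    rw [← h3, norm_pow, ← pow_mul]
    refine pow_le_pow_of_le_one (norm_nonneg _) ?_ hk
    rw [← sq_le_one_iff₀ (norm_nonneg _), h3]
    nlinarith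

end Laplace

section Multiplier

open Polynomial

lemma inner_le_trc {A : En n →L[ℝ] En n} (hA : ∀ w, 0 ≤ ⟪A w, w⟫_ℝ) (w : En n) :
    ⟪A w, w⟫_ℝ ≤ trc A * ‖w‖ ^ 2 := by
  rcases eq_or_ne w 0 with rfl | hw
  · simp
  have hw' : ‖w‖ ≠ 0 := norm_ne_zero_iff.2 hw
  set e := ‖w‖⁻¹ • w with he
  have he1 : ‖e‖ = 1 := by rw [he, norm_smul, norm_inv, norm_norm, inv_mul_cancel₀ hw']
  have hwe : w = ‖w‖ • e := by rw [he, smul_smul, mul_inv_cancel₀ hw', one_smul]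
  have ho : Orthonormal ℝ ((↑) : ({e} : Set (En n)) → En n) := by
    rw [orthonormal_iff_ite]
    rintro ⟨x, rfl⟩ ⟨y, rfl⟩
    rw [real_inner_self_eq_norm_sq, he1]; simp
  obtain ⟨s, b, hs, hb⟩ := ho.exists_orthonormalBasis_extension
  have ht : trc A = ∑ i, ⟪b i, A (b i)⟫_ℝ := by
    have e1 := LinearMap.trace_eq_sum_inner (A : En n →ₗ[ℝ] En n) b
    rw [LinearMap.trace_eq_sum_inner (A : En n →ₗ[ℝ] En n) (EuclideanSpace.basisFun (Fin n) ℝ)] at e1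
    refine Eq.trans ?_ e1
    simp [trc, EuclideanSpace.inner_single_left]
  have hes : e ∈ s := hs rfl
  have h1 : ⟪b ⟨e, hes⟩, A (b ⟨e, hes⟩)⟫_ℝ ≤ trc A := by
    rw [ht]
    refine Finset.single_le_sum (f := fun i => ⟪b i, A (b i)⟫_ℝ) (fun i _ => ?_) (Finset.mem_univ _)
    rw [real_inner_comm]; exact hA _
  rw [hb] at h1
  have h1' : ⟪e, A e⟫_ℝ ≤ trc A := h1
  have h2 : ⟪A w, w⟫_ℝ = ‖w‖ ^ 2 * ⟪e, A e⟫_ℝ := by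
    conv_lhs => rw [hwe]
    rw [map_smul, inner_smul_left, inner_smul_right, real_inner_comm]; simp; ring
  rw [h2, mul_comm]
  gcongr

lemma trc_nonneg {A : En n →L[ℝ] En n} (hA : ∀ w, 0 ≤ ⟪A w, w⟫_ℝ) : 0 ≤ trc A :=
  Finset.sum_nonneg fun j _ => by
    have := hA (EuclideanSpace.single j 1)
    rwa [EuclideanSpace.inner_single_right, one_mul] at this

lemma arg_sq_le {e : En n} (he : ‖e‖ = 1) (u : Sph n) : ⟪e, u⟫_ℝ ^ 2 ≤ 1 := by
  have := abs_real_inner_le_norm e (u : En n)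
  rw [he, Sph.norm, one_mul] at this
  exact (sq_le_one_iff_abs_le_one _).2 this

lemma continuous_trc_hess (h : HF n) : Continuous fun u : Sph n => trc (hess h u) :=
  continuous_trc.comp h.continuous_hess_sph

lemma integral_trc_le (hn : 3 ≤ n) {e : En n} (he : ‖e‖ = 1) {h : HF n}
    (hh : ∀ (u : Sph n) w, 0 ≤ ⟪hess h u w, w⟫_ℝ) {P : ℝ → ℝ} (hP : Continuous P) (q : ℝ[X])
    (c1 : ∀ t : ℝ, t ^ 2 ≤ 1 → 0 ≤ 1 - (n - 1) * P t - (n - 2) * (t * q.derivative.eval t))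
    (c2 : ∀ t : ℝ, t ^ 2 ≤ 1 → 0 ≤ 1 - (n - 1) * P t - (n - 2) * (t * q.derivative.eval t) +
      (1 - t ^ 2) * q.derivative.derivative.eval t) :
    (n - 1) * ∫ u : Sph n, trc (hess h u) * P ⟪e, u⟫_ℝ ∂sg n ≤
      ∫ u : Sph n, trc (hess h u) ∂sg n := by
  have hz := zon_identity e q hn he h
  have ct := continuous_trc_hess h
  have ca := continuous_arg e
  have ch := h.continuous_hess_sph
  have i1 : Integrable (fun u : Sph n => trc (hess h u)) (sg n) := integrable_sg ct
  have i2 : Integrable (fun u : Sph n => (n - 1) * (trc (hess h u) * P ⟪e, u⟫_ℝ)) (sg n) :=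
    integrable_sg (continuous_const.mul (ct.mul (hP.comp ca)))
  have i12 : Integrable (fun u : Sph n => trc (hess h u) -
      (n - 1) * (trc (hess h u) * P ⟪e, u⟫_ℝ)) (sg n) := i1.sub i2
  have i3 : Integrable (fun u : Sph n => q.derivative.derivative.eval ⟪e, u⟫_ℝ *
      ((1 - ⟪e, u⟫_ℝ ^ 2) * trc (hess h u) - ⟪hess h u e, e⟫_ℝ) -
      (n - 2) * (⟪e, u⟫_ℝ * q.derivative.eval ⟪e, u⟫_ℝ) * trc (hess h u)) (sg n) := by
    refine integrable_sg ?_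
    have h1 := q.derivative.derivative.continuous.comp ca
    have h2 := q.derivative.continuous.comp ca
    have h3 : Continuous fun u : Sph n => ⟪hess h u e, e⟫_ℝ := by fun_prop
    exact (h1.mul (((continuous_const.sub (ca.pow 2)).mul ct).sub h3)).sub
      ((continuous_const.mul (ca.mul h2)).mul ct)
  have hs := integral_add i12 i3
  rw [hz, add_zero, integral_sub i1 i2, integral_const_mul] at hs
  rw [← sub_nonneg, ← hs]
  refine integral_nonneg fun u => ?_
  have ht := arg_sq_le he u
  have hu := Sph.ne_zero u
  have hk0 := hh u e
  have hτ := trc_nonneg (hh u)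
  have hk1 : ⟪hess h u e, e⟫_ℝ ≤ trc (hess h u) * (1 - ⟪e, u⟫_ℝ ^ 2) := by
    have h1 := inner_le_trc (hh u) (e - ⟪e, u⟫_ℝ • (u : En n))
    have h3 : ⟪hess h u e, u⟫_ℝ = 0 := by
      rw [real_inner_comm]; exact h.inner_hess_self hu e
    rwa [map_sub, map_smul, h.hess_self hu, smul_zero, sub_zero, inner_sub_right, inner_smul_right,
      h3, mul_zero, sub_zero, perp_norm_sq e he] at h1
  have C1 := c1 _ ht
  have C2 := c2 _ ht
  simp only [Pi.zero_apply]
  generalize ⟪e, u⟫_ℝ = t at *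
  generalize ⟪hess h u e, e⟫_ℝ = κ at *
  generalize trc (hess h u) = τ at *
  rcases (sub_nonneg.2 ht).eq_or_lt with h0 | h0
  · have : κ = 0 := by rw [← h0] at hk1; linarith
    subst this
    have h1 := mul_nonneg hτ C1
    rw [← h0]
    linarith
  · have h1 := mul_nonneg hk0 C1
    have h2 := mul_nonneg (sub_nonneg.2 hk1) C2
    refine nonneg_of_mul_nonneg_right (a := 1 - t ^ 2) ?_ h0
    linear_combination h1 + h2

/-- A pointwise certificate via the differential equation of Legendre polynomials. -/
lemma abs_integral_legP_le_of_cert (hn : 3 ≤ n) {e : En n} (he : ‖e‖ = 1) {h : HF n}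
    (hh : ∀ (u : Sph n) w, 0 ≤ ⟪hess h u w, w⟫_ℝ) {k : ℕ} (hk : k ≠ 0)
    (hc : ∀ t : ℝ, t ^ 2 ≤ 1 → |(n - 1) * (legP n k).eval t -
      (n - 1) ^ 2 / lam n k * (t * (legP n k).derivative.eval t)| ≤ 1) :
    (n - 1) * |∫ u : Sph n, trc (hess h u) * (legP n k).eval ⟪e, u⟫_ℝ ∂sg n| ≤
      ∫ u : Sph n, trc (hess h u) ∂sg n := by
  have hn' : (3 : ℝ) ≤ n := by exact_mod_cast hn
  have h2 : (0 : ℝ) < n - 2 := by linarith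
  have hl : 0 < lam n k := by
    have := lam_strictMono hn (Nat.pos_of_ne_zero hk)
    simpa [lam] using this
  have key : ∀ s : ℝ, |s| = 1 → s * ((n - 1) * ∫ u : Sph n, trc (hess h u) *
      (legP n k).eval ⟪e, u⟫_ℝ ∂sg n) ≤ ∫ u : Sph n, trc (hess h u) ∂sg n := by
    intro s hs
    have hb : ∀ t : ℝ, t ^ 2 ≤ 1 → s * ((n - 1) * (legP n k).eval t -
      (n - 1) ^ 2 / lam n k * (t * (legP n k).derivative.eval t)) ≤ 1 ∧
      -1 ≤ s * ((n - 1) * (legP n k).eval t -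
      (n - 1) ^ 2 / lam n k * (t * (legP n k).derivative.eval t)) := fun t ht => by
      have := hc t ht
      rw [← one_mul |_|, ← hs, ← abs_mul, hs] at this
      exact ⟨(abs_le.1 this).2, (abs_le.1 this).1⟩
    have := integral_trc_le hn he hh (P := fun t => s * (legP n k).eval t)
      (continuous_const.mul (legP n k).continuous)
      (C (-s * (n - 1) ^ 2 / ((n - 2) * lam n k)) * legP n k) ?_ ?_
    · refine le_trans (le_of_eq ?_) this
      rw [mul_left_comm, ← integral_const_mul]
      congr 2
      ext u; ring
    · intro t ht
      have := (hb t ht).1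
      simp only [derivative_mul, derivative_C, zero_mul, zero_add, eval_mul, eval_C]
      have e1 : 1 - (n - 1) * (s * (legP n k).eval t) - (n - 2) * (t * (-s * (n - 1) ^ 2 /
          ((n - 2) * lam n k) * (legP n k).derivative.eval t)) = 1 - s * ((n - 1) * (legP n k).eval t -
          (n - 1) ^ 2 / lam n k * (t * (legP n k).derivative.eval t)) := by
        field_simp
        ring
      rw [e1]; linarith
    · intro t ht
      have h1 := (hb t ht).2
      have ho := legP_ode hn k t
      simp only [derivative_mul, derivative_C, zero_mul, zero_add, eval_mul, eval_C]
      have e1 : 1 - (n - 1) * (s * (legP n k).eval t) - (n - 2) * (t * (-s * (n - 1) ^ 2 /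
          ((n - 2) * lam n k) * (legP n k).derivative.eval t)) +
          (1 - t ^ 2) * (-s * (n - 1) ^ 2 / ((n - 2) * lam n k) *
          (legP n k).derivative.derivative.eval t) = 1 + (1 / (n - 2)) * (s * ((n - 1) * (legP n k).eval t -
          (n - 1) ^ 2 / lam n k * (t * (legP n k).derivative.eval t))) := by
        have hd : (1 - t ^ 2) * (legP n k).derivative.derivative.eval t =
          (n - 1) * (t * (legP n k).derivative.eval t) - lam n k * (legP n k).eval t := by linarith
        have : (1 - t ^ 2) * (-s * (n - 1) ^ 2 / ((n - 2) * lam n k) *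
          (legP n k).derivative.derivative.eval t) = -s * (n - 1) ^ 2 / ((n - 2) * lam n k) *
          ((n - 1) * (t * (legP n k).derivative.eval t) - lam n k * (legP n k).eval t) := by
          rw [← hd]; ring
        rw [this]
        field_simp
        ring
      rw [e1]
      have h3 : 1 / ((n : ℝ) - 2) ≤ 1 := by rw [div_le_one h2]; linarith
      have h4 : 0 ≤ 1 / ((n : ℝ) - 2) := by positivity
      nlinarith
  rcases abs_cases (∫ u : Sph n, trc (hess h u) * (legP n k).eval ⟪e, u⟫_ℝ ∂sg n) with h | h
  · rw [h.1]; have := key 1 (by simp); linarith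
  · rw [h.1]; have := key (-1) (by simp); linarith

/-- A pointwise certificate via Laplace's representation. -/
lemma abs_integral_legP_le_of_tail (hn : 3 ≤ n) {e : En n} (he : ‖e‖ = 1) {h : HF n}
    (hh : ∀ (u : Sph n) w, 0 ≤ ⟪hess h u w, w⟫_ℝ) {k r : ℕ} (hk : 2 * r ≤ k)
    (hm : Continuous (tailm n r)) (q : ℝ[X])
    (c1 : ∀ t : ℝ, t ^ 2 ≤ 1 → 0 ≤ 1 - (n - 1) * tailm n r (t ^ 2) - (n - 2) * (t * q.derivative.eval t))
    (c2 : ∀ t : ℝ, t ^ 2 ≤ 1 → 0 ≤ 1 - (n - 1) * tailm n r (t ^ 2) - (n - 2) * (t * q.derivative.eval t) +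
      (1 - t ^ 2) * q.derivative.derivative.eval t) :
    (n - 1) * |∫ u : Sph n, trc (hess h u) * (legP n k).eval ⟪e, u⟫_ℝ ∂sg n| ≤
      ∫ u : Sph n, trc (hess h u) ∂sg n := by
  have hn' : (3 : ℝ) ≤ n := by exact_mod_cast hn
  have hmc : Continuous fun t : ℝ => tailm n r (t ^ 2) := hm.comp (continuous_pow 2)
  refine le_trans ?_ (integral_trc_le hn he hh hmc q c1 c2)
  refine mul_le_mul_of_nonneg_left ?_ (by linarith)
  rw [← Real.norm_eq_abs]
  refine (norm_integral_le_integral_norm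
    (fun u : Sph n => trc (hess h u) * (legP n k).eval ⟪e, u⟫_ℝ)).trans ?_
  have ct := continuous_trc_hess h
  have ca := continuous_arg e
  refine integral_mono (integrable_sg (continuous_norm.comp (ct.mul ((legP n k).continuous.comp ca))))
    (integrable_sg (ct.mul (hmc.comp ca))) fun u => ?_
  show ‖trc (hess h u) * (legP n k).eval ⟪e, u⟫_ℝ‖ ≤ _
  rw [norm_mul, Real.norm_of_nonneg (trc_nonneg (hh u))]
  exact mul_le_mul_of_nonneg_left (abs_legP_le hn (arg_sq_le he u) hk) (trc_nonneg (hh u))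

end Multiplier

section LegendreThree

open Polynomial

lemma legP_three_step {k : ℕ} {p q r : ℝ[X]} (hp : legP 3 k = p) (hq : legP 3 (k + 1) = q)
    (h : ∀ t, (k + 2) * r.eval t = (2 * k + 3) * (t * q.eval t) - (k + 1) * p.eval t) :
    legP 3 (k + 2) = r := by
  refine Polynomial.funext fun t => ?_
  have h' := legP_rec (n := 3) le_rfl k t
  rw [hp, hq] at h'
  have : (k + 2 : ℝ) ≠ 0 := by positivity
  refine mul_left_cancel₀ this ?_
  push_cast at h'
  linarith [h t]

lemma legP_three :
    legP 3 6 = C (-5/16) + C (105/16) * X ^ 2 - C (315/16) * X ^ 4 + C (231/16) * X ^ 6 ∧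
    legP 3 8 = C (35/128) - C (315/32) * X ^ 2 + C (3465/64) * X ^ 4 - C (3003/32) * X ^ 6 + C (6435/128) * X ^ 8 ∧
    legP 3 10 = C (-63/256) + C (3465/256) * X ^ 2 - C (15015/128) * X ^ 4 + C (45045/128) * X ^ 6 - C (109395/256) * X ^ 8 + C (46189/256) * X ^ 10 := by
  have e2 : legP 3 2 = C (-1/2) + C (3/2) * X ^ 2 :=
    legP_three_step legP_zero legP_one fun t => by simp; ring
  have e3 : legP 3 3 = C (-3/2) * X + C (5/2) * X ^ 3 :=
    legP_three_step legP_one e2 fun t => by simp; ring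
  have e4 : legP 3 4 = C (3/8) - C (15/4) * X ^ 2 + C (35/8) * X ^ 4 :=
    legP_three_step e2 e3 fun t => by simp; ring
  have e5 : legP 3 5 = C (15/8) * X - C (35/4) * X ^ 3 + C (63/8) * X ^ 5 :=
    legP_three_step e3 e4 fun t => by simp; ring
  have e6 : legP 3 6 = C (-5/16) + C (105/16) * X ^ 2 - C (315/16) * X ^ 4 + C (231/16) * X ^ 6 :=
    legP_three_step e4 e5 fun t => by simp; ring
  have e7 : legP 3 7 = C (-35/16) * X + C (315/16) * X ^ 3 - C (693/16) * X ^ 5 + C (429/16) * X ^ 7 :=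
    legP_three_step e5 e6 fun t => by simp; ring
  have e8 : legP 3 8 = C (35/128) - C (315/32) * X ^ 2 + C (3465/64) * X ^ 4 - C (3003/32) * X ^ 6 + C (6435/128) * X ^ 8 :=
    legP_three_step e6 e7 fun t => by simp; ring
  have e9 : legP 3 9 = C (315/128) * X - C (1155/32) * X ^ 3 + C (9009/64) * X ^ 5 - C (6435/32) * X ^ 7 + C (12155/128) * X ^ 9 :=
    legP_three_step e7 e8 fun t => by simp; ring
  have e10 : legP 3 10 = C (-63/256) + C (3465/256) * X ^ 2 - C (15015/128) * X ^ 4 + C (45045/128) * X ^ 6 - C (109395/256) * X ^ 8 + C (46189/256) * X ^ 10 :=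
    legP_three_step e8 e9 fun t => by simp; ring
  exact ⟨e6, e8, e10⟩

lemma cert_two (hn : 3 ≤ n) {t : ℝ} (ht : t ^ 2 ≤ 1) : |(n - 1) * (legP n 2).eval t -
    (n - 1) ^ 2 / lam n 2 * (t * (legP n 2).derivative.eval t)| ≤ 1 := by
  have hn' : (3 : ℝ) ≤ n := by exact_mod_cast hn
  have h0 : (n : ℝ) ≠ 0 := by linarith
  have h1 : (n : ℝ) - 1 ≠ 0 := by linarith
  have e : (legP n 2).eval t = (n * t ^ 2 - 1) / (n - 1) := by
    simp [legP]; field_simp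
  have d : (legP n 2).derivative.eval t = 2 * n * t / (n - 1) := by
    simp [legP]; field_simp; ring
  have : (n - 1) * (legP n 2).eval t -
    (n - 1) ^ 2 / lam n 2 * (t * (legP n 2).derivative.eval t) = t ^ 2 - 1 := by
    rw [e, d, show lam n 2 = 2 * n by rw [lam]; push_cast; ring]
    field_simp
    ring
  rw [this, abs_le]
  constructor <;> nlinarith [sq_nonneg t]

lemma cert_four (hn : 3 ≤ n) {t : ℝ} (ht : t ^ 2 ≤ 1) : |(n - 1) * (legP n 4).eval t -
    (n - 1) ^ 2 / lam n 4 * (t * (legP n 4).derivative.eval t)| ≤ 1 := by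
  have hn' : (3 : ℝ) ≤ n := by exact_mod_cast hn
  have h1 : (n : ℝ) - 1 ≠ 0 := by linarith
  have h2 : (n : ℝ) + 2 ≠ 0 := by linarith
  have h3 : (n : ℝ) + 1 ≠ 0 := by linarith
  have h0 : (n : ℝ) ≠ 0 := by linarith
  have e2 : (legP n 2).eval t = (n * t ^ 2 - 1) / (n - 1) := by
    simp [legP]; field_simp
  have d2 : (legP n 2).derivative.eval t = 2 * n * t / (n - 1) := by
    simp [legP]; field_simp; ring
  have e3 : (legP n 3).eval t = ((n + 2) * t ^ 3 - 3 * t) / (n - 1) := by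
    have h := legP_rec hn 1 t
    norm_num [e2, legP_one] at h
    apply mul_left_cancel₀ h0
    rw [h]; field_simp; ring
  have d3 : (legP n 3).derivative.eval t = (3 * (n + 2) * t ^ 2 - 3) / (n - 1) := by
    have h := legP_rec_deriv hn 1 t
    norm_num [e2, d2, legP_one] at h
    apply mul_left_cancel₀ h0
    rw [h]; field_simp; ring
  have e4 : (legP n 4).eval t = ((n + 4) * (n + 2) * t ^ 4 - 6 * (n + 2) * t ^ 2 + 3) / ((n - 1) * (n + 1)) := by
    have h := legP_rec hn 2 t
    norm_num [e2, e3] at h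
    have h' : (2 : ℝ) + n - 1 ≠ 0 := by linarith
    apply mul_left_cancel₀ h'
    rw [h]; field_simp; ring
  have d4 : (legP n 4).derivative.eval t = (4 * (n + 4) * (n + 2) * t ^ 3 - 12 * (n + 2) * t) / ((n - 1) * (n + 1)) := by
    have h := legP_rec_deriv hn 2 t
    norm_num [e3, d2, d3] at h
    have h' : (2 : ℝ) + n - 1 ≠ 0 := by linarith
    apply mul_left_cancel₀ h'
    rw [h]; field_simp; ring
  obtain ⟨y, hy⟩ : ∃ y, y = 1 - t ^ 2 := ⟨_, rfl⟩
  have : (n - 1) * (legP n 4).eval t -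
    (n - 1) ^ 2 / lam n 4 * (t * (legP n 4).derivative.eval t) =
      -(3 * y * ((n + 3) - (n + 4) * y)) / (n + 1) := by
    rw [e4, d4, lam, hy]; push_cast
    have h' : (4 : ℝ) + n - 2 ≠ 0 := by linarith
    field_simp; ring
  have hy0 : 0 ≤ y := by linarith
  have hy1 : y ≤ 1 := by rw [hy]; nlinarith [sq_nonneg t]
  have hp : (0 : ℝ) < n + 1 := by linarith
  rw [this, abs_le, le_div_iff₀ hp, div_le_iff₀ hp]
  constructor
  · nlinarith [sq_nonneg (2 * (n + 4) * y - (n + 3))]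
  · nlinarith [mul_nonneg hy0 (sub_nonneg.2 hy1)]

lemma cert_three_6 {t : ℝ} (ht : t ^ 2 ≤ 1) : |((3 : ℕ) - 1) * (legP 3 6).eval t -
    ((3 : ℕ) - 1) ^ 2 / lam 3 6 * (t * (legP 3 6).derivative.eval t)| ≤ 1 := by
  have h1 := poly_lower_6 (sq_nonneg t) ht
  have h2 := poly_upper_6 (sq_nonneg t) ht
  rw [legP_three.1, lam, abs_le]
  norm_num
  constructor <;> linarith

lemma cert_three_8 {t : ℝ} (ht : t ^ 2 ≤ 1) : |((3 : ℕ) - 1) * (legP 3 8).eval t -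
    ((3 : ℕ) - 1) ^ 2 / lam 3 8 * (t * (legP 3 8).derivative.eval t)| ≤ 1 := by
  have h1 := poly_lower_8 (sq_nonneg t) ht
  have h2 := poly_upper_8 (sq_nonneg t) ht
  rw [legP_three.2.1, lam, abs_le]
  norm_num
  constructor <;> linarith

lemma cert_three_10 {t : ℝ} (ht : t ^ 2 ≤ 1) : |((3 : ℕ) - 1) * (legP 3 10).eval t -
    ((3 : ℕ) - 1) ^ 2 / lam 3 10 * (t * (legP 3 10).derivative.eval t)| ≤ 1 := by
  have h1 := poly_lower_10 (sq_nonneg t) ht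
  have h2 := poly_upper_10 (sq_nonneg t) ht
  rw [legP_three.2.2, lam, abs_le]
  norm_num
  constructor <;> linarith

lemma tail_three {t : ℝ} (ht : t ^ 2 ≤ 1) :
    0 ≤ 1 - ((3 : ℕ) - 1) * tailm 3 6 (t ^ 2) + t ^ 2 * (2 / 5 + t ^ 2 / 5 + 2 / 5 * t ^ 4) -
      (1 - t ^ 2) * (2 / 5 + 3 * t ^ 2 / 5 + 5 * (2 / 5) * t ^ 4) := by
  have h := mul_nonneg (sub_nonneg.2 ht) (poly_tail_nonneg (sq_nonneg t) ht)
  refine le_of_le_of_eq h ?_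
  simp [tailm, Finset.sum_range_succ, mom, Nat.choose]
  ring

lemma tail_four (hn : 4 ≤ n) {t : ℝ} (ht : t ^ 2 ≤ 1) :
    0 ≤ 1 - (n - 1) * tailm n 3 (t ^ 2) + (n - 2) * (t ^ 2 * (2 / 5 + 3 * t ^ 2 / 5)) -
      (1 - t ^ 2) * (2 / 5 + 9 * t ^ 2 / 5) := by
  have hn' : (4 : ℝ) ≤ n := by exact_mod_cast hn
  have hcast : ((n - 1 : ℕ) : ℝ) = n - 1 := by push_cast [show 1 ≤ n by omega]; ring
  have hp1 : (n : ℝ) - 1 ≠ 0 := by linarith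
  have hp2 : (n : ℝ) + 1 ≠ 0 := by linarith
  have hp3 : (n : ℝ) + 3 ≠ 0 := by linarith
  obtain ⟨x, hx⟩ : ∃ x, x = t ^ 2 := ⟨_, rfl⟩
  have hx0 : 0 ≤ x := by rw [hx]; positivity
  have ht4 : t ^ 4 = x ^ 2 := by rw [hx]; ring
  rw [← hx] at ht ⊢
  have hq : 0 ≤ (3 * n ^ 2 + 12 * n - 66) / 5 + (2 * n ^ 3 - 71 * n - 9) / 5 * x + (n ^ 3 - 4 * n) * x ^ 2 := by
    rcases hn.eq_or_lt with h | h
    · rw [← h]; norm_num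
      nlinarith [sq_nonneg (96 * x - 33)]
    · have h5 : (5 : ℝ) ≤ n := by exact_mod_cast h
      obtain ⟨s, hs⟩ : ∃ s : ℝ, s = n - 5 := ⟨_, rfl⟩
      have hs0 : 0 ≤ s := by linarith
      have hns : (n : ℝ) = s + 5 := by linarith
      obtain ⟨y, hy⟩ : ∃ y : ℝ, y = 1 - x := ⟨_, rfl⟩
      have hy0 : 0 ≤ y := by linarith
      refine le_of_le_of_eq (b := (3 * s ^ 2 + 42 * s + 69) / 5 * y ^ 2 +
        (2 * s ^ 3 + 36 * s ^ 2 + 163 * s + 24) / 5 * (x * y) +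
        (7 * s ^ 3 + 108 * s ^ 2 + 476 * s + 480) / 5 * x ^ 2) (by positivity) ?_
      rw [hns, hy]; ring
  have h := mul_nonneg (sub_nonneg.2 ht) hq
  have hpos : (0 : ℝ) < (n + 1) * (n + 3) := by positivity
  refine nonneg_of_mul_nonneg_right (le_of_le_of_eq h ?_) hpos
  have h' : (n : ℝ) - 1 + 2 ≠ 0 := by linarith
  have h'' : (n : ℝ) - 1 + 4 ≠ 0 := by linarith
  have h1' : (n : ℝ) - 1 + 2 = n + 1 := by ring
  have h1'' : (n : ℝ) - 1 + 2 * 2 = n + 3 := by ring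
  simp [tailm, Finset.sum_range_succ, mom, Nat.choose, hcast, h1', h1'']
  field_simp
  ring

lemma continuous_tailm (r : ℕ) : Continuous (tailm n r) := by
  unfold tailm
  fun_prop

/-- The multipliers of even degree of the trace of the Hessian of a convex function. -/
theorem abs_integral_legP_le (hn : 3 ≤ n) {e : En n} (he : ‖e‖ = 1) {h : HF n}
    (hh : ∀ (u : Sph n) w, 0 ≤ ⟪hess h u w, w⟫_ℝ) {k : ℕ} (hk : k ≠ 0) (hke : Even k) :
    (n - 1) * |∫ u : Sph n, trc (hess h u) * (legP n k).eval ⟪e, u⟫_ℝ ∂sg n| ≤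
      ∫ u : Sph n, trc (hess h u) ∂sg n := by
  rcases (show k = 2 ∨ k = 4 ∨ 6 ≤ k by obtain ⟨r, rfl⟩ := hke; omega) with rfl | rfl | h6
  · exact abs_integral_legP_le_of_cert hn he hh hk fun t ht => cert_two hn ht
  · exact abs_integral_legP_le_of_cert hn he hh hk fun t ht => cert_four hn ht
  rcases hn.eq_or_lt with rfl | h4
  · rcases (show k = 6 ∨ k = 8 ∨ k = 10 ∨ 2 * 6 ≤ k by obtain ⟨r, rfl⟩ := hke; omega) with
      rfl | rfl | rfl | h12
    · exact abs_integral_legP_le_of_cert hn he hh hk fun t ht => cert_three_6 ht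
    · exact abs_integral_legP_le_of_cert hn he hh hk fun t ht => cert_three_8 ht
    · exact abs_integral_legP_le_of_cert hn he hh hk fun t ht => cert_three_10 ht
    · refine abs_integral_legP_le_of_tail hn he hh h12 (continuous_tailm 6)
        (C (-1 / 5 : ℝ) * X ^ 2 + C (-1 / 20 : ℝ) * X ^ 4 + C (-1 / 15 : ℝ) * X ^ 6)
        (fun t ht => ?_) (fun t ht => ?_)
      · have := tail_three ht
        have h0 : 0 ≤ (1 - t ^ 2) * (2 / 5 + 3 * t ^ 2 / 5 + 5 * (2 / 5) * t ^ 4) :=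
          mul_nonneg (sub_nonneg.2 ht) (by positivity)
        simp at this ⊢
        linarith
      · refine le_of_le_of_eq (tail_three ht) ?_
        simp
        ring
  · refine abs_integral_legP_le_of_tail hn he hh (r := 3) h6 (continuous_tailm 3)
        (C (-1 / 5 : ℝ) * X ^ 2 + C (-3 / 20 : ℝ) * X ^ 4)
        (fun t ht => ?_) (fun t ht => ?_)
    · have := tail_four h4 ht
      have h0 : 0 ≤ (1 - t ^ 2) * (2 / 5 + 9 * t ^ 2 / 5) :=
          mul_nonneg (sub_nonneg.2 ht) (by positivity)
      simp at this ⊢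
      linarith
    · refine le_of_le_of_eq (tail_four h4 ht) ?_
      simp
      ring

end LegendreThree

section Reflection

/-- The reflection in the hyperplane orthogonal to `w` (the identity if `w = 0`). -/
def rfn (w : En n) : En n →L[ℝ] En n := ContinuousLinearMap.id ℝ (En n) - (2 * (‖w‖ ^ 2)⁻¹) • rk w w

lemma rfn_apply (w x : En n) : rfn w x = x - (2 * (‖w‖ ^ 2)⁻¹ * ⟪w, x⟫_ℝ) • w := by
  simp [rfn, smul_smul]

lemma inner_rfn (w x y : En n) : ⟪rfn w x, y⟫_ℝ = ⟪x, rfn w y⟫_ℝ := by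
  simp only [rfn_apply, inner_sub_left, inner_sub_right, real_inner_smul_left, real_inner_smul_right]
  rw [real_inner_comm w x]; ring

lemma rfn_rfn (w x : En n) : rfn w (rfn w x) = x := by
  by_cases hw : w = 0
  · subst hw; simp [rfn_apply]
  have : ‖w‖ ^ 2 ≠ 0 := by positivity
  simp only [rfn_apply, inner_sub_right, real_inner_smul_right, real_inner_self_eq_norm_sq]
  rw [sub_sub, ← add_smul, sub_eq_self, smul_eq_zero]
  left
  field_simp
  ring

lemma inner_rfn_rfn (w x y : En n) : ⟪rfn w x, rfn w y⟫_ℝ = ⟪x, y⟫_ℝ := by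
  rw [inner_rfn, rfn_rfn]

lemma norm_rfn (w x : En n) : ‖rfn w x‖ = ‖x‖ := by
  have h := inner_rfn_rfn w x x
  rw [real_inner_self_eq_norm_sq, real_inner_self_eq_norm_sq] at h
  exact (sq_eq_sq₀ (norm_nonneg _) (norm_nonneg _)).1 h

lemma norm_rfn_le (w : En n) : ‖rfn w‖ ≤ 1 :=
  ContinuousLinearMap.opNorm_le_bound _ zero_le_one fun x => by rw [norm_rfn, one_mul]

lemma rfn_sub {x y : En n} (h : ‖x‖ = ‖y‖) : rfn (x - y) x = y := by
  by_cases hw : x - y = 0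
  · rw [hw]; simp [rfn_apply, sub_eq_zero.1 hw]
  have h0 : ‖x - y‖ ^ 2 ≠ 0 := by positivity
  have h1 : 2 * ⟪x - y, x⟫_ℝ = ‖x - y‖ ^ 2 := by
    rw [norm_sub_sq_real, inner_sub_left, real_inner_self_eq_norm_sq, real_inner_comm, h]
    ring
  rw [rfn_apply, show 2 * (‖x - y‖ ^ 2)⁻¹ * ⟪x - y, x⟫_ℝ = 1 by
    rw [mul_right_comm, h1, mul_inv_cancel₀ h0]]
  simp

/-- The reflection as a linear isometry equivalence. -/
def rfnE (w : En n) : En n ≃ₗᵢ[ℝ] En n where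
  toLinearEquiv := LinearEquiv.ofInvolutive (rfn w : En n →ₗ[ℝ] En n) (rfn_rfn w)
  norm_map' := norm_rfn w

lemma integral_isometry (hn : 0 < n) (L : En n ≃ₗᵢ[ℝ] En n) (F : En n → ℝ) :
    ∫ u : Sph n, F (L u) ∂sg n = ∫ u : Sph n, F u ∂sg n := by
  set φ : ℝ → ℝ := (Set.Icc 0 1).indicator 1
  have hc : ∫ r in Set.Ioi (0 : ℝ), r ^ (n - 1) * φ r = (n : ℝ)⁻¹ := by
    have : ∀ r : ℝ, r ^ (n - 1) * φ r = (Set.Icc 0 1).indicator (fun r : ℝ => r ^ (n - 1)) r := by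
      intro r
      by_cases hr : r ∈ Set.Icc (0 : ℝ) 1 <;> simp [φ, hr]
    simp_rw [this]
    rw [setIntegral_indicator measurableSet_Icc]
    have : Set.Ioi (0 : ℝ) ∩ Set.Icc 0 1 = Set.Ioc 0 1 := by
      ext r; simp only [Set.mem_inter_iff, Set.mem_Ioi, Set.mem_Icc, Set.mem_Ioc]
      constructor
      · rintro ⟨h, -, h'⟩; exact ⟨h, h'⟩
      · rintro ⟨h, h'⟩; exact ⟨h, h.le, h'⟩
    rw [this, ← intervalIntegral.integral_of_le zero_le_one, integral_pow]
    have : n - 1 + 1 = n := by omega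
    rw [this]
    simp [hn.ne']
    rw [← Nat.cast_add_one, this]
  have h1 := integral_polar hn φ (fun x => F (L x))
  have h2 := integral_polar hn φ F
  rw [hc] at h1 h2
  have h3 : ∫ x : En n, φ ‖x‖ * F (L (‖x‖⁻¹ • x)) = ∫ x : En n, φ ‖x‖ * F (‖x‖⁻¹ • x) := by
    rw [← L.measurePreserving.integral_comp L.toHomeomorph.measurableEmbedding
      (fun x => φ ‖x‖ * F (‖x‖⁻¹ • x))]
    simp
  rw [h1, h2] at h3
  have h0 : (n : ℝ)⁻¹ ≠ 0 := by positivity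
  rw [integral_sg, integral_sg, mul_right_cancel₀ h0 h3]

lemma integral_rfn (hn : 0 < n) (w : En n) (F : En n → ℝ) :
    ∫ u : Sph n, F (rfn w u) ∂sg n = ∫ u : Sph n, F u ∂sg n :=
  integral_isometry hn (rfnE w) F

lemma integral_neg_sph (hn : 0 < n) (F : En n → ℝ) :
    ∫ u : Sph n, F (-u) ∂sg n = ∫ u : Sph n, F u ∂sg n :=
  integral_isometry hn (LinearIsometryEquiv.neg ℝ) F

lemma norm_pole (hn : 0 < n) : ‖pole n‖ = 1 := by simp [pole, hn]

/-- The reflection interchanging `v` with the pole. -/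
def rp (v : En n) : En n →L[ℝ] En n := rfn (v - pole n)

lemma rp_self (hn : 0 < n) (v : Sph n) : rp (v : En n) v = pole n :=
  rfn_sub (by rw [Sph.norm, norm_pole hn])

lemma inner_rp_pole (hn : 0 < n) (v : Sph n) (x : En n) :
    ⟪rp (v : En n) x, pole n⟫_ℝ = ⟪x, v⟫_ℝ := by
  rw [← rp_self hn v, rp, inner_rfn_rfn]

lemma measurable_rp : Measurable fun v : Sph n => rp (v : En n) := by
  have hc : Continuous fun v : Sph n => (v : En n) - pole n := by fun_prop
  have h1 : Measurable fun v : Sph n => 2 * (‖(v : En n) - pole n‖ ^ 2)⁻¹ :=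
    ((hc.norm.pow 2).measurable.inv).const_mul 2
  have h2 : Measurable fun v : Sph n => rk ((v : En n) - pole n) ((v : En n) - pole n) :=
    (continuous_rk hc hc).measurable
  exact measurable_const.sub (h1.smul h2)

lemma integral_inner_const (hn : 0 < n) {e e' : En n} (he : ‖e‖ = ‖e'‖) (F : ℝ → ℝ) :
    ∫ u : Sph n, F ⟪e, u⟫_ℝ ∂sg n = ∫ u : Sph n, F ⟪e', u⟫_ℝ ∂sg n := by
  rw [← integral_rfn hn (e - e') (fun x => F ⟪e', x⟫_ℝ)]
  refine integral_congr_all fun u => ?_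
  have h := inner_rfn_rfn (e - e') e u
  rw [rfn_sub he] at h
  simp only [h]

end Reflection

section Convolution

lemma contDiffOn_two_of {f : En n → ℝ} {g : En n → En n} {H : En n → En n →L[ℝ] En n}
    (h1 : ∀ x ≠ 0, HasFDerivAt f (innerSL ℝ (g x)) x) (h2 : ∀ x ≠ 0, HasFDerivAt g (H x) x)
    (h3 : ContinuousOn H {0}ᶜ) : ContDiffOn ℝ 2 f {0}ᶜ := by
  have hg : ContDiffOn ℝ 1 g {0}ᶜ := by
    rw [show (1 : WithTop ℕ∞) = 0 + 1 by simp, contDiffOn_succ_iff_fderiv_of_isOpen isOpen_compl_zero]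
    refine ⟨fun x hx => (h2 x hx).differentiableAt.differentiableWithinAt, by simp, ?_⟩
    rw [contDiffOn_zero]
    exact h3.congr fun x hx => (h2 x hx).fderiv
  rw [show (2 : WithTop ℕ∞) = 1 + 1 by norm_num, contDiffOn_succ_iff_fderiv_of_isOpen isOpen_compl_zero]
  refine ⟨fun x hx => (h1 x hx).differentiableAt.differentiableWithinAt, by simp, ?_⟩
  exact ((innerSL ℝ (E := En n)).contDiff.comp_contDiffOn hg).congr fun x hx => (h1 x hx).fderiv

lemma HF.map_zero (f : HF n) : f (0 : En n) = 0 := by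
  have h := f.homog (two_pos (α := ℝ)) (0 : En n)
  rw [smul_zero] at h
  linarith

lemma HF.exists_bound (f : HF n) : ∃ C : ℝ, 0 ≤ C ∧ (∀ x, |f x| ≤ C * ‖x‖) ∧
    (∀ x ≠ 0, ‖gradient f x‖ ≤ C) ∧ (∀ x ≠ 0, ‖hess f x‖ ≤ C * ‖x‖⁻¹) := by
  obtain ⟨C1, h1⟩ := isCompact_univ.exists_bound_of_continuousOn f.continuous_sph.continuousOn
  obtain ⟨C2, h2⟩ := isCompact_univ.exists_bound_of_continuousOn f.continuous_gradient_sph.continuousOn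
  obtain ⟨C3, h3⟩ := isCompact_univ.exists_bound_of_continuousOn f.continuous_hess_sph.continuousOn
  refine ⟨max 0 (max C1 (max C2 C3)), le_max_left _ _, fun x => ?_, fun x hx => ?_, fun x hx => ?_⟩
  all_goals
    rcases eq_or_ne x 0 with rfl | hx'
  · simp [f.map_zero]
  · have hx0 := norm_pos_iff.2 hx'
    have hu := norm_normalize hx0
    have := h1 ⟨‖x‖⁻¹ • x, by simpa using hu⟩ trivial
    simp only at this
    rw [f.homog (inv_pos.2 hx0), norm_mul, norm_inv, norm_norm, inv_mul_le_iff₀ hx0, mul_comm] at this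
    exact this.trans (mul_le_mul_of_nonneg_right (by simp) hx0.le)
  · exact absurd rfl hx
  · have hx0 := norm_pos_iff.2 hx'
    have hu := norm_normalize hx0
    have := h2 ⟨‖x‖⁻¹ • x, by simpa using hu⟩ trivial
    simp only at this
    rw [f.gradient_smul_arg (inv_pos.2 hx0) hx] at this
    exact this.trans (by simp)
  · exact absurd rfl hx
  · have hx0 := norm_pos_iff.2 hx'
    have hu := norm_normalize hx0
    have := h3 ⟨‖x‖⁻¹ • x, by simpa using hu⟩ trivial
    simp only at this
    rw [f.hess_smul_arg (inv_pos.2 hx0) hx, inv_inv, norm_smul, norm_norm, mul_comm,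
      ← le_div_iff₀ hx0] at this
    exact this.trans (mul_le_mul_of_nonneg_right (by simp) (inv_nonneg.2 hx0.le))

lemma HF.measurable (f : HF n) : Measurable f :=
  measurable_of_continuousOn_compl_singleton 0 f.contDiffOn.continuousOn

lemma HF.measurable_gradient (f : HF n) : Measurable (gradient f) :=
  measurable_of_continuousOn_compl_singleton 0 (continuousOn_gradient f.contDiffOn)

lemma HF.measurable_hess (f : HF n) : Measurable (hess f) :=
  measurable_of_continuousOn_compl_singleton 0 (continuousOn_hess f.contDiffOn)

lemma measurable_rp_apply (x : En n) : Measurable fun v : Sph n => rp (v : En n) x :=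
  measurable_rp.apply_continuousLinearMap x

lemma norm_rp (v x : En n) : ‖rp v x‖ = ‖x‖ := norm_rfn _ _
lemma rp_rp (v x : En n) : rp v (rp v x) = x := rfn_rfn _ _
lemma inner_rp (v x y : En n) : ⟪rp v x, y⟫_ℝ = ⟪x, rp v y⟫_ℝ := inner_rfn _ _ _

lemma rp_ne_zero (v : En n) {x : En n} (hx : x ≠ 0) : rp v x ≠ 0 := by
  rw [← norm_pos_iff, norm_rp]; exact norm_pos_iff.2 hx

lemma norm_rp_le (v : En n) : ‖rp v‖ ≤ 1 := norm_rfn_le _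

variable (φ : HF n) (s : Sph n → ℝ)

/-- The gradient of the convolution kernel. -/
def kerG (v : Sph n) (x : En n) : En n := s v • rp (v : En n) (gradient φ (rp (v : En n) x))

/-- The Hessian of the convolution kernel. -/
def kerH (v : Sph n) (x : En n) : En n →L[ℝ] En n :=
  s v • ((rp (v : En n)).comp ((hess φ (rp (v : En n) x)).comp (rp (v : En n))))

lemma hasFDerivAt_ker (v : Sph n) {x : En n} (hx : x ≠ 0) :
    HasFDerivAt (fun x => φ (rp (v : En n) x) * s v) (innerSL ℝ (kerG φ s v x)) x := by
  have h1 : HasFDerivAt φ _ (rp (v : En n) x) := hasFDerivAt_HF φ (rp_ne_zero (v : En n) hx)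
  have h2 : HasFDerivAt (fun x => rp (v : En n) x) (rp (v : En n)) x := (rp (v : En n)).hasFDerivAt
  have h := (h1.comp x h2).mul_const (s v)
  refine h.congr_fderiv ?_
  ext w
  simp [kerG, inner_rp]

lemma hasFDerivAt_kerG (v : Sph n) {x : En n} (hx : x ≠ 0) :
    HasFDerivAt (kerG φ s v) (kerH φ s v x) x := by
  have h1 : HasFDerivAt (gradient φ) _ (rp (v : En n) x) :=
    φ.hasFDerivAt_gradient (rp_ne_zero (v : En n) hx)
  have h2 : HasFDerivAt (fun x => rp (v : En n) x) (rp (v : En n)) x := (rp (v : En n)).hasFDerivAt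
  have h3 : HasFDerivAt (fun y => rp (v : En n) y) (rp (v : En n))
    (gradient φ (rp (v : En n) x)) := (rp (v : En n)).hasFDerivAt
  exact (h3.comp x (h1.comp x h2)).const_smul (s v)

lemma measurable_clm_apply {f : Sph n → En n →L[ℝ] En n} {g : Sph n → En n} (hf : Measurable f)
    (hg : Measurable g) : Measurable fun v => f v (g v) :=
  (isBoundedBilinearMap_apply (𝕜 := ℝ) (E := En n) (F := En n)).continuous.measurable.comp
    (hf.prodMk hg)

lemma measurable_clm_comp {f g : Sph n → En n →L[ℝ] En n} (hf : Measurable f)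
    (hg : Measurable g) : Measurable fun v => (f v).comp (g v) :=
  (isBoundedBilinearMap_comp (𝕜 := ℝ) (E := En n) (F := En n) (G := En n)).continuous.measurable.comp
    (hf.prodMk hg)

lemma measurable_kerG (hs : Continuous s) (x : En n) : Measurable fun v => kerG φ s v x := by
  have h1 : Measurable fun v : Sph n => gradient φ (rp (v : En n) x) :=
    φ.measurable_gradient.comp (measurable_rp_apply x)
  exact hs.measurable.smul (measurable_clm_apply measurable_rp h1)

lemma measurable_kerH (hs : Continuous s) (x : En n) : Measurable fun v => kerH φ s v x := by
  have h1 : Measurable fun v : Sph n => hess φ (rp (v : En n) x) :=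
    φ.measurable_hess.comp (measurable_rp_apply x)
  exact hs.measurable.smul (measurable_clm_comp measurable_rp (measurable_clm_comp h1 measurable_rp))

variable {φ s} in
lemma norm_kerG_le {C M : ℝ} (hM : ∀ v, |s v| ≤ M) (hC : ∀ x ≠ 0, ‖gradient φ x‖ ≤ C)
    (v : Sph n) {x : En n} (hx : x ≠ 0) : ‖kerG φ s v x‖ ≤ M * C := by
  rw [kerG, norm_smul, norm_rp]
  exact mul_le_mul (hM v) (hC _ (rp_ne_zero _ hx)) (norm_nonneg _) ((abs_nonneg _).trans (hM v))

variable {φ s} in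
lemma norm_kerH_le {C M : ℝ} (hM : ∀ v, |s v| ≤ M) (hC : ∀ x ≠ 0, ‖hess φ x‖ ≤ C * ‖x‖⁻¹)
    (v : Sph n) {x : En n} (hx : x ≠ 0) : ‖kerH φ s v x‖ ≤ M * (C * ‖x‖⁻¹) := by
  rw [kerH, norm_smul]
  refine mul_le_mul (hM v) ?_ (norm_nonneg _) ((abs_nonneg _).trans (hM v))
  have h := hC _ (rp_ne_zero (v : En n) hx)
  rw [norm_rp] at h
  refine (ContinuousLinearMap.opNorm_comp_le _ _).trans ?_
  refine (mul_le_of_le_one_left (norm_nonneg _) (norm_rp_le _)).trans ?_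
  refine (ContinuousLinearMap.opNorm_comp_le _ _).trans ?_
  exact (mul_le_of_le_one_right (norm_nonneg _) (norm_rp_le _)).trans h

lemma exists_sph_bound {s : Sph n → ℝ} (hs : Continuous s) : ∃ M, 0 ≤ M ∧ ∀ v, |s v| ≤ M := by
  obtain ⟨C1, h1⟩ := isCompact_univ.exists_bound_of_continuousOn hs.continuousOn
  exact ⟨max 0 C1, le_max_left _ _, fun v => (h1 v trivial).trans (le_max_right _ _)⟩

lemma half_norm_le {x y : En n} (hy : y ∈ ball x (‖x‖ / 2)) : ‖x‖ / 2 ≤ ‖y‖ := by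
  rw [mem_ball, dist_eq_norm] at hy
  have := norm_sub_norm_le x (x - y)
  rw [sub_sub_cancel, norm_sub_rev] at this
  linarith

lemma integrable_ker (hs : Continuous s) (x : En n) :
    Integrable (fun v : Sph n => φ (rp (v : En n) x) * s v) (sg n) := by
  obtain ⟨M, hM0, hM⟩ := exists_sph_bound hs
  obtain ⟨C, hC0, hC, -, -⟩ := φ.exists_bound
  refine Integrable.of_bound (C := C * ‖x‖ * M)
    ((φ.measurable.comp (measurable_rp_apply x)).mul hs.measurable).aestronglyMeasurable
    (Eventually.of_forall fun v => ?_)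
  rw [norm_mul]
  have := hC (rp (v : En n) x)
  rw [norm_rp] at this
  exact mul_le_mul this (hM v) (abs_nonneg _) (by positivity)

lemma hasFDerivAt_cvl (hs : Continuous s) {x : En n} (hx : x ≠ 0) :
    HasFDerivAt (fun x => ∫ v : Sph n, φ (rp (v : En n) x) * s v ∂sg n)
      (innerSL ℝ (∫ v, kerG φ s v x ∂sg n)) x := by
  obtain ⟨M, hM0, hM⟩ := exists_sph_bound hs
  obtain ⟨C, hC0, -, hC, -⟩ := φ.exists_bound
  have hx0 := norm_pos_iff.2 hx
  have hm : ∀ y, Measurable fun v => innerSL ℝ (kerG φ s v y) := fun y =>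
    (innerSL ℝ (E := En n)).continuous.measurable.comp (measurable_kerG φ s hs y)
  have hi : Integrable (fun v => kerG φ s v x) (sg n) :=
    Integrable.of_bound (C := M * C) (measurable_kerG φ s hs x).aestronglyMeasurable
      (Eventually.of_forall fun v => norm_kerG_le hM hC v hx)
  have key := hasFDerivAt_integral_of_dominated_of_fderiv_le (𝕜 := ℝ) (μ := sg n)
    (F := fun (x : En n) (v : Sph n) => φ (rp (v : En n) x) * s v)
    (F' := fun x v => innerSL ℝ (kerG φ s v x)) (x₀ := x) (bound := fun _ => M * C)
    (ball_mem_nhds x (half_pos hx0))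
    (Eventually.of_forall fun y => (integrable_ker φ s hs y).1) (integrable_ker φ s hs x)
    (hm x).aestronglyMeasurable
    (Eventually.of_forall fun v y hy => by
      rw [innerSL_apply_norm]
      exact norm_kerG_le hM hC v (norm_pos_iff.1 ((half_pos hx0).trans_le (half_norm_le hy))))
    (integrable_const _)
    (Eventually.of_forall fun v y hy => hasFDerivAt_ker φ s v
      (norm_pos_iff.1 ((half_pos hx0).trans_le (half_norm_le hy))))
  rwa [ContinuousLinearMap.integral_comp_comm _ hi] at key

lemma integrable_kerH (hs : Continuous s) {x : En n} (hx : x ≠ 0) :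
    Integrable (fun v => kerH φ s v x) (sg n) := by
  obtain ⟨M, hM0, hM⟩ := exists_sph_bound hs
  obtain ⟨C, hC0, -, -, hC⟩ := φ.exists_bound
  exact Integrable.of_bound (C := M * (C * ‖x‖⁻¹)) (measurable_kerH φ s hs x).aestronglyMeasurable
      (Eventually.of_forall fun v => norm_kerH_le hM hC v hx)

lemma hasFDerivAt_cvlG (hs : Continuous s) {x : En n} (hx : x ≠ 0) :
    HasFDerivAt (fun x => ∫ v, kerG φ s v x ∂sg n) (∫ v, kerH φ s v x ∂sg n) x := by
  obtain ⟨M, hM0, hM⟩ := exists_sph_bound hs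
  obtain ⟨C, hC0, -, hC1, hC⟩ := φ.exists_bound
  have hx0 := norm_pos_iff.2 hx
  have hi : Integrable (fun v => kerG φ s v x) (sg n) :=
    Integrable.of_bound (C := M * C) (measurable_kerG φ s hs x).aestronglyMeasurable
      (Eventually.of_forall fun v => norm_kerG_le hM hC1 v hx)
  refine hasFDerivAt_integral_of_dominated_of_fderiv_le (𝕜 := ℝ) (μ := sg n)
    (F := fun (x : En n) (v : Sph n) => kerG φ s v x)
    (F' := fun x v => kerH φ s v x) (x₀ := x) (bound := fun _ => M * (C * (‖x‖ / 2)⁻¹))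
    (ball_mem_nhds x (half_pos hx0))
    (Eventually.of_forall fun y => (measurable_kerG φ s hs y).aestronglyMeasurable) hi
    (measurable_kerH φ s hs x).aestronglyMeasurable
    (Eventually.of_forall fun v y hy => ?_)
    (integrable_const _)
    (Eventually.of_forall fun v y hy => hasFDerivAt_kerG φ s v
      (norm_pos_iff.1 ((half_pos hx0).trans_le (half_norm_le hy))))
  have h := half_norm_le hy
  refine (norm_kerH_le hM hC v (norm_pos_iff.1 ((half_pos hx0).trans_le h))).trans ?_
  gcongr

lemma continuousOn_cvlH (hs : Continuous s) :
    ContinuousOn (fun x => ∫ v, kerH φ s v x ∂sg n) {0}ᶜ := by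
  intro x hx
  refine ContinuousAt.continuousWithinAt ?_
  obtain ⟨M, hM0, hM⟩ := exists_sph_bound hs
  obtain ⟨C, hC0, -, hC1, hC⟩ := φ.exists_bound
  have hx0 : 0 < ‖x‖ := norm_pos_iff.2 hx
  refine continuousAt_of_dominated (bound := fun _ => M * (C * (‖x‖ / 2)⁻¹))
    (Eventually.of_forall fun y => (measurable_kerH φ s hs y).aestronglyMeasurable)
    ?_ (integrable_const _) (Eventually.of_forall fun v => ?_)
  · filter_upwards [ball_mem_nhds x (half_pos hx0)] with y hy
    refine Eventually.of_forall fun v => ?_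
    have h := half_norm_le hy
    refine (norm_kerH_le hM hC v (norm_pos_iff.1 ((half_pos hx0).trans_le h))).trans ?_
    gcongr
  · have h1 : ContinuousAt (fun y => hess φ (rp (v : En n) y)) x :=
      ContinuousAt.comp (g := hess φ) ((continuousOn_hess φ.contDiffOn).continuousAt
        (isOpen_compl_zero.mem_nhds (rp_ne_zero (v : En n) hx))) (rp (v : En n)).continuous.continuousAt
    exact (continuousAt_const.clm_comp (h1.clm_comp continuousAt_const)).const_smul (s v)

/-- The spherical convolution of `s` with (the profile of) `φ`. -/
def cvl (hs : Continuous s) : HF n :=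
  ⟨fun x => ∫ v : Sph n, φ (rp (v : En n) x) * s v ∂sg n,
    contDiffOn_two_of (fun _ hx => hasFDerivAt_cvl φ s hs hx) (fun _ hx => hasFDerivAt_cvlG φ s hs hx)
      (continuousOn_cvlH φ s hs), fun c hc x => by
        rw [← integral_const_mul]
        refine integral_congr_all fun v => ?_
        simp only [map_smul, φ.homog hc, mul_assoc]⟩

lemma cvl_apply (hs : Continuous s) (x : En n) :
    cvl φ s hs x = ∫ v : Sph n, φ (rp (v : En n) x) * s v ∂sg n := rfl

lemma gradient_cvl (hs : Continuous s) {x : En n} (hx : x ≠ 0) :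
    gradient (cvl φ s hs) x = ∫ v, kerG φ s v x ∂sg n :=
  gradient_of_hasFDerivAt (hasFDerivAt_cvl φ s hs hx)

lemma hess_cvl (hs : Continuous s) {x : En n} (hx : x ≠ 0) :
    hess (cvl φ s hs) x = ∫ v, kerH φ s v x ∂sg n := by
  refine (HasFDerivAt.congr_of_eventuallyEq (hasFDerivAt_cvlG φ s hs hx) ?_).fderiv
  filter_upwards [isOpen_compl_zero.mem_nhds hx] with y hy using gradient_cvl φ s hs hy

end Convolution

section Convolution

lemma trc_comm (A B : En n →L[ℝ] En n) : trc (A.comp B) = trc (B.comp A) := by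
  have h : ∀ A B : En n →L[ℝ] En n, trc (A.comp B) =
      ∑ j, ∑ k, B (EuclideanSpace.single j 1) k * A (EuclideanSpace.single k 1) j := by
    intro A B
    refine Finset.sum_congr rfl fun j _ => ?_
    have h1 : ∀ x : En n, x = ∑ k, x k • EuclideanSpace.single k (1 : ℝ) := fun x => by
      ext l; simp [Pi.single_apply]
    rw [ContinuousLinearMap.comp_apply, congrArg A (h1 (B (EuclideanSpace.single j 1))), map_sum]
    simp
  rw [h, h, Finset.sum_comm]
  simp only [mul_comm]

/-- The trace as a continuous linear functional. -/
def trcL (n : ℕ) : (En n →L[ℝ] En n) →L[ℝ] ℝ := ⟨⟨⟨trc, trc_add⟩, trc_smul⟩, continuous_trc⟩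

@[simp] lemma trcL_apply (A : En n →L[ℝ] En n) : trcL n A = trc A := rfl

lemma trc_kerH (φ : HF n) (s : Sph n → ℝ) (v : Sph n) (x : En n) :
    trc (kerH φ s v x) = s v * trc (hess φ (rp (v : En n) x)) := by
  have h : (rp (v : En n)).comp (rp (v : En n)) = ContinuousLinearMap.id ℝ (En n) := by
    ext1 x; exact rp_rp _ x
  rw [kerH, trc_smul, trc_comm, ContinuousLinearMap.comp_assoc, h, ContinuousLinearMap.comp_id]

variable (φ : HF n) {s : Sph n → ℝ}

lemma bx_cvl (hs : Continuous s) (u : Sph n) :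
    bx (cvl φ s hs) u = ∫ v : Sph n, bx φ (rp (v : En n) u) * s v ∂sg n := by
  rw [bx, hess_cvl φ s hs (Sph.ne_zero u), ← trcL_apply,
    ← ContinuousLinearMap.integral_comp_comm _ (integrable_kerH φ s hs (Sph.ne_zero u)),
    ← integral_const_mul]
  refine integral_congr_all fun v => ?_
  simp only [trcL_apply, trc_kerH, bx]
  ring

/-- The reflected point on the sphere. -/
def rps (v u : Sph n) : Sph n := ⟨rp (v : En n) u, by
  rw [mem_sphere_zero_iff_norm, norm_rp, Sph.norm]⟩

@[simp] lemma rps_coe (v u : Sph n) : (rps v u : En n) = rp (v : En n) u := rfl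

/-- The composition of a function with a reflection. -/
def crf (f : HF n) (v : Sph n) : HF n :=
  ⟨fun x => f (rp (v : En n) x), f.contDiffOn.comp (rp (v : En n)).contDiff.contDiffOn
    (fun x hx => rp_ne_zero _ hx), fun c hc x => by
      simp only [map_smul, f.homog hc]⟩

lemma crf_apply (f : HF n) (v : Sph n) (x : En n) : crf f v x = f (rp (v : En n) x) := rfl

lemma gradient_crf (f : HF n) (v : Sph n) {x : En n} (hx : x ≠ 0) :
    gradient (crf f v) x = kerG f 1 v x := by
  refine gradient_of_hasFDerivAt ?_
  have := hasFDerivAt_ker f 1 v hx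
  simp only [Pi.one_apply, mul_one] at this
  exact this

lemma hess_crf (f : HF n) (v : Sph n) {x : En n} (hx : x ≠ 0) :
    hess (crf f v) x = kerH f 1 v x := by
  refine (HasFDerivAt.congr_of_eventuallyEq (hasFDerivAt_kerG f 1 v hx) ?_).fderiv
  filter_upwards [isOpen_compl_zero.mem_nhds hx] with y hy using gradient_crf f v hy

lemma bx_crf (f : HF n) (u v : Sph n) : bx (crf f v) u = bx f (rp (v : En n) u) := by
  rw [bx, hess_crf f v (Sph.ne_zero u), trc_kerH, bx]; simp

lemma norm_hess_crf_le (f : HF n) {C : ℝ} (hC : ∀ x ≠ 0, ‖hess f x‖ ≤ C * ‖x‖⁻¹) (u v : Sph n) :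
    ‖hess (crf f v) u‖ ≤ C := by
  rw [hess_crf f v (Sph.ne_zero u)]
  have := norm_kerH_le (s := (1 : Sph n → ℝ)) (M := 1) (by simp) hC v (Sph.ne_zero u)
  simpa using this

/-- The function `φ` is zonal with profile `G`. -/
def Zonal (φ : HF n) (G : ℝ → ℝ) : Prop :=
  Continuous G ∧ ∀ u : Sph n, φ u = G ⟪(u : En n), pole n⟫_ℝ

variable {φ} {G : ℝ → ℝ}

lemma Zonal.ker (hn : 0 < n) (hG : Zonal φ G) (u v : Sph n) :
    φ (rp (v : En n) u) = G ⟪(u : En n), v⟫_ℝ := by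
  rw [← rps_coe, hG.2, rps_coe, inner_rp_pole hn]

lemma Zonal.ker_symm (hn : 0 < n) (hG : Zonal φ G) (u v : Sph n) :
    φ (rp (v : En n) u) = φ (rp (u : En n) v) := by
  rw [hG.ker hn, hG.ker hn, real_inner_comm]

lemma Zonal.cvl_sph (hn : 0 < n) (hG : Zonal φ G) (hs : Continuous s) (u : Sph n) :
    cvl φ s hs u = ∫ v : Sph n, G ⟪(u : En n), v⟫_ℝ * s v ∂sg n := by
  rw [cvl_apply]; simp only [hG.ker hn]

lemma Zonal.cvl_bx (hn : 2 ≤ n) (hG : Zonal φ G) (f : HF n) (u : Sph n) :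
    cvl φ (fun v => bx f v) f.continuous_bx u = ∫ v : Sph n, bx φ (rp (u : En n) v) * f v ∂sg n := by
  rw [cvl_apply]
  have h : ∀ v : Sph n, φ (rp (v : En n) u) * bx f v = crf φ u v * bx f v := fun v => by
    rw [crf_apply, hG.ker_symm (by omega)]
  simp only [h]
  rw [integral_bx_comm hn]
  refine integral_congr_all fun v => ?_
  simp only [bx_crf, mul_comm]

lemma abs_cvl_le {C M : ℝ} (hM : ∀ v, |s v| ≤ M) (hs : Continuous s) (hn : 0 < n)
    (hC : ∀ u : Sph n, |φ u| ≤ C) (u : Sph n) : |cvl φ s hs u| ≤ C * M := by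
  have := sg_isProb hn
  rw [cvl_apply, ← Real.norm_eq_abs]
  refine (norm_integral_le_of_norm_le_const (C := C * M) (Eventually.of_forall fun v => ?_)).trans (by simp)
  rw [norm_mul, Real.norm_eq_abs, Real.norm_eq_abs]
  exact mul_le_mul (hC (rps v u)) (hM v) (abs_nonneg _) ((abs_nonneg _).trans (hC u))

lemma abs_bx_cvl_le {C M : ℝ} (hM : ∀ v, |s v| ≤ M) (hs : Continuous s) (hn : 0 < n)
    (hC : ∀ u : Sph n, |bx φ u| ≤ C) (u : Sph n) : |bx (cvl φ s hs) u| ≤ C * M := by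
  have := sg_isProb hn
  rw [bx_cvl, ← Real.norm_eq_abs]
  refine (norm_integral_le_of_norm_le_const (C := C * M) (Eventually.of_forall fun v => ?_)).trans (by simp)
  rw [norm_mul, Real.norm_eq_abs, Real.norm_eq_abs]
  exact mul_le_mul (hC (rps v u)) (hM v) (abs_nonneg _) ((abs_nonneg _).trans (hC u))

lemma norm_hess_cvl_le {C M : ℝ} (hM : ∀ v, |s v| ≤ M) (hs : Continuous s) (hn : 0 < n)
    (hC : ∀ x ≠ 0, ‖hess φ x‖ ≤ C * ‖x‖⁻¹) (u : Sph n) : ‖hess (cvl φ s hs) u‖ ≤ M * C := by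
  have := sg_isProb hn
  rw [hess_cvl φ s hs (Sph.ne_zero u)]
  refine (norm_integral_le_of_norm_le_const (C := M * C) (Eventually.of_forall fun v => ?_)).trans (by simp)
  simpa using norm_kerH_le hM hC v (Sph.ne_zero u)

lemma Zonal.integral_mul_swap (hG : Zonal φ G) {s t : Sph n → ℝ} (hs : Continuous s)
    (ht : Continuous t) :
    ∫ u : Sph n, ∫ v : Sph n, G ⟪(u : En n), v⟫_ℝ * s v * t u ∂sg n ∂sg n =
    ∫ v : Sph n, ∫ u : Sph n, G ⟪(u : En n), v⟫_ℝ * s v * t u ∂sg n ∂sg n := by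
  refine integral_integral_swap ?_
  have : Continuous fun p : Sph n × Sph n => G ⟪(p.1 : En n), (p.2 : En n)⟫_ℝ * s p.2 * t p.1 :=
    ((hG.1.comp (by fun_prop)).mul (hs.comp continuous_snd)).mul (ht.comp continuous_fst)
  exact this.integrable_of_hasCompactSupport (HasCompactSupport.of_compactSpace _)

lemma Zonal.cvl_adj (hn : 0 < n) (hG : Zonal φ G) {s t : Sph n → ℝ} (hs : Continuous s)
    (ht : Continuous t) :
    ∫ u : Sph n, cvl φ s hs u * t u ∂sg n = ∫ u : Sph n, s u * cvl φ t ht u ∂sg n := by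
  simp only [hG.cvl_sph hn, ← integral_mul_const, ← integral_const_mul]
  rw [hG.integral_mul_swap hs ht]
  refine integral_congr_ae (Eventually.of_forall fun u => integral_congr_ae
    (Eventually.of_forall fun v => ?_))
  simp only
  rw [real_inner_comm]; ring

lemma Zonal.integral_row (hn : 0 < n) (hG : Zonal φ G) (v : Sph n) :
    ∫ u : Sph n, G ⟪(u : En n), v⟫_ℝ ∂sg n = ∫ u : Sph n, φ u ∂sg n := by
  rw [← integral_rfn hn ((v : En n) - pole n) φ]
  exact integral_congr_ae (Eventually.of_forall fun u => (hG.ker hn u v).symm)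

lemma Zonal.integral_cvl (hn : 0 < n) (hG : Zonal φ G) (hs : Continuous s) :
    ∫ u : Sph n, cvl φ s hs u ∂sg n = (∫ u : Sph n, φ u ∂sg n) * ∫ u, s u ∂sg n := by
  have h := hG.cvl_adj hn hs (t := fun _ => 1) continuous_const
  simp only [mul_one] at h
  rw [h, ← integral_const_mul]
  refine integral_congr_all fun u => ?_
  simp only [hG.cvl_sph hn, mul_one]
  rw [← hG.integral_row hn u, mul_comm]
  simp only [real_inner_comm]

lemma cvl_add {s t : Sph n → ℝ} (hs : Continuous s) (ht : Continuous t) :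
    cvl φ (fun v => s v + t v) (hs.add ht) = cvl φ s hs + cvl φ t ht := by
  ext x
  show cvl φ _ _ x = cvl φ s hs x + cvl φ t ht x
  simp only [cvl_apply, mul_add]
  exact integral_add (integrable_ker φ s hs x) (integrable_ker φ t ht x)

lemma Zonal.cvl_one (hn : 0 < n) (hG : Zonal φ G) (x : En n) :
    cvl φ (fun _ => 1) continuous_const x = (∫ u : Sph n, φ u ∂sg n) * ‖x‖ := by
  rcases eq_or_ne x 0 with rfl | hx
  · rw [HF.map_zero]; simp
  have hx0 := norm_pos_iff.2 hx
  have hu := norm_normalize hx0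
  have h := hG.cvl_sph hn (s := fun _ => 1) continuous_const ⟨‖x‖⁻¹ • x, by simpa using hu⟩
  simp only [mul_one] at h
  rw [HF.homog _ (inv_pos.2 hx0), inv_mul_eq_iff_eq_mul₀ hx0.ne'] at h
  rw [h, ← hG.integral_row hn ⟨‖x‖⁻¹ • x, by simpa using hu⟩, mul_comm]
  simp only [real_inner_comm]

lemma zonal_zon (q : Polynomial ℝ) : Zonal (zon (pole n) q) (fun t => q.eval t) :=
  ⟨q.continuous, fun u => by rw [zon_sph, real_inner_comm]⟩

end Convolution

section Spectral

open Polynomial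

lemma HF.ext_sph {f g : HF n} (h : ∀ u : Sph n, f u = g u) : f = g := by
  ext x
  rcases eq_or_ne x 0 with rfl | hx
  · rw [HF.map_zero, HF.map_zero]
  have hx0 := norm_pos_iff.2 hx
  have hu := norm_normalize hx0
  have h := h ⟨‖x‖⁻¹ • x, by simpa using hu⟩
  simp only at h
  rw [HF.homog _ (inv_pos.2 hx0), HF.homog _ (inv_pos.2 hx0)] at h
  exact mul_left_cancel₀ (inv_pos.2 hx0).ne' h

lemma sg_isOpenPos (hn : 0 < n) : (sg n).IsOpenPosMeasure := by
  have : Nonempty (Fin n) := ⟨⟨0, hn⟩⟩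
  refine ⟨fun U hU hU' => ?_⟩
  have h : (volume : Measure (En n)).toSphere U ≠ 0 := hU.measure_ne_zero _ hU'
  rw [sg, Measure.smul_apply, smul_eq_mul]
  exact mul_ne_zero (ENNReal.inv_ne_zero.2 (measure_ne_top _ _)) h

lemma inner_sph_le (u v : Sph n) : ⟪(u : En n), v⟫_ℝ ≤ 1 := by
  have := real_inner_le_norm (u : En n) v
  simpa [Sph.norm] using this

lemma neg_one_le_inner_sph (u v : Sph n) : -1 ≤ ⟪(u : En n), v⟫_ℝ := by
  have := neg_le_of_abs_le (abs_real_inner_le_norm (u : En n) v)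
  simpa [Sph.norm] using this

lemma inner_sph_lt (u v : Sph n) (h : v ≠ u) : ⟪(u : En n), v⟫_ℝ < 1 := by
  refine lt_of_le_of_ne (inner_sph_le u v) fun h' => h ?_
  exact Subtype.ext ((inner_eq_one_iff_of_norm_eq_one (Sph.norm u) (Sph.norm v)).1 h').symm

lemma continuous_inner_sph {G : ℝ → ℝ} (hG : Continuous G) (u : En n) :
    Continuous fun v : Sph n => G ⟪u, v⟫_ℝ :=
  hG.comp (by fun_prop)

/-- The mass of the unnormalised concentrating kernel. -/
def pkZ (n m : ℕ) : ℝ := ∫ v : Sph n, (2⁻¹ * (1 + ⟪pole n, v⟫_ℝ)) ^ m ∂sg n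

/-- Polynomial kernels concentrating at `1`. -/
def pkQ (n m : ℕ) : ℝ[X] := C (pkZ n m)⁻¹ * (C 2⁻¹ * (1 + X)) ^ m

lemma pkQ_eval (m : ℕ) (t : ℝ) : (pkQ n m).eval t = (pkZ n m)⁻¹ * (2⁻¹ * (1 + t)) ^ m := by
  simp [pkQ]

lemma pkZ_eq (hn : 0 < n) (m : ℕ) (u : Sph n) :
    ∫ v : Sph n, (2⁻¹ * (1 + ⟪(u : En n), v⟫_ℝ)) ^ m ∂sg n = pkZ n m :=
  integral_inner_const hn ((Sph.norm u).trans (norm_pole hn).symm)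
    (fun t => (2⁻¹ * (1 + t)) ^ m)

lemma tendsto_pk (hn : 0 < n) (u : Sph n) {F : Sph n → ℝ} (hF : Continuous F) :
    Tendsto (fun m => ∫ v : Sph n, (pkQ n m).eval ⟪(u : En n), v⟫_ℝ * F v ∂sg n)
      atTop (𝓝 (F u)) := by
  have := sg_isOpenPos hn
  have h := tendsto_setIntegral_pow_smul_of_unique_maximum_of_isCompact_of_continuousOn
    (μ := sg n) (s := Set.univ) (x₀ := u) (g := F) isCompact_univ
    (c := fun v : Sph n => 2⁻¹ * (1 + ⟪(u : En n), v⟫_ℝ))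
    (by fun_prop) (fun y _ hy => by
      have := inner_sph_lt u y hy
      have h1 : ⟪(u : En n), u⟫_ℝ = 1 := Sph.inner_self u
      simp only [h1]; linarith)
    (fun y _ => by have := neg_one_le_inner_sph u y; linarith)
    (by have h1 : ⟪(u : En n), u⟫_ℝ = 1 := Sph.inner_self u
        simp only [h1]; norm_num) (by simp) hF.continuousOn
  simp only [Measure.restrict_univ, pkZ_eq hn, smul_eq_mul] at h
  refine h.congr fun m => ?_
  rw [← integral_const_mul]
  refine integral_congr_all fun v => ?_
  simp only [pkQ_eval]; ring

lemma pkZ_nonneg (hn : 0 < n) (m : ℕ) : 0 ≤ pkZ n m := by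
  rw [← pkZ_eq hn m ⟨pole n, by simp [norm_pole hn]⟩]
  refine integral_nonneg fun v => pow_nonneg ?_ _
  have := neg_one_le_inner_sph ⟨pole n, by simp [norm_pole hn]⟩ v
  linarith

lemma pkQ_nonneg (hn : 0 < n) (m : ℕ) (u v : Sph n) :
    0 ≤ (pkQ n m).eval ⟪(u : En n), v⟫_ℝ := by
  rw [pkQ_eval]
  have := neg_one_le_inner_sph u v
  exact mul_nonneg (inv_nonneg.2 (pkZ_nonneg hn m)) (pow_nonneg (by linarith) _)

lemma abs_pk_le (hn : 0 < n) (m : ℕ) (u : Sph n) {F : Sph n → ℝ} (hF : Continuous F) {M : ℝ}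
    (hM : ∀ v, |F v| ≤ M) :
    |∫ v : Sph n, (pkQ n m).eval ⟪(u : En n), v⟫_ℝ * F v ∂sg n| ≤ M := by
  have hM0 : 0 ≤ M := (abs_nonneg _).trans (hM u)
  have hc := continuous_inner_sph (pkQ n m).continuous (u : En n)
  refine (abs_integral_le_integral_abs).trans ?_
  calc ∫ v : Sph n, |(pkQ n m).eval ⟪(u : En n), v⟫_ℝ * F v| ∂sg n
      ≤ ∫ v : Sph n, (pkQ n m).eval ⟪(u : En n), v⟫_ℝ * M ∂sg n := by
        refine integral_mono (integrable_sg (hc.mul hF).abs) (integrable_sg (hc.mul continuous_const))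
          fun v => ?_
        simp only
        rw [abs_mul, abs_of_nonneg (pkQ_nonneg hn m u v)]
        exact mul_le_mul_of_nonneg_left (hM v) (pkQ_nonneg hn m u v)
    _ ≤ M := by
        rw [integral_mul_const]
        refine mul_le_of_le_one_left hM0 ?_
        simp only [pkQ_eval]
        rw [integral_const_mul, pkZ_eq hn]
        exact inv_mul_le_one

lemma legP_span (hn : 3 ≤ n) (p : ℝ[X]) :
    ∃ c : ℕ →₀ ℝ, ∀ t, p.eval t = ∑ k ∈ c.support, c k * (legP n k).eval t := by
  have hn' : (3 : ℝ) ≤ n := by exact_mod_cast hn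
  set V := Submodule.span ℝ (Set.range (legP n)) with hV
  have hmem : ∀ k, legP n k ∈ V := fun k => Submodule.subset_span ⟨k, rfl⟩
  have hX : ∀ k, X * legP n k ∈ V := by
    intro k
    cases k with
    | zero => rw [legP_zero, mul_one, ← legP_one (n := n)]; exact hmem 1
    | succ k =>
      have hk : (0 : ℝ) ≤ k := k.cast_nonneg
      have h : X * legP n (k + 1) = (((2 * k + n : ℝ)⁻¹ * (k + n - 1)) • legP n (k + 2) +
          ((2 * k + n : ℝ)⁻¹ * (k + 1)) • legP n k) := by
        refine Polynomial.funext fun t => ?_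
        have h1 := legP_rec hn k t
        have h2 : (2 * k + n : ℝ) ≠ 0 := by linarith
        simp only [eval_mul, eval_X, eval_add, eval_smul, smul_eq_mul]
        rw [mul_assoc, h1]
        field_simp
        ring
      rw [h]
      exact V.add_mem (V.smul_mem _ (hmem _)) (V.smul_mem _ (hmem _))
  have hXV : ∀ q ∈ V, X * q ∈ V := by
    intro q hq
    induction hq using Submodule.span_induction with
    | mem q hq => obtain ⟨k, rfl⟩ := hq; exact hX k
    | zero => simp
    | add x y _ _ hx hy => rw [mul_add]; exact V.add_mem hx hy
    | smul a x _ hx => rw [mul_smul_comm]; exact V.smul_mem a hx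
  have hpow : ∀ k, (X ^ k : ℝ[X]) ∈ V := by
    intro k
    induction k with
    | zero => rw [pow_zero, ← legP_zero (n := n)]; exact hmem 0
    | succ k ih => rw [pow_succ']; exact hXV _ ih
  have hp : p ∈ V := by
    rw [p.as_sum_range_C_mul_X_pow]
    exact V.sum_mem fun k _ => by rw [← smul_eq_C_mul]; exact V.smul_mem _ (hpow k)
  obtain ⟨c, hc⟩ := Finsupp.mem_span_range_iff_exists_finsupp.1 hp
  refine ⟨c, fun t => ?_⟩
  rw [← hc, Finsupp.sum, eval_finsetSum]
  simp

lemma integral_legP_mul (hn : 3 ≤ n) {j k : ℕ} (hjk : j ≠ k) (u w : Sph n) :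
    ∫ v : Sph n, (legP n j).eval ⟪(u : En n), v⟫_ℝ *
      (legP n k).eval ⟪(w : En n), v⟫_ℝ ∂sg n = 0 := by
  have h := integral_bx_comm (by omega) (zon (u : En n) (legP n j)) (zon (w : En n) (legP n k))
  simp only [bx_legP hn (Sph.norm _), zon_sph] at h
  set A := ∫ v : Sph n, (legP n j).eval ⟪(u : En n), v⟫_ℝ *
      (legP n k).eval ⟪(w : En n), v⟫_ℝ ∂sg n
  have h1 : bk n k * A = bk n j * A := by
    rw [← integral_const_mul, ← integral_const_mul]
    refine Eq.trans ?_ (h.trans ?_) <;>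
    · refine integral_congr_all fun v => ?_
      ring
  by_contra hA
  exact hjk (bk_injective hn (mul_right_cancel₀ hA h1)).symm

lemma integral_poly_legP (hn : 3 ≤ n) (p : ℝ[X]) (k : ℕ) : ∃ a : ℝ, ∀ u w : Sph n,
    ∫ v : Sph n, p.eval ⟪(u : En n), v⟫_ℝ *
      (legP n k).eval ⟪(w : En n), v⟫_ℝ ∂sg n =
    a * ∫ v : Sph n, (legP n k).eval ⟪(u : En n), v⟫_ℝ *
      (legP n k).eval ⟪(w : En n), v⟫_ℝ ∂sg n := by
  obtain ⟨c, hc⟩ := legP_span hn p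
  refine ⟨c k, fun u w => ?_⟩
  simp only [hc, Finset.sum_mul]
  have hi : ∀ j ∈ c.support, Integrable (fun v : Sph n => c j *
      (legP n j).eval ⟪(u : En n), v⟫_ℝ * (legP n k).eval ⟪(w : En n), v⟫_ℝ) (sg n) :=
    fun j _ => integrable_sg ((continuous_const.mul
      (continuous_inner_sph (legP n j).continuous (u : En n))).mul
        (continuous_inner_sph (legP n k).continuous (w : En n)))
  rw [integral_finsetSum _ hi]
  simp only [mul_assoc, integral_const_mul]
  rw [Finset.sum_eq_single k]
  · intro j _ hj; rw [integral_legP_mul hn hj, mul_zero]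
  · intro hk; rw [Finsupp.notMem_support_iff.1 hk, zero_mul]

lemma exists_legP_conv (hn : 3 ≤ n) (k : ℕ) : ∃ β : ℝ, ∀ u w : Sph n,
    ∫ v : Sph n, (legP n k).eval ⟪(u : En n), v⟫_ℝ *
      (legP n k).eval ⟪(w : En n), v⟫_ℝ ∂sg n =
      β * (legP n k).eval ⟪(u : En n), w⟫_ℝ := by
  choose c hc using fun m => integral_poly_legP hn (pkQ n m) k
  set φ : Sph n → Sph n → ℝ := fun u w => ∫ v : Sph n, (legP n k).eval ⟪(u : En n), v⟫_ℝ *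
      (legP n k).eval ⟪(w : En n), v⟫_ℝ ∂sg n with hφ
  have hlim : ∀ u w : Sph n, Tendsto (fun m => c m * φ u w) atTop
      (𝓝 ((legP n k).eval ⟪(u : En n), w⟫_ℝ)) := fun u w => by
    have := tendsto_pk (by omega) u (continuous_inner_sph (legP n k).continuous (w : En n))
    simp only [hc] at this
    rwa [real_inner_comm] at this
  set e : Sph n := ⟨pole n, by simp [norm_pole (show 0 < n by omega)]⟩
  have h1 := hlim e e
  have hee : ⟪(e : En n), e⟫_ℝ = 1 := Sph.inner_self e
  rw [hee, legP_eval_one hn] at h1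
  have hβ : φ e e ≠ 0 := fun h0 => by
    simp only [h0, mul_zero] at h1
    exact zero_ne_one (tendsto_nhds_unique tendsto_const_nhds h1)
  refine ⟨φ e e, fun u w => ?_⟩
  have h2 : Tendsto (fun m => c m * φ e e * (φ u w / φ e e)) atTop (𝓝 (1 * (φ u w / φ e e))) :=
    h1.mul_const _
  have h3 := tendsto_nhds_unique (h2.congr fun m => by field_simp) (hlim u w)
  rw [← h3]
  field_simp
  rfl

lemma funk_hecke_poly (hn : 3 ≤ n) (p : ℝ[X]) (k : ℕ) (u w : Sph n) :
    ∫ v : Sph n, p.eval ⟪(u : En n), v⟫_ℝ *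
      (legP n k).eval ⟪(w : En n), v⟫_ℝ ∂sg n =
    (∫ v : Sph n, p.eval ⟪pole n, v⟫_ℝ *
      (legP n k).eval ⟪pole n, v⟫_ℝ ∂sg n) * (legP n k).eval ⟪(u : En n), w⟫_ℝ := by
  obtain ⟨a, ha⟩ := integral_poly_legP hn p k
  obtain ⟨β, hβ⟩ := exists_legP_conv hn k
  set e : Sph n := ⟨pole n, by simp [norm_pole (show 0 < n by omega)]⟩
  have h := ha e e
  have hee : ⟪(e : En n), e⟫_ℝ = 1 := Sph.inner_self e
  rw [hβ, hee, legP_eval_one hn, mul_one] at h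
  rw [show pole n = (e : En n) from rfl, h, ha, hβ]
  ring

/-- The Funk-Hecke formula. -/
lemma funk_hecke (hn : 3 ≤ n) {G : ℝ → ℝ} (hG : Continuous G) (k : ℕ) (u w : Sph n) :
    ∫ v : Sph n, G ⟪(u : En n), v⟫_ℝ *
      (legP n k).eval ⟪(w : En n), v⟫_ℝ ∂sg n =
    (∫ v : Sph n, G ⟪pole n, v⟫_ℝ *
      (legP n k).eval ⟪pole n, v⟫_ℝ ∂sg n) * (legP n k).eval ⟪(u : En n), w⟫_ℝ := by
  have := sg_isProb (show 0 < n by omega)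
  set e : Sph n := ⟨pole n, by simp [norm_pole (show 0 < n by omega)]⟩
  rw [show pole n = (e : En n) from rfl]
  obtain ⟨M, hM⟩ := isCompact_Icc.exists_bound_of_continuousOn (s := Set.Icc (-1 : ℝ) 1)
    (legP n k).continuous.continuousOn
  have hP : ∀ u v : Sph n, |(legP n k).eval ⟪(u : En n), v⟫_ℝ| ≤ M := fun u v =>
    hM _ ⟨neg_one_le_inner_sph u v, inner_sph_le u v⟩
  have hM0 : 0 ≤ M := (abs_nonneg _).trans (hP u u)
  have hI : ∀ ε > 0, ∀ p : ℝ[X], (∀ x ∈ Set.Icc (-1 : ℝ) 1, |p.eval x - G x| < ε) → ∀ u w : Sph n,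
      |∫ v : Sph n, p.eval ⟪(u : En n), v⟫_ℝ *
        (legP n k).eval ⟪(w : En n), v⟫_ℝ ∂sg n -
      ∫ v : Sph n, G ⟪(u : En n), v⟫_ℝ *
        (legP n k).eval ⟪(w : En n), v⟫_ℝ ∂sg n| ≤ ε * M := by
    intro ε hε p hp u w
    have hc := continuous_inner_sph (legP n k).continuous (w : En n)
    have i1 : Integrable (fun v : Sph n => p.eval ⟪(u : En n), v⟫_ℝ *
        (legP n k).eval ⟪(w : En n), v⟫_ℝ) (sg n) :=
      integrable_sg ((continuous_inner_sph p.continuous (u : En n)).mul hc)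
    have i2 : Integrable (fun v : Sph n => G ⟪(u : En n), v⟫_ℝ *
        (legP n k).eval ⟪(w : En n), v⟫_ℝ) (sg n) :=
      integrable_sg ((continuous_inner_sph hG (u : En n)).mul hc)
    rw [← integral_sub i1 i2, ← Real.norm_eq_abs]
    refine (norm_integral_le_of_norm_le_const (C := ε * M) (Eventually.of_forall fun v => ?_)).trans
      (by simp)
    rw [← sub_mul, norm_mul]
    exact mul_le_mul (hp _ ⟨neg_one_le_inner_sph u v, inner_sph_le u v⟩).le (hP w v)
      (abs_nonneg _) hε.le
  refine eq_of_abs_sub_le_all fun ε hε => ?_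
  set ε' := ε / (M + M * M + 1)
  have hd : 0 < M + M * M + 1 := by positivity
  have hε' : 0 < ε' := by positivity
  obtain ⟨p, hp⟩ := exists_polynomial_near_of_continuousOn (-1) 1 G hG.continuousOn ε' hε'
  have h1 := hI ε' hε' p hp u w
  have h2 := hI ε' hε' p hp e e
  have h3 := funk_hecke_poly hn p k u w
  rw [show pole n = (e : En n) from rfl] at h3
  rw [h3] at h1
  set A := ∫ v : Sph n, p.eval ⟪(e : En n), v⟫_ℝ *
        (legP n k).eval ⟪(e : En n), v⟫_ℝ ∂sg n
  set B := ∫ v : Sph n, G ⟪(e : En n), v⟫_ℝ *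
        (legP n k).eval ⟪(e : En n), v⟫_ℝ ∂sg n
  set L := ∫ v : Sph n, G ⟪(u : En n), v⟫_ℝ *
        (legP n k).eval ⟪(w : En n), v⟫_ℝ ∂sg n
  set P := (legP n k).eval ⟪(u : En n), w⟫_ℝ with hPd
  calc |L - B * P| = |-(A * P - L) + (A - B) * P| := by ring_nf
    _ ≤ |A * P - L| + |A - B| * |P| := by
        refine (abs_add_le _ _).trans ?_
        rw [abs_neg, abs_mul]
    _ ≤ ε' * M + ε' * M * M := add_le_add h1 (mul_le_mul h2 (hP u w) (abs_nonneg _) (by positivity))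
    _ ≤ ε' * (M + M * M + 1) := by nlinarith
    _ = ε := by rw [div_mul_cancel₀ _ hd.ne']

/-- The projection onto spherical harmonics of degree `k`, up to normalisation. -/
def prk (k : ℕ) (s : Sph n → ℝ) (hs : Continuous s) : HF n := cvl (zon (pole n) (legP n k)) s hs

variable {s : Sph n → ℝ} {φ f : HF n} {G : ℝ → ℝ}

lemma prk_sph (hn : 0 < n) (k : ℕ) (hs : Continuous s) (u : Sph n) :
    prk k s hs u = ∫ v : Sph n, (legP n k).eval ⟪(u : En n), v⟫_ℝ * s v ∂sg n :=
  (zonal_zon _).cvl_sph hn hs u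

lemma bx_prk (hn : 3 ≤ n) (k : ℕ) (hs : Continuous s) (u : Sph n) :
    bx (prk k s hs) u = bk n k * prk k s hs u := by
  rw [prk, bx_cvl, cvl_apply, ← integral_const_mul]
  refine integral_congr_all fun v => ?_
  simp only [← rps_coe, bx_legP hn (norm_pole (show 0 < n by omega)), mul_assoc]

lemma Zonal.cvl_prk (hn : 3 ≤ n) (hG : Zonal φ G) (k : ℕ) (hs : Continuous s) (u : Sph n) :
    cvl φ (fun v => prk k s hs v) (prk k s hs).continuous_sph u =
      (∫ v : Sph n, φ v * (legP n k).eval ⟪pole n, v⟫_ℝ ∂sg n) * prk k s hs u := by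
  have h0 : 0 < n := by omega
  have ht := continuous_inner_sph hG.1 (u : En n)
  have h := (zonal_zon (n := n) (legP n k)).cvl_adj h0 ht hs
  rw [hG.cvl_sph h0]
  refine Eq.trans ?_ (h.symm.trans ?_)
  · rfl
  have h1 : ∀ w : Sph n, cvl (zon (pole n) (legP n k)) (fun v : Sph n => G ⟪(u : En n), v⟫_ℝ) ht w
      = (∫ v : Sph n, φ v * (legP n k).eval ⟪pole n, v⟫_ℝ ∂sg n) *
        (legP n k).eval ⟪(u : En n), w⟫_ℝ := fun w => by
    rw [(zonal_zon (n := n) (legP n k)).cvl_sph h0]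
    simp only [mul_comm ((legP n k).eval _)]
    rw [funk_hecke hn hG.1]
    simp only [hG.2, real_inner_comm (pole n)]
  simp only [h1, mul_assoc]
  rw [integral_const_mul, prk_sph h0]

end Spectral

section SpectralGap

open Polynomial

variable {s : Sph n → ℝ} {φ f : HF n} {G : ℝ → ℝ}

lemma HF.coe_sum {ι : Type*} (S : Finset ι) (F : ι → HF n) (x : En n) :
    (∑ k ∈ S, F k : HF n) x = ∑ k ∈ S, F k x := by
  classical
  induction S using Finset.induction_on with
  | empty => rfl
  | insert a S ha ih => rw [Finset.sum_insert ha, Finset.sum_insert ha, ← ih]; rfl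

lemma bx_sum {ι : Type*} (S : Finset ι) (F : ι → HF n) (u : Sph n) :
    bx (∑ k ∈ S, F k : HF n) u = ∑ k ∈ S, bx (F k) u := by
  classical
  induction S using Finset.induction_on with
  | empty =>
    have := bx_smul (n := n) 0 0 u
    rw [zero_smul, zero_mul] at this
    simpa using this
  | insert a S ha ih => rw [Finset.sum_insert ha, Finset.sum_insert ha, ← ih, bx_add]

lemma cvl_sph_sum {ι : Type*} (S : Finset ι) (t : ι → Sph n → ℝ) (ht : ∀ k, Continuous (t k))
    (c : ι → ℝ) (hs : Continuous s) (h : ∀ v, s v = ∑ k ∈ S, c k * t k v) (u : Sph n) :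
    cvl φ s hs u = ∑ k ∈ S, c k * cvl φ (t k) (ht k) u := by
  simp only [cvl_apply, h, Finset.mul_sum, ← integral_const_mul]
  rw [← integral_finsetSum _ fun k _ => (integrable_ker φ (t k) (ht k) (u : En n)).const_mul (c k)]
  refine integral_congr_ae (Eventually.of_forall fun v => Finset.sum_congr rfl fun k _ => ?_)
  ring

/-- The normalised second order quadratic form of the mixed volume functional. -/
def qf (f : HF n) : ℝ := (∫ u, f u ∂sg n) ^ 2 - ∫ u, f u * bx f u ∂sg n

lemma integral_harm_mul (hn : 3 ≤ n) {g : ℕ → HF n}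
    (hg : ∀ k (u : Sph n), bx (g k) u = bk n k * g k u) {j k : ℕ} (hjk : j ≠ k) :
    ∫ u, g j u * g k u ∂sg n = 0 := by
  have h := integral_bx_comm (by omega) (g j) (g k)
  simp only [hg] at h
  have h1 : bk n k * ∫ u, g j u * g k u ∂sg n = bk n j * ∫ u, g j u * g k u ∂sg n := by
    rw [← integral_const_mul, ← integral_const_mul]
    refine Eq.trans ?_ (h.trans ?_) <;>
    · refine integral_congr_all fun v => ?_
      ring
  by_contra hA
  exact hjk (bk_injective hn (mul_right_cancel₀ hA h1)).symm

lemma integral_harm_sum (hn : 3 ≤ n) {g : ℕ → HF n}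
    (hg : ∀ k (u : Sph n), bx (g k) u = bk n k * g k u)
    (S : Finset ℕ) (x y : ℕ → ℝ) :
    ∫ u, (∑ k ∈ S, x k * g k u) * (∑ k ∈ S, y k * g k u) ∂sg n =
      ∑ k ∈ S, x k * y k * ∫ u, g k u * g k u ∂sg n := by
  have hc : ∀ j k, Continuous fun u : Sph n => (x j * g j u) * (y k * g k u) := fun j k =>
    (continuous_const.mul (g j).continuous_sph).mul (continuous_const.mul (g k).continuous_sph)
  have hi : ∀ j k, Integrable (fun u : Sph n => (x j * g j u) * (y k * g k u)) (sg n) := fun j k =>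
    integrable_sg (hc j k)
  simp only [Finset.sum_mul_sum]
  rw [integral_finsetSum _ fun j _ => integrable_finsetSum _ fun k _ => hi j k]
  refine Finset.sum_congr rfl fun j hj => ?_
  rw [integral_finsetSum _ fun k _ => hi j k, Finset.sum_eq_single j]
  · rw [← integral_const_mul]
    refine integral_congr_all fun u => ?_
    ring
  · intro k _ hk
    have h0 := integral_harm_mul hn hg hk.symm
    have : ∀ u : Sph n, (x j * g j u) * (y k * g k u) = (x j * y k) * (g j u * g k u) := fun u => by ring
    simp only [this]
    rw [integral_const_mul, h0, mul_zero]
  · exact fun h => absurd hj h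

lemma integral_mul_self_nonneg (f : HF n) : 0 ≤ ∫ u, f u * f u ∂sg n :=
  integral_nonneg fun _ => mul_self_nonneg _

/-- The spectral estimates for finite sums of spherical harmonics of degree at least two. -/
lemma harm_sum_bounds (hn : 3 ≤ n) {g : ℕ → HF n}
    (hg : ∀ k (u : Sph n), bx (g k) u = bk n k * g k u) (hg0 : ∀ k < 2, ∀ u : Sph n, g k u = 0)
    (a : ℕ → ℝ) (ha : ∀ k, ∀ u : Sph n,
      cvl φ (fun v => g k v) (g k).continuous_sph u = a k * g k u)
    {r : ℝ} (hr : ∀ k, 2 ≤ k → (bk n k * a k) ^ 2 ≤ r)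
    (S : Finset ℕ) (x : ℕ → ℝ) {F : HF n} (hF : ∀ u : Sph n, F u = ∑ k ∈ S, x k * g k u) :
    -bk n 2 * ∫ u, F u * F u ∂sg n ≤ -∫ u, F u * bx F u ∂sg n ∧
    -∫ u, cvl φ (fun v => bx F v) F.continuous_bx u * bx (cvl φ (fun v => bx F v) F.continuous_bx) u
      ∂sg n ≤ r * -∫ u, F u * bx F u ∂sg n := by
  have key : ∀ y : ℕ → ℝ, ∀ H : HF n, (∀ u : Sph n, H u = ∑ k ∈ S, y k * g k u) → ∀ u : Sph n,
      bx H u = ∑ k ∈ S, (y k * bk n k) * g k u := by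
    intro y H hH u
    have : H = ∑ k ∈ S, y k • g k := HF.ext_sph fun _ => by rw [hH, HF.coe_sum]; rfl
    rw [this, bx_sum]
    refine Finset.sum_congr rfl fun k _ => ?_
    rw [bx_smul, hg]; ring
  have hY : ∀ u : Sph n, cvl φ (fun v => bx F v) F.continuous_bx u =
      ∑ k ∈ S, (x k * bk n k * a k) * g k u := fun u => by
    rw [cvl_sph_sum S (fun k v => g k v) (fun k => (g k).continuous_sph) _ F.continuous_bx
      (key x F hF)]
    refine Finset.sum_congr rfl fun k _ => ?_
    rw [ha]; ring
  have hbY := key _ _ hY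
  have hbF := key _ _ hF
  generalize hYd : cvl φ (fun v => bx F v) F.continuous_bx = Y at hY hbY ⊢
  simp only [hY, hbY, hF, hbF]
  rw [integral_harm_sum hn hg, integral_harm_sum hn hg, integral_harm_sum hn hg,
    Finset.mul_sum, ← Finset.sum_neg_distrib, ← Finset.sum_neg_distrib, Finset.mul_sum]
  have hz : ∀ k < 2, ∫ u, g k u * g k u ∂sg n = 0 := fun k hk => by simp [hg0 k hk]
  constructor
  · refine Finset.sum_le_sum fun k _ => ?_
    rcases lt_or_ge k 2 with hk | hk
    · rw [hz k hk]; simp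
    · have h1 := bk_le_two hn hk
      have h2 := mul_nonneg (mul_self_nonneg (x k)) (integral_mul_self_nonneg (g k))
      nlinarith [mul_le_mul_of_nonneg_right h1 h2]
  · refine Finset.sum_le_sum fun k _ => ?_
    rcases lt_or_ge k 2 with hk | hk
    · rw [hz k hk]; simp
    · have h1 := (bk_le_two hn hk).trans (bk_two_neg hn).le
      have h2 := mul_nonneg (mul_self_nonneg (x k)) (integral_mul_self_nonneg (g k))
      have h3 := mul_le_mul_of_nonneg_right (hr k hk) (mul_nonneg (neg_nonneg.2 h1) h2)
      nlinarith [h3]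

lemma tendsto_integral_sg (hn : 0 < n) {X : ℕ → Sph n → ℝ} {Y : Sph n → ℝ} {C : ℝ}
    (hX : ∀ m, Measurable (X m)) (hC : ∀ m u, |X m u| ≤ C)
    (h : ∀ u, Tendsto (fun m => X m u) atTop (𝓝 (Y u))) :
    Tendsto (fun m => ∫ u, X m u ∂sg n) atTop (𝓝 (∫ u, Y u ∂sg n)) := by
  have := sg_isProb hn
  exact tendsto_integral_of_dominated_convergence (fun _ => C)
    (fun m => (hX m).aestronglyMeasurable) (integrable_const C)
    (fun m => Eventually.of_forall (hC m)) (Eventually.of_forall h)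

lemma tendsto_integral_mul_sg (hn : 0 < n) {X Y : ℕ → Sph n → ℝ} {X' Y' : Sph n → ℝ} {C D : ℝ}
    (hX : ∀ m, Measurable (X m)) (hC : ∀ m u, |X m u| ≤ C)
    (h : ∀ u, Tendsto (fun m => X m u) atTop (𝓝 (X' u)))
    (hY : ∀ m, Measurable (Y m)) (hD : ∀ m u, |Y m u| ≤ D)
    (h' : ∀ u, Tendsto (fun m => Y m u) atTop (𝓝 (Y' u))) :
    Tendsto (fun m => ∫ u, X m u * Y m u ∂sg n) atTop (𝓝 (∫ u, X' u * Y' u ∂sg n)) :=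
  tendsto_integral_sg hn (C := C * D) (fun m => (hX m).mul (hY m))
    (fun m u => by
      rw [abs_mul]
      exact mul_le_mul (hC m u) (hD m u) (abs_nonneg _) ((abs_nonneg _).trans (hC m u)))
    (fun u => (h u).mul (h' u))

lemma measurable_bx_rps (φ : HF n) (u : Sph n) :
    Measurable fun v : Sph n => bx φ (rp (v : En n) (u : En n)) := by
  have h1 : Measurable fun v : Sph n => hess φ (rp (v : En n) (u : En n)) :=
    φ.measurable_hess.comp (measurable_rp_apply (u : En n))
  exact ((trcL n).continuous.measurable.comp h1).const_mul _

lemma bx_cvl_zon (hn : 2 ≤ n) (q : ℝ[X]) (f : HF n) (u : Sph n) :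
    bx (cvl (zon (pole n) q) (fun v => f v) f.continuous_sph) u =
      cvl (zon (pole n) q) (fun v => bx f v) f.continuous_bx u := by
  have h0 : 0 < n := by omega
  rw [(zonal_zon q).cvl_bx hn, bx_cvl]
  refine integral_congr_all fun v => ?_
  simp only [← rps_coe, bx_zon _ _ hn (norm_pole h0)]
  rw [rps_coe, rps_coe, real_inner_comm, inner_rp_pole h0,
    real_inner_comm (rp (u : En n) (v : En n)), inner_rp_pole h0, real_inner_comm]

theorem spectral_gap (hn : 3 ≤ n) (hG : Zonal φ G) (f : HF n) (hf0 : ∫ u, f u ∂sg n = 0)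
    (hf1 : ∀ a : En n, ∫ u : Sph n, ⟪a, u⟫_ℝ * f u ∂sg n = 0)
    {r : ℝ} (hr : ∀ k, 2 ≤ k →
      (bk n k * ∫ v : Sph n, φ v * (legP n k).eval ⟪pole n, v⟫_ℝ ∂sg n) ^ 2 ≤ r) :
    -bk n 2 * ∫ u, f u * f u ∂sg n ≤ qf f ∧
      qf (cvl φ (fun v => bx f v) f.continuous_bx) ≤ r * qf f := by
  have h0 : 0 < n := by omega
  set Q : ℕ → HF n := fun m => zon (pole n) (pkQ n m)
  set F : ℕ → HF n := fun m => cvl (Q m) (fun v => f v) f.continuous_sph with hFd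
  obtain ⟨M, hM0, hM⟩ := exists_sph_bound f.continuous_sph
  obtain ⟨N, hN0, hN⟩ := exists_sph_bound f.continuous_bx
  have hFs : ∀ m (u : Sph n), F m u =
      ∫ v : Sph n, (pkQ n m).eval ⟪(u : En n), v⟫_ℝ * f v ∂sg n := fun m u =>
    (zonal_zon _).cvl_sph h0 _ u
  have hbFs : ∀ m (u : Sph n), bx (F m) u =
      ∫ v : Sph n, (pkQ n m).eval ⟪(u : En n), v⟫_ℝ * bx f v ∂sg n := fun m u => by
    rw [hFd]
    simp only
    rw [bx_cvl_zon (by omega), (zonal_zon _).cvl_sph h0]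
  have lF : ∀ u : Sph n, Tendsto (fun m => F m u) atTop (𝓝 (f u)) := fun u => by
    simp only [hFs]; exact tendsto_pk h0 u f.continuous_sph
  have lbF : ∀ u : Sph n, Tendsto (fun m => bx (F m) u) atTop (𝓝 (bx f u)) := fun u => by
    simp only [hbFs]; exact tendsto_pk h0 u f.continuous_bx
  have bF : ∀ m (u : Sph n), |F m u| ≤ M := fun m u => by
    rw [hFs]; exact abs_pk_le h0 m u f.continuous_sph hM
  have bbF : ∀ m (u : Sph n), |bx (F m) u| ≤ N := fun m u => by
    rw [hbFs]; exact abs_pk_le h0 m u f.continuous_bx hN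
  set Y : ℕ → HF n := fun m => cvl φ (fun v => bx (F m) v) (F m).continuous_bx
  set Yf : HF n := cvl φ (fun v => bx f v) f.continuous_bx with hYf
  obtain ⟨A, hA0, hA⟩ := exists_sph_bound φ.continuous_sph
  obtain ⟨B, hB0, hB⟩ := exists_sph_bound φ.continuous_bx
  have hKm : ∀ u : Sph n, Measurable fun v : Sph n => φ (rp (v : En n) (u : En n)) := fun u =>
    φ.measurable.comp (measurable_rp_apply (u : En n))
  have lY : ∀ u : Sph n, Tendsto (fun m => Y m u) atTop (𝓝 (Yf u)) := fun u => by
    simp only [Y, Yf, cvl_apply]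
    exact tendsto_integral_mul_sg h0 (fun _ => hKm u) (fun _ v => hA (rps v u))
      (fun _ => tendsto_const_nhds) (fun m => (F m).continuous_bx.measurable) bbF lbF
  have lbY : ∀ u : Sph n, Tendsto (fun m => bx (Y m) u) atTop (𝓝 (bx Yf u)) := fun u => by
    simp only [Y, Yf, bx_cvl]
    exact tendsto_integral_mul_sg h0 (fun _ => measurable_bx_rps φ u) (fun _ v => hB (rps v u))
      (fun _ => tendsto_const_nhds) (fun m => (F m).continuous_bx.measurable) bbF lbF
  have bY : ∀ m (u : Sph n), |Y m u| ≤ A * N := fun m u => abs_cvl_le (bbF m) _ h0 hA u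
  have bbY : ∀ m (u : Sph n), |bx (Y m) u| ≤ B * N := fun m u => abs_bx_cvl_le (bbF m) _ h0 hB u
  have hfin : ∀ m, -bk n 2 * ∫ u, F m u * F m u ∂sg n ≤ -∫ u, F m u * bx (F m) u ∂sg n ∧
      -∫ u, Y m u * bx (Y m) u ∂sg n ≤ r * -∫ u, F m u * bx (F m) u ∂sg n := fun m => by
    obtain ⟨c, hc⟩ := legP_span hn (pkQ n m)
    refine harm_sum_bounds hn (g := fun k => prk k (fun v => f v) f.continuous_sph)
      (fun k u => bx_prk hn k _ u) (fun k hk u => ?_) _ (fun k u => hG.cvl_prk hn k _ u) hr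
      c.support c (F := F m) fun u => ?_
    · rw [prk_sph h0]
      interval_cases k
      · simpa [legP_zero] using hf0
      · simpa [legP_one] using hf1 u
    · simp only [hFs, hc, Finset.sum_mul, prk_sph h0, ← integral_const_mul]
      have hi : ∀ j ∈ c.support, Integrable (fun v : Sph n => c j *
          (legP n j).eval ⟪(u : En n), v⟫_ℝ * f v) (sg n) :=
        fun j _ => integrable_sg ((continuous_const.mul
          (continuous_inner_sph (legP n j).continuous (u : En n))).mul f.continuous_sph)
      rw [integral_finsetSum _ hi]
      simp only [mul_assoc]
  have t1 := tendsto_integral_mul_sg h0 (fun m => (F m).continuous_sph.measurable) bF lF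
    (fun m => (F m).continuous_sph.measurable) bF lF
  have t2 := tendsto_integral_mul_sg h0 (fun m => (F m).continuous_sph.measurable) bF lF
    (fun m => (F m).continuous_bx.measurable) bbF lbF
  have t3 := tendsto_integral_mul_sg h0 (fun m => (Y m).continuous_sph.measurable) bY lY
    (fun m => (Y m).continuous_bx.measurable) bbY lbY
  have e1 : qf f = -∫ u, f u * bx f u ∂sg n := by rw [qf, hf0]; ring
  have e2 : qf Yf = -∫ u, Yf u * bx Yf u ∂sg n := by
    rw [qf, hYf, hG.integral_cvl h0, integral_bx (by omega), hf0]; ring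
  rw [e1, e2]
  exact ⟨le_of_tendsto_of_tendsto' (t1.const_mul _) t2.neg fun m => (hfin m).1,
    le_of_tendsto_of_tendsto' t3.neg (t2.neg.const_mul r) fun m => (hfin m).2⟩

/-- Poincaré type inequality for functions orthogonal to affine functions. -/
lemma exists_nsq_le_qf (hn : 3 ≤ n) : ∃ C > 0, ∀ f : HF n, ∫ u, f u ∂sg n = 0 →
    (∀ a : En n, ∫ u : Sph n, ⟪a, u⟫_ℝ * f u ∂sg n = 0) → nsq f ≤ C * qf f := by
  have hn' : (3 : ℝ) ≤ n := by exact_mod_cast hn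
  have hb := bk_two_neg hn
  refine ⟨n + n / -bk n 2, by have := div_pos (show (0 : ℝ) < n by linarith) (neg_pos.2 hb); linarith,
    fun f hf0 hf1 => ?_⟩
  obtain ⟨r, hr⟩ : ∃ r : ℝ, ∀ k, 2 ≤ k → (bk n k * ∫ v : Sph n, (0 : HF n) v *
      (legP n k).eval ⟪pole n, v⟫_ℝ ∂sg n) ^ 2 ≤ r := ⟨0, fun k _ => by
        have : ∀ v : Sph n, (0 : HF n) v = 0 := fun v => rfl
        simp [this]⟩
  have h := (spectral_gap hn (φ := 0) (G := fun _ => 0) ⟨continuous_const, fun u => rfl⟩ f hf0 hf1 hr).1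
  have h1 := integral_bx_self (by omega) f
  have e1 : qf f = -∫ u, f u * bx f u ∂sg n := by rw [qf, hf0]; ring
  rw [nsq_eq]
  have e2 : ∫ u, f u * f u ∂sg n = ∫ u : Sph n, f u ^ 2 ∂sg n := by simp only [pow_two]
  rw [e2] at h
  set I := ∫ u : Sph n, f u ^ 2 ∂sg n
  set T := ∫ u : Sph n, ‖tgr f u‖ ^ 2 ∂sg n
  have h2 : T = (n - 1) * (qf f + I) := by
    rw [e1, h1]
    have : (n : ℝ) - 1 ≠ 0 := by linarith
    field_simp
    ring
  have hI : I ≤ qf f / -bk n 2 := by rw [le_div_iff₀ (neg_pos.2 hb)]; linarith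
  have hI0 : 0 ≤ I := integral_nonneg fun u => sq_nonneg _
  have hq : 0 ≤ qf f := le_trans (mul_nonneg (neg_pos.2 hb).le hI0) h
  calc I + T = n * I + (n - 1) * qf f := by rw [h2]; ring
    _ ≤ n * (qf f / -bk n 2) + n * qf f := by
        gcongr
        linarith
    _ = _ := by ring

end SpectralGap

theorem bddAbove_inner_image (K : ConvexBody (En n)) (x : En n) :
    BddAbove ((fun y => ⟪x, y⟫_ℝ) '' (K : Set (En n))) :=
  (K.isCompact.image (by fun_prop)).bddAbove

theorem inner_le_supp {K : ConvexBody (En n)} {y : En n} (hy : y ∈ K) (x : En n) :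
    ⟪x, y⟫_ℝ ≤ supp K x :=
  le_csSup (bddAbove_inner_image K x) ⟨y, hy, rfl⟩

theorem supp_le {K : ConvexBody (En n)} {x : En n} {c : ℝ} (h : ∀ y ∈ K, ⟪x, y⟫_ℝ ≤ c) :
    supp K x ≤ c :=
  csSup_le (K.nonempty.image _) (by rintro _ ⟨y, hy, rfl⟩; exact h y hy)

theorem exists_supp_eq (K : ConvexBody (En n)) (x : En n) : ∃ y ∈ K, ⟪x, y⟫_ℝ = supp K x := by
  obtain ⟨y, hy, h⟩ := (K.isCompact.image (f := fun y => ⟪x, y⟫_ℝ) (by fun_prop)).sSup_mem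
    (K.nonempty.image _)
  exact ⟨y, hy, h⟩

theorem mem_of_inner_le_supp {K : ConvexBody (En n)} {y : En n}
    (h : ∀ x, ⟪x, y⟫_ℝ ≤ supp K x) : y ∈ K := by
  by_contra hy
  obtain ⟨f, c, h1, h2⟩ := geometric_hahn_banach_closed_point (s := (K : Set (En n))) K.convex
    K.isCompact.isClosed hy
  set a := (InnerProductSpace.toDual ℝ (En n)).symm f with ha
  have hf : ∀ z, f z = ⟪a, z⟫_ℝ := fun z => by simp [ha]
  have h3 : supp K a ≤ c := supp_le fun z hz => by rw [← hf]; exact (h1 z hz).le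
  have h4 := h a
  rw [← hf] at h4
  linarith

theorem le_of_supp_le {K L : ConvexBody (En n)} (h : ∀ x, supp K x ≤ supp L x) :
    (K : Set (En n)) ⊆ L := fun _ hy =>
  mem_of_inner_le_supp fun x => (inner_le_supp hy x).trans (h x)

theorem ext_supp {K L : ConvexBody (En n)} (h : ∀ x, supp K x = supp L x) : K = L :=
  ConvexBody.ext ((le_of_supp_le fun x => (h x).le).antisymm (le_of_supp_le fun x => (h x).ge))

theorem supp_add (K L : ConvexBody (En n)) (x : En n) :
    supp (K + L) x = supp K x + supp L x := by
  apply le_antisymm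
  · refine supp_le fun y hy => ?_
    obtain ⟨a, ha, b, hb, rfl⟩ := Set.mem_add.1 (show y ∈ (K : Set (En n)) + (L : Set (En n)) by
      rw [← ConvexBody.coe_add]; exact hy)
    rw [inner_add_right]
    exact add_le_add (inner_le_supp ha x) (inner_le_supp hb x)
  · obtain ⟨a, ha, h1⟩ := exists_supp_eq K x
    obtain ⟨b, hb, h2⟩ := exists_supp_eq L x
    rw [← h1, ← h2, ← inner_add_right]
    refine inner_le_supp (show a + b ∈ ((K + L : ConvexBody (En n)) : Set (En n)) from ?_) x
    rw [ConvexBody.coe_add]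
    exact Set.add_mem_add ha hb

theorem supp_zero (x : En n) : supp (0 : ConvexBody (En n)) x = 0 := by
  have h : ((0 : ConvexBody (En n)) : Set (En n)) = {0} := by simp [← Set.singleton_zero]
  rw [supp, h]
  simp

theorem supp_sum {ι : Type*} (S : Finset ι) (K : ι → ConvexBody (En n)) (x : En n) :
    supp (∑ k ∈ S, K k) x = ∑ k ∈ S, supp (K k) x := by
  classical
  induction S using Finset.induction_on with
  | empty => simp [supp_zero]
  | insert a S ha ih => rw [Finset.sum_insert ha, Finset.sum_insert ha, supp_add, ih]

theorem supp_translate (K : ConvexBody (En n)) (a x : En n) :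
    supp (translate K a) x = ⟪x, a⟫_ℝ + supp K x := by
  apply le_antisymm
  · refine supp_le ?_
    rintro _ ⟨y, hy, rfl⟩
    simp only [inner_add_right]
    linarith [inner_le_supp hy x]
  · obtain ⟨b, hb, h1⟩ := exists_supp_eq K x
    rw [← h1, ← inner_add_right]
    exact inner_le_supp (show a + b ∈ ((translate K a : ConvexBody (En n)) : Set (En n)) from
      ⟨b, hb, rfl⟩) x

theorem supp_smul_arg (K : ConvexBody (En n)) {c : ℝ} (hc : 0 ≤ c) (x : En n) :
    supp K (c • x) = c * supp K x := by
  apply le_antisymm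
  · refine supp_le fun y hy => ?_
    rw [real_inner_smul_left]
    exact mul_le_mul_of_nonneg_left (inner_le_supp hy x) hc
  · obtain ⟨b, hb, h1⟩ := exists_supp_eq K x
    rw [← h1, ← real_inner_smul_left]
    exact inner_le_supp hb _

theorem supp_add_le (K : ConvexBody (En n)) (x y : En n) :
    supp K (x + y) ≤ supp K x + supp K y :=
  supp_le fun z hz => by
    rw [inner_add_left]; exact add_le_add (inner_le_supp hz x) (inner_le_supp hz y)

theorem supp_scale {c : ℝ} (K : ConvexBody (En n)) (x : En n) :
    supp (scale c K) x = supp K (c • x) := by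
  apply le_antisymm
  · refine supp_le ?_
    rintro _ ⟨y, hy, rfl⟩
    simp only [real_inner_smul_right]
    rw [← real_inner_smul_left]
    exact inner_le_supp hy _
  · obtain ⟨b, hb, h1⟩ := exists_supp_eq K (c • x)
    rw [← h1, real_inner_smul_left, ← real_inner_smul_right]
    exact inner_le_supp (show c • b ∈ ((scale c K : ConvexBody (En n)) : Set (En n)) from
      ⟨b, hb, rfl⟩) x

theorem supp_ballB (x : En n) : supp (ballB n) x = ‖x‖ := by
  apply le_antisymm
  · refine supp_le fun y hy => ?_
    have h1 : ‖y‖ ≤ 1 := by simpa using mem_closedBall.1 (show y ∈ closedBall (0 : En n) 1 from hy)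
    calc ⟪x, y⟫_ℝ ≤ ‖x‖ * ‖y‖ := real_inner_le_norm x y
      _ ≤ ‖x‖ * 1 := by gcongr
      _ = ‖x‖ := mul_one _
  · by_cases hx : x = 0
    · subst hx
      obtain ⟨b, _, h1⟩ := exists_supp_eq (ballB n) 0
      rw [← h1]; simp
    · have h1 : ‖x‖⁻¹ • x ∈ ballB n := by
        change _ ∈ closedBall (0 : En n) 1
        simp [norm_smul, hx]
      have h2 := inner_le_supp h1 x
      rw [real_inner_smul_right, real_inner_self_eq_norm_sq] at h2
      have h3 : ‖x‖ ≠ 0 := norm_ne_zero_iff.2 hx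
      calc ‖x‖ = ‖x‖⁻¹ * ‖x‖ ^ 2 := by field_simp
        _ ≤ _ := h2

/-- The support function of a convex body, when of class `C²` off the origin. -/
def suppHF (K : ConvexBody (En n)) (h : ContDiffOn ℝ 2 (supp K) {0}ᶜ) : HF n :=
  ⟨supp K, h, fun _ hc x => supp_smul_arg K hc.le x⟩

theorem suppHF_apply (K : ConvexBody (En n)) (h) (x : En n) : suppHF K h x = supp K x := rfl

theorem HF.inner_gradient_le (F : HF n) (hF : ∀ x y, F (x + y) ≤ F x + F y) {x : En n}
    (hx : x ≠ 0) (z : En n) : ⟪z, gradient F x⟫_ℝ ≤ F z := by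
  have h1 : HasFDerivAt F (innerSL ℝ (gradient F x)) x := by
    have := (F.differentiableAt hx).hasGradientAt
    exact this.hasFDerivAt
  have h2 : HasDerivAt (fun t : ℝ => F (x + t • z)) ⟪z, gradient F x⟫_ℝ 0 := by
    have h3 : HasDerivAt (fun t : ℝ => x + t • z) z 0 := by
      simpa using ((hasDerivAt_id (0 : ℝ)).smul_const z).const_add x
    have h4 : HasFDerivAt F (innerSL ℝ (gradient F x)) (x + (0 : ℝ) • z) := by simpa using h1
    have h5 := h4.comp_hasDerivAt (0 : ℝ) h3
    rw [innerSL_apply_apply, real_inner_comm] at h5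
    exact h5
  have h5 := (hasDerivAt_iff_tendsto_slope_zero.1 h2).mono_left
    (nhdsWithin_mono (0 : ℝ) (s := Set.Ioi 0) fun t ht => ne_of_gt ht)
  refine le_of_tendsto h5 ?_
  filter_upwards [self_mem_nhdsWithin] with t ht
  have ht' : (0 : ℝ) < t := ht
  have h6 := hF x (t • z)
  rw [F.homog ht'] at h6
  simp only [zero_add, zero_smul, add_zero, smul_eq_mul]
  rw [inv_mul_le_iff₀ ht']
  linarith

theorem HF.gradient_eq_of_touch (F : HF n) {x p : En n} (hx : x ≠ 0)
    (h : ∀ z, ⟪z, p⟫_ℝ ≤ F z) (he : ⟪x, p⟫_ℝ = F x) : gradient F x = p := by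
  have h1 : HasFDerivAt F (innerSL ℝ (gradient F x)) x :=
    (F.differentiableAt hx).hasGradientAt.hasFDerivAt
  have h2 : HasFDerivAt (fun z : En n => ⟪p, z⟫_ℝ) (innerSL ℝ p) x := (innerSL ℝ p).hasFDerivAt
  have h3 := h1.sub h2
  have h4 : IsLocalMin ((F : En n → ℝ) - fun z : En n => ⟪p, z⟫_ℝ) x := by
    refine Eventually.of_forall fun z => ?_
    simp only [Pi.sub_apply]
    rw [real_inner_comm, he, sub_self]
    have := h z
    rw [real_inner_comm]
    linarith
  have h5 := h4.hasFDerivAt_eq_zero h3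
  have h6 : innerSL ℝ (gradient F x) (gradient F x - p) - innerSL ℝ p (gradient F x - p) = 0 := by
    rw [← sub_apply, h5]; rfl
  rw [innerSL_apply_apply, innerSL_apply_apply, ← inner_sub_left, inner_self_eq_zero] at h6
  exact sub_eq_zero.1 h6

theorem HF.hess_nonneg (F : HF n) (hF : ∀ x y, F (x + y) ≤ F x + F y) {x : En n}
    (hx : x ≠ 0) (w : En n) : 0 ≤ ⟪hess F x w, w⟫_ℝ := by
  have h2 : HasDerivAt (fun t : ℝ => ⟪gradient F (x + t • w), w⟫_ℝ) ⟪hess F x w, w⟫_ℝ 0 := by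
    have h3 : HasDerivAt (fun t : ℝ => x + t • w) w 0 := by
      simpa using ((hasDerivAt_id (0 : ℝ)).smul_const w).const_add x
    have h4 : HasFDerivAt (gradient F) (hess F x) (x + (0 : ℝ) • w) := by
      simpa using F.hasFDerivAt_gradient hx
    have h5 := h4.comp_hasDerivAt (0 : ℝ) h3
    have h6 := h5.inner ℝ (hasDerivAt_const (0 : ℝ) w)
    simpa using h6
  have h5 := (hasDerivAt_iff_tendsto_slope_zero.1 h2).mono_left
    (nhdsWithin_mono (0 : ℝ) (s := Set.Ioi 0) fun t ht => ne_of_gt ht)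
  refine ge_of_tendsto h5 ?_
  have h7 : ∀ᶠ t : ℝ in 𝓝[>] 0, x + t • w ≠ 0 := by
    have h8 : Tendsto (fun t : ℝ => x + t • w) (𝓝[>] 0) (𝓝 (x + (0 : ℝ) • w)) :=
      (Continuous.tendsto (by fun_prop) 0).mono_left nhdsWithin_le_nhds
    rw [zero_smul, add_zero] at h8
    exact h8.eventually_ne hx
  filter_upwards [self_mem_nhdsWithin, h7] with t ht hne
  have ht' : (0 : ℝ) < t := ht
  simp only [zero_add, zero_smul, add_zero, smul_eq_mul]
  refine mul_nonneg (inv_nonneg.2 ht'.le) ?_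
  have a1 := F.inner_gradient_le hF hne x
  have a2 := F.inner_gradient_le hF hx (x + t • w)
  have a3 := F.inner_gradient_self hx
  have a4 := F.inner_gradient_self hne
  rw [real_inner_comm] at a3 a4
  rw [inner_add_left, real_inner_smul_left] at a2 a4
  have : t * (⟪gradient F (x + t • w), w⟫_ℝ - ⟪gradient F x, w⟫_ℝ) ≥ 0 := by
    rw [real_inner_comm w, real_inner_comm w]
    nlinarith
  exact nonneg_of_mul_nonneg_right this ht'

theorem det_pos_of_inner_pos (A : En n →L[ℝ] En n) (hA : ∀ w, w ≠ 0 → 0 < ⟪A w, w⟫_ℝ) :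
    0 < A.det := by
  have hne : ∀ t ∈ Set.Icc (0 : ℝ) 1, (1 + t • (A - 1)).det ≠ 0 := by
    intro t ht h
    have h2 : LinearMap.det ((1 + t • (A - 1) : En n →L[ℝ] En n) : En n →ₗ[ℝ] En n) = 0 := h
    obtain ⟨w, hw, hw0⟩ := (Submodule.ne_bot_iff _).1 (LinearMap.bot_lt_ker_of_det_eq_zero h2).ne'
    have h3 : (1 - t) • w + t • A w = 0 := by
      have h4 : w + t • (A w - w) = 0 := by simpa using LinearMap.mem_ker.1 hw
      rw [← h4, smul_sub, sub_smul, one_smul]; abel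
    have h5 := congrArg (fun z => ⟪z, w⟫_ℝ) h3
    simp only [inner_add_left, real_inner_smul_left, inner_zero_left] at h5
    have h6 := hA w hw0
    have h7 : 0 < ⟪w, w⟫_ℝ := real_inner_self_pos.2 hw0
    rcases ht.1.eq_or_lt with h8 | h8
    · rw [← h8] at h5; linarith
    · nlinarith [mul_nonneg (sub_nonneg.2 ht.2) h7.le, mul_pos h8 h6]
  have hc : ContinuousOn (fun t : ℝ => (1 + t • (A - 1)).det) (Set.Icc 0 1) :=
    ((ContinuousLinearMap.continuous_det (𝕜 := ℝ) (E := En n)).comp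
      (f := fun t : ℝ => 1 + t • (A - 1)) (by fun_prop)).continuousOn
  by_contra hneg
  push Not at hneg
  obtain ⟨t, ht, h0⟩ := intermediate_value_Icc' zero_le_one hc
    (show (0 : ℝ) ∈ Set.Icc _ _ by
      constructor
      · simpa using hneg
      · simp [ContinuousLinearMap.det])
  exact hne t ht h0

theorem det_hess_add_rk (F : HF n) (u : Sph n) :
    (hess F u + rk (gradient F u) u).det = (sop F u).det := by
  have hu := Sph.norm u
  have h0 := Sph.ne_zero u
  have h1 := mdisc_add_rk hu (fun _ => hess F u) (fun _ => gradient F u)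
    (fun _ => F.hess_self h0) (fun _ w => F.inner_hess_self h0 w)
  have h2 := mdisc_add_rk hu (fun _ => hess F u) (fun _ => F u • (u : En n))
    (fun _ => F.hess_self h0) (fun _ w => F.inner_hess_self h0 w)
  rw [mdisc_diag] at h1 h2
  have h3 : hess F u + rk (F u • (u : En n)) u = sop F u := by
    rw [rk_smul_left, sop, add_comm]
  rw [h3] at h2
  rw [h1, h2]
  refine Finset.sum_congr rfl fun l _ => ?_
  rw [real_inner_smul_right, Sph.inner_self, mul_one, real_inner_comm, F.inner_gradient_self h0]

theorem sop_inner_self (F : HF n) (u : Sph n) (w : En n) :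
    ⟪sop F u w, w⟫_ℝ = F u * ⟪(u : En n), w⟫_ℝ ^ 2 + ⟪hess F u w, w⟫_ℝ := by
  simp only [sop, add_apply, smul_apply, rk_apply,
    inner_add_left, real_inner_smul_left]
  ring

theorem HF.hess_perp (F : HF n) (u : Sph n) (w : En n) :
    ⟪hess F u w, w⟫_ℝ = ⟪hess F u (w - ⟪(u : En n), w⟫_ℝ • (u : En n)),
      w - ⟪(u : En n), w⟫_ℝ • (u : En n)⟫_ℝ := by
  have h0 := Sph.ne_zero u
  rw [map_sub, map_smul, F.hess_self h0, smul_zero, sub_zero, inner_sub_right,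
    real_inner_smul_right, real_inner_comm (u : En n), F.inner_hess_self h0]
  ring

theorem inner_perp (u : Sph n) (w : En n) :
    ⟪(u : En n), w - ⟪(u : En n), w⟫_ℝ • (u : En n)⟫_ℝ = 0 := by
  rw [inner_sub_right, real_inner_smul_right, Sph.inner_self]; ring

/-- The unit vector in direction `x`, for `x ≠ 0`. -/
def unitv (x : En n) (hx : x ≠ 0) : Sph n :=
  ⟨‖x‖⁻¹ • x, by simp [norm_smul, hx]⟩

theorem unitv_coe (x : En n) (hx : x ≠ 0) : (unitv x hx : En n) = ‖x‖⁻¹ • x := rfl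

theorem norm_smul_unitv (x : En n) (hx : x ≠ 0) : ‖x‖ • (unitv x hx : En n) = x := by
  rw [unitv_coe, smul_smul, mul_inv_cancel₀ (norm_ne_zero_iff.2 hx), one_smul]

theorem gradient_unitv (F : HF n) {x : En n} (hx : x ≠ 0) :
    gradient F (‖x‖⁻¹ • x) = gradient F x :=
  F.gradient_smul_arg (inv_pos.2 (norm_pos_iff.2 hx)) hx

theorem hasFDerivAt_norm_smul_gradient (F : HF n) {x : En n} (hx : x ≠ 0) :
    HasFDerivAt (fun x => ‖x‖ • gradient F x)
      (hess F (‖x‖⁻¹ • x) + rk (gradient F (‖x‖⁻¹ • x)) (‖x‖⁻¹ • x)) x := by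
  have h1 := (MinkIter.hasFDerivAt_norm hx).smul (F.hasFDerivAt_gradient hx)
  refine h1.congr_fderiv ?_
  have hp : 0 < ‖x‖ := norm_pos_iff.2 hx
  rw [gradient_unitv F hx, F.hess_smul_arg (inv_pos.2 hp) hx, inv_inv]
  ext w k
  simp [real_inner_smul_left]

section strict

variable {F : HF n} {K : ConvexBody (En n)}

theorem injOn_norm_smul_gradient (hK : ∀ x, supp K x = F x) (hF0 : ∀ u : Sph n, 0 < F u)
    (hpos : ∀ (u : Sph n) (w : En n), ⟪(u : En n), w⟫_ℝ = 0 → w ≠ 0 → 0 < ⟪hess F u w, w⟫_ℝ) :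
    Set.InjOn (fun x => ‖x‖ • gradient F x) {0}ᶜ := by
  have hsub : ∀ x y, F (x + y) ≤ F x + F y := fun x y => by
    rw [← hK, ← hK, ← hK]; exact supp_add_le K x y
  have hle : ∀ x y : En n, ∀ (hx : x ≠ 0) (_ : y ≠ 0),
      ‖x‖ • gradient F x = ‖y‖ • gradient F y → ‖x‖ ≤ ‖y‖ := by
    intro x y hx hy h
    have h1 := F.inner_gradient_le hsub hy (unitv x hx)
    have h2 : ⟪(unitv x hx : En n), ‖x‖ • gradient F x⟫_ℝ = ‖x‖ * F (unitv x hx) := by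
      rw [real_inner_smul_right, ← gradient_unitv F hx, ← unitv_coe x hx, real_inner_comm,
        F.inner_gradient_self (Sph.ne_zero _)]
    rw [h, real_inner_smul_right] at h2
    have h3 := hF0 (unitv x hx)
    have h4 : ‖x‖ * F (unitv x hx) ≤ ‖y‖ * F (unitv x hx) := by
      rw [← h2]; exact mul_le_mul_of_nonneg_left h1 (norm_nonneg _)
    exact le_of_mul_le_mul_right h4 h3
  intro x hx y hy h
  have hx : x ≠ 0 := hx
  have hy : y ≠ 0 := hy
  simp only at h
  have hn : ‖x‖ = ‖y‖ := le_antisymm (hle x y hx hy h) (hle y x hy hx h.symm)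
  have hxp : 0 < ‖x‖ := norm_pos_iff.2 hx
  rw [← hn] at h
  have hg : gradient F x = gradient F y := smul_right_injective _ hxp.ne' h
  set u := unitv x hx with hu
  set v := unitv y hy with hv
  have hgu : gradient F u = gradient F v := by
    rw [hu, hv, unitv_coe, unitv_coe, gradient_unitv F hx, gradient_unitv F hy, hg]
  set p := gradient F u with hp
  have hup : ⟪(u : En n), p⟫_ℝ = F u := by
    rw [real_inner_comm, hp, F.inner_gradient_self (Sph.ne_zero u)]
  have hvp : ⟪(v : En n), p⟫_ℝ = F v := by
    rw [real_inner_comm, hgu, F.inner_gradient_self (Sph.ne_zero v)]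
  have hall : ∀ z, ⟪z, p⟫_ℝ ≤ F z := fun z => F.inner_gradient_le hsub (Sph.ne_zero u) z
  set w : En n := (v : En n) - u with hw
  have hseg : ∀ t ∈ Set.Ioo (0 : ℝ) 1, ⟪(u : En n) + t • w, p⟫_ℝ = F (u + t • w) := by
    intro t ht
    have e : (u : En n) + t • w = (1 - t) • (u : En n) + t • (v : En n) := by
      rw [hw, smul_sub, sub_smul, one_smul]; abel
    refine le_antisymm (hall _) ?_
    rw [e]
    refine (hsub _ _).trans ?_
    rw [F.homog (sub_pos.2 ht.2), F.homog ht.1, inner_add_left, real_inner_smul_left,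
      real_inner_smul_left, hup, hvp]
  have h2 : HasDerivAt (fun t : ℝ => gradient F ((u : En n) + t • w)) (hess F u w) 0 := by
    have h3 : HasDerivAt (fun t : ℝ => (u : En n) + t • w) w 0 := by
      simpa using ((hasDerivAt_id (0 : ℝ)).smul_const w).const_add (u : En n)
    have h4 : HasFDerivAt (gradient F) (hess F u) ((u : En n) + (0 : ℝ) • w) := by
      simpa using F.hasFDerivAt_gradient (Sph.ne_zero u)
    exact h4.comp_hasDerivAt (0 : ℝ) h3
  have h5 := (hasDerivAt_iff_tendsto_slope_zero.1 h2).mono_left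
    (nhdsWithin_mono (0 : ℝ) (s := Set.Ioi 0) fun t ht => ne_of_gt ht)
  have h7 : ∀ᶠ t : ℝ in 𝓝[>] 0, (u : En n) + t • w ≠ 0 := by
    have h8 : Tendsto (fun t : ℝ => (u : En n) + t • w) (𝓝[>] 0) (𝓝 ((u : En n) + (0 : ℝ) • w)) :=
      (Continuous.tendsto (by fun_prop) 0).mono_left nhdsWithin_le_nhds
    rw [zero_smul, add_zero] at h8
    exact h8.eventually_ne (Sph.ne_zero u)
  have h9 : hess F u w = 0 := by
    refine tendsto_nhds_unique h5 (tendsto_const_nhds.congr' ?_)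
    filter_upwards [Ioo_mem_nhdsGT (zero_lt_one' ℝ), h7] with t ht hne
    rw [zero_add, zero_smul, add_zero, F.gradient_eq_of_touch hne hall (hseg t ht), ← hp, sub_self,
      smul_zero]
  have h10 : w - ⟪(u : En n), w⟫_ℝ • (u : En n) = 0 := by
    by_contra h
    have := hpos u _ (inner_perp u w) h
    rw [← F.hess_perp u w, h9, inner_zero_left] at this
    exact lt_irrefl _ this
  set c := ⟪(u : En n), w⟫_ℝ with hc
  have hvu : (v : En n) = (1 + c) • (u : En n) := by
    rw [add_smul, one_smul, ← sub_eq_zero.1 h10, hw]; abel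
  have hc1 : 0 < 1 + c := by
    have h11 := hF0 v
    rw [← hvp, hvu, real_inner_smul_left, hup] at h11
    exact pos_of_mul_pos_left h11 (hF0 u).le
  have hc2 : 1 + c = 1 := by
    have h12 := Sph.norm v
    rwa [hvu, norm_smul, Sph.norm, mul_one, Real.norm_of_nonneg hc1.le] at h12
  rw [hc2, one_smul] at hvu
  rw [← norm_smul_unitv x hx, ← norm_smul_unitv y hy, ← hn, ← hu, ← hv, hvu]

theorem image_norm_smul_gradient (hK : ∀ x, supp K x = F x)
    (hF0 : ∀ u : Sph n, 0 < F u) :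
    (fun x => ‖x‖ • gradient F x) '' (closedBall 0 1 \ {0}) = (K : Set (En n)) \ {0} := by
  have hsub : ∀ x y, F (x + y) ≤ F x + F y := fun x y => by
    rw [← hK, ← hK, ← hK]; exact supp_add_le K x y
  have hF : ∀ x, x ≠ 0 → 0 < F x := fun x hx => by
    rw [← norm_smul_unitv x hx, F.homog (norm_pos_iff.2 hx)]
    exact mul_pos (norm_pos_iff.2 hx) (hF0 _)
  have hFn : ∀ x, 0 ≤ F x := fun x => by
    by_cases hx : x = 0
    · rw [hx, F.map_zero]
    · exact (hF x hx).le
  apply Set.Subset.antisymm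
  · rintro _ ⟨x, ⟨hx1, hx0⟩, rfl⟩
    have hx0 : x ≠ 0 := hx0
    have hx1 : ‖x‖ ≤ 1 := by simpa using hx1
    refine ⟨mem_of_inner_le_supp fun z => ?_, fun h => ?_⟩
    · rw [hK, real_inner_smul_right]
      calc ‖x‖ * ⟪z, gradient F x⟫_ℝ ≤ ‖x‖ * F z :=
            mul_le_mul_of_nonneg_left (F.inner_gradient_le hsub hx0 z) (norm_nonneg _)
        _ ≤ 1 * F z := mul_le_mul_of_nonneg_right hx1 (hFn z)
        _ = F z := one_mul _
    · have h1 : ‖x‖ • gradient F x = 0 := h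
      have h2 := congrArg (fun z => ⟪z, x⟫_ℝ) h1
      simp only [real_inner_smul_left, inner_zero_left, F.inner_gradient_self hx0] at h2
      exact (mul_pos (norm_pos_iff.2 hx0) (hF x hx0)).ne' h2
  · rintro y ⟨hyK, hy0⟩
    have hy0 : y ≠ 0 := hy0
    have hcont : Continuous fun u : Sph n => ⟪(u : En n), y⟫_ℝ / F u :=
      (by fun_prop : Continuous fun u : Sph n => ⟪(u : En n), y⟫_ℝ).div F.continuous_sph
        fun u => (hF0 u).ne'
    obtain ⟨u, -, hu⟩ := isCompact_univ.exists_isMaxOn (⟨unitv y hy0, trivial⟩)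
      hcont.continuousOn
    have hu : ∀ v : Sph n, ⟪(v : En n), y⟫_ℝ / F v ≤ ⟪(u : En n), y⟫_ℝ / F u := fun v =>
      hu (Set.mem_univ v)
    set r := ⟪(u : En n), y⟫_ℝ / F u with hr
    have hyp : 0 < ‖y‖ := norm_pos_iff.2 hy0
    have hr0 : 0 < r := by
      refine lt_of_lt_of_le (div_pos ?_ (hF0 (unitv y hy0))) (hu (unitv y hy0))
      rw [unitv_coe, real_inner_smul_left]
      exact mul_pos (inv_pos.2 hyp) (real_inner_self_pos.2 hy0)
    have hr1 : r ≤ 1 := by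
      rw [hr, div_le_one (hF0 u), ← hK]
      exact inner_le_supp hyK _
    have hru : r * F u = ⟪(u : En n), y⟫_ℝ := div_mul_cancel₀ _ (hF0 u).ne'
    have hall : ∀ z, ⟪z, r⁻¹ • y⟫_ℝ ≤ F z := by
      intro z
      by_cases hz : z = 0
      · rw [hz, inner_zero_left, F.map_zero]
      · have h1 := hu (unitv z hz)
        rw [div_le_iff₀ (hF0 _)] at h1
        rw [real_inner_smul_right, inv_mul_le_iff₀ hr0]
        have hzp := norm_pos_iff.2 hz
        rw [← norm_smul_unitv z hz, F.homog hzp, real_inner_smul_left]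
        nlinarith
    have htouch : ⟪(u : En n), r⁻¹ • y⟫_ℝ = F u := by
      rw [real_inner_smul_right, ← hru, inv_mul_cancel_left₀ hr0.ne']
    have hg := F.gradient_eq_of_touch (Sph.ne_zero u) hall htouch
    refine ⟨r • (u : En n), ⟨?_, smul_ne_zero hr0.ne' (Sph.ne_zero u)⟩, ?_⟩
    · simpa [norm_smul, abs_of_pos hr0] using hr1
    · simp only
      rw [F.gradient_smul_arg hr0 (Sph.ne_zero u), hg, norm_smul, Sph.norm, mul_one,
        Real.norm_of_nonneg hr0.le, smul_smul, mul_inv_cancel₀ hr0.ne', one_smul]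

theorem integral_closedBall_polar (hn : 0 < n) (G : En n → ℝ) :
    ∫ x in closedBall (0 : En n) 1, G (‖x‖⁻¹ • x) =
      (volume (closedBall (0 : En n) 1)).toReal * ∫ u, G u ∂sg n := by
  have key : ∀ G : En n → ℝ, ∫ x in closedBall (0 : En n) 1, G (‖x‖⁻¹ • x) =
      (∫ u : Sph n, G u ∂(sphVol n)) *
        ∫ r in Set.Ioi (0 : ℝ), r ^ (n - 1) * (Set.Iic (1 : ℝ)).indicator 1 r := by
    intro G
    rw [← integral_polar hn, ← integral_indicator measurableSet_closedBall]
    refine integral_congr_all fun x => ?_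
    by_cases hx : ‖x‖ ≤ 1
    · simp [Set.indicator, hx]
    · simp [Set.indicator, hx]
  have h1 := key fun _ => 1
  rw [setIntegral_const, integral_const] at h1
  simp only [smul_eq_mul, mul_one] at h1
  rw [key G, integral_sphVol hn]
  change (volume (closedBall (0 : En n) 1)).toReal = (sphVol n Set.univ).toReal * _ at h1
  rw [h1]; ring

theorem volume_eq_of_strict (hn : 0 < n) (hK : ∀ x, supp K x = F x) (hF0 : ∀ u : Sph n, 0 < F u)
    (hpos : ∀ (u : Sph n) (w : En n), ⟪(u : En n), w⟫_ℝ = 0 → w ≠ 0 → 0 < ⟪hess F u w, w⟫_ℝ) :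
    (volume (K : Set (En n))).toReal =
      (volume (closedBall (0 : En n) 1)).toReal * mixV n (fun _ => F) := by
  have : Nonempty (Fin n) := ⟨⟨0, hn⟩⟩
  set s : Set (En n) := closedBall 0 1 \ {0} with hs
  have hms : MeasurableSet s := measurableSet_closedBall.diff (measurableSet_singleton 0)
  have h1 := integral_image_eq_integral_abs_det_fderiv_smul (volume : Measure (En n)) hms
    (f := fun x => ‖x‖ • gradient F x)
    (f' := fun x => hess F (‖x‖⁻¹ • x) + rk (gradient F (‖x‖⁻¹ • x)) (‖x‖⁻¹ • x))
    (fun x hx => (hasFDerivAt_norm_smul_gradient F hx.2).hasFDerivWithinAt)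
    ((injOn_norm_smul_gradient hK hF0 hpos).mono fun x hx => hx.2) (fun _ => (1 : ℝ))
  rw [image_norm_smul_gradient hK hF0, setIntegral_const] at h1
  simp only [smul_eq_mul, mul_one] at h1
  have h2 : volume ((K : Set (En n)) \ {0}) = volume (K : Set (En n)) :=
    measure_sdiff_null (measure_singleton 0)
  rw [Measure.real, h2] at h1
  rw [h1]
  have h3 : ∫ x in s, |(hess F (‖x‖⁻¹ • x) +
      rk (gradient F (‖x‖⁻¹ • x)) (‖x‖⁻¹ • x)).det| =
      ∫ x in closedBall (0 : En n) 1, |(hess F (‖x‖⁻¹ • x) +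
        rk (gradient F (‖x‖⁻¹ • x)) (‖x‖⁻¹ • x)).det| :=
    setIntegral_congr_set (sdiff_null_ae_eq_self (measure_singleton 0))
  rw [h3, integral_closedBall_polar hn fun y => |(hess F y + rk (gradient F y) y).det|, mixV_apply]
  congr 1
  refine integral_congr_all fun u => ?_
  rw [det_hess_add_rk, mdisc_diag, abs_of_pos]
  refine det_pos_of_inner_pos _ fun w hw => ?_
  rw [sop_inner_self, F.hess_perp u w]
  by_cases h : w - ⟪(u : En n), w⟫_ℝ • (u : En n) = 0
  · rw [h, inner_zero_right, add_zero]
    have h4 : ⟪(u : En n), w⟫_ℝ ≠ 0 := fun h5 => hw (by rw [sub_eq_zero.1 h, h5, zero_smul])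
    have := hF0 u
    positivity
  · have h4 := hpos u _ (inner_perp u w) h
    have h5 := mul_nonneg (hF0 u).le (sq_nonneg ⟪(u : En n), w⟫_ℝ)
    linarith

end strict

theorem mixV_add_lin (hn : 2 ≤ n) (F : Fin n → HF n) (a : Fin n → En n) :
    mixV n (fun j => F j + lin (a j)) = mixV n F := by
  classical
  have h := (mixV n).map_add_univ F (fun j => lin (a j))
  change mixV n (fun j => F j + lin (a j)) = _ at h
  rw [h, Finset.sum_eq_single Finset.univ]
  · simp
  · intro s _ hs
    obtain ⟨l, hl⟩ : ∃ l, l ∉ s := by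
      by_contra hc
      push Not at hc
      exact hs (Finset.eq_univ_iff_forall.2 hc)
    have : s.piecewise F (fun j => lin (a j)) =
        update (s.piecewise F (fun j => lin (a j))) l (lin (a l)) := by
      rw [eq_comm, Function.update_eq_self_iff, Finset.piecewise_eq_of_notMem _ _ _ hl]
    rw [this, mixV_lin hn]
  · simp

theorem tendsto_mixV (F G : Fin n → HF n) :
    Tendsto (fun t : ℝ => mixV n (fun j => F j + t • G j)) (𝓝 0) (𝓝 (mixV n F)) := by
  classical
  have h : ∀ t : ℝ, mixV n (fun j => F j + t • G j) =
      ∑ s : Finset (Fin n), t ^ s.card * mixV n (s.piecewise G F) := by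
    intro t
    have h1 := (mixV n).map_add_univ (fun j => t • G j) F
    have h2 : (fun j => F j + t • G j) = (fun j => t • G j) + F := by
      funext j; exact add_comm _ _
    rw [h2, h1]
    refine Finset.sum_congr rfl fun s _ => ?_
    have h3 := (mixV n).map_piecewise_smul (fun _ => t) (s.piecewise G F) s
    rw [Finset.prod_const, smul_eq_mul] at h3
    rw [← h3]
    congr 1
    funext j
    by_cases hj : j ∈ s <;> simp [hj]
  simp only [h]
  have hc : Continuous fun t : ℝ => ∑ s : Finset (Fin n), t ^ s.card * mixV n (s.piecewise G F) := by
    fun_prop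
  have h0 := hc.tendsto 0
  rw [← h 0] at h0
  have e : (fun j => F j + (0 : ℝ) • G j) = F := by funext j; simp
  rwa [e] at h0

theorem coe_scale_ballB {t : ℝ} (ht : 0 ≤ t) :
    ((scale t (ballB n) : ConvexBody (En n)) : Set (En n)) = closedBall 0 t := by
  change t • closedBall (0 : En n) 1 = _
  rw [_root_.smul_closedBall _ _ zero_le_one, smul_zero, Real.norm_of_nonneg ht, mul_one]

theorem coe_add_scale_ballB (K : ConvexBody (En n)) {t : ℝ} (ht : 0 ≤ t) :
    ((K + scale t (ballB n) : ConvexBody (En n)) : Set (En n)) = cthickening t K := by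
  rw [ConvexBody.coe_add, coe_scale_ballB ht, K.isCompact.add_closedBall_zero ht]

theorem tendsto_volume_add_ball (K : ConvexBody (En n)) :
    Tendsto (fun t : ℝ => (volume ((K + scale t (ballB n) : ConvexBody (En n)) : Set (En n))).toReal)
      (𝓝[>] 0) (𝓝 (volume (K : Set (En n))).toReal) := by
  have h1 := (tendsto_measure_cthickening_of_isCompact (μ := (volume : Measure (En n)))
    K.isCompact).mono_left (nhdsWithin_le_nhds (s := Set.Ioi 0))
  have h2 := (ENNReal.tendsto_toReal K.isCompact.measure_lt_top.ne).comp h1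
  refine h2.congr' ?_
  filter_upwards [self_mem_nhdsWithin] with t ht
  rw [coe_add_scale_ballB K (le_of_lt ht)]
  rfl

theorem supp_scale_ballB {t : ℝ} (ht : 0 ≤ t) (x : En n) :
    supp (scale t (ballB n)) x = t * ‖x‖ := by
  rw [supp_scale, supp_smul_arg _ ht, supp_ballB]

theorem inner_prj_pos {u : Sph n} {w : En n} (h : ⟪(u : En n), w⟫_ℝ = 0) (hw : w ≠ 0) :
    0 < ⟪prj (u : En n) w, w⟫_ℝ := by
  rw [prj_apply, h, zero_smul, sub_zero]
  exact real_inner_self_pos.2 hw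

theorem volume_eq (hn : 2 ≤ n) {K : ConvexBody (En n)} {F : HF n} (hK : ∀ x, supp K x = F x) :
    (volume (K : Set (En n))).toReal =
      (volume (closedBall (0 : En n) 1)).toReal * mixV n (fun _ => F) := by
  obtain ⟨y, hy⟩ := K.nonempty
  set K' := translate K (-y) with hK'
  set F' : HF n := F + lin (-y) with hF'
  have hs : ∀ x, supp K' x = F' x := fun x => by
    rw [hK', supp_translate, hK, hF', HF.coe_add]
    simp [real_inner_comm, add_comm]
  have h0 : ∀ x, 0 ≤ F' x := fun x => by
    rw [← hs, ← inner_zero_right x]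
    refine inner_le_supp (show (0 : En n) ∈ (K' : Set (En n)) from ⟨y, hy, ?_⟩) x
    simp
  have hsub : ∀ x y, F' (x + y) ≤ F' x + F' y := fun x y => by
    rw [← hs, ← hs, ← hs]; exact supp_add_le K' x y
  have hvol : volume (K' : Set (En n)) = volume (K : Set (En n)) := by
    change volume ((fun z => -y + z) '' (K : Set (En n))) = _
    rw [Set.image_add_left, measure_preimage_add]
  have hmix : mixV n (fun _ => F') = mixV n (fun _ => F) :=
    mixV_add_lin hn (fun _ => F) (fun _ => -y)
  rw [← hvol, ← hmix]
  have h1 := tendsto_volume_add_ball K'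
  have h2 := ((tendsto_mixV (fun _ => F') (fun _ => nrm n)).mono_left
    (nhdsWithin_le_nhds (s := Set.Ioi (0 : ℝ)))).const_mul
    (volume (closedBall (0 : En n) 1)).toReal
  refine tendsto_nhds_unique h1 (h2.congr' ?_)
  filter_upwards [self_mem_nhdsWithin] with t ht
  have ht : (0 : ℝ) < t := ht
  refine (volume_eq_of_strict (by omega) (fun x => ?_) (fun u => ?_) (fun u w huw hw => ?_)).symm
  · rw [supp_add, supp_scale_ballB ht.le, hs]
    rfl
  · change 0 < F' u + t * ‖(u : En n)‖
    rw [Sph.norm]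
    linarith [h0 u]
  · have hu0 := Sph.ne_zero u
    rw [HF.hess_add _ _ hu0, HF.hess_smul _ _ hu0, hess_nrm]
    have a1 := F'.hess_nonneg hsub hu0 w
    have a2 := inner_prj_pos huw hw
    simp only [add_apply, smul_apply, inner_add_left, real_inner_smul_left]
    positivity

theorem mixedVol_eq (hn : 2 ≤ n) {K : Fin n → ConvexBody (En n)} {F : Fin n → HF n}
    (hK : ∀ j x, supp (K j) x = F j x) :
    mixedVol K = (volume (closedBall (0 : En n) 1)).toReal * mixV n F := by
  have h1 : ∀ S : Finset (Fin n),
      (volume ((∑ k ∈ S, K k : ConvexBody (En n)) : Set (En n))).toReal =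
        (volume (closedBall (0 : En n) 1)).toReal * mixV n (fun _ => 0 + ∑ k ∈ S, F k) := by
    intro S
    refine volume_eq hn fun x => ?_
    rw [supp_sum, zero_add, HF.coe_sum]
    exact Finset.sum_congr rfl fun k _ => hK k x
  simp only [mixedVol, h1]
  have h2 := polarization (mixV n) 0 F
  have h3 : ∑ S : Finset (Fin n), (-1 : ℝ) ^ (n - S.card) *
      ((volume (closedBall (0 : En n) 1)).toReal * mixV n (fun _ => 0 + ∑ k ∈ S, F k)) =
      (volume (closedBall (0 : En n) 1)).toReal * ((n.factorial : ℝ) * mixV n F) := by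
    simp only [mixV_perm, Finset.sum_const, Finset.card_univ, Fintype.card_perm, Fintype.card_fin,
      nsmul_eq_mul] at h2
    rw [← h2, Finset.mul_sum]
    exact Finset.sum_congr rfl fun S _ => by ring
  rw [h3]
  have : (n.factorial : ℝ) ≠ 0 := by positivity
  field_simp

theorem volume_ball_pos : 0 < (volume (closedBall (0 : En n) 1)).toReal :=
  ENNReal.toReal_pos (measure_closedBall_pos _ _ one_pos).ne'
    (isCompact_closedBall (0 : En n) 1).measure_lt_top.ne

theorem hasDerivAt_max_pow (k : ℕ) (t : ℝ) :
    HasDerivAt (fun t : ℝ => max t 0 ^ (k + 2)) ((k + 2) * max t 0 ^ (k + 1)) t := by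
  have hne : ∀ t : ℝ, t ≠ 0 →
      HasDerivAt (fun t : ℝ => max t 0 ^ (k + 2)) ((k + 2) * max t 0 ^ (k + 1)) t := by
    intro t ht
    rcases lt_or_gt_of_ne ht with h | h
    · have h1 : (fun t : ℝ => max t 0 ^ (k + 2)) =ᶠ[𝓝 t] fun _ => 0 := by
        filter_upwards [Iio_mem_nhds h] with s hs
        rw [max_eq_right (le_of_lt hs), zero_pow (by omega)]
      rw [max_eq_right h.le, zero_pow (by omega), mul_zero]
      exact (hasDerivAt_const t (0 : ℝ)).congr_of_eventuallyEq h1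
    · have h1 : (fun t : ℝ => max t 0 ^ (k + 2)) =ᶠ[𝓝 t] fun t => t ^ (k + 2) := by
        filter_upwards [Ioi_mem_nhds h] with s hs
        rw [max_eq_left (le_of_lt hs)]
      rw [max_eq_left h.le]
      have h2 := hasDerivAt_pow (k + 2) t
      push_cast at h2
      exact h2.congr_of_eventuallyEq h1
  by_cases ht : t = 0
  · subst ht
    exact hasDerivAt_of_hasDerivAt_of_ne (fun y hy => hne y hy)
      (by fun_prop) (g := fun t => ((k : ℝ) + 2) * max t 0 ^ (k + 1)) (by fun_prop)
  · exact hne t ht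

theorem contDiff_max_pow (m k : ℕ) : ContDiff ℝ m (fun t : ℝ => max t 0 ^ (m + k + 1)) := by
  induction m generalizing k with
  | zero => exact contDiff_zero.2 (by fun_prop)
  | succ m ih =>
    push_cast
    rw [contDiff_succ_iff_deriv]
    have hd : ∀ t, HasDerivAt (fun t : ℝ => max t 0 ^ (m + 1 + k + 1))
        (((m + k : ℕ) + 2) * max t 0 ^ (m + k + 1)) t := fun t => by
      have h := hasDerivAt_max_pow (m + k) t
      rwa [show m + k + 2 = m + 1 + k + 1 by ring] at h
    refine ⟨fun t => (hd t).differentiableAt, by simp, ?_⟩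
    rw [funext fun t => (hd t).deriv]
    exact contDiff_const.mul (ih k)

/-- The convex body with given sublinear support function of class `C²`. -/
def bodyOf (hn : 0 < n) (F : HF n) (hF : ∀ x y, F (x + y) ≤ F x + F y) : ConvexBody (En n) where
  carrier := {y | ∀ x, ⟪x, y⟫_ℝ ≤ F x}
  convex' := by
    have : {y | ∀ x, ⟪x, y⟫_ℝ ≤ F x} = ⋂ x, {y : En n | ⟪x, y⟫_ℝ ≤ F x} := by ext; simp
    rw [this]
    exact convex_iInter fun x => convex_halfSpace_le (innerSL ℝ x).isLinear _
  isCompact' := by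
    obtain ⟨C, hC, h1, -, -⟩ := F.exists_bound
    refine (isCompact_closedBall (0 : En n) C).of_isClosed_subset ?_ fun y hy => ?_
    · rw [Set.ofPred_forall]
      exact isClosed_iInter fun x => isClosed_le (by fun_prop) continuous_const
    · have h2 : ‖y‖ ^ 2 ≤ C * ‖y‖ := by
        rw [← real_inner_self_eq_norm_sq]
        exact (hy y).trans ((le_abs_self _).trans (h1 y))
      rw [mem_closedBall_zero_iff]
      by_contra hc
      push Not at hc
      nlinarith [norm_nonneg y]
  nonempty' := by
    have hp : pole n ≠ 0 := norm_ne_zero_iff.1 (by rw [norm_pole hn]; norm_num)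
    exact ⟨gradient F (pole n), fun x => F.inner_gradient_le hF hp x⟩

theorem supp_bodyOf (hn : 0 < n) (F : HF n) (hF : ∀ x y, F (x + y) ≤ F x + F y) (x : En n) :
    supp (bodyOf hn F hF) x = F x := by
  refine le_antisymm (supp_le fun y hy => hy x) ?_
  by_cases hx : x = 0
  · obtain ⟨y, -, h⟩ := exists_supp_eq (bodyOf hn F hF) x
    rw [← h, hx, F.map_zero, inner_zero_left]
  · have h1 := inner_le_supp (K := bodyOf hn F hF) (y := gradient F x)
      (fun z => F.inner_gradient_le hF hx z) x
    rwa [real_inner_comm, F.inner_gradient_self hx] at h1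

section smoothing

variable (T : Finset (En n)) (δ : ℝ)

/-- The terms of a smoothed maximum of finitely many linear functions. -/
def smTerm (o : Option T) (x : En n) : ℝ :=
  o.elim (δ * ‖x‖) fun y => max ⟪x, y⟫_ℝ 0

theorem smTerm_nonneg (hδ : 0 < δ) (o : Option T) (x : En n) : 0 ≤ smTerm T δ o x := by
  cases o with
  | none => exact mul_nonneg hδ.le (norm_nonneg x)
  | some y => exact le_max_right _ _

theorem smTerm_add (hδ : 0 < δ) (o : Option T) (x z : En n) :
    smTerm T δ o (x + z) ≤ smTerm T δ o x + smTerm T δ o z := by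
  cases o with
  | none =>
    change δ * ‖x + z‖ ≤ δ * ‖x‖ + δ * ‖z‖
    rw [← mul_add]
    exact mul_le_mul_of_nonneg_left (norm_add_le x z) hδ.le
  | some y =>
    change max ⟪x + z, y⟫_ℝ 0 ≤ max ⟪x, y⟫_ℝ 0 + max ⟪z, y⟫_ℝ 0
    rw [inner_add_left]
    exact max_add_add_le_max_add_max.trans_eq' (by rw [add_zero])

theorem smTerm_smul {c : ℝ} (hc : 0 < c) (o : Option T) (x : En n) :
    smTerm T δ o (c • x) = c * smTerm T δ o x := by
  cases o with
  | none =>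
    change δ * ‖c • x‖ = c * (δ * ‖x‖)
    rw [norm_smul, Real.norm_of_nonneg hc.le]; ring
  | some y =>
    change max ⟪c • x, y⟫_ℝ 0 = c * max ⟪x, y⟫_ℝ 0
    rw [real_inner_smul_left, mul_max_of_nonneg _ _ hc.le, mul_zero]

theorem smSum_pos (hδ : 0 < δ) (p : ℕ) {x : En n} (hx : x ≠ 0) :
    0 < ∑ o : Option T, smTerm T δ o x ^ p := by
  rw [Fintype.sum_option]
  refine add_pos_of_pos_of_nonneg (pow_pos (mul_pos hδ (norm_pos_iff.2 hx)) _)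
    (Finset.sum_nonneg fun o _ => pow_nonneg (smTerm_nonneg T δ hδ _ x) _)

/-- A smoothed maximum of finitely many linear functions. -/
def smHF (hδ : 0 < δ) (k : ℕ) : HF n :=
  ⟨fun x => (∑ o : Option T, smTerm T δ o x ^ (k + 3)) ^ ((1 : ℝ) / (k + 3 : ℕ)), by
    intro x hx
    have hx : x ≠ 0 := hx
    have h1 : ContDiffAt ℝ 2 (fun x : En n => ∑ o : Option T, smTerm T δ o x ^ (k + 3)) x := by
      refine ContDiffAt.sum fun o _ => ?_
      cases o with
      | none => exact ((contDiffAt_norm ℝ hx).const_smul δ).pow _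
      | some y =>
        have h1 := contDiff_max_pow 2 k
        rw [show 2 + k + 1 = k + 3 by ring] at h1
        exact (h1.comp (f := fun x : En n => ⟪x, y⟫_ℝ)
          (contDiff_id.inner ℝ contDiff_const)).contDiffAt
    exact (h1.rpow_const_of_ne (smSum_pos T δ hδ (k + 3) hx).ne').contDiffWithinAt, by
    intro c hc x
    simp only [smTerm_smul T δ hc, mul_pow, ← Finset.mul_sum]
    rw [Real.mul_rpow (by positivity) (Finset.sum_nonneg fun o _ =>
      pow_nonneg (smTerm_nonneg T δ hδ _ x) _), ← Real.rpow_natCast, ← Real.rpow_mul hc.le,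
      mul_one_div_cancel (by positivity), Real.rpow_one]⟩

theorem smHF_apply (hδ : 0 < δ) (k : ℕ) (x : En n) : smHF T δ hδ k x =
    (∑ o : Option T, smTerm T δ o x ^ (k + 3)) ^ ((1 : ℝ) / (k + 3 : ℕ)) := rfl

theorem smHF_add_le (hδ : 0 < δ) (k : ℕ) (x z : En n) :
    smHF T δ hδ k (x + z) ≤ smHF T δ hδ k x + smHF T δ hδ k z := by
  have hp : (1 : ℝ) ≤ (k + 3 : ℕ) := by push_cast; linarith [(Nat.cast_nonneg k : (0 : ℝ) ≤ k)]
  have h := Real.Lp_add_le_of_nonneg (s := (Finset.univ : Finset (Option T)))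
    (f := fun o => smTerm T δ o x) (g := fun o => smTerm T δ o z) hp
    (fun o _ => smTerm_nonneg T δ hδ o x) (fun o _ => smTerm_nonneg T δ hδ o z)
  simp only [Real.rpow_natCast] at h
  refine le_trans ?_ h
  rw [smHF_apply]
  refine Real.rpow_le_rpow (Finset.sum_nonneg fun o _ => pow_nonneg (smTerm_nonneg T δ hδ _ _) _)
    (Finset.sum_le_sum fun o _ => pow_le_pow_left₀ (smTerm_nonneg T δ hδ _ _)
      (smTerm_add T δ hδ o x z) _) (by positivity)

theorem le_smHF (hδ : 0 < δ) (k : ℕ) (o : Option T) (x : En n) :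
    smTerm T δ o x ≤ smHF T δ hδ k x := by
  have h1 : smTerm T δ o x ^ (k + 3) ≤ ∑ o : Option T, smTerm T δ o x ^ (k + 3) :=
    Finset.single_le_sum (f := fun o => smTerm T δ o x ^ (k + 3))
      (fun o _ => pow_nonneg (smTerm_nonneg T δ hδ _ _) _) (Finset.mem_univ o)
  have h0 := smTerm_nonneg T δ hδ o x
  rw [smHF_apply]
  calc smTerm T δ o x = (smTerm T δ o x ^ (k + 3)) ^ ((1 : ℝ) / (k + 3 : ℕ)) := by
        rw [← Real.rpow_natCast, ← Real.rpow_mul h0, mul_one_div_cancel (by positivity),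
          Real.rpow_one]
    _ ≤ _ := Real.rpow_le_rpow (by positivity) h1 (by positivity)

theorem smHF_le (hδ : 0 < δ) (k : ℕ) {x : En n} {b c : ℝ} (hb : 0 ≤ b) (hc : 0 ≤ c)
    (h : ∀ o, smTerm T δ o x ≤ b) (hck : (T.card : ℝ) ≤ (k + 3 : ℕ) * c) :
    smHF T δ hδ k x ≤ (1 + c) * b := by
  have h1 : ∑ o : Option T, smTerm T δ o x ^ (k + 3) ≤ ((1 + c) * b) ^ (k + 3) := by
    calc ∑ o : Option T, smTerm T δ o x ^ (k + 3) ≤ ∑ o : Option T, b ^ (k + 3) :=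
          Finset.sum_le_sum fun o _ => pow_le_pow_left₀ (smTerm_nonneg T δ hδ _ _) (h o) _
      _ = (T.card + 1) * b ^ (k + 3) := by
          rw [Finset.sum_const, Finset.card_univ, Fintype.card_option, Fintype.card_coe]
          simp
      _ ≤ (1 + c) ^ (k + 3) * b ^ (k + 3) := by
          refine mul_le_mul_of_nonneg_right ?_ (by positivity)
          have := one_add_mul_le_pow (by linarith : (-2 : ℝ) ≤ c) (k + 3)
          linarith
      _ = _ := (mul_pow _ _ _).symm
  have h0 : 0 ≤ (1 + c) * b := by positivity
  rw [smHF_apply]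
  calc _ ≤ (((1 + c) * b) ^ (k + 3)) ^ ((1 : ℝ) / (k + 3 : ℕ)) :=
        Real.rpow_le_rpow (Finset.sum_nonneg fun o _ => pow_nonneg (smTerm_nonneg T δ hδ _ _) _)
          h1 (by positivity)
    _ = _ := by
        rw [← Real.rpow_natCast, ← Real.rpow_mul h0, mul_one_div_cancel (by positivity),
          Real.rpow_one]

end smoothing

theorem exists_smooth_approx_of_zero_mem (hn : 0 < n) {L : ConvexBody (En n)}
    (h0 : (0 : En n) ∈ L) {ε : ℝ} (hε : 0 < ε) : ∃ (M : ConvexBody (En n)) (F : HF n),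
      (∀ x, supp M x = F x) ∧ ∀ x, supp L x ≤ F x ∧ F x ≤ supp L x + ε * ‖x‖ := by
  set δ := ε / 3 with hδ
  have hδ0 : 0 < δ := by positivity
  obtain ⟨t, htL, htf, hcov⟩ := L.isCompact.finite_cover_balls hδ0
  obtain ⟨R, hR⟩ := L.isCompact.isBounded.exists_norm_le
  have hR0 : 0 ≤ R := (norm_nonneg _).trans (hR 0 h0)
  set T := htf.toFinset with hT
  set c := δ / (R + δ) with hc
  have hc0 : 0 < c := by positivity
  obtain ⟨k, hk⟩ := exists_nat_ge ((T.card : ℝ) / c)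
  have hck : (T.card : ℝ) ≤ (k + 3 : ℕ) * c := by
    rw [div_le_iff₀ hc0] at hk
    refine hk.trans (mul_le_mul_of_nonneg_right ?_ hc0.le)
    push_cast; linarith
  set G : HF n := smHF T δ hδ0 k with hG
  have hsL : ∀ x, 0 ≤ supp L x := fun x => by
    have := inner_le_supp h0 x; rwa [inner_zero_right] at this
  have hLR : ∀ x, supp L x ≤ R * ‖x‖ := fun x => supp_le fun y hy => by
    calc ⟪x, y⟫_ℝ ≤ ‖x‖ * ‖y‖ := real_inner_le_norm x y
      _ ≤ ‖x‖ * R := mul_le_mul_of_nonneg_left (hR y hy) (norm_nonneg x)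
      _ = _ := mul_comm _ _
  have hup : ∀ x, G x ≤ (1 + c) * (supp L x + δ * ‖x‖) := by
    intro x
    refine smHF_le T δ hδ0 k (by have := hsL x; positivity) hc0.le (fun o => ?_) hck
    cases o with
    | none =>
      change δ * ‖x‖ ≤ _
      linarith [hsL x]
    | some y =>
      have hy : (y : En n) ∈ L := htL (htf.mem_toFinset.1 y.2)
      have h1 := inner_le_supp hy x
      have h2 : 0 ≤ δ * ‖x‖ := by positivity
      change max ⟪x, y⟫_ℝ 0 ≤ _
      exact max_le (by linarith) (by linarith [hsL x])
  have hlow : ∀ x, supp L x ≤ G x + δ * ‖x‖ := by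
    intro x
    refine supp_le fun y hy => ?_
    obtain ⟨z, hz, hyz⟩ := Set.mem_iUnion₂.1 (hcov hy)
    have hzT : z ∈ T := htf.mem_toFinset.2 hz
    have h1 := le_smHF T δ hδ0 k (some ⟨z, hzT⟩) x
    have h2 : ⟪x, z⟫_ℝ ≤ smTerm T δ (some ⟨z, hzT⟩) x := le_max_left _ _
    have h3 : ⟪x, y - z⟫_ℝ ≤ ‖x‖ * δ := (real_inner_le_norm x _).trans
      (mul_le_mul_of_nonneg_left (by rw [← dist_eq_norm]; exact (mem_ball.1 hyz).le)
        (norm_nonneg x))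
    rw [inner_sub_right] at h3
    linarith
  have hsub : ∀ x y, (G + δ • nrm n : HF n) (x + y) ≤
      (G + δ • nrm n : HF n) x + (G + δ • nrm n : HF n) y := by
    intro x y
    have h1 := smHF_add_le T δ hδ0 k x y
    have h2 := mul_le_mul_of_nonneg_left (norm_add_le x y) hδ0.le
    change G (x + y) + δ * ‖x + y‖ ≤ (G x + δ * ‖x‖) + (G y + δ * ‖y‖)
    linarith
  refine ⟨bodyOf hn (G + δ • nrm n) hsub, G + δ • nrm n, supp_bodyOf hn _ hsub, fun x => ⟨?_, ?_⟩⟩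
  · exact hlow x
  · have h1 := hup x
    have h2 : c * (supp L x + δ * ‖x‖) ≤ δ * ‖x‖ := by
      calc c * (supp L x + δ * ‖x‖) ≤ c * ((R + δ) * ‖x‖) :=
            mul_le_mul_of_nonneg_left (by linarith [hLR x]) hc0.le
        _ = δ * ‖x‖ := by rw [hc]; field_simp
    change G x + δ * ‖x‖ ≤ _
    have h3 : ε = 3 * δ := by rw [hδ]; ring
    rw [h3]
    nlinarith

theorem exists_smooth_approx (hn : 0 < n) (L : ConvexBody (En n)) {ε : ℝ} (hε : 0 < ε) :
    ∃ (M : ConvexBody (En n)) (F : HF n),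
      (∀ x, supp M x = F x) ∧ ∀ x, supp L x ≤ F x ∧ F x ≤ supp L x + ε * ‖x‖ := by
  obtain ⟨y, hy⟩ := L.nonempty
  have h0 : (0 : En n) ∈ translate L (-y) :=
    show (0 : En n) ∈ (translate L (-y) : Set (En n)) from ⟨y, hy, by simp⟩
  obtain ⟨M, F, h1, h2⟩ := exists_smooth_approx_of_zero_mem hn h0 hε
  refine ⟨translate M y, F + lin y, fun x => ?_, fun x => ?_⟩
  · rw [supp_translate, h1, HF.coe_add, lin_apply, real_inner_comm, add_comm]
  · have := h2 x
    rw [supp_translate, inner_neg_right] at this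
    rw [HF.coe_add, lin_apply, real_inner_comm]
    constructor <;> linarith

theorem supp_sub_le (K : ConvexBody (En n)) :
    ∃ R : ℝ, 0 ≤ R ∧ ∀ x y, supp K x - supp K y ≤ R * ‖x - y‖ := by
  obtain ⟨R, hR⟩ := K.isCompact.isBounded.exists_norm_le
  obtain ⟨y₀, hy₀⟩ := K.nonempty
  refine ⟨R, (norm_nonneg y₀).trans (hR y₀ hy₀), fun x y => ?_⟩
  have h1 : supp K (x - y) ≤ R * ‖x - y‖ := supp_le fun z hz => by
    calc ⟪x - y, z⟫_ℝ ≤ ‖x - y‖ * ‖z‖ := real_inner_le_norm _ _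
      _ ≤ ‖x - y‖ * R := mul_le_mul_of_nonneg_left (hR z hz) (norm_nonneg _)
      _ = R * ‖x - y‖ := mul_comm _ _
  have h2 := supp_add_le K (x - y) y
  rw [sub_add_cancel] at h2
  linarith

theorem continuous_supp (K : ConvexBody (En n)) : Continuous (supp K) := by
  obtain ⟨R, hR, h⟩ := supp_sub_le K
  refine (LipschitzWith.of_dist_le_mul (K := ⟨R, hR⟩) fun x y => ?_).continuous
  rw [Real.dist_eq, dist_eq_norm, abs_le]
  have h1 := h x y
  have h2 := h y x
  rw [norm_sub_rev] at h2
  constructor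
  · change -(R * ‖x - y‖) ≤ _
    linarith
  · exact h1

theorem tendsto_mixedVol {X : Fin n → ConvexBody (En n)} {Y : ℝ → Fin n → ConvexBody (En n)}
    (h : ∀ ε : ℝ, 0 < ε → ∀ k x, supp (X k) x ≤ supp (Y ε k) x ∧
      supp (Y ε k) x ≤ supp (X k) x + ε * ‖x‖) :
    Tendsto (fun ε => mixedVol (Y ε)) (𝓝[>] 0) (𝓝 (mixedVol X)) := by
  refine Tendsto.const_mul _ (tendsto_finsetSum _ fun S _ => Tendsto.const_mul _ ?_)
  have h0 : Tendsto (fun ε : ℝ => S.card * ε + ε) (𝓝[>] 0) (𝓝[>] 0) := by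
    refine tendsto_nhdsWithin_iff.2 ⟨?_, ?_⟩
    · have : Continuous fun ε : ℝ => S.card * ε + ε := by fun_prop
      have h2 := this.tendsto 0
      simp only [mul_zero, add_zero] at h2
      exact h2.mono_left nhdsWithin_le_nhds
    · filter_upwards [self_mem_nhdsWithin] with ε hε
      have hε : (0 : ℝ) < ε := hε
      change (0 : ℝ) < _
      positivity
  have h1 := (tendsto_volume_add_ball (∑ k ∈ S, X k)).comp h0
  refine tendsto_of_tendsto_of_tendsto_of_le_of_le' tendsto_const_nhds h1 ?_ ?_
  · filter_upwards [self_mem_nhdsWithin] with ε hε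
    refine ENNReal.toReal_mono (ConvexBody.isCompact _).measure_lt_top.ne
      (measure_mono (le_of_supp_le fun x => ?_))
    rw [supp_sum, supp_sum]
    exact Finset.sum_le_sum fun k _ => (h ε hε k x).1
  · filter_upwards [self_mem_nhdsWithin] with ε hε
    have hε : (0 : ℝ) < ε := hε
    refine ENNReal.toReal_mono (ConvexBody.isCompact _).measure_lt_top.ne
      (measure_mono (le_of_supp_le fun x => ?_))
    rw [supp_add, supp_scale_ballB (by positivity), supp_sum, supp_sum]
    calc ∑ k ∈ S, supp (Y ε k) x ≤ ∑ k ∈ S, (supp (X k) x + ε * ‖x‖) :=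
          Finset.sum_le_sum fun k _ => (h ε hε k x).2
      _ = ∑ k ∈ S, supp (X k) x + S.card * ε * ‖x‖ := by
          rw [Finset.sum_add_distrib, Finset.sum_const, nsmul_eq_mul, mul_assoc]
      _ ≤ _ := by
          have : 0 ≤ ε * ‖x‖ := by positivity
          linarith

/-- The family whose first `i + 1` entries are `h`, the others being the norm. -/
def fam (n i : ℕ) (h : HF n) : Fin n → HF n := fun k => if (k : ℕ) ≤ i then h else nrm n

/-- The normalised density of the area measure of order `i`. -/
def sdn (hn : 0 < n) (i : ℕ) (h : HF n) (u : En n) : ℝ :=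
  n * mdisc n (update (hs (fam n i h) u) ⟨0, hn⟩ (rk u u))

theorem continuous_sdn (hn : 0 < n) (i : ℕ) (h : HF n) :
    Continuous fun u : Sph n => sdn hn i h u :=
  continuous_const.mul (continuous_slot _ _)

theorem mixV_fam (hn : 0 < n) (i : ℕ) (h f : HF n) :
    mixV n (update (fam n i h) ⟨0, hn⟩ f) = ∫ u : Sph n, f u * sdn hn i h u ∂sg n := by
  rw [mixV_eq _ ⟨0, hn⟩, ← integral_const_mul]
  refine integral_congr_all fun u => ?_
  have h1 : update (hs (update (fam n i h) ⟨0, hn⟩ f) u) ⟨0, hn⟩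
      (rk (u : En n) u) = update (hs (fam n i h) u) ⟨0, hn⟩ (rk (u : En n) u) := by
    ext1 l
    rcases eq_or_ne l ⟨0, hn⟩ with rfl | hl
    · simp
    · rw [Function.update_of_ne hl, Function.update_of_ne hl, hs, hs, Function.update_of_ne hl]
  simp only [h1, Function.update_self, sdn]
  ring

/-- The area measure of order `i` of the body with support function `h`. -/
def areaM (hn : 0 < n) (i : ℕ) (h : HF n) : Measure (Sph n) :=
  (sg n).withDensity fun u =>
    ENNReal.ofReal (n * (volume (closedBall (0 : En n) 1)).toReal * sdn hn i h u)

theorem integral_areaM (hn : 0 < n) {i : ℕ} {h : HF n} (hs : ∀ u : Sph n, 0 ≤ sdn hn i h u)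
    (G : Sph n → ℝ) : ∫ u, G u ∂(areaM hn i h) =
      n * (volume (closedBall (0 : En n) 1)).toReal * ∫ u, G u * sdn hn i h u ∂sg n := by
  have hc : Continuous fun u : Sph n =>
      n * (volume (closedBall (0 : En n) 1)).toReal * sdn hn i h u :=
    continuous_const.mul (continuous_sdn hn i h)
  rw [areaM, integral_withDensity_eq_integral_toReal_smul
    hc.measurable.ennreal_ofReal (Eventually.of_forall fun u => ENNReal.ofReal_lt_top),
    ← integral_const_mul]
  refine integral_congr_all fun u => ?_
  rw [ENNReal.toReal_ofReal (mul_nonneg (by positivity) (hs u)), smul_eq_mul]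
  ring

theorem isAreaMeasure_areaM (hn : 2 ≤ n) {i : ℕ} {K : ConvexBody (En n)} {h : HF n}
    (hK : ∀ x, supp K x = h x) (hs : ∀ u : Sph n, 0 ≤ sdn (by omega) i h u) :
    IsAreaMeasure i K (areaM (by omega) i h) := by
  intro L
  have hn0 : 0 < n := by omega
  rw [integral_areaM hn0 hs, mul_assoc]
  congr 1
  set V := (volume (closedBall (0 : En n) 1)).toReal
  set s : En n → ℝ := sdn hn0 i h with hs_def
  have hsc : Continuous fun u : Sph n => s u := continuous_sdn hn0 i h
  have hLc : Continuous fun u : Sph n => supp L u :=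
    (continuous_supp L).comp continuous_subtype_val
  choose! M F hMF hF using fun ε : ℝ => fun hε : 0 < ε => exists_smooth_approx hn0 L hε
  have h1 : Tendsto (fun ε => mixedVol (fun k : Fin n =>
      if (k : ℕ) = 0 then M ε else if (k : ℕ) ≤ i then K else ballB n)) (𝓝[>] 0)
      (𝓝 (mixedVol (fun k : Fin n =>
        if (k : ℕ) = 0 then L else if (k : ℕ) ≤ i then K else ballB n))) := by
    refine tendsto_mixedVol fun ε hε k x => ?_
    by_cases hk : (k : ℕ) = 0
    · simp only [if_pos hk]
      rw [hMF ε hε]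
      exact hF ε hε x
    · simp only [if_neg hk]
      exact ⟨le_rfl, le_add_of_nonneg_right (by positivity)⟩
  have h2 : Tendsto (fun ε => V * ∫ u : Sph n, F ε u * s u ∂sg n) (𝓝[>] 0)
      (𝓝 (V * ∫ u : Sph n, supp L u * s u ∂sg n)) := by
    refine Tendsto.const_mul _ ?_
    have h3 : Tendsto (fun ε : ℝ => ε * ∫ u : Sph n, s u ∂sg n) (𝓝[>] 0) (𝓝 0) := by
      have : Continuous fun ε : ℝ => ε * ∫ u : Sph n, s u ∂sg n := by fun_prop
      have h4 := this.tendsto 0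
      simp only [zero_mul] at h4
      exact h4.mono_left nhdsWithin_le_nhds
    rw [tendsto_iff_norm_sub_tendsto_zero]
    refine squeeze_zero' (Eventually.of_forall fun ε => norm_nonneg _) ?_ h3
    filter_upwards [self_mem_nhdsWithin] with ε hε
    have i1 : Integrable (fun u : Sph n => F ε u * s u) (sg n) :=
      integrable_sg ((F ε).continuous_sph.mul hsc)
    have i2 : Integrable (fun u : Sph n => supp L u * s u) (sg n) := integrable_sg (hLc.mul hsc)
    have i3 : Integrable (fun u : Sph n => ε * s u) (sg n) :=
      integrable_sg (continuous_const.mul hsc)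
    rw [← integral_sub i1 i2, ← integral_const_mul]
    refine norm_integral_le_of_norm_le i3 (Eventually.of_forall fun u => ?_)
    have h5 := hF ε hε u
    rw [Sph.norm, mul_one] at h5
    rw [← sub_mul, Real.norm_eq_abs, abs_mul, abs_of_nonneg (hs u)]
    refine mul_le_mul_of_nonneg_right (abs_le.2 ⟨?_, ?_⟩) (hs u)
    · have hε : (0 : ℝ) < ε := hε
      linarith [h5.1]
    · linarith [h5.2]
  refine tendsto_nhds_unique (h2.congr' ?_) h1
  filter_upwards [self_mem_nhdsWithin] with ε hε
  rw [← mixV_fam hn0 i h (F ε)]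
  refine (mixedVol_eq hn fun k x => ?_).symm
  by_cases hk : (k : ℕ) = 0
  · have : k = ⟨0, hn0⟩ := Fin.ext hk
    rw [if_pos hk, this, Function.update_self, hMF ε hε]
  · rw [if_neg hk, Function.update_of_ne (fun h => hk (by rw [h])), fam]
    split_ifs
    · exact hK x
    · exact supp_ballB x

/-- The composition of `f` with the reflection at the origin. -/
def reflect (f : HF n) : HF n :=
  ⟨fun x => f (-x), f.contDiffOn.comp contDiff_neg.contDiffOn (fun _ hx => neg_ne_zero.2 hx),
    fun c hc x => by simp only [← smul_neg, f.homog hc]⟩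

theorem reflect_apply (f : HF n) (x : En n) : reflect f x = f (-x) := rfl

theorem gradient_reflect (f : HF n) {x : En n} (hx : x ≠ 0) :
    gradient (reflect f) x = -gradient f (-x) := by
  refine gradient_of_hasFDerivAt ?_
  have h1 : HasFDerivAt f (innerSL ℝ (gradient f (-x))) (-x) :=
    hasFDerivAt_HF f (neg_ne_zero.2 hx)
  have h2 : HasFDerivAt (fun y : En n => -y) (-ContinuousLinearMap.id ℝ (En n)) x :=
    (hasFDerivAt_id x).neg
  have h3 := h1.comp x h2
  exact h3.congr_fderiv (by ext w; simp)

theorem hess_reflect (f : HF n) {x : En n} (hx : x ≠ 0) : hess (reflect f) x = hess f (-x) := by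
  have h1 : HasFDerivAt (gradient f) (hess f (-x)) (-x) :=
    f.hasFDerivAt_gradient (neg_ne_zero.2 hx)
  have h2 : HasFDerivAt (fun y : En n => -y) (-ContinuousLinearMap.id ℝ (En n)) x :=
    (hasFDerivAt_id x).neg
  have h3 : HasFDerivAt (fun y => -gradient f (-y))
      (-((hess f (-x)).comp (-ContinuousLinearMap.id ℝ (En n)))) x := (h1.comp x h2).neg
  have h4 : HasFDerivAt (gradient (reflect f))
      (-((hess f (-x)).comp (-ContinuousLinearMap.id ℝ (En n)))) x := by
    refine h3.congr_of_eventuallyEq ?_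
    filter_upwards [isOpen_compl_zero.mem_nhds hx] with y hy using gradient_reflect f hy
  rw [hess, h4.fderiv]
  ext w
  simp

theorem sdn_reflect (hn : 0 < n) (i : ℕ) (h : HF n) (u : Sph n) :
    sdn hn i (reflect h) u = sdn hn i h (-u) := by
  have h0 := Sph.ne_zero u
  rw [sdn, sdn]
  congr 3
  · ext1 k
    rw [hs, hs, fam, fam]
    split_ifs
    · exact hess_reflect h h0
    · rw [← coe_neg_sphere, hess_nrm, hess_nrm, coe_neg_sphere]
      ext w
      simp [prj_apply]
  · ext w
    simp [rk_apply]

theorem inner_hess_ge {f : HF n}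
    (hf : ∀ (u : Sph n) (w : En n), w ≠ 0 → ⟪(u : En n), w⟫_ℝ = 0 → 0 < ⟪hess f u w, w⟫_ℝ) :
    ∃ c : ℝ, 0 < c ∧ ∀ (u : Sph n) (w : En n),
      c * ⟪prj (u : En n) w, w⟫_ℝ ≤ ⟪hess f u w, w⟫_ℝ := by
  set S : Set (Sph n × Sph n) := {p | ⟪(p.1 : En n), (p.2 : En n)⟫_ℝ = 0} with hS
  have hc1 : Continuous fun p : Sph n × Sph n => ⟪(p.1 : En n), (p.2 : En n)⟫_ℝ := by fun_prop
  have hcl : IsCompact S := (isClosed_singleton.preimage hc1).isCompact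
  have hc2 : Continuous fun p : Sph n × Sph n => ⟪hess f p.1 p.2, (p.2 : En n)⟫_ℝ := by
    have h1 : Continuous fun p : Sph n × Sph n => hess f p.1 :=
      f.continuous_hess_sph.comp continuous_fst
    have h2 : Continuous fun p : Sph n × Sph n => (p.2 : En n) := by fun_prop
    exact (h1.clm_apply h2).inner h2
  obtain ⟨c, hc, h⟩ : ∃ c : ℝ, 0 < c ∧ ∀ p ∈ S, c ≤ ⟪hess f p.1 p.2, (p.2 : En n)⟫_ℝ := by
    rcases S.eq_empty_or_nonempty with h | h
    · exact ⟨1, one_pos, fun p hp => absurd hp (by rw [h]; exact id)⟩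
    · obtain ⟨p, hp, hm⟩ := hcl.exists_isMinOn h hc2.continuousOn
      exact ⟨_, hf p.1 p.2 (Sph.ne_zero _) hp, fun q hq => hm hq⟩
  refine ⟨c, hc, fun u w => ?_⟩
  rw [f.hess_perp, prj_apply]
  have h0 := inner_perp u w
  set z := w - ⟪(u : En n), w⟫_ℝ • (u : En n) with hz
  have h1 : ⟪z, w⟫_ℝ = ‖z‖ ^ 2 := by
    have : w = z + ⟪(u : En n), w⟫_ℝ • (u : En n) := by rw [hz, sub_add_cancel]
    have h5 : ⟪z, u⟫_ℝ = 0 := by rw [real_inner_comm, h0]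
    rw [this, inner_add_right, real_inner_self_eq_norm_sq, real_inner_smul_right, h5, mul_zero,
      add_zero]
  rw [h1]
  by_cases hz0 : z = 0
  · simp [hz0]
  · have hz1 := norm_pos_iff.2 hz0
    have h2 := h (u, unitv z hz0) (by
      change ⟪(u : En n), ((unitv z hz0 : Sph n) : En n)⟫_ℝ = 0
      rw [unitv_coe, real_inner_smul_right, h0, mul_zero])
    simp only at h2
    rw [← norm_smul_unitv z hz0, norm_smul, Sph.norm, mul_one, Real.norm_of_nonneg (norm_nonneg _),
      map_smul, real_inner_smul_left, real_inner_smul_right]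
    nlinarith [mul_le_mul_of_nonneg_left h2 (sq_nonneg ‖z‖)]

/-- A unit vector whose inner product with the pole is the truncation of `t` to `[-1,1]`. -/
def merid (hn : 2 ≤ n) (t : ℝ) : En n :=
  max (-1) (min t 1) • pole n +
    √(1 - (max (-1) (min t 1)) ^ 2) • EuclideanSpace.single (⟨1, hn⟩ : Fin n) 1

theorem inner_pole_single (hn : 2 ≤ n) :
    ⟪pole n, (EuclideanSpace.single (⟨1, hn⟩ : Fin n) 1 : En n)⟫_ℝ = 0 := by
  rw [pole, dif_pos (by omega)]
  simp [EuclideanSpace.inner_single_left]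

theorem continuous_merid (hn : 2 ≤ n) : Continuous (merid hn) := by
  unfold merid
  fun_prop

theorem norm_merid (hn : 2 ≤ n) (t : ℝ) : ‖merid hn t‖ = 1 := by
  have h1 : ‖merid hn t‖ ^ 2 = 1 := by
    set c := max (-1) (min t 1) with hc
    have hc1 : -1 ≤ c := le_max_left _ _
    have hc2 : c ≤ 1 := max_le (by norm_num) (min_le_right _ _)
    have hp := norm_pole (n := n) (by omega)
    rw [merid, ← hc, norm_add_sq_real, real_inner_smul_left, real_inner_smul_right,
      inner_pole_single hn, norm_smul, norm_smul, hp, mul_pow, mul_pow, Real.norm_eq_abs,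
      Real.norm_eq_abs, sq_abs, sq_abs, Real.sq_sqrt (by nlinarith)]
    simp
  nlinarith [norm_nonneg (merid hn t)]

theorem inner_merid (hn : 2 ≤ n) {t : ℝ} (h1 : -1 ≤ t) (h2 : t ≤ 1) :
    ⟪merid hn t, pole n⟫_ℝ = t := by
  have hp := norm_pole (n := n) (by omega)
  rw [merid, min_eq_left h2, max_eq_right h1, inner_add_left, real_inner_smul_left,
    real_inner_smul_left, real_inner_comm _ (EuclideanSpace.single _ _),
    inner_pole_single hn, real_inner_self_eq_norm_sq, hp]
  simp

theorem neg_sub_one_le_inner (u v : Sph n) : -1 ≤ ⟪(u : En n), v⟫_ℝ := by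
  have := abs_real_inner_le_norm (u : En n) v
  rw [Sph.norm, Sph.norm, one_mul] at this
  exact (abs_le.1 this).1

theorem inner_le_one_sph (u v : Sph n) : ⟪(u : En n), v⟫_ℝ ≤ 1 := by
  have := abs_real_inner_le_norm (u : En n) v
  rw [Sph.norm, Sph.norm, one_mul] at this
  exact (abs_le.1 this).2

theorem exists_zonal {Φ : ConvexBody (En n) → ConvexBody (En n)} {i : ℕ} (hn : 2 ≤ n)
    (heven : IsEven Φ) (hreg : CInfRegular i Φ) :
    ∃ (φ : HF n) (G : ℝ → ℝ), Zonal φ G ∧ (∀ x, φ (-x) = φ x) ∧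
      (∃ c : ℝ, 0 < c ∧ ∀ (u : Sph n) (w : En n),
        c * ⟪prj (u : En n) w, w⟫_ℝ ≤ ⟪hess φ u w, w⟫_ℝ) ∧
      ∀ (K : ConvexBody (En n)) (h : HF n), (∀ x, supp K x = h x) →
        (∀ u : Sph n, 0 ≤ sdn (by omega) i h u) → ∀ x, supp (Φ K) x =
          n * (volume (closedBall (0 : En n) 1)).toReal *
            cvl φ (fun u => sdn (by omega) i h u) (continuous_sdn (by omega) i h) x := by
  have hn0 : 0 < n := by omega
  obtain ⟨L, g, -, ⟨hsm, hpos⟩, hLg, hgen⟩ := hreg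
  set f : HF n := suppHF L (hsm.of_le (WithTop.coe_le_coe.2 (le_top : (2 : ℕ∞) ≤ ⊤))) with hf
  set G₀ : ℝ → ℝ := fun t => supp L (merid hn t) with hG₀
  have hG₀c : Continuous G₀ := (continuous_supp L).comp (continuous_merid hn)
  have hGg : ∀ u v : Sph n, G₀ ⟪(u : En n), v⟫_ℝ = g ⟪(u : En n), v⟫_ℝ := by
    intro u v
    simp only [hG₀]
    rw [hLg _ (norm_merid hn _), inner_merid hn (neg_sub_one_le_inner u v) (inner_le_one_sph u v)]
  have hp : pole n ∈ Metric.sphere (0 : En n) 1 := by simp [norm_pole hn0]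
  have hz : ∀ u : Sph n, f u = G₀ ⟪(u : En n), pole n⟫_ℝ := fun u => by
    change supp L u = _
    rw [hLg u (Sph.norm u)]
    exact (hGg u ⟨pole n, hp⟩).symm
  have hfp : ∀ (u : Sph n) (w : En n), w ≠ 0 → ⟪(u : En n), w⟫_ℝ = 0 →
      0 < ⟪hess f u w, w⟫_ℝ := fun u w hw huw => by
    rw [hess_inner_iter (f.contDiffAt (Sph.ne_zero u))]
    exact hpos u (Sph.norm u) w hw huw
  obtain ⟨c, hc, hcf⟩ := inner_hess_ge hfp
  set φ : HF n := (1 / 2 : ℝ) • (f + reflect f) with hφ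
  have hφx : ∀ x, φ x = (1 / 2) * (f x + f (-x)) := fun x => rfl
  have hz' : Zonal φ fun t => (1 / 2) * (G₀ t + G₀ (-t)) := by
    refine ⟨by fun_prop, fun u => ?_⟩
    have := hz (-u)
    rw [coe_neg_sphere, inner_neg_left] at this
    rw [hφx, hz, this]
  refine ⟨φ, _, hz', fun x => ?_, ⟨c, hc, fun u w => ?_⟩, ?_⟩
  · rw [hφx, hφx, neg_neg, add_comm]
  · have h0 := Sph.ne_zero u
    have h1 : hess φ u = (1 / 2 : ℝ) • (hess f u + hess f (-u)) := by
      rw [hφ, HF.hess_smul _ _ h0, HF.hess_add _ _ h0, hess_reflect f h0]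
    have h2 := hcf u w
    have h3 := hcf (-u) w
    rw [h1]
    simp only [smul_apply, add_apply, real_inner_smul_left, inner_add_left]
    rw [coe_neg_sphere] at h3
    have h4 : prj (-(u : En n)) w = prj (u : En n) w := by simp [prj_apply]
    rw [h4] at h3
    linarith
  · intro K h hK hs x
    set V := (volume (closedBall (0 : En n) 1)).toReal
    set s : En n → ℝ := sdn hn0 i h with hs_def
    have hsc : Continuous fun u : Sph n => s u := continuous_sdn hn0 i h
    have hu : ∀ u : Sph n, supp (Φ K) u = n * V * cvl φ (fun u => s u) hsc u := by
      intro u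
      have h1 : supp (Φ K) u = n * V * ∫ v : Sph n, G₀ ⟪(u : En n), v⟫_ℝ * s v ∂sg n := by
        rw [hgen K _ (isAreaMeasure_areaM hn hK hs) u (Sph.norm u), integral_areaM hn0 hs]
        simp only [hGg]; rfl
      have h2 : supp (Φ K) u =
          n * V * ∫ v : Sph n, G₀ (-⟪(u : En n), v⟫_ℝ) * s v ∂sg n := by
        have hK' : ∀ x, supp (scale (-1) K) x = reflect h x := fun x => by
          rw [supp_scale, hK, reflect_apply, neg_one_smul]
        have hs' : ∀ v : Sph n, 0 ≤ sdn hn0 i (reflect h) v := fun v => by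
          rw [sdn_reflect]
          exact hs (-v)
        rw [← heven K, hgen _ _ (isAreaMeasure_areaM hn hK' hs') u (Sph.norm u),
          integral_areaM hn0 hs']
        congr 1
        rw [← integral_neg_sph hn0 (fun v => G₀ (-⟪(u : En n), v⟫_ℝ) * s v)]
        refine integral_congr_all fun v => ?_
        rw [← hGg, sdn_reflect, inner_neg_right, neg_neg]
      have i1 : Integrable (fun v : Sph n => G₀ ⟪(u : En n), v⟫_ℝ * s v) (sg n) :=
        integrable_sg (Continuous.mul (by fun_prop) hsc)
      have i2 : Integrable (fun v : Sph n => G₀ (-⟪(u : En n), v⟫_ℝ) * s v) (sg n) :=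
        integrable_sg (Continuous.mul (by fun_prop) hsc)
      rw [hz'.cvl_sph hn0 hsc]
      have h3 : ∫ v : Sph n, (1 / 2) * (G₀ ⟪(u : En n), v⟫_ℝ +
          G₀ (-⟪(u : En n), v⟫_ℝ)) * s v ∂sg n =
          (1 / 2) * ((∫ v : Sph n, G₀ ⟪(u : En n), v⟫_ℝ * s v ∂sg n) +
            ∫ v : Sph n, G₀ (-⟪(u : En n), v⟫_ℝ) * s v ∂sg n) := by
        rw [← integral_add i1 i2, ← integral_const_mul]
        refine integral_congr_all fun v => ?_
        ring
      rw [h3]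
      linarith
    rcases eq_or_ne x 0 with rfl | hx
    · rw [HF.map_zero, mul_zero]
      have := supp_smul_arg (Φ K) le_rfl (0 : En n)
      simpa using this
    · rw [← norm_smul_unitv x hx, supp_smul_arg _ (norm_nonneg x),
        HF.homog _ (norm_pos_iff.2 hx), hu]
      ring

theorem integral_bx_legP (hn : 3 ≤ n) (f : HF n) (k : ℕ) :
    ∫ v : Sph n, bx f v * (legP n k).eval ⟪pole n, v⟫_ℝ ∂sg n =
      bk n k * ∫ v : Sph n, f v * (legP n k).eval ⟪pole n, v⟫_ℝ ∂sg n := by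
  have h1 := integral_bx_comm (by omega) f (zon (pole n) (legP n k))
  simp only [bx_legP hn (norm_pole (by omega)), zon_sph] at h1
  rw [← integral_const_mul]
  simp only [mul_comm (bx f _)]
  rw [← h1]
  exact integral_congr_ae (Eventually.of_forall fun u => by simp only; ring)

theorem abs_multiplier_le (hn3 : 3 ≤ n) {φ : HF n} {c : ℝ} (hφ : ∀ (u : Sph n) (w : En n),
    c * ⟪prj (u : En n) w, w⟫_ℝ ≤ ⟪hess φ u w, w⟫_ℝ) {k : ℕ} (hk : k ≠ 0) (hke : Even k) :
    c ≤ ∫ u, φ u ∂sg n ∧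
    (n - 1) * |bk n k * ∫ v : Sph n, φ v * (legP n k).eval ⟪pole n, v⟫_ℝ ∂sg n| ≤
      ∫ u, φ u ∂sg n - c := by
  have hn : 2 ≤ n := by omega
  have h0 : 0 < n := by omega
  have hp := norm_pole h0
  have := sg_isProb h0
  have hn1 : (0 : ℝ) < n - 1 := by
    have : (2 : ℝ) ≤ n := by exact_mod_cast hn
    linarith
  set ψ : HF n := φ - c • nrm n with hψ
  have hb : ∀ u : Sph n, bx ψ u = bx φ u - c := fun u => by
    rw [hψ, bx_sub, bx_smul, bx_nrm hn, mul_one]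
  have hh : ∀ u : Sph n, hess ψ u = hess φ u - c • prj (u : En n) := fun u => by
    have h1 : ψ = φ + (-c) • nrm n := by ext x; simp [hψ, sub_eq_add_neg]
    rw [h1, HF.hess_add _ _ (Sph.ne_zero u), HF.hess_smul _ _ (Sph.ne_zero u), hess_nrm]
    ext w j
    simp [sub_eq_add_neg, add_comm]
  have hpos : ∀ (u : Sph n) w, 0 ≤ ⟪hess ψ u w, w⟫_ℝ := fun u w => by
    rw [hh, sub_apply, smul_apply, inner_sub_left, real_inner_smul_left]
    linarith [hφ u w]
  have hP : Continuous fun u : Sph n => (legP n k).eval ⟪pole n, u⟫_ℝ := by fun_prop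
  have ht : ∀ u : Sph n, trc (hess ψ u) = (n - 1) * bx ψ u := fun u => by
    rw [bx, mul_inv_cancel_left₀ hn1.ne']
  have hI : ∫ u : Sph n, trc (hess ψ u) ∂sg n = (n - 1) * (∫ u, φ u ∂sg n - c) := by
    simp only [ht]
    rw [integral_const_mul, integral_bx hn]
    congr 1
    have i1 : Integrable (fun u : Sph n => φ u) (sg n) := integrable_sg φ.continuous_sph
    have i2 : Integrable (fun _ : Sph n => c) (sg n) := integrable_const c
    have h2 : ∀ u : Sph n, ψ u = φ u - c := fun u => by
      change φ u - c * ‖(u : En n)‖ = _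
      rw [Sph.norm, mul_one]
    simp only [h2]
    rw [integral_sub i1 i2]
    simp
  have hI0 : 0 ≤ ∫ u : Sph n, trc (hess ψ u) ∂sg n :=
    integral_nonneg fun u => trc_nonneg (hpos u)
  rw [hI] at hI0
  have hA : c ≤ ∫ u, φ u ∂sg n := by nlinarith
  refine ⟨hA, ?_⟩
  have h1 := abs_integral_legP_le hn3 hp hpos hk hke
  have h2 : ∫ u : Sph n, trc (hess ψ u) * (legP n k).eval ⟪pole n, u⟫_ℝ ∂sg n =
      (n - 1) * (bk n k *
        ∫ v : Sph n, φ v * (legP n k).eval ⟪pole n, v⟫_ℝ ∂sg n) := by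
    rw [← integral_bx_legP hn3]
    simp only [ht, mul_assoc]
    rw [integral_const_mul]
    congr 1
    have i1 : Integrable (fun u : Sph n =>
        bx φ u * (legP n k).eval ⟪pole n, u⟫_ℝ) (sg n) :=
      integrable_sg (φ.continuous_bx.mul hP)
    have i2 : Integrable (fun u : Sph n =>
        c * (legP n k).eval ⟪pole n, u⟫_ℝ) (sg n) :=
      integrable_sg (continuous_const.mul hP)
    simp only [hb, sub_mul]
    rw [integral_sub i1 i2, integral_const_mul, integral_legP hn3 hp hk, mul_zero, sub_zero]
  rw [h2, hI, abs_mul, abs_of_pos hn1] at h1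
  exact le_of_mul_le_mul_left h1 hn1

theorem multiplier_odd (hn : 0 < n) {φ : HF n} (hφ : ∀ x, φ (-x) = φ x) {k : ℕ} (hk : Odd k) :
    ∫ v : Sph n, φ v * (legP n k).eval ⟪pole n, v⟫_ℝ ∂sg n = 0 := by
  have h := integral_neg_sph hn (fun v => φ v * (legP n k).eval ⟪pole n, v⟫_ℝ)
  simp only [hφ, inner_neg_right, legP_neg, hk.neg_one_pow] at h
  have h1 : ∫ v : Sph n, φ v * (-1 * (legP n k).eval ⟪pole n, v⟫_ℝ) ∂sg n =
      -∫ v : Sph n, φ v * (legP n k).eval ⟪pole n, v⟫_ℝ ∂sg n := by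
    rw [← integral_neg]
    exact integral_congr_ae (Eventually.of_forall fun u => by simp only; ring)
  linarith

theorem exists_kernel {Φ : ConvexBody (En n) → ConvexBody (En n)} {i : ℕ} (hn : 3 ≤ n)
    (hi : i ≤ n - 1) (heven : IsEven Φ) (hreg : CInfRegular i Φ) :
    ∃ (φ : HF n) (G : ℝ → ℝ) (κ δ : ℝ), 0 < κ ∧ 0 < δ ∧ δ ≤ 1 ∧ Zonal φ G ∧
      (∀ x, φ (-x) = φ x) ∧ ∫ u, φ u ∂sg n = 1 ∧
      (∀ k, 2 ≤ k → i * |bk n k *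
        ∫ v : Sph n, φ v * (legP n k).eval ⟪pole n, v⟫_ℝ ∂sg n| ≤ 1 - δ) ∧
      ∀ (K : ConvexBody (En n)) (h : HF n), (∀ x, supp K x = h x) →
        (∀ u : Sph n, 0 ≤ sdn (by omega) i h u) → ∀ x, supp (Φ K) x =
          κ * cvl φ (fun u => sdn (by omega) i h u) (continuous_sdn (by omega) i h) x := by
  have h0 : 0 < n := by omega
  obtain ⟨φ, G, hG, he, ⟨c, hc, hφ⟩, hsupp⟩ := exists_zonal (by omega) heven hreg
  set A := ∫ u, φ u ∂sg n with hA
  have hcA : c ≤ A := (abs_multiplier_le hn hφ two_ne_zero even_two).1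
  have hA0 : 0 < A := hc.trans_le hcA
  have hi' : (i : ℝ) ≤ n - 1 := by
    have : (i : ℝ) ≤ ((n - 1 : ℕ) : ℝ) := by exact_mod_cast hi
    rwa [Nat.cast_sub (by omega), Nat.cast_one] at this
  have hφa : ∀ x, (A⁻¹ • φ : HF n) x = A⁻¹ * φ x := fun x => rfl
  refine ⟨A⁻¹ • φ, fun t => A⁻¹ * G t, n * (volume (closedBall (0 : En n) 1)).toReal * A, c / A,
    ?_, by positivity, (div_le_one hA0).2 hcA, ⟨continuous_const.mul hG.1, fun u => ?_⟩,
    fun x => ?_, ?_, fun k hk => ?_, fun K h hK hs x => ?_⟩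
  · have := volume_ball_pos (n := n)
    positivity
  · rw [hφa, hG.2]
  · rw [hφa, hφa, he]
  · simp only [hφa]
    rw [integral_const_mul, ← hA, inv_mul_cancel₀ hA0.ne']
  · simp only [hφa, mul_assoc]
    rw [integral_const_mul]
    rcases Nat.even_or_odd k with hke | hko
    · have h1 := (abs_multiplier_le hn hφ (by omega : k ≠ 0) hke).2
      set I := ∫ v : Sph n, φ v * (legP n k).eval ⟪pole n, v⟫_ℝ ∂sg n
      rw [← hA] at h1
      rw [mul_left_comm, abs_mul, abs_of_pos (inv_pos.2 hA0), mul_left_comm]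
      have h2 : i * |bk n k * I| ≤ A - c :=
        (mul_le_mul_of_nonneg_right hi' (abs_nonneg _)).trans h1
      calc A⁻¹ * (i * |bk n k * I|) ≤ A⁻¹ * (A - c) :=
            mul_le_mul_of_nonneg_left h2 (inv_nonneg.2 hA0.le)
        _ = 1 - c / A := by field_simp
    · rw [multiplier_odd h0 he hko]
      simpa using (div_le_one hA0).2 hcA
  · rw [hsupp K h hK hs, mul_assoc (_ * _) A]
    congr 1
    rw [cvl_apply, cvl_apply, ← integral_const_mul]
    refine integral_congr_all fun v => ?_
    simp only [hφa]
    field_simp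

theorem abs_sum_powerset_sub_le {α : Type*} (T : Finset α) (c : Finset α → ℝ)
    {m₀ m₁ m₂ B : ℝ} (h : ∀ S ∈ T.powerset,
      |c S - (if S.card = 0 then m₀ else if S.card = 1 then m₁ else if S.card = 2 then m₂ else 0)|
        ≤ B) :
    |∑ S ∈ T.powerset, c S - m₀ - T.card * m₁ - (T.card.choose 2) * m₂| ≤ 2 ^ T.card * B := by
  set m : ℕ → ℝ := fun k => if k = 0 then m₀ else if k = 1 then m₁ else if k = 2 then m₂ else 0
    with hm
  have h1 : ∑ S ∈ T.powerset, m S.card = m₀ + T.card * m₁ + (T.card.choose 2) * m₂ := by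
    rw [Finset.sum_powerset_apply_card,
      Finset.sum_subset (Finset.range_mono (by omega : T.card + 1 ≤ T.card + 3))]
    · rw [Finset.sum_range_succ', Finset.sum_range_succ', Finset.sum_range_succ',
        Finset.sum_eq_zero]
      · simp [hm]
        ring
      · intro k _
        simp [hm]
    · intro k _ hk
      rw [Finset.mem_range, not_lt] at hk
      rw [Nat.choose_eq_zero_of_lt (by omega), zero_smul]
  have h2 : ∑ S ∈ T.powerset, c S - m₀ - T.card * m₁ - (T.card.choose 2) * m₂ =
      ∑ S ∈ T.powerset, (c S - m S.card) := by
    rw [Finset.sum_sub_distrib, h1]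
    ring
  rw [h2]
  refine (Finset.abs_sum_le_sum_abs _ _).trans ((Finset.sum_le_sum h).trans_eq ?_)
  rw [Finset.sum_const, Finset.card_powerset, nsmul_eq_mul]
  push_cast
  rfl

theorem mixV_update_nrm (hn : 2 ≤ n) (a : Fin n) (f : HF n) :
    mixV n (update (fun _ => nrm n) a f) = ∫ u : Sph n, f u ∂sg n := by
  obtain ⟨b, hb⟩ : ∃ b : Fin n, a ≠ b := by
    have : Nontrivial (Fin n) := Fin.nontrivial_iff_two_le.2 hn
    obtain ⟨b, hb⟩ := exists_ne a
    exact ⟨b, hb.symm⟩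
  have h := mixV_two f (nrm n) hb
  rw [Function.update_eq_self b (fun _ => nrm n)] at h
  rw [h]
  simp only [bx_nrm hn, mul_one]

theorem norm_hess_nrm_le (u : Sph n) : ‖hess (nrm n) u‖ ≤ 2 := by
  rw [hess_nrm]
  exact norm_prj_le (Sph.norm u)

theorem exists_mixV_bound_three (n : ℕ) : ∃ C > 0, ∀ (F : Fin n → HF n) (a b c : Fin n) (μ : ℝ),
    a ≠ b → a ≠ c → b ≠ c → F a = F b → 0 ≤ μ → (∀ u : Sph n, ‖hess (F c) u‖ ≤ μ) →
    (∀ l, l ≠ c → ∀ u : Sph n, ‖hess (F l) u‖ ≤ 2) → |mixV n F| ≤ C * μ * nsq (F a) := by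
  obtain ⟨C, hC, h⟩ := exists_mixV_bound n
  refine ⟨C * 2 ^ n, by positivity, fun F a b c μ hab hac hbc hF hμ hc hl => ?_⟩
  set M : Fin n → ℝ := fun l => if l = a ∨ l = b then 1 else if l = c then μ else 2 with hM
  have h1 := h F M a b hab hF (by simp [hM]) (by simp [hM]) fun l hla hlb u => by
    by_cases hlc : l = c
    · subst hlc
      simpa [hM, hla, hlb] using hc u
    · simpa [hM, hla, hlb, hlc] using hl l hlc u
  refine h1.trans ?_
  have h2 : ∏ l, M l ≤ μ * 2 ^ n := by
    rw [← Finset.mul_prod_erase Finset.univ M (Finset.mem_univ c)]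
    have h3 : M c = μ := by simp [hM, hac.symm, hbc.symm]
    rw [h3]
    refine mul_le_mul_of_nonneg_left ?_ hμ
    calc ∏ l ∈ Finset.univ.erase c, M l ≤ ∏ l ∈ Finset.univ.erase c, (2 : ℝ) := by
          refine Finset.prod_le_prod (fun l hl => ?_) fun l hl => ?_
          · simp only [hM]
            split_ifs <;> positivity
          · have := Finset.ne_of_mem_erase hl
            simp only [hM, this, if_false]
            split_ifs <;> norm_num
      _ = 2 ^ (n - 1) := by simp
      _ ≤ 2 ^ n := pow_le_pow_right₀ (by norm_num) (by omega)
  have h4 := mul_le_mul_of_nonneg_right (mul_le_mul_of_nonneg_left h2 hC.le) (nsq_nonneg (F a))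
  linarith [h4]

theorem mixV_piecewise_add (T : Finset (Fin n)) (A : Fin n → HF n) (f : HF n)
    (hA : ∀ l ∈ T, A l = nrm n) :
    mixV n (T.piecewise (fun _ => f + nrm n) A) =
      ∑ S ∈ T.powerset, mixV n (S.piecewise (fun _ => f) A) := by
  rw [← MultilinearMap.map_piecewise_add]
  congr 1
  ext1 l
  by_cases hl : l ∈ T
  · simp [hl, hA l hl]
  · simp [hl]

theorem exists_mixV_expansion (hn : 3 ≤ n) : ∃ C > 0, ∀ (T : Finset (Fin n)) (f : HF n) (η : ℝ),
    0 ≤ η → η ≤ 1 → (∀ u : Sph n, ‖hess f u‖ ≤ η) →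
    |mixV n (T.piecewise (fun _ => f + nrm n) fun _ => nrm n) - 1
      - T.card * ∫ u : Sph n, f u ∂sg n - (T.card.choose 2) * ∫ u : Sph n, f u * bx f u ∂sg n|
      ≤ C * η * nsq f := by
  obtain ⟨C, hC, hb⟩ := exists_mixV_bound_three n
  refine ⟨2 ^ n * C, by positivity, fun T f η hη hη1 hf => ?_⟩
  rw [mixV_piecewise_add T _ f fun _ _ => rfl]
  have hB : 0 ≤ C * η * nsq f := mul_nonneg (mul_nonneg hC.le hη) (nsq_nonneg f)
  refine (abs_sum_powerset_sub_le T _ (B := C * η * nsq f) fun S _ => ?_).trans ?_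
  · split_ifs with h0 h1 h2
    · rw [Finset.card_eq_zero] at h0
      subst h0
      rw [Finset.piecewise_empty, mixV_nrm (by omega), sub_self, abs_zero]
      exact hB
    · obtain ⟨a, rfl⟩ := Finset.card_eq_one.1 h1
      rw [Finset.piecewise_singleton, mixV_update_nrm (by omega), sub_self, abs_zero]
      exact hB
    · obtain ⟨a, b, hab, rfl⟩ := Finset.card_eq_two.1 h2
      have h3 : ({a, b} : Finset (Fin n)).piecewise (fun _ => f) (fun _ => nrm n) =
          update (update (fun _ => nrm n) b f) a f := by
        rw [Finset.piecewise_insert, Finset.piecewise_singleton]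
      rw [h3, mixV_two f f hab, sub_self, abs_zero]
      exact hB
    · obtain ⟨a, b, c, ha, hb', hc, hab, hac, hbc⟩ := Finset.two_lt_card_iff.1 (by omega : 2 < S.card)
      rw [sub_zero]
      have h3 := hb (S.piecewise (fun _ => f) fun _ => nrm n) a b c η hab hac hbc (by simp [ha, hb'])
        hη (fun u => by simpa [hc] using hf u) fun l _ u => by
          by_cases hl : l ∈ S
          · simp only [hl, Finset.piecewise_eq_of_mem]
            linarith [hf u]
          · simp only [hl, not_false_eq_true, Finset.piecewise_eq_of_notMem]
            exact norm_hess_nrm_le u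
      rwa [Finset.piecewise_eq_of_mem _ _ _ ha] at h3
  · have h4 : (2 : ℝ) ^ T.card ≤ 2 ^ n :=
      pow_le_pow_right₀ (by norm_num) ((Finset.card_le_univ T).trans_eq (Fintype.card_fin n))
    calc _ ≤ 2 ^ n * (C * η * nsq f) := mul_le_mul_of_nonneg_right h4 hB
      _ = _ := by ring

theorem exists_mixV_expansion_one (hn : 3 ≤ n) : ∃ C > 0, ∀ (T : Finset (Fin n)) (c : Fin n)
    (f g : HF n) (M : ℝ), c ∉ T → (∀ u : Sph n, ‖hess f u‖ ≤ 1) → 0 ≤ M →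
    (∀ u : Sph n, ‖hess g u‖ ≤ M) →
    |mixV n (T.piecewise (fun _ => f + nrm n) (update (fun _ => nrm n) c g))
      - ∫ u : Sph n, g u ∂sg n - T.card * ∫ u : Sph n, g u * bx f u ∂sg n|
      ≤ C * M * nsq f := by
  obtain ⟨C, hC, hb⟩ := exists_mixV_bound_three n
  refine ⟨2 ^ n * C, by positivity, fun T c f g M hcT hf hM hg => ?_⟩
  rw [mixV_piecewise_add T _ f fun l hl =>
    Function.update_of_ne (ne_of_mem_of_not_mem hl hcT) _ _]
  have hB : 0 ≤ C * M * nsq f := mul_nonneg (mul_nonneg hC.le hM) (nsq_nonneg f)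
  have key := abs_sum_powerset_sub_le T
    (fun S => mixV n (S.piecewise (fun _ => f) (update (fun _ => nrm n) c g)))
    (m₀ := ∫ u : Sph n, g u ∂sg n) (m₁ := ∫ u : Sph n, g u * bx f u ∂sg n) (m₂ := 0)
    (B := C * M * nsq f) fun S hS => ?_
  · rw [mul_zero, sub_zero] at key
    refine key.trans ?_
    have h4 : (2 : ℝ) ^ T.card ≤ 2 ^ n :=
      pow_le_pow_right₀ (by norm_num) ((Finset.card_le_univ T).trans_eq (Fintype.card_fin n))
    calc _ ≤ 2 ^ n * (C * M * nsq f) := mul_le_mul_of_nonneg_right h4 hB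
      _ = _ := by ring
  · have hcS : c ∉ S := fun h => hcT (Finset.mem_powerset.1 hS h)
    rw [ite_self]
    split_ifs with h0 h1
    · rw [Finset.card_eq_zero] at h0
      subst h0
      rw [Finset.piecewise_empty, mixV_update_nrm (by omega), sub_self, abs_zero]
      exact hB
    · obtain ⟨b, rfl⟩ := Finset.card_eq_one.1 h1
      have hcb : c ≠ b := by simpa using hcS
      rw [Finset.piecewise_singleton, Function.update_comm hcb, mixV_two g f hcb,
        sub_self, abs_zero]
      exact hB
    · obtain ⟨a, ha, b, hb', hab⟩ := Finset.one_lt_card.1 (by omega : 1 < S.card)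
      have hac : a ≠ c := fun h => hcS (h ▸ ha)
      have hbc : b ≠ c := fun h => hcS (h ▸ hb')
      rw [sub_zero]
      have h3 := hb (S.piecewise (fun _ => f) (update (fun _ => nrm n) c g)) a b c M
        hab hac hbc (by simp [ha, hb']) hM (fun u => by simpa [hcS] using hg u) fun l hlc u => by
          by_cases hl : l ∈ S
          · simp only [hl, Finset.piecewise_eq_of_mem]
            linarith [hf u]
          · simp only [hl, not_false_eq_true, Finset.piecewise_eq_of_notMem]
            rw [Function.update_of_ne hlc]
            exact norm_hess_nrm_le u
      rwa [Finset.piecewise_eq_of_mem _ _ _ ha] at h3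

/-- The slots of the body in the area measure of order `i`. -/
def areaSlots (n i : ℕ) : Finset (Fin n) := Finset.univ.filter fun k => (k : ℕ) ≠ 0 ∧ (k : ℕ) ≤ i

theorem card_areaSlots {i : ℕ} (hi : i ≤ n - 1) (hn : 0 < n) : (areaSlots n i).card = i := by
  have h : areaSlots n i = Finset.Ioc (⟨0, hn⟩ : Fin n) ⟨i, by omega⟩ := by
    ext k
    simp [areaSlots, Fin.lt_def, Fin.le_def, Nat.pos_iff_ne_zero]
  rw [h, Fin.card_Ioc]
  rfl

theorem notMem_areaSlots (hn : 0 < n) (i : ℕ) : (⟨0, hn⟩ : Fin n) ∉ areaSlots n i := by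
  simp [areaSlots]

theorem update_fam (hn : 0 < n) (i : ℕ) (h g : HF n) :
    update (fam n i h) ⟨0, hn⟩ g =
      (areaSlots n i).piecewise (fun _ => h) (update (fun _ => nrm n) ⟨0, hn⟩ g) := by
  ext1 k
  by_cases hk : k = ⟨0, hn⟩
  · subst hk
    rw [Finset.piecewise_eq_of_notMem _ _ _ (notMem_areaSlots hn i)]
    simp
  · have hk' : (k : ℕ) ≠ 0 := fun h => hk (Fin.ext h)
    rw [Function.update_of_ne hk]
    by_cases hki : (k : ℕ) ≤ i
    · rw [Finset.piecewise_eq_of_mem _ _ _ (by simp [areaSlots, hk', hki])]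
      simp [fam, hki]
    · rw [Finset.piecewise_eq_of_notMem _ _ _ (by simp [areaSlots, hki]),
        Function.update_of_ne hk]
      simp [fam, hki]

theorem exists_integral_sdn_bound (hn : 3 ≤ n) : ∃ C > 0, ∀ (i : ℕ) (f : HF n) (η : ℝ),
    i ≤ n - 1 → 0 ≤ η → η ≤ 1 → (∀ u : Sph n, ‖hess f u‖ ≤ η) →
    |∫ u : Sph n, sdn (by omega) i (f + nrm n) u ∂sg n - 1 - i * ∫ u : Sph n, f u ∂sg n
      - (i.choose 2) * ∫ u : Sph n, f u * bx f u ∂sg n| ≤ C * η * nsq f := by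
  obtain ⟨C, hC, h⟩ := exists_mixV_expansion hn
  refine ⟨C, hC, fun i f η hi hη hη1 hf => ?_⟩
  have h0 : 0 < n := by omega
  have h1 := h (areaSlots n i) f η hη hη1 hf
  have h2 := mixV_fam h0 i (f + nrm n) (nrm n)
  rw [update_fam, Function.update_eq_self (⟨0, h0⟩ : Fin n) (fun _ => nrm n)] at h2
  rw [h2, card_areaSlots hi h0] at h1
  simpa only [nrm_apply, Sph.norm, one_mul] using h1

theorem exists_integral_mul_sdn_bound (hn : 3 ≤ n) : ∃ C > 0, ∀ (i : ℕ) (f g : HF n) (M : ℝ),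
    i ≤ n - 1 → (∀ u : Sph n, ‖hess f u‖ ≤ 1) → 0 ≤ M → (∀ u : Sph n, ‖hess g u‖ ≤ M) →
    |∫ u : Sph n, g u * sdn (by omega) i (f + nrm n) u ∂sg n - ∫ u : Sph n, g u ∂sg n
      - i * ∫ u : Sph n, g u * bx f u ∂sg n| ≤ C * M * nsq f := by
  obtain ⟨C, hC, h⟩ := exists_mixV_expansion_one hn
  refine ⟨C, hC, fun i f g M hi hf hM hg => ?_⟩
  have h0 : 0 < n := by omega
  have h1 := h (areaSlots n i) ⟨0, h0⟩ f g M (notMem_areaSlots h0 i) hf hM hg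
  rwa [← update_fam, mixV_fam h0, card_areaSlots hi h0] at h1

theorem exists_sdn_sub_one_bound (hn : 3 ≤ n) : ∃ C > 0, ∀ (i : ℕ) (f : HF n) (η : ℝ),
    0 ≤ η → η ≤ 1 → (∀ u : Sph n, ‖hess f u‖ ≤ η) →
    ∀ u : Sph n, |sdn (by omega) i (f + nrm n) u - 1| ≤ C * η := by
  obtain ⟨C, hC, hb⟩ := exists_mdisc_bound n
  have h0 : 0 < n := by omega
  refine ⟨n * (C * n * 3 ^ (n - 1)), by positivity, fun i f η hη hη1 hf u => ?_⟩
  set B : Fin n → En n →L[ℝ] En n :=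
    update (hs (fam n i (f + nrm n)) u) ⟨0, h0⟩ (rk (u : En n) u) with hB
  set A : Fin n → En n →L[ℝ] En n :=
    update (fun _ => prj (u : En n)) ⟨0, h0⟩ (rk (u : En n) u) with hA
  have hrk : ‖rk (u : En n) u‖ ≤ 1 := (norm_rk_le _ _).trans_eq (by rw [Sph.norm, mul_one])
  have hp : ‖prj (u : En n)‖ ≤ 2 := norm_prj_le (Sph.norm u)
  have hBA : ∀ l, ‖B l - A l‖ ≤ η := fun l => by
    rcases eq_or_ne l ⟨0, h0⟩ with rfl | hl
    · simpa [hB, hA] using hη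
    · simp only [hB, hA, Function.update_of_ne hl, hs, fam]
      split_ifs
      · rw [HF.hess_add f (nrm n) (Sph.ne_zero u), hess_nrm, add_sub_cancel_right]
        exact hf u
      · rw [hess_nrm, sub_self, norm_zero]
        exact hη
  have hA2 : ∀ l, ‖A l‖ ≤ 2 := fun l => by
    rcases eq_or_ne l ⟨0, h0⟩ with rfl | hl
    · simp only [hA, Function.update_self]
      linarith
    · simpa only [hA, Function.update_of_ne hl] using hp
  have hB3 : ∀ l, ‖B l‖ ≤ 3 := fun l => by
    have := norm_add_le (B l - A l) (A l)
    rw [sub_add_cancel] at this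
    linarith [hBA l, hA2 l]
  have h1 := (mdisc n).norm_image_sub_le_of_bound hC.le (fun m => by simpa using hb m) B A
  have h2 : max ‖B‖ ‖A‖ ≤ 3 := max_le ((pi_norm_le_iff_of_nonneg (by norm_num)).2 hB3)
    ((pi_norm_le_iff_of_nonneg (by norm_num)).2 fun l => (hA2 l).trans (by norm_num))
  have h3 : ‖B - A‖ ≤ η := (pi_norm_le_iff_of_nonneg hη).2 hBA
  have h4 : ‖mdisc n B - mdisc n A‖ ≤ C * n * 3 ^ (n - 1) * η := by
    refine h1.trans ?_
    rw [Fintype.card_fin]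
    gcongr
  rw [mdisc_uu_prj (Sph.norm u), Real.norm_eq_abs] at h4
  have h5 : sdn h0 i (f + nrm n) u - 1 = n * (mdisc n B - 1 / n) := by
    rw [hB, sdn]
    field_simp
  rw [h5, abs_mul, abs_of_nonneg (Nat.cast_nonneg n)]
  calc (n : ℝ) * |mdisc n B - 1 / n| ≤ n * (C * n * 3 ^ (n - 1) * η) :=
        mul_le_mul_of_nonneg_left h4 (Nat.cast_nonneg n)
    _ = _ := by ring

theorem exists_bx_bound (n : ℕ) : ∃ C > 0, ∀ (f : HF n) (M : ℝ) (u : Sph n),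
    ‖hess f u‖ ≤ M → |bx f u| ≤ C * M := by
  refine ⟨|((n : ℝ) - 1)⁻¹| * ‖trcL n‖ + 1, by positivity, fun f M u h => ?_⟩
  have h1 := (trcL n).le_opNorm (hess f u)
  rw [trcL_apply, Real.norm_eq_abs] at h1
  have hM := (norm_nonneg _).trans h
  rw [bx, abs_mul]
  have h2 : |trc (hess f u)| ≤ ‖trcL n‖ * M :=
    h1.trans (mul_le_mul_of_nonneg_left h (norm_nonneg _))
  have h3 := mul_le_mul_of_nonneg_left h2 (abs_nonneg ((n : ℝ) - 1)⁻¹)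
  linarith

theorem abs_integral_mul_le (hn : 0 < n) {a b : Sph n → ℝ} {A B : ℝ} (ha : ∀ u, |a u| ≤ A)
    (hb : ∀ u, |b u| ≤ B) : |∫ u, a u * b u ∂sg n| ≤ A * B := by
  have := sg_isProb hn
  rw [← Real.norm_eq_abs]
  refine (norm_integral_le_of_norm_le_const (C := A * B)
    (Eventually.of_forall fun v => ?_)).trans (by simp)
  rw [Real.norm_eq_abs, abs_mul]
  exact mul_le_mul (ha v) (hb v) (abs_nonneg _) ((abs_nonneg _).trans (ha v))

theorem integral_inner_mul_of_even (hn : 0 < n) {f : HF n} (hf : ∀ x, f (-x) = f x) (a : En n) :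
    ∫ u : Sph n, ⟪a, u⟫_ℝ * f u ∂sg n = 0 := by
  have h := integral_neg_sph hn fun x => ⟪a, x⟫_ℝ * f x
  simp only [inner_neg_right, hf, neg_mul, integral_neg] at h
  linarith

theorem cvl_neg {φ : HF n} (hφ : ∀ x, φ (-x) = φ x) {s : Sph n → ℝ} (hs : Continuous s)
    (x : En n) : cvl φ s hs (-x) = cvl φ s hs x := by
  simp only [cvl_apply, map_neg, hφ]

theorem Zonal.cvl_eq_crf {φ : HF n} {G : ℝ → ℝ} (hn : 0 < n) (hG : Zonal φ G) {s : Sph n → ℝ}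
    (hs : Continuous s) (u : Sph n) :
    cvl φ s hs u = ∫ v : Sph n, crf φ u v * s v ∂sg n := by
  simp only [cvl_apply, crf_apply, hG.ker_symm hn u]

theorem qf_add (hn : 2 ≤ n) (f g : HF n) : qf (f + g) = qf f + qf g +
    2 * ((∫ u : Sph n, f u ∂sg n) * ∫ u : Sph n, g u ∂sg n
      - ∫ u : Sph n, g u * bx f u ∂sg n) := by
  have h1 : ∫ u : Sph n, (f + g : HF n) u ∂sg n =
      ∫ u : Sph n, f u ∂sg n + ∫ u : Sph n, g u ∂sg n :=
    integral_add (integrable_sg f.continuous_sph) (integrable_sg g.continuous_sph)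
  have i1 : Integrable (fun u : Sph n => f u * bx f u) (sg n) :=
    integrable_sg (f.continuous_sph.mul f.continuous_bx)
  have i2 : Integrable (fun u : Sph n => g u * bx g u) (sg n) :=
    integrable_sg (g.continuous_sph.mul g.continuous_bx)
  have i3 : Integrable (fun u : Sph n => f u * bx g u) (sg n) :=
    integrable_sg (f.continuous_sph.mul g.continuous_bx)
  have i4 : Integrable (fun u : Sph n => g u * bx f u) (sg n) :=
    integrable_sg (g.continuous_sph.mul f.continuous_bx)
  have h2 : ∫ u : Sph n, (f + g : HF n) u * bx (f + g : HF n) u ∂sg n =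
      ∫ u : Sph n, ((f u * bx f u + g u * bx g u) + (f u * bx g u + g u * bx f u)) ∂sg n := by
    refine integral_congr_all fun u => ?_
    simp only [bx_add]
    change (f u + g u) * _ = _
    ring
  have i5 : Integrable (fun u : Sph n => f u * bx f u + g u * bx g u) (sg n) := i1.add i2
  have i6 : Integrable (fun u : Sph n => f u * bx g u + g u * bx f u) (sg n) := i3.add i4
  rw [integral_add i5 i6, integral_add i1 i2, integral_add i3 i4, integral_bx_comm hn f g] at h2
  rw [qf, qf, qf, h1, h2]
  ring

theorem qf_smul (c : ℝ) (f : HF n) : qf (c • f) = c ^ 2 * qf f := by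
  have h1 : ∫ u : Sph n, (c • f : HF n) u ∂sg n = c * ∫ u : Sph n, f u ∂sg n :=
    integral_const_mul c _
  have h2 : ∫ u : Sph n, (c • f : HF n) u * bx (c • f : HF n) u ∂sg n =
      c ^ 2 * ∫ u : Sph n, f u * bx f u ∂sg n := by
    rw [← integral_const_mul]
    refine integral_congr_all fun u => ?_
    simp only [bx_smul]
    change c * f u * _ = _
    ring
  rw [qf, qf, h1, h2]
  ring

theorem nsq_le (hn : 2 ≤ n) (f : HF n) :
    nsq f ≤ n * ∫ u : Sph n, f u ^ 2 ∂sg n + (n - 1) * qf f := by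
  have hn' : (2 : ℝ) ≤ n := by exact_mod_cast hn
  have h1 := nsq_eq f
  have h2 := integral_bx_self hn f
  have h3 : ∫ u : Sph n, ‖tgr f u‖ ^ 2 ∂sg n =
      (n - 1) * (∫ u : Sph n, f u ^ 2 ∂sg n - ∫ u : Sph n, f u * bx f u ∂sg n) := by
    rw [h2]
    field_simp [show (n : ℝ) - 1 ≠ 0 by linarith]
    ring
  have h4 : 0 ≤ ((n : ℝ) - 1) * (∫ u : Sph n, f u ∂sg n) ^ 2 :=
    mul_nonneg (by linarith) (sq_nonneg _)
  rw [h1, h3, qf]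
  linarith

theorem qf_le_nsq (hn : 2 ≤ n) {f : HF n} (hf : ∫ u : Sph n, f u ∂sg n = 0) : qf f ≤ nsq f := by
  have hn' : (2 : ℝ) ≤ n := by exact_mod_cast hn
  have h0 : 0 ≤ ∫ u : Sph n, ‖tgr f u‖ ^ 2 ∂sg n := integral_nonneg fun u => by positivity
  have h1 : 0 ≤ ∫ u : Sph n, f u ^ 2 ∂sg n := integral_nonneg fun u => by positivity
  have h2 : ((n : ℝ) - 1)⁻¹ ≤ 1 := inv_le_one_of_one_le₀ (by linarith)
  rw [qf, integral_bx_self hn f, nsq_eq, hf]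
  nlinarith [mul_le_mul_of_nonneg_right h2 h0]

theorem integral_sq_le_nsq (f : HF n) : ∫ u : Sph n, f u ^ 2 ∂sg n ≤ nsq f := by
  rw [nsq_eq]
  exact le_add_of_nonneg_right (integral_nonneg fun u => by positivity)

theorem integral_sq_add_le (hn : 0 < n) (f g : HF n) {τ : ℝ} (hg : ∀ u : Sph n, |g u| ≤ τ) :
    ∫ u : Sph n, (f + g : HF n) u ^ 2 ∂sg n ≤ 2 * ∫ u : Sph n, f u ^ 2 ∂sg n + 2 * τ ^ 2 := by
  have := sg_isProb hn
  have i1 : Integrable (fun u : Sph n => 2 * f u ^ 2) (sg n) :=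
    integrable_sg (continuous_const.mul (f.continuous_sph.pow 2))
  have i2 : Integrable (fun u : Sph n => 2 * f u ^ 2 + 2 * τ ^ 2) (sg n) :=
    i1.add (integrable_const _)
  calc _ ≤ ∫ u : Sph n, (2 * f u ^ 2 + 2 * τ ^ 2) ∂sg n := by
        refine integral_mono (integrable_sg ((f + g).continuous_sph.pow 2)) i2 fun u => ?_
        change (f u + g u) ^ 2 ≤ 2 * f u ^ 2 + 2 * τ ^ 2
        have h1 : g u ^ 2 ≤ τ ^ 2 := sq_le_sq' (abs_le.1 (hg u)).1 (abs_le.1 (hg u)).2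
        nlinarith [sq_nonneg (f u - g u)]
    _ = _ := by
        rw [integral_add i1 (integrable_const _), integral_const_mul]
        simp

theorem qf_cvl_smul_le {φ : HF n} {G : ℝ → ℝ} (hn : 3 ≤ n) (hG : Zonal φ G) {i : ℕ} (hi : 1 ≤ i)
    {δ : ℝ} (hδ0 : 0 < δ) (hδ1 : δ ≤ 1)
    (hmult : ∀ k, 2 ≤ k → i * |bk n k *
      ∫ v : Sph n, φ v * (legP n k).eval ⟪pole n, v⟫_ℝ ∂sg n| ≤ 1 - δ)
    (f : HF n) (hf0 : ∫ u : Sph n, f u ∂sg n = 0)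
    (hf1 : ∀ a : En n, ∫ u : Sph n, ⟪a, u⟫_ℝ * f u ∂sg n = 0) :
    0 ≤ qf f ∧ qf ((i : ℝ) • cvl φ (fun v => bx f v) f.continuous_bx) ≤ (1 - δ) * qf f := by
  have hi' : (1 : ℝ) ≤ i := by exact_mod_cast hi
  obtain ⟨h1, h2⟩ := spectral_gap hn hG f hf0 hf1 (r := ((1 - δ) / i) ^ 2) fun k hk => by
    refine sq_le_sq' ?_ ?_
    · have h := hmult k hk
      rw [mul_comm, ← le_div_iff₀ (by linarith)] at h
      exact (abs_le.1 h).1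
    · have h := hmult k hk
      rw [mul_comm, ← le_div_iff₀ (by linarith)] at h
      exact (abs_le.1 h).2
  have h3 : 0 ≤ qf f :=
    (mul_nonneg (neg_nonneg.2 (bk_two_neg hn).le) (integral_mul_self_nonneg f)).trans h1
  refine ⟨h3, ?_⟩
  rw [qf_smul]
  calc (i : ℝ) ^ 2 * qf (cvl φ (fun v => bx f v) f.continuous_bx)
      ≤ (i : ℝ) ^ 2 * (((1 - δ) / i) ^ 2 * qf f) := mul_le_mul_of_nonneg_left h2 (sq_nonneg _)
    _ = (1 - δ) ^ 2 * qf f := by field_simp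
    _ ≤ (1 - δ) * qf f := mul_le_mul_of_nonneg_right (by nlinarith) h3

theorem exists_remainder_bound {φ : HF n} {G : ℝ → ℝ} (hn : 3 ≤ n) (hG : Zonal φ G)
    (hmas : ∫ u : Sph n, φ u ∂sg n = 1) {i : ℕ} (hi : i ≤ n - 1) :
    ∃ C > 0, ∀ f : HF n, (∀ u : Sph n, ‖hess f u‖ ≤ 1) → ∀ u : Sph n,
      |cvl φ (fun v => sdn (by omega) i (f + nrm n) v) (continuous_sdn (by omega) i _) u - 1
        - i * cvl φ (fun v => bx f v) f.continuous_bx u| ≤ C * nsq f := by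
  have h0 : 0 < n := by omega
  obtain ⟨C, hC, h⟩ := exists_integral_mul_sdn_bound hn
  obtain ⟨M, hM0, -, -, hM⟩ := φ.exists_bound
  refine ⟨C * M + 1, by positivity, fun f hf u => ?_⟩
  have h1 := h i f (crf φ u) M hi hf hM0 fun v => norm_hess_crf_le φ hM v u
  have h2 : ∫ v : Sph n, crf φ u v ∂sg n = 1 := by
    have h3 := hG.cvl_eq_crf h0 (s := fun _ => 1) continuous_const u
    rw [hG.cvl_one h0, hmas, Sph.norm, mul_one] at h3
    simpa using h3.symm
  rw [hG.cvl_eq_crf h0, hG.cvl_eq_crf h0, ← h2]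
  exact h1.trans (mul_le_mul_of_nonneg_right (by linarith) (nsq_nonneg f))

set_option maxHeartbeats 2000000 in
theorem exists_perturbation {ker : HF n} {G : ℝ → ℝ} (hn : 3 ≤ n) (hG : Zonal ker G)
    (heven : ∀ x, ker (-x) = ker x) (hmas : ∫ u : Sph n, ker u ∂sg n = 1)
    {i : ℕ} (hi1 : 1 ≤ i) (hi : i ≤ n - 1) {δ : ℝ} (hδ0 : 0 < δ) (hδ1 : δ ≤ 1)
    (hmult : ∀ k, 2 ≤ k → i * |bk n k *
      ∫ v : Sph n, ker v * (legP n k).eval ⟪pole n, v⟫_ℝ ∂sg n| ≤ 1 - δ) :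
    ∃ C > 0, ∀ (f : HF n) (η : ℝ), 0 ≤ η → η ≤ 1 → (∀ u : Sph n, |f u| ≤ η) →
      (∀ u : Sph n, ‖hess f u‖ ≤ η) → ∫ u : Sph n, f u ∂sg n = 0 →
      (∀ a : En n, ∫ u : Sph n, ⟪a, u⟫_ℝ * f u ∂sg n = 0) →
      ∃ φ : HF n,
        cvl ker (fun v => sdn (by omega) i (f + nrm n) v) (continuous_sdn (by omega) i _) =
          φ + nrm n ∧
        (∀ u : Sph n, ‖hess φ u‖ ≤ C * η) ∧ nsq φ ≤ C * nsq f ∧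
        qf φ ≤ (1 - δ) * qf f + C * η * nsq f ∧
        -(i.choose 2 : ℝ) * qf f - C * η * nsq f ≤ ∫ u : Sph n, φ u ∂sg n := by
  have h0 : 0 < n := by omega
  have h2n : 2 ≤ n := by omega
  have hn' : (3 : ℝ) ≤ n := by exact_mod_cast hn
  have hi' : (1 : ℝ) ≤ i := by exact_mod_cast hi1
  obtain ⟨C1, hC1, hs1⟩ := exists_sdn_sub_one_bound hn
  obtain ⟨C2, hC2, hrem⟩ := exists_remainder_bound hn hG hmas hi
  obtain ⟨C3, hC3, hI⟩ := exists_integral_sdn_bound hn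
  obtain ⟨C4, hC4, hgap⟩ := exists_nsq_le_qf hn
  obtain ⟨C5, hC5, hbx⟩ := exists_bx_bound n
  obtain ⟨K, hK0, -, -, hK⟩ := ker.exists_bound
  obtain ⟨L, hL0, hL⟩ := exists_sph_bound ker.continuous_bx
  -- the constants of the individual estimates
  set D1 := L * C1 + i * (L * C5) with hD1
  have hD1' : 0 ≤ D1 := by positivity
  set E1 := C2 ^ 2 * (C4 * C5) + C2 * D1 with hE1
  have hE1' : 0 ≤ E1 := by positivity
  set E2 := E1 + 2 * (C2 * (i * (L * C5))) with hE2
  have hE2' : 0 ≤ E2 := by positivity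
  set E3 := n * (2 * C4 + 2 * (C2 ^ 2 * (C4 * C5))) + (n - 1) * (1 + E2) with hE3
  have hE3' : 0 ≤ E3 := by
    have : (0 : ℝ) ≤ n - 1 := by linarith
    positivity
  refine ⟨C1 * K + E3 + E2 + C3, by positivity, fun f η hη hη1 hf hhf hf0 hf1 => ?_⟩
  have hhf1 : ∀ u : Sph n, ‖hess f u‖ ≤ 1 := fun u => (hhf u).trans hη1
  set s : En n → ℝ := sdn h0 i (f + nrm n) with hs
  have hsc : Continuous fun u : Sph n => s u := continuous_sdn h0 i _
  have hsc' : Continuous fun u : Sph n => s u - 1 := hsc.sub continuous_const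
  set N := nsq f with hN
  have hN0 : 0 ≤ N := nsq_nonneg f
  have hbf : ∀ u : Sph n, |bx f u| ≤ C5 * η := fun u => hbx f η u (hhf u)
  obtain ⟨hq0, hq1⟩ := qf_cvl_smul_le hn hG hi1 hδ0 hδ1 hmult f hf0 hf1
  have hNq : N ≤ C4 * qf f := hgap f hf0 hf1
  have hqN : qf f ≤ N := qf_le_nsq h2n hf0
  have hqη : qf f ≤ η * (C5 * η) := by
    have h1 := abs_integral_mul_le h0 (a := fun u => f u) (b := fun u => bx f u) hf hbf
    rw [qf, hf0]
    have := (abs_le.1 h1).1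
    linarith
  have hNη : N ≤ C4 * C5 * η := by
    have h1 : η * (C5 * η) ≤ C5 * η := by nlinarith [mul_nonneg hC5.le hη]
    calc N ≤ C4 * qf f := hNq
      _ ≤ C4 * (C5 * η) := mul_le_mul_of_nonneg_left (hqη.trans h1) hC4.le
      _ = _ := by ring
  set φ : HF n := cvl ker (fun u => s u - 1) hsc' with hφ
  have hp : cvl ker (fun v => s v) hsc = φ + nrm n := by
    have h1 := cvl_add (φ := ker) hsc' (continuous_const (y := (1 : ℝ)))
    simp only [sub_add_cancel] at h1
    rw [h1]
    congr 1
    ext x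
    rw [hG.cvl_one h0, hmas, one_mul, nrm_apply]
  set φ1 : HF n := (i : ℝ) • cvl ker (fun v => bx f v) f.continuous_bx with hφ1
  set φ2 : HF n := φ + (-1 : ℝ) • φ1 with hφ2
  have hsum : φ = φ1 + φ2 := by
    ext x
    simp [hφ2]
  have hφ1_apply : ∀ x, φ1 x = i * cvl ker (fun v => bx f v) f.continuous_bx x := fun x => rfl
  have hφ2_apply : ∀ x, φ2 x = φ x + (-1) * φ1 x := fun x => rfl
  have hφ2_le : ∀ u : Sph n, |φ2 u| ≤ C2 * N := fun u => by
    have h1 := hrem f hhf1 u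
    have h2 : cvl ker (fun v => s v) hsc u = φ u + 1 := by
      rw [hp, HF.coe_add, nrm_apply, Sph.norm]
    rw [h2] at h1
    rw [hφ2_apply, hφ1_apply]
    convert h1 using 2
    ring
  have hbφ : ∀ u : Sph n, |bx φ u| ≤ L * (C1 * η) := fun u =>
    abs_bx_cvl_le (fun v => hs1 i f η hη hη1 hhf v) hsc' h0 hL u
  have hbφ1 : ∀ u : Sph n, |bx φ1 u| ≤ i * (L * C5) * η := fun u => by
    rw [hφ1, bx_smul, abs_mul, abs_of_nonneg (by linarith)]
    have := abs_bx_cvl_le hbf f.continuous_bx h0 hL u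
    calc _ ≤ (i : ℝ) * (L * (C5 * η)) := mul_le_mul_of_nonneg_left this (by linarith)
      _ = _ := by ring
  have hbφ2 : ∀ u : Sph n, |bx φ2 u| ≤ D1 * η := fun u => by
    rw [hφ2, bx_add, bx_smul]
    have h1 := abs_add_le (bx φ u) (-1 * bx φ1 u)
    rw [abs_mul, abs_neg, abs_one, one_mul] at h1
    have h2 := hbφ u
    have h3 := hbφ1 u
    rw [hD1]
    linarith
  have hφ1_int : ∫ u : Sph n, φ1 u ∂sg n = 0 := by
    simp only [hφ1_apply, integral_const_mul]
    rw [hG.integral_cvl h0, integral_bx h2n, hf0]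
    ring
  have hφ1_even : ∀ x, φ1 (-x) = φ1 x := fun x => by
    rw [hφ1_apply, hφ1_apply, cvl_neg heven]
  have hNφ1 : nsq φ1 ≤ C4 * N := by
    refine (hgap φ1 hφ1_int fun a => integral_inner_mul_of_even h0 hφ1_even a).trans
      (mul_le_mul_of_nonneg_left ?_ hC4.le)
    nlinarith [hq1]
  have hτ : (C2 * N) ^ 2 ≤ C2 ^ 2 * (C4 * C5) * η * N := by
    have h1 : N * N ≤ C4 * C5 * η * N := mul_le_mul_of_nonneg_right hNη hN0
    nlinarith [mul_le_mul_of_nonneg_left h1 (sq_nonneg C2)]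
  have hqφ2 : qf φ2 ≤ E1 * η * N := by
    have := sg_isProb h0
    have h1 : |∫ u : Sph n, φ2 u ∂sg n| ≤ C2 * N := by
      have := abs_integral_mul_le h0 (b := fun _ => 1) (B := 1) hφ2_le (by simp)
      simpa using this
    have h2 := sq_le_sq' (abs_le.1 h1).1 (abs_le.1 h1).2
    have h3 := (abs_le.1 (abs_integral_mul_le h0 (a := fun u => φ2 u) (b := fun u => bx φ2 u)
      hφ2_le hbφ2)).1
    rw [qf, hE1]
    linarith
  have hqφ : qf φ ≤ (1 - δ) * qf f + E2 * η * N := by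
    have h3 := (abs_le.1 (abs_integral_mul_le h0 (a := fun u => φ2 u) (b := fun u => bx φ1 u)
      hφ2_le hbφ1)).1
    rw [hsum, qf_add h2n, hφ1_int, hE2]
    linarith
  have hηN : η * N ≤ N := mul_le_of_le_one_left hN0 hη1
  have hηN0 : 0 ≤ η * N := mul_nonneg hη hN0
  refine ⟨φ, hp, fun u => ?_, ?_, ?_, ?_⟩
  · have h1 := norm_hess_cvl_le (φ := ker) (fun v => hs1 i f η hη hη1 hhf v) hsc' h0 hK u
    refine h1.trans ?_
    have h2 : 0 ≤ (E3 + E2 + C3) * η := by positivity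
    linarith
  · have h1 := nsq_le h2n φ
    have h2 := integral_sq_add_le h0 φ1 φ2 hφ2_le
    rw [← hsum] at h2
    have h3 := integral_sq_le_nsq φ1
    have h4 : ∫ u : Sph n, φ u ^ 2 ∂sg n ≤ (2 * C4 + 2 * (C2 ^ 2 * (C4 * C5))) * N := by
      have h5 := mul_le_mul_of_nonneg_left hηN (by positivity : 0 ≤ C2 ^ 2 * (C4 * C5))
      linarith
    have h6 : qf φ ≤ (1 + E2) * N := by
      have h7 := mul_le_mul_of_nonneg_left hηN hE2'
      have h8 : (1 - δ) * qf f ≤ N := by nlinarith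
      linarith
    have h9 := mul_le_mul_of_nonneg_left h4 (by linarith : (0 : ℝ) ≤ n)
    have h10 := mul_le_mul_of_nonneg_left h6 (by linarith : (0 : ℝ) ≤ n - 1)
    have h11 : 0 ≤ (C1 * K + E2 + C3) * N := by positivity
    rw [hE3]
    linarith
  · have h1 : 0 ≤ (C1 * K + E3 + C3) * (η * N) := by positivity
    linarith
  · have h1 := hI i f η hi hη hη1 hhf
    have := sg_isProb h0
    have h2 : ∫ u : Sph n, φ u ∂sg n = ∫ u : Sph n, s u ∂sg n - 1 := by
      rw [hφ, hG.integral_cvl h0, hmas, one_mul,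
        integral_sub (integrable_sg hsc) (integrable_const _)]
      simp
    have h3 : ∫ u : Sph n, f u * bx f u ∂sg n = -qf f := by
      rw [qf, hf0]
      ring
    rw [hf0, h3] at h1
    have h4 := (abs_le.1 h1).1
    have h5 : 0 ≤ (C1 * K + E3 + E2) * (η * N) := by positivity
    rw [h2]
    change -(C3 * η * N) ≤ (∫ u : Sph n, s u ∂sg n) - 1 - _ - _ at h4
    linarith

theorem card_filter_val_le {i : ℕ} (hi : i < n) :
    (Finset.univ.filter fun k : Fin n => (k : ℕ) ≤ i).card = i + 1 := by
  have h : (Finset.univ.filter fun k : Fin n => (k : ℕ) ≤ i) = Finset.Iic ⟨i, hi⟩ := by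
    ext k
    simp [Fin.le_def]
  rw [h, Fin.card_Iic]

theorem fam_eq_piecewise (i : ℕ) (h : HF n) : fam n i h =
    (Finset.univ.filter fun k : Fin n => (k : ℕ) ≤ i).piecewise (fun _ => h) fun _ => nrm n := by
  ext1 k
  by_cases hk : (k : ℕ) ≤ i
  · rw [Finset.piecewise_eq_of_mem _ _ _ (by simpa using hk)]
    simp [fam, hk]
  · rw [Finset.piecewise_eq_of_notMem _ _ _ (by simpa using hk)]
    simp [fam, hk]

theorem one_sub_pow_le {e : ℝ} {i : ℕ} (he1 : |e| ≤ 1) (he2 : i * |e| ≤ 1 / 2) :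
    (1 - e) ^ i ≤ 1 - i * e + 2 * (i * e) ^ 2 := by
  have h1 := one_add_mul_le_pow (a := e) (by linarith [(abs_le.1 he1).1]) i
  have h2 : |i * e| ≤ 1 / 2 := by rwa [abs_mul, Nat.abs_cast]
  have h3 := abs_le.1 h2
  have h4 : 0 ≤ (1 - e) ^ i := pow_nonneg (by linarith [(abs_le.1 he1).2]) i
  have h5 : (1 - e) ^ i * (1 + e) ^ i ≤ 1 := by
    rw [← mul_pow]
    refine pow_le_one₀ ?_ (by nlinarith [sq_nonneg e])
    nlinarith [abs_le.1 he1, abs_nonneg e, sq_abs e]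
  set x := (i : ℝ) * e
  have h6 : (1 - e) ^ i * (1 + x) ≤ 1 := (mul_le_mul_of_nonneg_left h1 h4).trans h5
  have h7 : 1 ≤ (1 - x + 2 * x ^ 2) * (1 + x) := by
    nlinarith [mul_nonneg (sq_nonneg x) (by linarith : 0 ≤ 1 + 2 * x)]
  exact le_of_mul_le_mul_right (h6.trans h7) (by linarith)

set_option maxHeartbeats 2000000 in
theorem exists_local_inequality {ker : HF n} {G : ℝ → ℝ} (hn : 3 ≤ n) (hG : Zonal ker G)
    (heven : ∀ x, ker (-x) = ker x) (hmas : ∫ u : Sph n, ker u ∂sg n = 1)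
    {i : ℕ} (hi1 : 1 ≤ i) (hi : i ≤ n - 1) {δ : ℝ} (hδ0 : 0 < δ) (hδ1 : δ ≤ 1)
    (hmult : ∀ k, 2 ≤ k → i * |bk n k *
      ∫ v : Sph n, ker v * (legP n k).eval ⟪pole n, v⟫_ℝ ∂sg n| ≤ 1 - δ) :
    ∃ η > 0, ∃ c > 0, ∀ f : HF n, (∀ u : Sph n, |f u| ≤ η) → (∀ u : Sph n, ‖hess f u‖ ≤ η) →
      ∫ u : Sph n, f u ∂sg n = 0 →
      (∀ a : En n, ∫ u : Sph n, ⟪a, u⟫_ℝ * f u ∂sg n = 0) →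
      (∀ u : Sph n, 0 ≤ sdn (by omega) i (f + nrm n) u) ∧
      0 < mixV n (fam n i (f + nrm n)) ∧
      mixV n (fam n i (f + nrm n)) ^ i + c * nsq f ≤ mixV n (fam n i
        (cvl ker (fun v => sdn (by omega) i (f + nrm n) v) (continuous_sdn (by omega) i _))) := by
  have h0 : 0 < n := by omega
  have hi' : (1 : ℝ) ≤ i := by exact_mod_cast hi1
  obtain ⟨C1, hC1, hW⟩ := exists_mixV_expansion hn
  obtain ⟨C2, hC2, hP⟩ := exists_perturbation hn hG heven hmas hi1 hi hδ0 hδ1 hmult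
  obtain ⟨C4, hC4, hgap⟩ := exists_nsq_le_qf hn
  obtain ⟨C5, hC5, hs1⟩ := exists_sdn_sub_one_bound hn
  obtain ⟨C6, hC6, hbx⟩ := exists_bx_bound n
  set T : Finset (Fin n) := Finset.univ.filter fun k : Fin n => (k : ℕ) ≤ i with hT
  have hTc : T.card = i + 1 := card_filter_val_le (by omega)
  set b : ℝ := (i.choose 2 : ℝ) with hb
  set b2 : ℝ := ((i + 1).choose 2 : ℝ) with hb2
  have hbb : (i + 1) * b = b2 * (i - 1) := by
    rw [hb, hb2, Nat.cast_choose_two, Nat.cast_choose_two]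
    push_cast
    ring
  have hb2pos : 0 < b2 := by
    rw [hb2]
    exact_mod_cast Nat.choose_pos (by omega)
  set K1 := (i + 1) * C2 + b2 * C2 + C1 * C2 ^ 2 with hK1
  have hK1' : 0 ≤ K1 := by positivity
  set K2 := b2 + C1 with hK2
  have hK2' : 0 ≤ K2 := by positivity
  set K3 := K1 + i * C1 + 2 * i ^ 2 * (K2 ^ 2 * (C4 * C6)) with hK3
  have hK3' : 0 ≤ K3 := by positivity
  set D := 1 + C2 + C5 + 2 * (i * (K2 * (C4 * C6))) + K3 * (2 * C4 / (δ * b2)) with hD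
  have hDpos : 0 < D := by positivity
  refine ⟨1 / D, by positivity, δ * b2 / (2 * C4), by positivity, fun f hf hhf hf0 hf1 => ?_⟩
  set η := 1 / D with hη_def
  have hη : 0 ≤ η := by positivity
  have hle : ∀ x, x ≤ D → x * η ≤ 1 := fun x hx => by
    rw [hη_def, mul_one_div]
    exact div_le_one_of_le₀ hx hDpos.le
  have q1 : 0 ≤ 2 * (i * (K2 * (C4 * C6))) := by positivity
  have q2 : 0 ≤ K3 * (2 * C4 / (δ * b2)) := by positivity
  have hη1 : η ≤ 1 := by
    have := hle 1 (by linarith)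
    linarith
  have hη2 : C2 * η ≤ 1 := hle _ (by linarith)
  have hη3 : C5 * η ≤ 1 := hle _ (by linarith)
  have hη4 : 2 * (i * (K2 * (C4 * C6))) * η ≤ 1 := hle _ (by linarith)
  have hη5 : K3 * (2 * C4 / (δ * b2)) * η ≤ 1 := hle _ (by linarith)
  have hη6 : K3 * η ≤ δ * b2 / (2 * C4) := by
    have h1 : K3 * (2 * C4 / (δ * b2)) * η = K3 * η / (δ * b2 / (2 * C4)) := by
      field_simp
    rw [h1] at hη5
    exact (div_le_one (by positivity)).1 hη5
  set N := nsq f with hN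
  have hN0 : 0 ≤ N := nsq_nonneg f
  set Q := qf f with hQ
  have hNQ : N ≤ C4 * Q := hgap f hf0 hf1
  have hQN : Q ≤ N := qf_le_nsq (by omega) hf0
  have hfb : ∫ u : Sph n, f u * bx f u ∂sg n = -Q := by
    rw [hQ, qf, hf0]
    ring
  have hNη : N ≤ C4 * C6 * η := by
    have h1 := (abs_le.1 (abs_integral_mul_le h0 (a := fun u => f u) (b := fun u => bx f u) hf
      fun u => hbx f η u (hhf u))).1
    rw [hfb] at h1
    have h2 : η * (C6 * η) ≤ C6 * η := mul_le_of_le_one_left (by positivity) hη1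
    calc N ≤ C4 * Q := hNQ
      _ ≤ C4 * (C6 * η) := mul_le_mul_of_nonneg_left (by linarith) hC4.le
      _ = _ := by ring
  have hQ0 : 0 ≤ Q := by
    by_contra h
    push Not at h
    have := mul_neg_of_pos_of_neg hC4 h
    linarith
  set e := 1 - mixV n (fam n i (f + nrm n)) with he
  have hWe : mixV n (fam n i (f + nrm n)) = 1 - e := by rw [he]; ring
  have he1 : |e - b2 * Q| ≤ C1 * η * N := by
    have h1 := hW T f η hη hη1 hhf
    rw [← fam_eq_piecewise, hTc, hf0, hfb, hWe] at h1
    rw [← abs_neg]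
    convert h1 using 2
    push_cast
    ring
  have hηN : η * N ≤ N := mul_le_of_le_one_left hN0 hη1
  have he2 : |e| ≤ K2 * N := by
    have h1 := abs_le.1 he1
    have h2 : 0 ≤ b2 * Q := by positivity
    have h3 : b2 * Q ≤ b2 * N := mul_le_mul_of_nonneg_left hQN hb2pos.le
    have h4 : C1 * η * N ≤ C1 * N := by
      rw [mul_assoc]
      exact mul_le_mul_of_nonneg_left hηN hC1.le
    have h5 : 0 ≤ b2 * N := by positivity
    rw [abs_le, hK2]
    constructor <;> linarith
  have he3 : |e| ≤ K2 * (C4 * C6) * η := by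
    calc |e| ≤ K2 * N := he2
      _ ≤ K2 * (C4 * C6 * η) := mul_le_mul_of_nonneg_left hNη hK2'
      _ = _ := by ring
  have he4 : i * |e| ≤ 1 / 2 := by
    have := mul_le_mul_of_nonneg_left he3 (by linarith : (0 : ℝ) ≤ i)
    linarith
  have he5 : |e| ≤ 1 / 2 := by nlinarith [abs_nonneg e]
  have he6 : e ^ 2 ≤ K2 ^ 2 * (C4 * C6) * (η * N) := by
    calc e ^ 2 = |e| * |e| := by rw [← sq, sq_abs]
      _ ≤ (K2 * (C4 * C6) * η) * (K2 * N) :=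
          mul_le_mul he3 he2 (abs_nonneg _) (by positivity)
      _ = _ := by ring
  obtain ⟨φ, hp, hφh, hφN, hφq, hφi⟩ := hP f η hη hη1 hf hhf hf0 hf1
  refine ⟨fun u => ?_, ?_, ?_⟩
  · have := (abs_le.1 (hs1 i f η hη hη1 hhf u)).1
    linarith
  · rw [hWe]
    linarith [(abs_le.1 he5).2]
  · rw [hp, hWe]
    have h1 := hW T φ (C2 * η) (by positivity) hη2 hφh
    rw [← fam_eq_piecewise, hTc] at h1
    have h2 := (abs_le.1 h1).1
    have h3 : ∫ u : Sph n, φ u * bx φ u ∂sg n = (∫ u : Sph n, φ u ∂sg n) ^ 2 - qf φ := by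
      rw [qf]
      ring
    rw [h3] at h2
    have h4 : C1 * (C2 * η) * nsq φ ≤ C1 * (C2 * η) * (C2 * N) :=
      mul_le_mul_of_nonneg_left hφN (by positivity)
    have h5 : 0 ≤ b2 * (∫ u : Sph n, φ u ∂sg n) ^ 2 := by positivity
    have h6 := mul_le_mul_of_nonneg_left hφq hb2pos.le
    have h7 := mul_le_mul_of_nonneg_left hφi (by linarith : (0 : ℝ) ≤ i + 1)
    have h8 := one_sub_pow_le (by linarith : |e| ≤ 1) he4
    have h9 := mul_le_mul_of_nonneg_left (abs_le.1 he1).1 (by linarith : (0 : ℝ) ≤ i)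
    have h10 := mul_le_mul_of_nonneg_left he6 (by positivity : (0 : ℝ) ≤ 2 * i ^ 2)
    have h11 := mul_le_mul_of_nonneg_right hη6 hN0
    have h12 : δ * b2 / (2 * C4) * N * 2 ≤ δ * b2 * Q := by
      have : δ * b2 / (2 * C4) * N * 2 = δ * b2 * (N / C4) := by
        field_simp
      rw [this]
      refine mul_le_mul_of_nonneg_left ?_ (by positivity)
      rw [div_le_iff₀ hC4]
      linarith
    have h13 : (i + 1) * (b * Q) = b2 * (i - 1) * Q := by
      rw [← mul_assoc, hbb]
    have h14 : 1 - b2 * (i - 1) * Q - b2 * (1 - δ) * Q - K1 * (η * N) ≤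
        mixV n (fam n i (φ + nrm n)) := by
      push_cast at h2
      rw [hK1]
      linarith
    have h15 : (1 - e) ^ i ≤ 1 - i * (b2 * Q) + i * C1 * (η * N) +
        2 * i ^ 2 * (K2 ^ 2 * (C4 * C6)) * (η * N) := by
      linarith
    have h16 : K3 * η * N = K1 * (η * N) + i * C1 * (η * N) +
        2 * i ^ 2 * (K2 ^ 2 * (C4 * C6)) * (η * N) := by
      rw [hK3]
      ring
    linarith

theorem HF.eq_zero_of_integral_sq (hn : 0 < n) {f : HF n}
    (hf : ∫ u : Sph n, f u ^ 2 ∂sg n = 0) : f = 0 := by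
  have := sg_isOpenPos hn
  have hc : Continuous fun u : Sph n => f u ^ 2 := f.continuous_sph.pow 2
  have h2 := (integral_eq_zero_iff_of_nonneg (fun u => sq_nonneg _) (integrable_sg hc)).1 hf
  refine HF.ext_sph fun u => ?_
  exact pow_eq_zero_iff two_ne_zero |>.1
    (congrFun ((hc.ae_eq_iff_eq (sg n) continuous_const).1 h2) u)

theorem integral_inner_sq (hn : 0 < n) (a : En n) :
    ∫ u : Sph n, ⟪a, u⟫_ℝ ^ 2 ∂sg n = ‖a‖ ^ 2 / n := by
  have := sg_isProb hn
  have hc : ∀ b : En n, Continuous fun u : Sph n => ⟪b, u⟫_ℝ ^ 2 := fun b => by fun_prop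
  have hj : ∀ j : Fin n, ∫ u : Sph n, ⟪EuclideanSpace.single j (1 : ℝ), u⟫_ℝ ^ 2 ∂sg n =
      ∫ u : Sph n, ⟪pole n, u⟫_ℝ ^ 2 ∂sg n := fun j =>
    integral_inner_const hn (by simp [norm_pole hn]) fun t => t ^ 2
  have h1 : (n : ℝ) * ∫ u : Sph n, ⟪pole n, u⟫_ℝ ^ 2 ∂sg n = 1 := by
    have h : ∑ j : Fin n, ∫ u : Sph n,
        ⟪EuclideanSpace.single j (1 : ℝ), u⟫_ℝ ^ 2 ∂sg n = 1 := by
      rw [← integral_finsetSum _ fun j _ => integrable_sg (hc _)]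
      have : ∀ u : Sph n, ∑ j : Fin n, ⟪EuclideanSpace.single j (1 : ℝ), u⟫_ℝ ^ 2 = 1 := by
        intro u
        have := EuclideanSpace.norm_sq_eq (u : En n)
        rw [Sph.norm u] at this
        simpa [EuclideanSpace.inner_single_left] using this.symm
      simp [this]
    simpa [hj] using h
  have h2 := integral_inner_const hn (e := a) (e' := ‖a‖ • pole n)
    (by rw [norm_smul, norm_pole hn, norm_norm, mul_one]) fun t => t ^ 2
  have hn' : (n : ℝ) ≠ 0 := by positivity
  simp only [real_inner_smul_left, mul_pow] at h2
  rw [h2, integral_const_mul, eq_div_iff hn']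
  linear_combination ‖a‖ ^ 2 * h1

theorem integral_inner_mul_inner (hn : 0 < n) (a b : En n) :
    ∫ u : Sph n, ⟪a, u⟫_ℝ * ⟪b, u⟫_ℝ ∂sg n = ⟪a, b⟫_ℝ / n := by
  have := sg_isProb hn
  have hc : ∀ b : En n, Integrable (fun u : Sph n => ⟪b, u⟫_ℝ ^ 2) (sg n) :=
    fun b => integrable_sg (by fun_prop)
  have h : ∫ u : Sph n, ⟪a, u⟫_ℝ * ⟪b, u⟫_ℝ ∂sg n =
      4⁻¹ * (∫ u : Sph n, ⟪a + b, u⟫_ℝ ^ 2 ∂sg n -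
        ∫ u : Sph n, ⟪a - b, u⟫_ℝ ^ 2 ∂sg n) := by
    rw [← integral_sub (hc _) (hc _), ← integral_const_mul]
    refine integral_congr_all fun u => ?_
    simp only [inner_add_left, inner_sub_left]
    ring
  rw [h, integral_inner_sq hn, integral_inner_sq hn,
    norm_add_sq_real, norm_sub_sq_real]
  ring

theorem exists_normalization (hn : 0 < n) {g : HF n} {ε : ℝ} (hε : ε ≤ 1 / 2)
    (hg : ∀ u : Sph n, |g u| ≤ ε) (hg' : ∀ u : Sph n, ‖hess g u‖ ≤ ε) :
    ∃ (m : ℝ) (a : En n) (f : HF n), 0 < m ∧ g + nrm n = m • (f + nrm n) + lin a ∧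
      (∀ u : Sph n, |f u| ≤ (2 * n + 6) * ε) ∧ (∀ u : Sph n, ‖hess f u‖ ≤ (2 * n + 6) * ε) ∧
      ∫ u : Sph n, f u ∂sg n = 0 ∧ ∀ b : En n, ∫ u : Sph n, ⟪b, u⟫_ℝ * f u ∂sg n = 0 := by
  have := sg_isProb hn
  have hn' : (1 : ℝ) ≤ n := by exact_mod_cast hn
  have hε0 : 0 ≤ ε := (abs_nonneg _).trans (hg ⟨pole n, by simp [norm_pole hn]⟩)
  have hi : Integrable (fun u : Sph n => g u) (sg n) := integrable_sg g.continuous_sph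
  set t : ℝ := ∫ u : Sph n, g u ∂sg n with ht
  have ht' : |t| ≤ ε := by
    have h := norm_integral_le_of_norm_le_const (μ := sg n) (f := fun u : Sph n => g u)
      (Eventually.of_forall hg)
    simpa using h
  have hi2 : Integrable (fun u : Sph n => g u • (u : En n)) (sg n) :=
    integrable_sg (g.continuous_sph.smul continuous_subtype_val)
  set a : En n := (n : ℝ) • ∫ u : Sph n, g u • (u : En n) ∂sg n with ha
  have ha' : ‖a‖ ≤ n * ε := by
    have h := norm_integral_le_of_norm_le_const (μ := sg n) (f := fun u : Sph n => g u • (u : En n))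
      (C := ε) (Eventually.of_forall fun u => by
        rw [norm_smul, Sph.norm u, mul_one]; exact hg u)
    rw [ha, norm_smul, Real.norm_of_nonneg (by positivity)]
    gcongr
    simpa using h
  have hb : ∀ b : En n, ∫ u : Sph n, ⟪b, u⟫_ℝ * g u ∂sg n = ⟪b, a⟫_ℝ / n := by
    intro b
    have h := integral_inner (𝕜 := ℝ) hi2 b
    rw [ha, real_inner_smul_right, ← h, mul_div_cancel_left₀ _ (by positivity)]
    refine integral_congr_all fun u => ?_
    simp only [real_inner_smul_right]
    ring
  have hm : 1 / 2 ≤ 1 + t := by linarith [(abs_le.1 ht').1]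
  have hm0 : 0 < 1 + t := by linarith
  have hm1 : (1 + t)⁻¹ ≤ 2 := by
    rw [inv_le_comm₀ hm0 two_pos]; linarith
  refine ⟨1 + t, a, (1 + t)⁻¹ • (g + ((-t) • nrm n + lin (-a))), hm0, ?_, ?_, ?_, ?_, ?_⟩
  · refine HF.ext_sph fun u => ?_
    simp only [HF.coe_add, HF.coe_smul, nrm_apply, lin_apply, inner_neg_left]
    field_simp
    ring
  · intro u
    have h1 : |⟪a, u⟫_ℝ| ≤ n * ε := by
      have := abs_real_inner_le_norm a u
      rw [Sph.norm u, mul_one] at this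
      exact this.trans ha'
    have h2 : |g u + (-t * 1 + -⟪a, u⟫_ℝ)| ≤ (n + 2) * ε := by
      have := abs_le.1 (hg u); have := abs_le.1 ht'; have := abs_le.1 h1
      rw [abs_le]; constructor <;> nlinarith
    simp only [HF.coe_add, HF.coe_smul, nrm_apply, lin_apply, inner_neg_left,
      Sph.norm u, real_inner_comm]
    simp only [real_inner_comm] at h2
    rw [abs_mul, abs_of_pos (inv_pos.2 hm0)]
    calc _ ≤ 2 * ((n + 2) * ε) := mul_le_mul hm1 h2 (abs_nonneg _) two_pos.le
      _ ≤ _ := by nlinarith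
  · intro u
    rw [HF.hess_smul _ _ (Sph.ne_zero u), HF.hess_add _ _ (Sph.ne_zero u),
      HF.hess_add _ _ (Sph.ne_zero u), HF.hess_smul _ _ (Sph.ne_zero u), hess_lin, add_zero,
      norm_smul, Real.norm_of_nonneg (inv_pos.2 hm0).le]
    have h2 : ‖hess g u + (-t) • hess (nrm n) u‖ ≤ 3 * ε := by
      refine (norm_add_le _ _).trans ?_
      rw [norm_smul, norm_neg, Real.norm_eq_abs]
      have := mul_le_mul ht' (norm_hess_nrm_le u) (norm_nonneg _) hε0
      linarith [hg' u]
    calc _ ≤ 2 * (3 * ε) := mul_le_mul hm1 h2 (norm_nonneg _) two_pos.le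
      _ ≤ _ := by nlinarith
  · have h : ∫ u : Sph n, ((1 + t)⁻¹ • (g + ((-t) • nrm n + lin (-a))) : HF n) u ∂sg n =
        (1 + t)⁻¹ * (t - ∫ u : Sph n, (t + ⟪a, u⟫_ℝ) ∂sg n) := by
      rw [ht, ← integral_sub hi (integrable_sg (by fun_prop)), ← integral_const_mul]
      refine integral_congr_all fun u => ?_
      simp only [HF.coe_add, HF.coe_smul, nrm_apply, lin_apply, inner_neg_left,
        Sph.norm u, real_inner_comm]
      ring
    have h3 := integral_inner_mul_of_even hn (f := nrm n) (fun x => by simp [nrm_apply]) a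
    simp only [nrm_apply, Sph.norm, mul_one] at h3
    rw [h, integral_add (integrable_const _) (integrable_sg (by fun_prop)), h3]
    simp
  · intro b
    have h : ∫ u : Sph n, ⟪b, u⟫_ℝ *
        ((1 + t)⁻¹ • (g + ((-t) • nrm n + lin (-a))) : HF n) u ∂sg n =
        (1 + t)⁻¹ * (∫ u : Sph n, ⟪b, u⟫_ℝ * g u ∂sg n -
          ∫ u : Sph n, (t * ⟪b, u⟫_ℝ + ⟪b, u⟫_ℝ * ⟪a, u⟫_ℝ) ∂sg n) := by
      have i1 : Integrable (fun u : Sph n => ⟪b, u⟫_ℝ * g u) (sg n) :=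
        integrable_sg ((by fun_prop : Continuous fun u : Sph n => ⟪b, u⟫_ℝ).mul
          g.continuous_sph)
      rw [← integral_sub i1 (integrable_sg (by fun_prop)), ← integral_const_mul]
      refine integral_congr_all fun u => ?_
      simp only [HF.coe_add, HF.coe_smul, nrm_apply, lin_apply, inner_neg_left,
        Sph.norm u, real_inner_comm (u : En n) a]
      ring
    have h3 := integral_inner_mul_of_even hn (f := nrm n) (fun x => by simp [nrm_apply]) b
    simp only [nrm_apply, Sph.norm, mul_one] at h3
    rw [h, integral_add (integrable_sg (by fun_prop)) (integrable_sg (by fun_prop)),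
      integral_const_mul, h3, integral_inner_mul_inner hn, hb]
    simp

theorem HF.continuous_fderiv_sph (F : HF n) : Continuous fun u : Sph n => fderiv ℝ F u :=
  continuous_iff_continuousAt.2 fun u =>
    ((F.contDiffAt (Sph.ne_zero u)).continuousAt_fderiv two_ne_zero).comp
      continuous_subtype_val.continuousAt

theorem HF.continuous_iteratedFDeriv_sph (F : HF n) :
    Continuous fun u : Sph n => iteratedFDeriv ℝ 2 F u :=
  continuous_iff_continuousAt.2 fun u =>
    ((F.contDiffAt (Sph.ne_zero u)).continuousAt_iteratedFDeriv (k := 2) le_rfl).comp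
      continuous_subtype_val.continuousAt

theorem le_C2dist (F G : HF n) (u : Sph n) :
    |(F - G : HF n) u| ≤ C2dist F G ∧ ‖hess (F - G : HF n) u‖ ≤ C2dist F G := by
  have hc : Continuous fun u : Sph n => |F u - G u| + ‖fderiv ℝ F u - fderiv ℝ G u‖ +
      ‖iteratedFDeriv ℝ 2 F u - iteratedFDeriv ℝ 2 G u‖ :=
    ((F.continuous_sph.sub G.continuous_sph).abs.add
      (F.continuous_fderiv_sph.sub G.continuous_fderiv_sph).norm).add
      (F.continuous_iteratedFDeriv_sph.sub G.continuous_iteratedFDeriv_sph).norm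
  have h := le_ciSup (isCompact_range hc).bddAbove u
  have h2 : ‖hess (F - G : HF n) u‖ ≤ ‖iteratedFDeriv ℝ 2 F u - iteratedFDeriv ℝ 2 G u‖ := by
    have := hess_norm_le ((F - G).contDiffAt (Sph.ne_zero u))
    rwa [show ((F - G : HF n) : En n → ℝ) = (F : En n → ℝ) - G from rfl,
      iteratedFDeriv_sub_apply (F.contDiffAt (Sph.ne_zero u)) (G.contDiffAt (Sph.ne_zero u))] at this
  have h1 := abs_nonneg (F u - G u)
  have h3 := norm_nonneg (fderiv ℝ F u - fderiv ℝ G u)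
  have h4 := norm_nonneg (iteratedFDeriv ℝ 2 F u - iteratedFDeriv ℝ 2 G u)
  unfold C2dist
  rw [HF.coe_sub]
  constructor <;> linarith

theorem kappa_pos (m : ℕ) : 0 < kappa m := volume_ball_pos

theorem intrinsicVol_eq (hn : 2 ≤ n) (i : ℕ) {K : ConvexBody (En n)} {h : HF n}
    (hK : ∀ x, supp K x = h x) : intrinsicVol (i + 1) K =
      n.choose (i + 1) / kappa (n - (i + 1)) * (kappa n * mixV n (fam n i h)) := by
  rw [intrinsicVol, mixedVol_eq hn (F := fam n i h)]
  · rfl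
  intro j x
  by_cases hj : (j : ℕ) ≤ i
  · simp only [fam, if_pos hj, if_pos (Nat.lt_succ_of_le hj), hK]
  · rw [fam, if_neg hj, if_neg (by omega), supp_ballB, nrm_apply]

theorem mixV_fam_smul {i : ℕ} (hi : i < n) (c : ℝ) (h : HF n) :
    mixV n (fam n i (c • h)) = c ^ (i + 1) * mixV n (fam n i h) := by
  have h1 : fam n i (c • h) = fun k : Fin n => (if (k : ℕ) ≤ i then c else 1) • fam n i h k := by
    funext k
    by_cases hk : (k : ℕ) ≤ i <;> simp [fam, hk]
  rw [h1, MultilinearMap.map_smul_univ, smul_eq_mul, Finset.prod_ite, Finset.prod_const,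
    Finset.prod_const_one, mul_one, card_filter_val_le hi]

theorem mixV_fam_add_lin (hn : 2 ≤ n) (i : ℕ) (h : HF n) (a : En n) :
    mixV n (fam n i (h + lin a)) = mixV n (fam n i h) := by
  rw [← mixV_add_lin hn (fam n i h) fun k => if (k : ℕ) ≤ i then a else 0]
  congr 1
  funext k
  by_cases hk : (k : ℕ) ≤ i
  · simp [fam, hk]
  · simp only [fam, hk, if_false]
    ext x
    simp [lin_apply]

/-- `C²` bodies near the unit ball satisfy the inequality with a quadratic gain, up to translation
and dilation. -/
theorem exists_ball_estimate (hn : 3 ≤ n) {i : ℕ} (hi1 : 1 ≤ i) (hi : i ≤ n - 1)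
    {Φ : ConvexBody (En n) → ConvexBody (En n)} (htrans : TranslationInvariant Φ)
    (hdeg : HasDegree i Φ) (heven : IsEven Φ) (hreg : CInfRegular i Φ) :
    ∃ η > 0, ∃ c > 0, ∃ A > 0,
      (∀ (K : ConvexBody (En n)) (m : ℝ) (a : En n), 0 < m →
        (∀ x, supp K x = (m • nrm n + lin a : HF n) x) →
        intrinsicVol (i + 1) (Φ K) / intrinsicVol (i + 1) K ^ i = A) ∧
      ∀ (f : HF n) (K : ConvexBody (En n)) (m : ℝ) (a : En n), 0 < m →
        (∀ x, supp K x = (m • (f + nrm n) + lin a : HF n) x) →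
        (∀ u : Sph n, |f u| ≤ η) → (∀ u : Sph n, ‖hess f u‖ ≤ η) →
        ∫ u : Sph n, f u ∂sg n = 0 →
        (∀ a : En n, ∫ u : Sph n, ⟪a, u⟫_ℝ * f u ∂sg n = 0) →
        ∃ W > 0, A * (1 + c * nsq f / W) ≤
          intrinsicVol (i + 1) (Φ K) / intrinsicVol (i + 1) K ^ i := by
  have hn2 : 2 ≤ n := by omega
  have hn0 : 0 < n := by omega
  have hin : i < n := by omega
  obtain ⟨φ, G, κ, δ, hκ, hδ0, hδ1, hG, hφe, hmas, hmult, hker⟩ := exists_kernel hn hi heven hreg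
  obtain ⟨η, hη, c, hc, hloc⟩ := exists_local_inequality hn hG hφe hmas hi1 hi hδ0 hδ1 hmult
  obtain ⟨C, -, hC⟩ := exists_sdn_sub_one_bound hn
  set B : ℝ := n.choose (i + 1) / kappa (n - (i + 1)) * kappa n with hB
  have hB0 : 0 < B := by
    have := kappa_pos n
    have := kappa_pos (n - (i + 1))
    have : 0 < n.choose (i + 1) := Nat.choose_pos (by omega)
    positivity
  have hV : ∀ {K : ConvexBody (En n)} {h : HF n}, (∀ x, supp K x = h x) →
      intrinsicVol (i + 1) K = B * mixV n (fam n i h) := fun hK => by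
    rw [intrinsicVol_eq hn2 i hK, hB, mul_assoc]
  have hR : ∀ (h : HF n) (K : ConvexBody (En n)) (m : ℝ) (a : En n), 0 < m →
      (∀ x, supp K x = (m • h + lin a : HF n) x) → (∀ u : Sph n, 0 ≤ sdn hn0 i h u) →
      0 < mixV n (fam n i h) → intrinsicVol (i + 1) (Φ K) / intrinsicVol (i + 1) K ^ i =
        B * κ ^ (i + 1) / B ^ i * (mixV n (fam n i (cvl φ (fun u : Sph n => sdn hn0 i h u)
          (continuous_sdn hn0 i h))) / mixV n (fam n i h) ^ i) := by
    intro h K m a hm hK hs hW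
    set K' := scale m⁻¹ (translate K (-a)) with hK'
    have hKK' : ∀ x, supp K' x = h x := fun x => by
      rw [hK', supp_scale, supp_smul_arg _ (inv_pos.2 hm).le, supp_translate, hK]
      simp only [HF.coe_add, HF.coe_smul, lin_apply, inner_neg_right, real_inner_comm]
      field_simp
      ring
    have hΦK : ∀ x, supp (Φ K) x = (m ^ i • κ • cvl φ (fun u : Sph n => sdn hn0 i h u)
        (continuous_sdn hn0 i h) : HF n) x := fun x => by
      have h := hker K' _ hKK' hs x
      rw [hK', hdeg _ _ (inv_pos.2 hm).le, htrans, supp_scale, supp_smul_arg _ (by positivity)] at h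
      rw [HF.coe_smul, HF.coe_smul, ← h, inv_pow, mul_inv_cancel_left₀ (by positivity)]
    rw [hV hΦK, hV hK, mixV_fam_add_lin hn2, mixV_fam_smul hin, mixV_fam_smul hin,
      mixV_fam_smul hin]
    field_simp
    ring
  refine ⟨η, hη, c, hc, B * κ ^ (i + 1) / B ^ i, by positivity, fun K m a hm hK => ?_,
    fun f K m a hm hK hf1 hf2 hf3 hf4 => ?_⟩
  · have hs1 : ∀ u : Sph n, sdn hn0 i (nrm n) u = 1 := fun u => by
      have h := hC i 0 0 le_rfl zero_le_one (fun u => by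
        rw [show ((0 : HF n) : En n → ℝ) = fun _ => 0 from rfl]
        simp [hess]) u
      rw [zero_add, mul_zero] at h
      exact sub_eq_zero.1 (abs_nonpos_iff.1 h)
    have hp : cvl φ (fun u : Sph n => sdn hn0 i (nrm n) u) (continuous_sdn hn0 i (nrm n)) =
        nrm n := by
      ext x
      simp only [hs1]
      rw [hG.cvl_one hn0, hmas, one_mul, nrm_apply]
    have hW1 : mixV n (fam n i (nrm n)) = 1 := by
      rw [show fam n i (nrm n) = fun _ => nrm n by funext k; simp [fam], mixV_nrm hn0]
    rw [hR _ K m a hm hK (fun u => by rw [hs1]; exact zero_le_one) (by rw [hW1]; exact one_pos),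
      hp, hW1, one_pow, div_one, mul_one]
  · obtain ⟨hs, hW, hle⟩ := hloc f hf1 hf2 hf3 hf4
    refine ⟨mixV n (fam n i (f + nrm n)) ^ i, by positivity, ?_⟩
    rw [hR _ K m a hm hK hs hW]
    refine mul_le_mul_of_nonneg_left ?_ (by positivity)
    rw [le_div_iff₀ (by positivity), add_mul, one_mul, div_mul_cancel₀ _ (by positivity)]
    exact hle

theorem isBall_iff {K : ConvexBody (En n)} :
    IsBall K ↔ ∃ (r : ℝ) (a : En n), 0 < r ∧ ∀ x, supp K x = (r • nrm n + lin a : HF n) x := by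
  have hB : ∀ (r : ℝ) (a : En n), 0 ≤ r →
      (translate (scale r (ballB n)) a : Set (En n)) = closedBall a r := fun r a hr => by
    change (fun y => a + y) '' (scale r (ballB n) : Set (En n)) = _
    rw [coe_scale_ballB hr, Set.image_add_left, preimage_add_closedBall]
    simp
  have hs : ∀ (r : ℝ) (a x : En n), 0 ≤ r →
      supp (translate (scale r (ballB n)) a) x = (r • nrm n + lin a : HF n) x := fun r a x hr => by
    rw [supp_translate, supp_scale_ballB hr, HF.coe_add, HF.coe_smul, nrm_apply, lin_apply,
      add_comm, real_inner_comm]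
  constructor
  · rintro ⟨a, r, hr, hK⟩
    refine ⟨r, a, hr, fun x => ?_⟩
    rw [← hs r a x hr.le, SetLike.coe_injective (hK.trans (hB r a hr.le).symm)]
  · rintro ⟨r, a, hr, hK⟩
    exact ⟨a, r, hr, by rw [ext_supp fun x => (hK x).trans (hs r a x hr.le).symm, hB r a hr.le]⟩

/-- **Corollary 2.** Local solution of the conjectured isoperimetric inequality
`V_{i+1}(Φ_i K)/V_{i+1}(K)^i ≥ V_{i+1}(Φ_i 𝔹ⁿ)/V_{i+1}(𝔹ⁿ)^i` with equality
exactly for balls. -/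
theorem local_volume_inequality
    (n i : ℕ) (hn : 3 ≤ n) (hi₁ : 2 ≤ i) (hi₂ : i ≤ n - 1)
    (Φ : ConvexBody (En n) → ConvexBody (En n))
    (hval : IsMinkowskiValuation Φ)
    (htrans : TranslationInvariant Φ)
    (hdeg : HasDegree i Φ)
    (hrot : RotationEquivariant Φ)
    (heven : IsEven Φ)
    (hreg : CInfRegular i Φ) :
    ∃ ε > (0 : ℝ), ∀ K : ConvexBody (En n),
      ContDiffOn ℝ 2 (supp K) {0}ᶜ →
      (∃ γ : ℝ, 0 < γ ∧ C2dist (supp (scale γ K)) (supp (ballB n)) < ε) →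
      intrinsicVol (i + 1) (Φ K) / intrinsicVol (i + 1) K ^ i ≥
        intrinsicVol (i + 1) (Φ (ballB n)) / intrinsicVol (i + 1) (ballB n) ^ i ∧
      (intrinsicVol (i + 1) (Φ K) / intrinsicVol (i + 1) K ^ i =
        intrinsicVol (i + 1) (Φ (ballB n)) / intrinsicVol (i + 1) (ballB n) ^ i ↔
        IsBall K) := by
  have hn0 : 0 < n := by omega
  obtain ⟨η, hη, c, hc, A, hA, hA1, hmain⟩ :=
    exists_ball_estimate hn (by omega) hi₂ htrans hdeg heven hreg
  refine ⟨min (1 / 2) (η / (2 * n + 6)), by positivity, fun K hKc ⟨γ, hγ, hd⟩ => ?_⟩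
  rw [hA1 (ballB n) 1 0 one_pos fun x => by
    rw [supp_ballB, HF.coe_add, HF.coe_smul, nrm_apply, lin_apply]; simp]
  set g : HF n := γ • suppHF K hKc - nrm n with hg
  have hd1 : ∀ u : Sph n, |g u| ≤ min (1 / 2) (η / (2 * n + 6)) ∧
      ‖hess g u‖ ≤ min (1 / 2) (η / (2 * n + 6)) := fun u => by
    have h1 : supp (scale γ K) = (γ • suppHF K hKc : HF n) := funext fun x => by
      rw [supp_scale, supp_smul_arg _ hγ.le, HF.coe_smul, suppHF_apply]
    have h2 : supp (ballB n) = nrm n := funext fun x => by rw [supp_ballB, nrm_apply]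
    rw [h1, h2] at hd
    exact ⟨(le_C2dist _ _ u).1.trans hd.le, (le_C2dist _ _ u).2.trans hd.le⟩
  obtain ⟨m, a, f, hm, hgf, hf1, hf2, hf3, hf4⟩ :=
    exists_normalization hn0 (min_le_left _ _) (fun u => (hd1 u).1) fun u => (hd1 u).2
  have hb : (2 * n + 6) * min (1 / 2) (η / (2 * n + 6)) ≤ η := by
    calc _ ≤ (2 * n + 6) * (η / (2 * n + 6)) := by gcongr; exact min_le_right _ _
      _ = η := by field_simp
  have hK : ∀ x, supp K x = ((γ⁻¹ * m) • (f + nrm n) + lin (γ⁻¹ • a) : HF n) x := fun x => by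
    have h := congrArg (fun F : HF n => F x) hgf
    simp only [hg, HF.coe_add, HF.coe_smul, suppHF_apply, lin_apply,
      sub_add_cancel] at h
    simp only [HF.coe_add, HF.coe_smul, lin_apply, real_inner_smul_left]
    rw [mul_assoc, ← mul_add, ← h, inv_mul_cancel_left₀ hγ.ne']
  have hm' : 0 < γ⁻¹ * m := by positivity
  obtain ⟨W, hW, hle⟩ := hmain f K _ _ hm' hK (fun u => (hf1 u).trans hb)
    (fun u => (hf2 u).trans hb) hf3 hf4
  have hnsq := nsq_nonneg f
  have hge : A ≤ intrinsicVol (i + 1) (Φ K) / intrinsicVol (i + 1) K ^ i := by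
    refine le_trans ?_ hle
    have : 0 ≤ c * nsq f / W := by positivity
    nlinarith
  refine ⟨hge, fun heq => ?_, fun hball => ?_⟩
  · rw [heq] at hle
    have h1 : c * nsq f / W ≤ 0 := by nlinarith
    have h2 : nsq f ≤ 0 := by
      by_contra! hpos
      have : 0 < c * nsq f / W := by positivity
      linarith
    have h3 : f = 0 := HF.eq_zero_of_integral_sq hn0
      (le_antisymm ((integral_sq_le_nsq f).trans h2) (integral_nonneg fun u => sq_nonneg _))
    refine isBall_iff.2 ⟨_, γ⁻¹ • a, hm', fun x => ?_⟩
    rw [hK, h3, zero_add]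
  · obtain ⟨r, b, -, hr⟩ := isBall_iff.1 hball
    have h1 : ∀ u : Sph n, f u ^ 2 = (γ⁻¹ * m)⁻¹ *
        ((r - γ⁻¹ * m) * f u + ⟪b - γ⁻¹ • a, u⟫_ℝ * f u) := fun u => by
      have h := (hK u).symm.trans (hr u)
      simp only [HF.coe_add, HF.coe_smul, nrm_apply, lin_apply, Sph.norm u, mul_one] at h
      rw [inner_sub_left, eq_inv_mul_iff_mul_eq₀ hm'.ne']
      simp only [real_inner_comm] at h ⊢
      linear_combination f u * h
    have h2 : f = 0 := HF.eq_zero_of_integral_sq hn0 (by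
      simp only [h1]
      rw [integral_const_mul, integral_add, integral_const_mul, hf3, hf4]
      · simp
      · exact integrable_sg (continuous_const.mul f.continuous_sph)
      · exact integrable_sg (Continuous.mul (by fun_prop) f.continuous_sph))
    exact hA1 K _ _ hm' fun x => by rw [hK, h2, zero_add]

end MinkIter
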